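/- Let Ω ⊆ ℂ be a domain such that ℂ̂ ∖ Ω has finitely many connected components (Koebe's uniformization theorem for finitely connected domains). Then there exists a conformal map from Ω onto a normalized circle domain. Moreover, for any two conformal maps f, g from Ω onto normalized circle domains, the composition f ∘ g⁻¹ : g(Ω) → f(Ω) is the restriction of a Möbius transformation. -/

import Mathlib

open Set Metric Complex Filter MeasureTheory Topology ENNReal NNReal

noncomputable section

/-- A conformal map from `U` onto `V`: an injective holomorphic function on `U` with image `V`. -/
def ConformalMapOnto (f : ℂ → ℂ) (U V : Set ℂ) : Prop :=
  DifferentiableOn ℂ f U ∧ Set.InjOn f U ∧ f '' U = V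

/-- `f` agrees on `U` with a Möbius transformation. -/
def IsMobiusOn (f : ℂ → ℂ) (U : Set ℂ) : Prop :=
  ∃ a b c d : ℂ, a * d - b * c ≠ 0 ∧ ∀ z ∈ U, c * z + d ≠ 0 ∧ f z = (a * z + b) / (c * z + d)

/-- The copy of a planar set in the Riemann sphere `ℂ̂ = OnePoint ℂ`. -/
def sph (S : Set ℂ) : Set (OnePoint ℂ) := (fun z : ℂ => (z : OnePoint ℂ)) '' S

/-- A normalized circle domain: a domain in `ℂ` such that every connected component of its
frontier in the Riemann sphere is a single point or a Euclidean circle. -/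
def IsNormalizedCircleDomain (D : Set ℂ) : Prop :=
  IsOpen D ∧ IsConnected D ∧
    ∀ x ∈ frontier (sph D),
      connectedComponentIn (frontier (sph D)) x = {x} ∨
        ∃ (c : ℂ) (r : ℝ), 0 < r ∧
          connectedComponentIn (frontier (sph D)) x = sph (Metric.sphere c r)

open scoped Real ComplexConjugate

/-! ### Plane topology -/

/-- A continuous function on a preconnected set whose exponential is `1` is constant. -/
lemma eq_of_exp_eq_one {X : Type*} [TopologicalSpace X] {S : Set X} (hS : IsPreconnected S)
    {f : X → ℂ} (hf : ContinuousOn f S) (h1 : ∀ x ∈ S, exp (f x) = 1) {x y : X}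
    (hx : x ∈ S) (hy : y ∈ S) : f x = f y := by
  have key : ∀ z ∈ S, ∃ n : ℤ, f z = n * (2 * Real.pi * I) := fun z hz => exp_eq_one_iff.1 (h1 z hz)
  have hpre : IsPreconnected ((fun z => (f z).im) '' S) :=
    hS.image _ (continuous_im.comp_continuousOn hf)
  have hlt : ∀ a ∈ S, ∀ b ∈ S, ¬ (f a).im < (f b).im := by
    intro a ha b hb hab
    obtain ⟨n, hn⟩ := key a ha
    obtain ⟨m, hm⟩ := key b hb
    have e1 : (f a).im = n * (2 * Real.pi) := by rw [hn]; simp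
    have e2 : (f b).im = m * (2 * Real.pi) := by rw [hm]; simp
    have hpi := Real.pi_pos
    have hnm : n < m := by
      rw [e1, e2] at hab
      exact_mod_cast lt_of_mul_lt_mul_right hab (by positivity)
    have hnm' : (n : ℝ) + 1 ≤ m := by exact_mod_cast hnm
    have hmem : (n : ℝ) * (2 * Real.pi) + Real.pi ∈ (fun z => (f z).im) '' S := by
      refine hpre.ordConnected.out ⟨a, ha, rfl⟩ ⟨b, hb, rfl⟩ ⟨?_, ?_⟩
      · simp only [e1]; linarith
      · simp only [e2]; nlinarith
    obtain ⟨c, hc, hc'⟩ := hmem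
    obtain ⟨k, hk⟩ := key c hc
    have e3 : (f c).im = k * (2 * Real.pi) := by rw [hk]; simp
    simp only [e3] at hc'
    have h4 : (2 * k - 2 * n - 1 : ℝ) * Real.pi = 0 := by linarith
    have h5 : (2 * k - 2 * n - 1 : ℝ) = 0 := by
      rcases mul_eq_zero.1 h4 with h | h
      · exact h
      · exact absurd h hpi.ne'
    have h6 : (2 * k - 2 * n - 1 : ℤ) = 0 := by exact_mod_cast h5
    omega
  obtain ⟨n, hn⟩ := key x hx
  obtain ⟨m, hm⟩ := key y hy
  have him : (f x).im = (f y).im :=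
    le_antisymm (not_lt.1 (hlt y hy x hx)) (not_lt.1 (hlt x hx y hy))
  apply Complex.ext _ him
  rw [hn, hm]; simp

/-- A continuous nonvanishing function on the plane has a continuous logarithm. -/
lemma exists_continuous_log {h : ℂ → ℂ} (hc : Continuous h) (h0 : ∀ z, h z ≠ 0) :
    ∃ L : ℂ → ℂ, Continuous L ∧ ∀ z, exp (L z) = h z := by
  have hs : IsSimplyConnected (univ : Set ℂ) := by
    have : ContractibleSpace (univ : Set ℂ) := convex_univ.contractibleSpace ⟨0, mem_univ _⟩
    exact SimplyConnectedSpace.ofContractible _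
  obtain ⟨L, hL, hE⟩ := Complex.exists_continuousOn_eqOn_exp_comp (U := univ) (g := h)
    hs isOpen_univ hc.continuousOn (by simpa using h0)
  exact ⟨L, by simpa using continuousOn_univ.1 hL, fun z => hE (mem_univ z)⟩

/-- The plane is unicoherent. -/
lemma isPreconnected_inter_of_union_eq_univ {N U : Set ℂ} (hN : IsOpen N) (hU : IsOpen U)
    (cN : IsPreconnected N) (cU : IsPreconnected U) (hNU : N ∪ U = univ) :
    IsPreconnected (N ∩ U) := by
  classical
  rcases eq_empty_or_nonempty Nᶜ with hN0 | hN0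
  · rw [compl_empty_iff.1 hN0, univ_inter]; exact cU
  rcases eq_empty_or_nonempty Uᶜ with hU0 | hU0
  · rw [compl_empty_iff.1 hU0, inter_univ]; exact cN
  rintro P Q hP hQ hPQ ⟨p, hp, hpP⟩ ⟨q, hq, hqQ⟩
  by_contra hcon
  rw [not_nonempty_iff_eq_empty] at hcon
  have hcon' : ∀ z ∈ N ∩ U, z ∈ P → z ∉ Q := fun z hz h1 h2 => by
    have : z ∈ N ∩ U ∩ (P ∩ Q) := ⟨hz, h1, h2⟩
    rw [hcon] at this; exact this
  have hmemNU : ∀ z, z ∈ N ∨ z ∈ U := fun z => by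
    have : z ∈ N ∪ U := hNU ▸ mem_univ z
    exact this
  set S : Set ℂ := N ∩ U ∩ P with hS
  have hSo : IsOpen S := (hN.inter hU).inter hP
  have hfr : ∀ z ∈ frontier S, z ∉ N ∩ U := by
    intro z hz hzNU
    rw [hSo.frontier_eq] at hz
    have hzP : z ∉ P := fun h => hz.2 ⟨hzNU, h⟩
    have hzQ : z ∈ Q := (hPQ hzNU).resolve_left hzP
    obtain ⟨w, hw1, hw2⟩ := mem_closure_iff.1 hz.1 Q hQ hzQ
    exact hcon' w hw2.1 hw2.2 hw1
  let φ : ℂ → ℝ := fun z => infDist z Uᶜ / (infDist z Uᶜ + infDist z Nᶜ)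
  have hden : ∀ z, infDist z Uᶜ + infDist z Nᶜ ≠ 0 := by
    intro z
    rcases hmemNU z with h | h
    · have : 0 < infDist z Nᶜ :=
        (hN.isClosed_compl.notMem_iff_infDist_pos hN0).1 (by simpa using h)
      have := infDist_nonneg (x := z) (s := Uᶜ)
      positivity
    · have : 0 < infDist z Uᶜ :=
        (hU.isClosed_compl.notMem_iff_infDist_pos hU0).1 (by simpa using h)
      have := infDist_nonneg (x := z) (s := Nᶜ)
      positivity
  have hφc : Continuous φ := by
    apply Continuous.div _ _ hden
    · exact continuous_infDist_pt _
    · exact (continuous_infDist_pt _).add (continuous_infDist_pt _)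
  have hφU : ∀ z, z ∉ U → φ z = 0 := fun z hz => by
    simp [φ, infDist_zero_of_mem (show z ∈ Uᶜ from hz)]
  have hφN : ∀ z, z ∉ N → φ z = 1 := fun z hz => by
    have h1 := infDist_zero_of_mem (show z ∈ Nᶜ from hz)
    have h2 := hden z
    simp only [φ, h1, add_zero] at h2 ⊢
    exact div_self h2
  have hc2 : Continuous fun z => 2 * Real.pi * I * (φ z : ℂ) := by fun_prop
  let h : ℂ → ℂ := S.piecewise (fun z => exp (2 * Real.pi * I * φ z)) (fun _ => 1)
  have hh : Continuous h := by
    apply Continuous.piecewise _ (continuous_exp.comp hc2) continuous_const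
    intro z hz
    rcases not_and_or.1 (hfr z hz) with h | h
    · simp [hφN z h, exp_two_pi_mul_I]
    · simp [hφU z h]
  have hh0 : ∀ z, h z ≠ 0 := by
    intro z
    by_cases hz : z ∈ S
    · simp only [h, piecewise_eq_of_mem S _ _ hz]; exact exp_ne_zero _
    · simp [h, piecewise_eq_of_notMem S _ _ hz]
  obtain ⟨L, hL, hLe⟩ := exists_continuous_log hh hh0
  have hcontN : ContinuousOn (S.piecewise (fun z => 2 * Real.pi * I * (φ z : ℂ)) (fun _ => 0)) N := by
    apply ContinuousOn.piecewise _ hc2.continuousOn continuousOn_const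
    rintro z ⟨hz, hz'⟩
    rw [hφU z (fun h => hfr z hz' ⟨hz, h⟩)]; simp
  have hcontU : ContinuousOn (S.piecewise (fun z => 2 * Real.pi * I * ((φ z : ℂ) - 1)) (fun _ => 0)) U := by
    apply ContinuousOn.piecewise _ _ continuousOn_const
    · rintro z ⟨hz, hz'⟩
      rw [hφN z (fun h => hfr z hz' ⟨h, hz⟩)]; simp
    · have : Continuous fun z => 2 * Real.pi * I * ((φ z : ℂ) - 1) := by fun_prop
      exact this.continuousOn
  have e1 := eq_of_exp_eq_one cN (hL.continuousOn.sub hcontN) (by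
    intro z _
    rw [Pi.sub_apply, exp_sub, hLe]
    by_cases hz : z ∈ S
    · simp only [h, piecewise_eq_of_mem S _ _ hz]; exact div_self (exp_ne_zero _)
    · simp [h, piecewise_eq_of_notMem S _ _ hz]) hp.1 hq.1
  have e2 := eq_of_exp_eq_one cU (hL.continuousOn.sub hcontU) (by
    intro z _
    rw [Pi.sub_apply, exp_sub, hLe]
    by_cases hz : z ∈ S
    · simp only [h, piecewise_eq_of_mem S _ _ hz, mul_sub, exp_sub, mul_one, exp_two_pi_mul_I,
        div_one]
      exact div_self (exp_ne_zero _)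
    · simp [h, piecewise_eq_of_notMem S _ _ hz]) hp.2 hq.2
  have hpS : p ∈ S := ⟨hp, hpP⟩
  have hqS : q ∉ S := fun h => hcon' q hq h.2 hqQ
  simp only [Pi.sub_apply, piecewise_eq_of_mem S _ _ hpS, piecewise_eq_of_notMem S _ _ hqS] at e1 e2
  have e3 : (2 * Real.pi * I : ℂ) = 0 := by linear_combination e2 - e1
  exact two_pi_I_ne_zero e3

lemma isConnected_thickening {A : Set ℂ} (hA : IsConnected A) {ε : ℝ} (hε : 0 < ε) :
    IsConnected (thickening ε A) := by
  obtain ⟨a, ha⟩ := hA.nonempty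
  have hsub : A ⊆ thickening ε A := self_subset_thickening hε A
  refine ⟨⟨a, hsub ha⟩, isPreconnected_of_forall a fun y hy => ?_⟩
  obtain ⟨x, hx, hxy⟩ := mem_thickening_iff.1 hy
  refine ⟨A ∪ ball x ε, union_subset hsub fun w hw => ?_, Or.inl ha, Or.inr hxy, ?_⟩
  · exact mem_thickening_iff.2 ⟨x, hx, hw⟩
  · exact hA.isPreconnected.union x hx (mem_ball_self hε) (convex_ball x ε).isPreconnected

lemma not_subset_of_isOpen_of_isCompact {A U : Set ℂ} (hA : IsCompact A) (hU : IsOpen U)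
    (hne : A.Nonempty) (hAU : A ⊆ U) : ∃ z ∈ U, z ∉ A := by
  by_contra! h
  have : A = U := Subset.antisymm hAU h
  have hcl : IsClopen A := ⟨hA.isClosed, this ▸ hU⟩
  rcases isClopen_iff.1 hcl with h | h
  · exact hne.ne_empty h
  · exact noncompact_univ ℂ (h ▸ hA)

/-- A finite family of disjoint continua with union `K`. -/
structure Pieces {ι : Type*} (K : Set ℂ) (A : ι → Set ℂ) : Prop where
  compact : ∀ i, IsCompact (A i)
  conn : ∀ i, IsConnected (A i)
  disj : ∀ i j, i ≠ j → Disjoint (A i) (A j)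
  union : ⋃ i, A i = K

namespace Pieces

variable {ι : Type*} {K : Set ℂ} {A : ι → Set ℂ}

lemma subset (h : Pieces K A) (i : ι) : A i ⊆ K := h.union ▸ subset_iUnion A i

lemma isCompact [Finite ι] (h : Pieces K A) : IsCompact K :=
  h.union ▸ isCompact_iUnion h.compact

lemma mem (h : Pieces K A) {z : ℂ} (hz : z ∈ K) : ∃ i, z ∈ A i := by
  rw [← h.union] at hz; exact mem_iUnion.1 hz

lemma eq_of_mem (h : Pieces K A) {i j : ι} {z : ℂ} (hi : z ∈ A i) (hj : z ∈ A j) : i = j := by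
  by_contra hij
  exact Set.disjoint_left.1 (h.disj i j hij) hi hj

lemma exists_thickening [Finite ι] (h : Pieces K A) :
    ∃ ε > 0, ∀ i j, i ≠ j → Disjoint (thickening ε (A i)) (thickening ε (A j)) := by
  have key : ∀ p : ι × ι, ∃ ε > 0, p.1 ≠ p.2 →
      Disjoint (thickening ε (A p.1)) (thickening ε (A p.2)) := by
    intro p
    by_cases hp : p.1 = p.2
    · exact ⟨1, one_pos, fun h => absurd hp h⟩
    · obtain ⟨δ, hδ, hd⟩ := (h.disj _ _ hp).exists_thickenings (h.compact _) (h.compact _).isClosed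
      exact ⟨δ, hδ, fun _ => hd⟩
  choose e he hd using key
  cases nonempty_fintype ι
  rcases isEmpty_or_nonempty (ι × ι) with hι | hι
  · exact ⟨1, one_pos, fun i j _ => (hι.false (i, j)).elim⟩
  · obtain ⟨p, hp⟩ := Finite.exists_min e
    refine ⟨e p, he p, fun i j hij => ?_⟩
    exact (hd (i, j) hij).mono (thickening_mono (hp _) _) (thickening_mono (hp _) _)

/-- A subcontinuum of a disjoint finite union of continua lies in one of them. -/
lemma subset_of_isPreconnected [Finite ι] (h : Pieces K A) {C : Set ℂ} (hC : IsPreconnected C)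
    (hCK : C ⊆ K) {i : ι} {z : ℂ} (hz : z ∈ C) (hi : z ∈ A i) : C ⊆ A i := by
  obtain ⟨ε, hε, hd⟩ := h.exists_thickening
  have h1 : C ⊆ thickening ε (A i) := by
    refine hC.subset_left_of_subset_union (v := ⋃ j ∈ {j | j ≠ i}, thickening ε (A j))
      isOpen_thickening (isOpen_biUnion fun j _ => isOpen_thickening) ?_ ?_
      ⟨z, hz, self_subset_thickening hε _ hi⟩
    · simp only [disjoint_iUnion_right]
      exact fun j hj => hd _ _ (Ne.symm hj)
    · intro w hw
      obtain ⟨j, hj⟩ := h.mem (hCK hw)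
      by_cases hji : j = i
      · left; exact self_subset_thickening hε _ (hji ▸ hj)
      · right; exact mem_biUnion (show j ∈ {j | j ≠ i} from hji) (self_subset_thickening hε _ hj)
  intro w hw
  obtain ⟨j, hj⟩ := h.mem (hCK hw)
  by_cases hji : j = i
  · exact hji ▸ hj
  · exact (Set.disjoint_left.1 (hd i j (Ne.symm hji)) (h1 hw) (self_subset_thickening hε _ hj)).elim

lemma card_le [Finite ι] {κ : Type*} [Finite κ] {B : κ → Set ℂ} (h : Pieces K A)
    (h' : Pieces K B) : Nat.card ι ≤ Nat.card κ := by
  have key : ∀ i, ∃ j, A i ⊆ B j := fun i => by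
    obtain ⟨z, hz⟩ := (h.conn i).nonempty
    obtain ⟨j, hj⟩ := h'.mem (h.subset i hz)
    exact ⟨j, h'.subset_of_isPreconnected (h.conn i).isPreconnected (h.subset i) hz hj⟩
  choose σ hσ using key
  refine Nat.card_le_card_of_injective σ fun i i' hii => ?_
  obtain ⟨z, hz⟩ := (h.conn i).nonempty
  obtain ⟨z', hz'⟩ := (h.conn i').nonempty
  have h2 := h.subset_of_isPreconnected (h'.conn (σ i)).isPreconnected (h'.subset _) (hσ i hz) hz
  exact h.eq_of_mem (h2 (hii ▸ hσ i' hz')) hz'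

/-- Removing only one of the pieces leaves a connected set. -/
lemma isPreconnected_compl [Finite ι] (h : Pieces K A) (hK : IsPreconnected Kᶜ) (i : ι) :
    IsPreconnected (A i)ᶜ := by
  obtain ⟨ε, hε, hd⟩ := h.exists_thickening
  have hKne : Kᶜ.Nonempty := by
    obtain ⟨z, -, hz⟩ := not_subset_of_isOpen_of_isCompact h.isCompact isOpen_univ
      ((h.conn i).nonempty.mono (h.subset i)) (subset_univ _)
    exact ⟨z, hz⟩
  obtain ⟨x, hx⟩ := hKne
  have hAi : ∀ z ∈ Kᶜ, z ∈ (A i)ᶜ := fun z hz h' => hz (h.subset i h')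
  refine isPreconnected_of_forall x fun y hy => ?_
  by_cases hyK : y ∈ K
  · obtain ⟨j, hj⟩ := h.mem hyK
    have hji : j ≠ i := fun e => hy (e ▸ hj)
    refine ⟨Kᶜ ∪ thickening ε (A j), ?_, Or.inl hx, Or.inr (self_subset_thickening hε _ hj), ?_⟩
    · refine union_subset hAi fun z hz hz' => ?_
      exact Set.disjoint_left.1 (hd j i hji) hz (self_subset_thickening hε _ hz')
    · obtain ⟨z, hz, hz'⟩ := not_subset_of_isOpen_of_isCompact (h.compact j) isOpen_thickening
        (h.conn j).nonempty (self_subset_thickening hε (A j))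
      refine hK.union z (fun hzK => ?_) hz (isConnected_thickening (h.conn j) hε).isPreconnected
      obtain ⟨k, hk⟩ := h.mem hzK
      have hkj : j ≠ k := fun e => hz' (e ▸ hk)
      exact Set.disjoint_left.1 (hd j k hkj) hz (self_subset_thickening hε _ hk)
  · exact ⟨Kᶜ, hAi, hx, hyK, hK⟩

/-- Thin punctured neighbourhoods of the pieces are connected. -/
lemma exists_isConnected_thickening_diff [Finite ι] (h : Pieces K A) (hK : IsPreconnected Kᶜ) :
    ∃ ε > 0, ∀ i, ∀ δ > 0, δ ≤ ε → IsConnected (thickening δ (A i) \ K) ∧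
      thickening δ (A i) \ K = thickening δ (A i) \ A i := by
  obtain ⟨ε, hε, hd⟩ := h.exists_thickening
  refine ⟨ε, hε, fun i δ hδ hδε => ?_⟩
  have e1 : thickening δ (A i) \ K = thickening δ (A i) \ A i := by
    ext z
    refine ⟨fun hz => ⟨hz.1, fun h' => hz.2 (h.subset i h')⟩, fun hz => ⟨hz.1, fun hzK => ?_⟩⟩
    obtain ⟨k, hk⟩ := h.mem hzK
    have hki : i ≠ k := fun e => hz.2 (e ▸ hk)
    exact Set.disjoint_left.1 (hd i k hki) (thickening_mono hδε _ hz.1)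
      (self_subset_thickening hε _ hk)
  refine ⟨?_, e1⟩
  rw [e1]
  obtain ⟨z, hz, hz'⟩ := not_subset_of_isOpen_of_isCompact (h.compact i) isOpen_thickening
    (h.conn i).nonempty (self_subset_thickening hδ (A i))
  refine ⟨⟨z, hz, hz'⟩, isPreconnected_inter_of_union_eq_univ isOpen_thickening
    (h.compact i).isClosed.isOpen_compl (isConnected_thickening (h.conn i) hδ).isPreconnected
    (h.isPreconnected_compl hK i) ?_⟩
  rw [eq_univ_iff_forall]
  intro w
  by_cases hw : w ∈ A i
  · exact Or.inl (self_subset_thickening hδ _ hw)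
  · exact Or.inr hw

end Pieces

/-- A decreasing intersection of compact connected sets is connected. -/
lemma isPreconnected_iInter_closure {W : ℕ → Set ℂ} (hW : ∀ n, IsConnected (W n))
    (hanti : Antitone W) (hb : Bornology.IsBounded (W 0)) :
    IsConnected (⋂ n, closure (W n)) := by
  have hcpt : ∀ n, IsCompact (closure (W n)) := fun n =>
    (hb.subset (hanti (Nat.zero_le n))).isCompact_closure
  have hdir : Directed (· ⊇ ·) fun n => closure (W n) :=
    (Antitone.directed_ge fun m n h => closure_mono (hanti h))
  refine ⟨IsCompact.nonempty_iInter_of_directed_nonempty_isCompact_isClosed _ hdir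
    (fun n => (hW n).nonempty.closure) hcpt fun n => isClosed_closure, ?_⟩
  set C := ⋂ n, closure (W n) with hC
  have hCc : IsCompact C := (hcpt 0).of_isClosed_subset (isClosed_iInter fun n => isClosed_closure)
    (iInter_subset _ 0)
  rintro P Q hP hQ hPQ ⟨p, hp, hpP⟩ ⟨q, hq, hqQ⟩
  by_contra hcon
  rw [not_nonempty_iff_eq_empty] at hcon
  have hd : Disjoint (C \ Q) (C \ P) := by
    rw [Set.disjoint_left]
    rintro z ⟨hz, h1⟩ ⟨-, h2⟩
    exact (hPQ hz).elim h2 h1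
  obtain ⟨P1, Q1, hP1, hQ1, hPs, hQs, hdis⟩ := SeparatedNhds.of_isCompact_isCompact
    (hCc.diff hQ) (hCc.diff hP) hd
  have hnot : ∀ z ∈ C, z ∈ P → z ∉ Q := fun z hz h1 h2 => by
    have : z ∈ C ∩ (P ∩ Q) := ⟨hz, h1, h2⟩
    rw [hcon] at this; exact this
  obtain ⟨n, hn⟩ := exists_subset_nhds_of_isCompact' (U := P1 ∪ Q1) hdir hcpt
    (fun n => isClosed_closure) (by
      intro x hx
      refine (hP1.union hQ1).mem_nhds ?_
      by_cases hxQ : x ∈ Q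
      · right; exact hQs ⟨hx, fun h => hnot x hx h hxQ⟩
      · left; exact hPs ⟨hx, hxQ⟩)
  have hpn : p ∈ closure (W n) := iInter_subset _ n hp
  have hqn : q ∈ closure (W n) := iInter_subset _ n hq
  have hpP1 : p ∈ P1 := hPs ⟨hp, hnot p hp hpP⟩
  have hqQ1 : q ∈ Q1 := hQs ⟨hq, fun h => hnot q hq h hqQ⟩
  rcases (hW n).closure.isPreconnected.subset_or_subset hP1 hQ1 hdis hn with h | h
  · exact Set.disjoint_left.1 hdis (h hqn) hqQ1
  · exact Set.disjoint_left.1 hdis hpP1 (h hpn)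

/-- A continuous logarithm of a holomorphic function is holomorphic. -/
lemma differentiableOn_of_exp {U : Set ℂ} (hU : IsOpen U) {L h : ℂ → ℂ} (hL : ContinuousOn L U)
    (hh : DifferentiableOn ℂ h U) (he : ∀ z ∈ U, exp (L z) = h z) : DifferentiableOn ℂ L U := by
  intro z hz
  have hz0 : h z ≠ 0 := he z hz ▸ exp_ne_zero _
  have hd := (hh z hz).differentiableAt (hU.mem_nhds hz)
  have hmem : ∀ᶠ w in 𝓝 z, h w / h z ∈ slitPlane := by
    have : ContinuousAt (fun w => h w / h z) z := hd.continuousAt.div_const _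
    refine this.eventually_mem (isOpen_slitPlane.mem_nhds ?_)
    simp [hz0]
  obtain ⟨r, hr, hball⟩ := Metric.eventually_nhds_iff_ball.1 (hmem.and (hU.mem_nhds hz))
  have hdb : ∀ w ∈ ball z r, DifferentiableAt ℂ (fun w => log (h w / h z)) w := fun w hw =>
    (((hh w (hball w hw).2).differentiableAt (hU.mem_nhds (hball w hw).2)).div_const _).clog
      (hball w hw).1
  have hconst : ∀ w ∈ ball z r, L w = log (h w / h z) + L z := by
    intro w hw
    have := eq_of_exp_eq_one (S := ball z r) (f := fun w => L w - log (h w / h z) - L z)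
      (convex_ball z r).isPreconnected
      (((hL.mono fun w hw => (hball w hw).2).sub fun w hw =>
        (hdb w hw).continuousAt.continuousWithinAt).sub continuousOn_const)
      (fun w hw => by
        have h1 : h w / h z ≠ 0 := slitPlane_ne_zero (hball w hw).1
        rw [exp_sub, exp_sub, exp_log h1, he w (hball w hw).2, he z hz]
        have : h w ≠ 0 := fun h => h1 (by simp [h])
        field_simp) hw (mem_ball_self hr)
    simp only [div_self hz0, Complex.log_one] at this
    linear_combination this
  have : DifferentiableAt ℂ L z := by
    refine ((hdb z (mem_ball_self hr)).add_const (L z)).congr_of_eventuallyEq ?_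
    filter_upwards [ball_mem_nhds z hr] with w hw using hconst w hw
  exact this.differentiableWithinAt

lemma tendsto_div_sub_cocompact (a b : ℂ) :
    Tendsto (fun z : ℂ => (z - a) / (z - b)) (cocompact ℂ) (𝓝 1) := by
  have h1 : Tendsto (fun z : ℂ => z - b) (cocompact ℂ) (cocompact ℂ) :=
    (Homeomorph.subRight b).isClosedEmbedding.tendsto_cocompact
  have h2 : Tendsto (fun z : ℂ => 1 + (b - a) * (z - b)⁻¹) (cocompact ℂ) (𝓝 (1 + (b - a) * 0)) :=
    ((tendsto_inv₀_cobounded.mono_left (by rw [Metric.cobounded_eq_cocompact])).comp h1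
      |>.const_mul _).const_add _
  simp only [mul_zero, add_zero] at h2
  refine h2.congr' ?_
  have : ∀ᶠ z : ℂ in cocompact ℂ, z ≠ b := by
    have := (isCompact_singleton (x := b)).compl_mem_cocompact
    filter_upwards [this] with z hz using hz
  filter_upwards [this] with z hz
  have : z - b ≠ 0 := sub_ne_zero.2 hz
  field_simp
  ring

lemma exists_log_far {E : Set ℂ} (hE : IsPreconnected E) {a b : ℂ} (ha : a ∈ E)
    (hb : b ∈ E) {δ : ℝ} (hδ : 0 < δ) :
    ∃ L : ℂ → ℂ, ContinuousOn L {z | δ ≤ infDist z E} ∧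
      (∀ z, δ ≤ infDist z E → exp (L z) = (z - a) / (z - b)) ∧
      Tendsto L (cocompact ℂ) (𝓝 0) := by
  set T : Set ℂ := {b ∈ E | ∃ L : ℂ → ℂ, ContinuousOn L {z | δ ≤ infDist z E} ∧
      (∀ z, δ ≤ infDist z E → exp (L z) = (z - a) / (z - b)) ∧
      Tendsto L (cocompact ℂ) (𝓝 0)} with hT
  have hfar : ∀ z, δ ≤ infDist z E → ∀ b ∈ E, δ ≤ dist z b := fun z hz b hb =>
    hz.trans (infDist_le_dist_of_mem hb)
  have hstep : ∀ b ∈ T, ∀ c ∈ E, dist b c < δ → c ∈ T := by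
    rintro b ⟨hb, L, hL, hLe, hL0⟩ c hc hbc
    have hsl : ∀ z, δ ≤ infDist z E → (z - b) / (z - c) ∈ slitPlane := by
      intro z hz
      have h1 := hfar z hz c hc
      have h2 : z - c ≠ 0 := by
        rw [dist_eq_norm] at h1
        exact norm_pos_iff.1 (hδ.trans_le h1)
      have h3 : (z - b) / (z - c) = 1 + (c - b) / (z - c) := by field_simp; ring
      rw [h3]
      apply mem_slitPlane_of_norm_lt_one
      rw [norm_div, div_lt_one (norm_pos_iff.2 h2), ← dist_eq_norm, ← dist_eq_norm, dist_comm c b]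
      linarith
    refine ⟨hc, fun z => L z + log ((z - b) / (z - c)), ?_, ?_, ?_⟩
    · refine hL.add (ContinuousOn.clog (ContinuousOn.div (by fun_prop) (by fun_prop) ?_) hsl)
      intro z hz h0
      have := slitPlane_ne_zero (hsl z hz)
      rw [h0] at this; simp at this
    · intro z hz
      have h1 := slitPlane_ne_zero (hsl z hz)
      have h2 : z - b ≠ 0 := fun h => h1 (by simp [h])
      rw [exp_add, exp_log h1, hLe z hz]
      field_simp
    · have := (tendsto_div_sub_cocompact b c).clog (by simp)
      simpa using hL0.add this
  have haT : a ∈ T := by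
    refine ⟨ha, fun _ => 0, continuousOn_const, fun z hz => ?_, tendsto_const_nhds⟩
    have h1 := hfar z hz a ha
    rw [dist_eq_norm] at h1
    have := norm_pos_iff.1 (hδ.trans_le h1)
    rw [exp_zero, div_self this]
  by_contra hcon
  have hbT : b ∉ T := fun h => hcon h.2
  obtain ⟨c, hc, hc1, hc2⟩ := hE (⋃ x ∈ T, ball x δ) (⋃ x ∈ E \ T, ball x δ)
    (isOpen_biUnion fun _ _ => isOpen_ball) (isOpen_biUnion fun _ _ => isOpen_ball)
    (fun x hx => by
      by_cases hxT : x ∈ T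
      · exact Or.inl (mem_biUnion hxT (mem_ball_self hδ))
      · exact Or.inr (mem_biUnion (show x ∈ E \ T from ⟨hx, hxT⟩) (mem_ball_self hδ)))
    ⟨a, ha, mem_biUnion haT (mem_ball_self hδ)⟩
    ⟨b, hb, mem_biUnion (show b ∈ E \ T from ⟨hb, hbT⟩) (mem_ball_self hδ)⟩
  obtain ⟨x, hx, hcx⟩ := mem_iUnion₂.1 hc1
  obtain ⟨y, hy, hcy⟩ := mem_iUnion₂.1 hc2
  exact hy.2 (hstep c (hstep x hx c hc (mem_ball'.1 hcx)) y hy.1 hcy)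

lemma isConnected_norm_gt (R : ℝ) : IsConnected {z : ℂ | R < ‖z‖} := by
  rcases lt_or_ge R 0 with hR | hR
  · have : {z : ℂ | R < ‖z‖} = univ := eq_univ_of_forall fun z => hR.trans_le (norm_nonneg z)
    rw [this]; exact isConnected_univ
  have h1 : {z : ℂ | R < ‖z‖} = exp '' {w : ℂ | (if R = 0 then True else Real.log R < w.re)} := by
    ext z
    constructor
    · intro hz
      have hz' : R < ‖z‖ := hz
      have hz0 : z ≠ 0 := norm_pos_iff.1 (hR.trans_lt hz')
      refine ⟨log z, ?_, exp_log hz0⟩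
      split_ifs with h
      · trivial
      · rw [mem_ofPred_eq, Complex.log_re]
        exact Real.log_lt_log (lt_of_le_of_ne hR (Ne.symm h)) hz'
    · rintro ⟨w, hw, rfl⟩
      simp only [mem_ofPred_eq, norm_exp] at hw ⊢
      split_ifs at hw with h
      · rw [h]; exact Real.exp_pos _
      · rwa [← Real.log_lt_iff_lt_exp (lt_of_le_of_ne hR (Ne.symm h))]
  rw [h1]
  refine IsConnected.image ?_ _ continuous_exp.continuousOn
  split_ifs with h
  · simpa using isConnected_univ
  · refine ⟨⟨((Real.log R + 1 : ℝ) : ℂ), by simp only [mem_ofPred_eq, ofReal_re]; linarith⟩, ?_⟩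
    exact (convex_halfSpace_re_gt _).isPreconnected

lemma mem_cocompact_iff_norm_gt {s : Set ℂ} :
    s ∈ cocompact ℂ ↔ ∃ R : ℝ, ∀ z : ℂ, R < ‖z‖ → z ∈ s := by
  rw [← Metric.cobounded_eq_cocompact, ← comap_norm_atTop]
  constructor
  · rintro ⟨t, ht, hts⟩
    obtain ⟨R, hR⟩ := mem_atTop_sets.1 ht
    exact ⟨R, fun z hz => hts (hR _ hz.le)⟩
  · rintro ⟨R, hR⟩
    exact ⟨Ioi R, Ioi_mem_atTop R, fun z hz => hR z hz⟩

/-- If `a`, `b` lie in the continuum `E`, then `(z - a) / (z - b)` has a logarithm off `E`. -/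
lemma exists_log_compl {E : Set ℂ} (hEc : IsCompact E) (hE : IsPreconnected E)
    (hEcompl : IsPreconnected Eᶜ) {a b : ℂ} (ha : a ∈ E) (hb : b ∈ E) :
    ∃ L : ℂ → ℂ, DifferentiableOn ℂ L Eᶜ ∧ (∀ z ∈ Eᶜ, exp (L z) = (z - a) / (z - b)) ∧
      Tendsto L (cocompact ℂ) (𝓝 0) := by
  have hpos : ∀ n : ℕ, (0 : ℝ) < 1 / ((n : ℝ) + 1) := fun n => by positivity
  choose L hLc hLe hL0 using fun n : ℕ => exists_log_far hE ha hb (hpos n)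
  have hne : E.Nonempty := ⟨a, ha⟩
  -- differences of the logarithms are locally constant
  have hsame : ∀ {S : Set ℂ} {n : ℕ} {m : ℕ}, IsPreconnected S →
      (∀ z ∈ S, 1 / ((n : ℝ) + 1) ≤ infDist z E) → (∀ z ∈ S, 1 / ((m : ℝ) + 1) ≤ infDist z E) →
      ∀ z ∈ S, ∀ w ∈ S, L n z - L m z = L n w - L m w := by
    intro S n m hS hn hm z hz w hw
    refine eq_of_exp_eq_one hS (((hLc n).mono hn).sub ((hLc m).mono hm)) (fun x hx => ?_) hz hw
    have : exp (L m x) ≠ 0 := exp_ne_zero _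
    rw [Pi.sub_apply, exp_sub, hLe n x (hn x hx), ← hLe m x (hm x hx), div_self this]
  obtain ⟨R, hR⟩ := hEc.isBounded.subset_closedBall 0
  have hRfar : ∀ z : ℂ, R + 1 < ‖z‖ → 1 ≤ infDist z E := by
    intro z hz
    refine (le_infDist hne).2 fun y hy => ?_
    have h1 : ‖y‖ ≤ R := by simpa using hR hy
    have := norm_sub_norm_le z y
    rw [dist_eq_norm]; linarith
  have hone : ∀ n : ℕ, 1 / ((n : ℝ) + 1) ≤ 1 := fun n => by
    rw [div_le_one (by positivity)]; linarith [(Nat.cast_nonneg n : (0 : ℝ) ≤ n)]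
  have hinf : ∀ n m : ℕ, ∀ z : ℂ, R + 1 < ‖z‖ → L n z = L m z := by
    intro n m z hz
    have h1 : Tendsto (fun w => L n w - L m w) (cocompact ℂ) (𝓝 (0 - 0)) := (hL0 n).sub (hL0 m)
    have h2 : Tendsto (fun w => L n w - L m w) (cocompact ℂ) (𝓝 (L n z - L m z)) := by
      refine tendsto_const_nhds.congr' ?_
      refine mem_cocompact_iff_norm_gt.2 ⟨R + 1, fun w hw => ?_⟩
      exact hsame (isConnected_norm_gt (R + 1)).isPreconnected
        (fun z hz => (hone n).trans (hRfar z hz)) (fun z hz => (hone m).trans (hRfar z hz)) z hz w hw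
    have := tendsto_nhds_unique h1 h2
    rw [sub_zero] at this
    exact (sub_eq_zero.1 this.symm)
  set G : Set ℂ := {z | ∃ n : ℕ, ∃ V ∈ 𝓝 z, (∀ w ∈ V, 1 / ((n : ℝ) + 1) ≤ infDist w E) ∧
    ∀ m ≥ n, ∀ w ∈ V, L m w = L n w} with hG
  have hGo : IsOpen G := by
    rw [isOpen_iff_mem_nhds]
    rintro z ⟨n, V, hV, h1, h2⟩
    filter_upwards [eventually_mem_nhds_iff.2 hV] with w hw using ⟨n, V, hw, h1, h2⟩
  have hball : ∀ z ∈ Eᶜ, ∃ r > 0, ∃ n : ℕ, ∀ m ≥ n, ∀ w ∈ ball z r,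
      1 / ((m : ℝ) + 1) ≤ infDist w E := by
    intro z hz
    have hd : 0 < infDist z E := (hEc.isClosed.notMem_iff_infDist_pos hne).1 hz
    obtain ⟨n, hn⟩ := exists_nat_one_div_lt (half_pos hd)
    refine ⟨infDist z E / 2, half_pos hd, n, fun m hm w hw => ?_⟩
    have h1 : infDist z E ≤ infDist w E + dist z w := infDist_le_infDist_add_dist
    have h2 := mem_ball'.1 hw
    have h3 : 1 / ((m : ℝ) + 1) ≤ 1 / ((n : ℝ) + 1) := by
      apply one_div_le_one_div_of_le (by positivity)
      have : (n : ℝ) ≤ m := by exact_mod_cast hm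
      linarith
    linarith
  have hGcl : closure G ∩ Eᶜ ⊆ G := by
    rintro z ⟨hz, hzE⟩
    obtain ⟨r, hr, n, hn⟩ := hball z hzE
    obtain ⟨w, hw, hwr⟩ := Metric.mem_closure_iff.1 hz r hr
    obtain ⟨k, V, hV, h1, h2⟩ := hw
    have hwV := mem_of_mem_nhds hV
    have hwb : w ∈ ball z r := mem_ball'.2 hwr
    refine ⟨max n k, ball z r, ball_mem_nhds z hr, hn _ (le_max_left _ _), fun m hm x hx => ?_⟩
    have h3 := hsame (S := ball z r) (convex_ball z r).isPreconnected
      (n := m) (m := max n k) (hn m ((le_max_left _ _).trans hm)) (hn _ (le_max_left _ _)) x hx w hwb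
    rw [h2 m ((le_max_right _ _).trans hm) w hwV, h2 (max n k) (le_max_right _ _) w hwV, sub_self] at h3
    exact sub_eq_zero.1 h3
  have hfarmem : ∀ z : ℂ, R + 1 < ‖z‖ → z ∈ G := by
    intro z hz
    refine ⟨0, {w | R + 1 < ‖w‖}, (isOpen_lt continuous_const continuous_norm).mem_nhds hz,
      fun w hw => ?_, fun m _ w hw => hinf m 0 w hw⟩
    exact (hone 0).trans (hRfar w hw)
  have hEG : Eᶜ ⊆ G := by
    refine hEcompl.subset_of_closure_inter_subset hGo ?_ hGcl
    obtain ⟨z, hz⟩ := (isConnected_norm_gt (R + 1)).nonempty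
    refine ⟨z, fun hzE => ?_, hfarmem z hz⟩
    have h1 := hRfar z hz
    rw [infDist_zero_of_mem hzE] at h1
    linarith
  choose! N V hV hfar heq using fun z (hz : z ∈ G) => hz
  refine ⟨fun z => L (N z) z, ?_, ?_, ?_⟩
  · refine differentiableOn_of_exp hEc.isClosed.isOpen_compl (h := fun z => (z - a) / (z - b)) ?_ ?_ ?_
    · intro z hz
      have hzG := hEG hz
      have hcont : ContinuousAt (L (N z)) z := (hLc (N z)).continuousAt
        (mem_of_superset (hV z hzG) fun w hw => hfar z hzG w hw)
      refine ContinuousAt.continuousWithinAt (hcont.congr ?_)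
      filter_upwards [hV z hzG, hEc.isClosed.isOpen_compl.mem_nhds hz] with w hw hwE
      have hwG := hEG hwE
      rcases le_total (N z) (N w) with h | h
      · exact (heq z hzG _ h w hw).symm
      · exact heq w hwG _ h w (mem_of_mem_nhds (hV w hwG))
    · intro z hz
      have : z - b ≠ 0 := sub_ne_zero.2 fun h => hz (h ▸ hb)
      exact ((by fun_prop : DifferentiableAt ℂ (fun z => z - a) z).div
        (by fun_prop) this).differentiableWithinAt
    · intro z hz
      exact hLe _ z (hfar z (hEG hz) z (mem_of_mem_nhds (hV z (hEG hz))))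
  · intro z hz
    exact hLe _ z (hfar z (hEG hz) z (mem_of_mem_nhds (hV z (hEG hz))))
  · refine (hL0 0).congr' (mem_cocompact_iff_norm_gt.2 ⟨R + 1, fun z hz => ?_⟩)
    exact hinf 0 (N z) z hz

/-! ### Injective holomorphic functions, normal families -/

section Injective

variable {U : Set ℂ} {f : ℂ → ℂ}

lemma analyticAt_of_mem (hU : IsOpen U) (hf : DifferentiableOn ℂ f U) {z : ℂ} (hz : z ∈ U) :
    AnalyticAt ℂ f z := hf.analyticAt (hU.mem_nhds hz)

lemma eventually_ne_of_injOn (hU : IsOpen U) (hi : InjOn f U) {z : ℂ} (hz : z ∈ U) :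
    ∀ᶠ w in 𝓝[≠] z, f w ≠ f z := by
  filter_upwards [mem_nhdsWithin_of_mem_nhds (hU.mem_nhds hz), self_mem_nhdsWithin] with w hw hne h
  exact hne (hi hw hz h)

lemma nhds_le_map_of_injOn (hU : IsOpen U) (hf : DifferentiableOn ℂ f U) (hi : InjOn f U) {z : ℂ}
    (hz : z ∈ U) : 𝓝 (f z) ≤ map f (𝓝 z) := by
  refine (analyticAt_of_mem hU hf hz).eventually_constant_or_nhds_le_map_nhds.resolve_left ?_
  intro h
  obtain ⟨w, h1, h2⟩ := ((h.filter_mono nhdsWithin_le_nhds).and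
    (eventually_ne_of_injOn hU hi hz)).exists
  exact h2 h1

lemma isOpen_image_of_injOn (hU : IsOpen U) (hf : DifferentiableOn ℂ f U) (hi : InjOn f U) :
    IsOpen (f '' U) := by
  rw [isOpen_iff_mem_nhds]
  rintro _ ⟨z, hz, rfl⟩
  exact nhds_le_map_of_injOn hU hf hi hz (image_mem_map (hU.mem_nhds hz))

/-- The inverse of an injective holomorphic function is holomorphic. -/
lemma differentiableOn_leftInverse (hU : IsOpen U) (hf : DifferentiableOn ℂ f U) (hi : InjOn f U)
    {g : ℂ → ℂ} (hg : ∀ z ∈ U, g (f z) = z) : DifferentiableOn ℂ g (f '' U) := by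
  have hVo := isOpen_image_of_injOn hU hf hi
  have hcont : ∀ z ∈ U, ContinuousAt g (f z) := by
    intro z hz
    rw [ContinuousAt, hg z hz]
    intro s hs
    have h1 : f '' (s ∩ U) ∈ 𝓝 (f z) := nhds_le_map_of_injOn hU hf hi hz
      (image_mem_map (inter_mem hs (hU.mem_nhds hz)))
    rw [Filter.mem_map]
    refine mem_of_superset h1 ?_
    rintro _ ⟨w, hw, rfl⟩
    simpa [hg w hw.2] using hw.1
  have hfg : ∀ w ∈ f '' U, f (g w) = w := by
    rintro _ ⟨z, hz, rfl⟩; rw [hg z hz]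
  have hd : ∀ z ∈ U, deriv f z ≠ 0 → DifferentiableAt ℂ g (f z) := by
    intro z hz h0
    refine (HasDerivAt.of_local_left_inverse (f := f) (f' := deriv f z) (hcont z hz) ?_ h0
      ?_).differentiableAt
    · rw [hg z hz]; exact ((hf z hz).differentiableAt (hU.mem_nhds hz)).hasDerivAt
    · filter_upwards [hVo.mem_nhds ⟨z, hz, rfl⟩] with w hw using hfg w hw
  rintro _ ⟨z, hz, rfl⟩
  have hne : ∀ᶠ w in 𝓝[≠] z, deriv f w ≠ 0 := by
    refine (analyticAt_of_mem hU hf hz).deriv.eventually_eq_zero_or_eventually_ne_zero.resolve_left ?_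
    intro h
    obtain ⟨r, hr, hb⟩ := Metric.eventually_nhds_iff_ball.1 (h.and (hU.mem_nhds hz))
    have hc : ∀ w ∈ ball z r, f w = f z := fun w hw => by
      have := (convex_ball z r).norm_image_sub_le_of_norm_deriv_le (f := f) (C := 0) (𝕜 := ℂ)
        (fun x hx => (hf x (hb x hx).2).differentiableAt (hU.mem_nhds (hb x hx).2))
        (fun x hx => by rw [(hb x hx).1, norm_zero]) (mem_ball_self hr) hw
      rw [zero_mul] at this
      exact sub_eq_zero.1 (norm_le_zero_iff.1 this)
    obtain ⟨w, h1, h2⟩ := ((eventually_ne_of_injOn hU hi hz).and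
      (mem_nhdsWithin_of_mem_nhds (ball_mem_nhds z hr))).exists
    exact h1 (hc w h2)
  refine (analyticAt_of_differentiable_on_punctured_nhds_of_continuousAt ?_
    (hcont z hz)).differentiableAt.differentiableWithinAt
  have ht : Tendsto g (𝓝[≠] (f z)) (𝓝[≠] z) := by
    refine tendsto_nhdsWithin_iff.2 ⟨?_, ?_⟩
    · have := hcont z hz
      rw [ContinuousAt, hg z hz] at this
      exact this.mono_left nhdsWithin_le_nhds
    · filter_upwards [self_mem_nhdsWithin,
        mem_nhdsWithin_of_mem_nhds (hVo.mem_nhds ⟨z, hz, rfl⟩)] with w hw hwV h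
      exact hw (by rw [← hfg w hwV, (show g w = z from h)]; rfl)
  filter_upwards [ht.eventually hne,
    mem_nhdsWithin_of_mem_nhds (hVo.mem_nhds ⟨z, hz, rfl⟩)] with w hw hwV
  obtain ⟨x, hx, rfl⟩ := hwV
  rw [hg x hx] at hw
  exact hd x hx hw

lemma deriv_ne_zero_of_injOn (hU : IsOpen U) (hf : DifferentiableOn ℂ f U) (hi : InjOn f U) {z : ℂ}
    (hz : z ∈ U) : deriv f z ≠ 0 := by
  have hg : ∀ z ∈ U, Function.invFunOn f U (f z) = z := fun z hz => hi.leftInvOn_invFunOn hz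
  have h1 := (differentiableOn_leftInverse hU hf hi hg (f z) ⟨z, hz, rfl⟩).differentiableAt
    ((isOpen_image_of_injOn hU hf hi).mem_nhds ⟨z, hz, rfl⟩)
  have h2 := ((hf z hz).differentiableAt (hU.mem_nhds hz)).hasDerivAt
  have h3 : HasDerivAt (fun w => Function.invFunOn f U (f w)) 1 z := by
    refine (hasDerivAt_id z).congr_of_eventuallyEq ?_
    filter_upwards [hU.mem_nhds hz] with w hw using hg w hw
  intro h0
  have h4 := (h1.hasDerivAt.comp z h2).unique h3
  rw [h0, mul_zero] at h4
  exact zero_ne_one h4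

end Injective

/-- Removal of the singularity at infinity. -/
lemma exists_tendsto_mul {h : ℂ → ℂ} {R : ℝ} (hd : DifferentiableOn ℂ h {z | R < ‖z‖})
    (h0 : Tendsto h (cocompact ℂ) (𝓝 0)) :
    ∃ a, Tendsto (fun z => z * h z) (cocompact ℂ) (𝓝 a) := by
  have hinv : Tendsto (fun z : ℂ => z⁻¹) (𝓝[≠] 0) (cocompact ℂ) := by
    rw [← Metric.cobounded_eq_cocompact]; exact tendsto_inv₀_nhdsNE_zero
  have hinv' : Tendsto (fun z : ℂ => z⁻¹) (cocompact ℂ) (𝓝[≠] 0) := by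
    refine tendsto_nhdsWithin_iff.2 ⟨?_, ?_⟩
    · rw [← Metric.cobounded_eq_cocompact]; exact tendsto_inv₀_cobounded
    · refine mem_cocompact_iff_norm_gt.2 ⟨0, fun z hz => ?_⟩
      exact inv_ne_zero (norm_pos_iff.1 hz)
  have hopen : IsOpen {z : ℂ | R < ‖z‖} := isOpen_lt continuous_const continuous_norm
  let g : ℂ → ℂ := Function.update (fun z => h z⁻¹) 0 0
  have hg0 : ContinuousAt g 0 := by
    rw [continuousAt_update_same]; exact h0.comp hinv
  have hgd : ∀ᶠ z in 𝓝[≠] (0 : ℂ), DifferentiableAt ℂ g z := by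
    have : {z : ℂ | R < ‖z‖} ∈ cocompact ℂ := mem_cocompact_iff_norm_gt.2 ⟨R, fun z hz => hz⟩
    filter_upwards [hinv.eventually this, self_mem_nhdsWithin] with z hz hz0
    have hz0' : z ≠ 0 := hz0
    have h1 : DifferentiableAt ℂ (fun z => h z⁻¹) z :=
      ((hd _ hz).differentiableAt (hopen.mem_nhds hz)).comp z (differentiableAt_inv hz0')
    refine h1.congr_of_eventuallyEq ?_
    filter_upwards [isOpen_ne.mem_nhds hz0'] with w hw
    exact Function.update_of_ne hw _ _
  have hga := (analyticAt_of_differentiable_on_punctured_nhds_of_continuousAt hgd hg0)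
  refine ⟨deriv g 0, ?_⟩
  have := (hga.differentiableAt.hasDerivAt.tendsto_slope).comp hinv'
  refine this.congr' ?_
  refine mem_cocompact_iff_norm_gt.2 ⟨0, fun z hz => ?_⟩
  have hz0 : z ≠ 0 := norm_pos_iff.1 hz
  have h2 : g z⁻¹ = h z := by
    simp only [g]; rw [Function.update_of_ne (inv_ne_zero hz0), inv_inv]
  have h3 : g 0 = 0 := Function.update_self _ _ _
  simp [slope_def_field, h2, h3, mul_comm]

section Normal

variable {ι : Type*} {U : Ultrafilter ι} {F : ι → ℂ → ℂ} {f : ℂ → ℂ} {Dom : ι → Set ℂ} {D : Set ℂ}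

/-- Local boundedness along a filter, with varying domains. -/
def LocBdd (U : Ultrafilter ι) (F : ι → ℂ → ℂ) (Dom : ι → Set ℂ) (D : Set ℂ) : Prop :=
  ∀ z ∈ D, ∃ r > 0, ∃ M : ℝ, ∀ᶠ i in (U : Filter ι), ball z r ⊆ Dom i ∧ ∀ w ∈ ball z r, ‖F i w‖ ≤ M

/-- Locally uniform convergence along a filter, with varying domains. -/
def LocConv (U : Ultrafilter ι) (F : ι → ℂ → ℂ) (f : ℂ → ℂ) (Dom : ι → Set ℂ) (D : Set ℂ) : Prop :=
  ∀ z ∈ D, ∃ r > 0, (∀ᶠ i in (U : Filter ι), ball z r ⊆ Dom i) ∧ TendstoUniformlyOn F f U (ball z r)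

lemma Ultrafilter.exists_tendsto_of_bdd {E : Type*} [PseudoMetricSpace E] [ProperSpace E]
    {u : ι → E} {x : E} {M : ℝ} (h : ∀ᶠ i in (U : Filter ι), dist (u i) x ≤ M) :
    ∃ a, Tendsto u U (𝓝 a) := by
  obtain ⟨a, -, ha⟩ := (isCompact_closedBall x M).ultrafilter_le_nhds (U.map u) (by
    rw [le_principal_iff]
    exact h)
  exact ⟨a, ha⟩

/-- Montel's theorem along an ultrafilter. -/
lemma LocBdd.exists_locConv (hD : LocBdd U F Dom D) (hF : ∀ i, DifferentiableOn ℂ (F i) (Dom i)) :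
    ∃ f, LocConv U F f Dom D := by
  have hpt : ∀ z, ∃ a, (∃ M : ℝ, ∀ᶠ i in (U : Filter ι), ‖F i z‖ ≤ M) →
      Tendsto (fun i => F i z) U (𝓝 a) := by
    intro z
    by_cases h : ∃ M : ℝ, ∀ᶠ i in (U : Filter ι), ‖F i z‖ ≤ M
    · obtain ⟨M, hM⟩ := h
      obtain ⟨a, ha⟩ := Ultrafilter.exists_tendsto_of_bdd (x := (0 : ℂ)) (u := fun i => F i z)
        (M := M) (by simpa using hM)
      exact ⟨a, fun _ => ha⟩
    · exact ⟨0, fun h' => absurd h' h⟩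
  choose f hf using hpt
  refine ⟨f, fun z hz => ?_⟩
  obtain ⟨r, hr, M, hM⟩ := hD z hz
  have hM0 : 0 ≤ M := by
    obtain ⟨i, hi⟩ := hM.exists
    exact (norm_nonneg _).trans (hi.2 z (mem_ball_self hr))
  have hlim : ∀ w ∈ ball z r, Tendsto (fun i => F i w) U (𝓝 (f w)) := fun w hw =>
    hf w ⟨M, hM.mono fun i hi => hi.2 w hw⟩
  set C := 2 * M / (r / 2) with hC
  have hC0 : 0 ≤ C := by positivity
  have hsub : ball z (r / 4) ⊆ ball z r := ball_subset_ball (by linarith)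
  have hlip : ∀ᶠ i in (U : Filter ι), ∀ w ∈ ball z (r / 4), ∀ w' ∈ ball z (r / 4),
      dist (F i w') (F i w) ≤ C * dist w' w := by
    filter_upwards [hM] with i hi w hw w' hw'
    have h1 : ball w (r / 2) ⊆ ball z r := by
      intro x hx
      have := dist_triangle x w z
      rw [mem_ball] at *; linarith
    refine dist_le_div_mul_dist_of_mapsTo_ball ((hF i).mono (h1.trans hi.1)) ?_ ?_
    · intro x hx
      rw [mem_closedBall, dist_eq_norm]
      have h2 := hi.2 x (h1 hx)
      have h3 := hi.2 w (hsub hw)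
      have := norm_sub_le (F i x) (F i w)
      linarith
    · have := dist_triangle w' z w
      rw [dist_comm z w] at this
      rw [mem_ball] at *; linarith
  have hlip' : ∀ w ∈ ball z (r / 4), ∀ w' ∈ ball z (r / 4), dist (f w') (f w) ≤ C * dist w' w := by
    intro w hw w' hw'
    refine le_of_tendsto ((hlim w' (hsub hw')).dist (hlim w (hsub hw))) ?_
    filter_upwards [hlip] with i hi using hi w hw w' hw'
  refine ⟨r / 4, by positivity, hM.mono fun i hi => hsub.trans hi.1, ?_⟩
  rw [Metric.tendstoUniformlyOn_iff]
  intro ε hε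
  have hη : 0 < ε / (3 * (C + 1)) := by positivity
  obtain ⟨t, hts, htf, htc⟩ := Metric.finite_approx_of_totallyBounded
    ((isCompact_closedBall z (r / 4)).totallyBounded.subset ball_subset_closedBall) _ hη
  have h1 : ∀ᶠ i in (U : Filter ι), ∀ c ∈ t, dist (F i c) (f c) < ε / 3 :=
    (eventually_all_finite htf).2 fun c hc =>
      (hlim c (hsub (hts hc))).eventually (ball_mem_nhds _ (by positivity))
  filter_upwards [hlip, h1] with i hi h1 w hw
  obtain ⟨c, hc, hwc⟩ := mem_iUnion₂.1 (htc hw)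
  have hCd : C * dist w c < ε / 3 := by
    calc C * dist w c ≤ C * (ε / (3 * (C + 1))) := by
          gcongr; exact (mem_ball.1 hwc).le
      _ < (C + 1) * (ε / (3 * (C + 1))) := by gcongr; linarith
      _ = ε / 3 := by field_simp
  have h2 := hi c (hts hc) w hw
  have h3 := hlip' c (hts hc) w hw
  have h4 := h1 c hc
  have h5 := dist_triangle4 (f w) (f c) (F i c) (F i w)
  rw [dist_comm (f c), dist_comm (F i c) (F i w)] at h5
  linarith

lemma LocConv.differentiableAt (h : LocConv U F f Dom D)
    (hF : ∀ i, DifferentiableOn ℂ (F i) (Dom i)) {z : ℂ} (hz : z ∈ D) : DifferentiableAt ℂ f z := by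
  obtain ⟨r, hr, h1, h2⟩ := h z hz
  exact (h2.tendstoLocallyUniformlyOn.differentiableOn (h1.mono fun i hi => (hF i).mono hi)
    isOpen_ball).differentiableAt (ball_mem_nhds z hr)

lemma LocConv.tendsto (h : LocConv U F f Dom D) {z : ℂ} (hz : z ∈ D) :
    Tendsto (fun i => F i z) U (𝓝 (f z)) := by
  obtain ⟨r, hr, h1, h2⟩ := h z hz
  exact h2.tendsto_at (mem_ball_self hr)

/-- Values of the limit are taken, uniformly, by the approximating functions. -/
lemma LocConv.ball_subset (h : LocConv U F f Dom D) (hF : ∀ i, DifferentiableOn ℂ (F i) (Dom i))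
    (hD : IsOpen D) {z : ℂ} (hz : z ∈ D) (hne : ∀ᶠ w in 𝓝[≠] z, f w ≠ f z) {ρ : ℝ} (hρ : 0 < ρ) :
    ∃ ε > 0, ∀ᶠ i in (U : Filter ι), closedBall z ρ ∩ Dom i ⊆ Dom i ∧
      ball (f z) ε ⊆ F i '' (ball z ρ ∩ Dom i) := by
  obtain ⟨r, hr, h1, h2⟩ := h z hz
  obtain ⟨r1, hr1, h3⟩ := Metric.mem_nhdsWithin_iff.1 hne
  obtain ⟨r2, hr2, h4⟩ := Metric.isOpen_iff.1 hD z hz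
  set s := min (min r r1) (min ρ r2) / 2 with hs
  have hm : 0 < min (min r r1) (min ρ r2) := lt_min (lt_min hr hr1) (lt_min hρ hr2)
  have hs0 : 0 < s := half_pos hm
  have hsr : s < r := (half_lt_self hm).trans_le ((min_le_left _ _).trans (min_le_left _ _))
  have hsr1 : s < r1 := (half_lt_self hm).trans_le ((min_le_left _ _).trans (min_le_right _ _))
  have hsρ : s < ρ := (half_lt_self hm).trans_le ((min_le_right _ _).trans (min_le_left _ _))
  have hsr2 : s < r2 := (half_lt_self hm).trans_le ((min_le_right _ _).trans (min_le_right _ _))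
  have hcont : ContinuousOn f (sphere z s) := fun w hw =>
    (h.differentiableAt hF (h4 (mem_ball.2 ((mem_sphere.1 hw).trans_lt hsr2)))).continuousAt
      |>.continuousWithinAt
  obtain ⟨w0, hw0, hmin⟩ := (isCompact_sphere z s).exists_isMinOn
    (NormedSpace.sphere_nonempty.2 hs0.le) ((hcont.sub (continuousOn_const (c := f z))).norm)
  set m := ‖f w0 - f z‖ with hmdef
  have hm0 : 0 < m := by
    refine norm_pos_iff.2 (sub_ne_zero.2 (h3 ⟨?_, ?_⟩))
    · exact mem_ball.2 ((mem_sphere.1 hw0).trans_lt hsr1)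
    · intro h
      rw [mem_singleton_iff.1 h, mem_sphere, dist_self] at hw0
      exact hs0.ne hw0
  refine ⟨m / 8, by positivity, ?_⟩
  filter_upwards [h1, (Metric.tendstoUniformlyOn_iff.1 h2) (m / 8) (by positivity)] with i hi1 hi2
  refine ⟨inter_subset_right, ?_⟩
  have hcb : closedBall z s ⊆ ball z r := closedBall_subset_ball hsr
  have hsph : ∀ w ∈ sphere z s, m / 2 ≤ ‖F i w - F i z‖ := by
    intro w hw
    have e1 := hi2 w (hcb (sphere_subset_closedBall hw))
    have e2 := hi2 z (mem_ball_self hr)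
    have e3 : m ≤ dist (f w) (f z) := by rw [dist_eq_norm]; exact hmin hw
    have e4 := dist_triangle4 (f w) (F i w) (F i z) (f z)
    rw [dist_comm (F i z)] at e4
    rw [← dist_eq_norm]; linarith
  have key := DiffContOnCl.ball_subset_image_closedBall (f := F i) (z₀ := z) (ε := m / 2) (r := s)
    (((hF i).mono (hcb.trans hi1)).diffContOnCl_ball Subset.rfl) hs0 hsph (by
      intro hev
      have hev' : ∀ᶠ w in 𝓝 z, F i w = F i z := by simpa using hev
      have han : AnalyticOnNhd ℂ (F i) (ball z r) :=
        ((hF i).mono hi1).analyticOnNhd isOpen_ball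
      have := han.eqOn_of_preconnected_of_eventuallyEq (g := fun _ => F i z)
        analyticOnNhd_const (convex_ball z r).isPreconnected (mem_ball_self hr) hev'
      have e1 := hsph w0 hw0
      rw [this (hcb (sphere_subset_closedBall hw0)), sub_self, norm_zero] at e1
      linarith)
  intro w hw
  obtain ⟨x, hx, rfl⟩ := key (show w ∈ ball (F i z) (m / 2 / 2) by
    have e2 := hi2 z (mem_ball_self hr)
    have e3 := dist_triangle w (f z) (F i z)
    rw [mem_ball] at hw ⊢
    linarith)
  exact ⟨x, ⟨closedBall_subset_ball hsρ hx, hi1 (hcb hx)⟩, rfl⟩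

/-- Hurwitz: a locally nonconstant limit of injective functions is injective. -/
lemma LocConv.injOn (h : LocConv U F f Dom D) (hF : ∀ i, DifferentiableOn ℂ (F i) (Dom i))
    (hi : ∀ i, InjOn (F i) (Dom i)) (hD : IsOpen D)
    (hne : ∀ z ∈ D, ∀ᶠ w in 𝓝[≠] z, f w ≠ f z) : InjOn f D := by
  intro z hz w hw hzw
  by_contra hcon
  have hd : 0 < dist z w / 2 := half_pos (dist_pos.2 hcon)
  obtain ⟨ε, hε, h1⟩ := h.ball_subset hF hD hz (hne z hz) hd
  obtain ⟨ε', hε', h2⟩ := h.ball_subset hF hD hw (hne w hw) hd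
  obtain ⟨i, hi1, hi2⟩ := (h1.and h2).exists
  obtain ⟨x, hx, hxe⟩ := hi1.2 (mem_ball_self hε)
  obtain ⟨y, hy, hye⟩ := hi2.2 (mem_ball_self hε')
  have hxy : x = y := hi i hx.2 hy.2 (by rw [hxe, hye, hzw])
  subst hxy
  have e1 := mem_ball.1 hx.1
  have e2 := mem_ball.1 hy.1
  have := dist_triangle z x w
  rw [dist_comm z x] at this
  linarith

end Normal

lemma eventually_ne_of_not_const {D : Set ℂ} (hD : IsOpen D) (hDc : IsPreconnected D) {f : ℂ → ℂ}
    (hf : DifferentiableOn ℂ f D) (hne : ∃ x ∈ D, ∃ y ∈ D, f x ≠ f y) {z : ℂ} (hz : z ∈ D) (c : ℂ) :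
    ∀ᶠ w in 𝓝[≠] z, f w ≠ c := by
  obtain ⟨x, hx, y, hy, hxy⟩ := hne
  have han : AnalyticOnNhd ℂ f D := hf.analyticOnNhd hD
  have h1 : AnalyticAt ℂ (fun w => f w - c) z := (han z hz).sub analyticAt_const
  rcases h1.eventually_eq_zero_or_eventually_ne_zero with h | h
  · have := han.eqOn_of_preconnected_of_eventuallyEq (g := fun _ => c) analyticOnNhd_const hDc hz
      (h.mono fun w hw => sub_eq_zero.1 hw)
    exact absurd ((this hx).trans (this hy).symm) hxy
  · exact h.mono fun w hw => sub_ne_zero.1 hw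

/-! ### Normalised univalent functions near infinity -/

/-- Univalent functions off `K`, normalised by `f z - z → 0` at infinity. -/
structure Sig (K : Set ℂ) (f : ℂ → ℂ) : Prop where
  diff : DifferentiableOn ℂ f Kᶜ
  inj : InjOn f Kᶜ
  inf : Tendsto (fun z => f z - z) (cocompact ℂ) (𝓝 0)

/-- The complement of the image of the complement of `K`. -/
def img (K : Set ℂ) (f : ℂ → ℂ) : Set ℂ := (f '' Kᶜ)ᶜ

lemma compl_img (K : Set ℂ) (f : ℂ → ℂ) : (img K f)ᶜ = f '' Kᶜ := compl_compl _

lemma Sig.id (K : Set ℂ) : Sig K (fun z => z) :=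
  ⟨differentiableOn_id, injOn_id _, by simp⟩

lemma img_id (K : Set ℂ) : img K (fun z => z) = K := by simp [img]

lemma Sig.mono {K K' : Set ℂ} {f : ℂ → ℂ} (h : Sig K f) (hK : K ⊆ K') : Sig K' f :=
  ⟨h.diff.mono (compl_subset_compl.2 hK), h.inj.mono (compl_subset_compl.2 hK), h.inf⟩

lemma tendsto_cocompact_of_sub {f : ℂ → ℂ} {c : ℂ}
    (h : Tendsto (fun z => f z - z) (cocompact ℂ) (𝓝 c)) :
    Tendsto f (cocompact ℂ) (cocompact ℂ) := by
  rw [← Metric.cobounded_eq_cocompact] at *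
  rw [← tendsto_norm_atTop_iff_cobounded]
  have h1 : Tendsto (fun z : ℂ => ‖z‖ + -‖f z - z‖) (Bornology.cobounded ℂ) atTop :=
    tendsto_norm_cobounded_atTop.atTop_add h.norm.neg
  refine tendsto_atTop_mono (fun z => ?_) h1
  have := norm_sub_norm_le z (z - f z)
  rw [show z - (z - f z) = f z by ring, norm_sub_rev z (f z)] at this
  linarith

namespace Sig

variable {K : Set ℂ} {f g : ℂ → ℂ}

lemma isClosed_image (hf : Sig K f) {S : Set ℂ} (hS : IsClosed S) (hSK : S ⊆ Kᶜ) :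
    IsClosed (f '' S) := by
  refine isClosed_of_closure_subset fun w hw => ?_
  obtain ⟨R, hR⟩ := mem_cocompact_iff_norm_gt.1 ((tendsto_cocompact_of_sub hf.inf)
    ((isCompact_closedBall w 1).compl_mem_cocompact))
  have hfT : IsClosed (f '' (closedBall 0 R ∩ S)) :=
    (((isCompact_closedBall 0 R).inter_right hS).image_of_continuousOn
      (hf.diff.continuousOn.mono (inter_subset_right.trans hSK))).isClosed
  by_contra hcon
  obtain ⟨y, hy1, z, hz, rfl⟩ := mem_closure_iff.1 hw ((f '' (closedBall 0 R ∩ S))ᶜ ∩ ball w 1)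
    (hfT.isOpen_compl.inter isOpen_ball)
    ⟨fun h => hcon (image_mono inter_subset_right h), mem_ball_self one_pos⟩
  refine hy1.1 ⟨z, ⟨?_, hz⟩, rfl⟩
  rw [mem_closedBall_zero_iff]
  by_contra! h
  exact hR z h (ball_subset_closedBall hy1.2)

lemma subset_image_norm_gt (hf : Sig K f) {ρ : ℝ} (hρ : K ⊆ ball 0 ρ) {T : Set ℂ}
    (hT : IsPreconnected T) (hTc : ∃ R, ∀ z : ℂ, R < ‖z‖ → z ∈ T)
    (hTρ : ∀ z : ℂ, ‖z‖ = ρ → f z ∉ T) : T ⊆ f '' {z : ℂ | ρ < ‖z‖} := by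
  have hout : {z : ℂ | ρ ≤ ‖z‖} ⊆ Kᶜ := fun z hz hzK => by
    have h1 : ‖z‖ < ρ := by simpa using hρ hzK
    exact absurd h1 (not_lt.2 hz)
  have hVo : IsOpen {z : ℂ | ρ < ‖z‖} := isOpen_lt continuous_const continuous_norm
  have hV : {z : ℂ | ρ < ‖z‖} ⊆ {z : ℂ | ρ ≤ ‖z‖} := fun z hz => le_of_lt (show ρ < ‖z‖ from hz)
  have hVK := hV.trans hout
  refine hT.subset_of_closure_inter_subset
    (isOpen_image_of_injOn hVo (hf.diff.mono hVK) (hf.inj.mono hVK)) ?_ ?_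
  · obtain ⟨S, hS⟩ := mem_cocompact_iff_norm_gt.1 ((tendsto_cocompact_of_sub hf.inf)
      (mem_cocompact_iff_norm_gt.2 hTc))
    obtain ⟨z, hz⟩ := (isConnected_norm_gt (max S ρ)).nonempty
    have hz' : max S ρ < ‖z‖ := hz
    exact ⟨f z, hS z ((le_max_left _ _).trans_lt hz'), z, (le_max_right _ _).trans_lt hz', rfl⟩
  · rintro w ⟨hw, hwT⟩
    have hcl := hf.isClosed_image (isClosed_le continuous_const continuous_norm) hout
    obtain ⟨z, hz, rfl⟩ := closure_minimal (image_mono hV) hcl hw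
    rcases (show ρ ≤ ‖z‖ from hz).eq_or_lt with h | h
    · exact absurd hwT (hTρ z h.symm)
    · exact ⟨z, h, rfl⟩

lemma exists_preimage (hK : IsCompact K) (hf : Sig K f) (R : ℝ) :
    ∃ R' : ℝ, ∀ w : ℂ, R' < ‖w‖ → ∃ z ∈ Kᶜ, R < ‖z‖ ∧ f z = w := by
  obtain ⟨ρ, hRρ, hρ⟩ := hK.isBounded.subset_ball_lt R 0
  have hout : ∀ z : ℂ, ρ ≤ ‖z‖ → z ∈ Kᶜ := fun z hz hzK => by
    have : ‖z‖ < ρ := by simpa using hρ hzK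
    linarith
  obtain ⟨M, hM⟩ := (isCompact_sphere (0 : ℂ) ρ).exists_bound_of_continuousOn
    (hf.diff.continuousOn.mono fun z hz => hout z (mem_sphere_zero_iff_norm.1 hz).ge)
  have key := hf.subset_image_norm_gt hρ (isConnected_norm_gt M).isPreconnected
    ⟨M, fun z hz => hz⟩ fun z hz => not_lt.2 (hM z (by simp [hz]))
  refine ⟨M, fun w hw => ?_⟩
  obtain ⟨z, hz, rfl⟩ := key hw
  exact ⟨z, hout z (le_of_lt hz), hRρ.trans hz, rfl⟩

lemma exists_bound (hK : IsCompact K) (hf : Sig K f) (R : ℝ) :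
    ∃ R' : ℝ, ∀ z ∈ Kᶜ, ‖z‖ ≤ R → ‖f z‖ ≤ R' := by
  obtain ⟨R', h⟩ := hf.exists_preimage hK R
  refine ⟨R', fun z hz hzR => ?_⟩
  by_contra! hcon
  obtain ⟨y, hy, hyR, hyz⟩ := h _ hcon
  rw [hf.inj hy hz hyz] at hyR
  linarith

lemma isOpen_image (hK : IsCompact K) (hf : Sig K f) : IsOpen (f '' Kᶜ) :=
  isOpen_image_of_injOn hK.isClosed.isOpen_compl hf.diff hf.inj

lemma isCompact_img (hK : IsCompact K) (hf : Sig K f) : IsCompact (img K f) := by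
  obtain ⟨R', h⟩ := hf.exists_preimage hK 0
  refine (isCompact_closedBall (0 : ℂ) R').of_isClosed_subset (hf.isOpen_image hK).isClosed_compl ?_
  intro w hw
  rw [mem_closedBall_zero_iff]
  by_contra! hcon
  obtain ⟨z, hz, -, rfl⟩ := h w hcon
  exact hw ⟨z, hz, rfl⟩

lemma isPreconnected_compl_img (hf : Sig K f) (hc : IsPreconnected Kᶜ) :
    IsPreconnected (img K f)ᶜ := by
  rw [compl_img]; exact hc.image _ hf.diff.continuousOn

lemma exists_inv (hK : IsCompact K) (hf : Sig K f) : ∃ g : ℂ → ℂ, Sig (img K f) g ∧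
    img (img K f) g = K ∧ (∀ z ∈ Kᶜ, g (f z) = z) ∧
    ∀ w ∈ (img K f)ᶜ, g w ∈ Kᶜ ∧ f (g w) = w := by
  have hg : ∀ z ∈ Kᶜ, Function.invFunOn f Kᶜ (f z) = z := fun z hz => hf.inj.leftInvOn_invFunOn hz
  set g := Function.invFunOn f Kᶜ with hgdef
  have hg2 : ∀ w ∈ (img K f)ᶜ, g w ∈ Kᶜ ∧ f (g w) = w := by
    rw [compl_img]
    rintro _ ⟨z, hz, rfl⟩
    rw [hg z hz]; exact ⟨hz, rfl⟩
  refine ⟨g, ⟨?_, ?_, ?_⟩, ?_, hg, hg2⟩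
  · rw [compl_img]
    exact differentiableOn_leftInverse hK.isClosed.isOpen_compl hf.diff hf.inj hg
  · rw [compl_img]
    rintro _ ⟨z, hz, rfl⟩ _ ⟨w, hw, rfl⟩ h
    rw [hg z hz, hg w hw] at h
    rw [h]
  · have hcc : Tendsto g (cocompact ℂ) (cocompact ℂ) := by
      intro s hs
      obtain ⟨R, hR⟩ := mem_cocompact_iff_norm_gt.1 hs
      obtain ⟨R', h⟩ := hf.exists_preimage hK R
      refine mem_cocompact_iff_norm_gt.2 ⟨R', fun w hw => ?_⟩
      obtain ⟨z, hz, hzR, rfl⟩ := h w hw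
      refine hR _ ?_
      rw [hg z hz]; exact hzR
    have h1 := (hf.inf.comp hcc).neg
    rw [neg_zero] at h1
    refine h1.congr' ?_
    filter_upwards [(hf.isCompact_img hK).compl_mem_cocompact] with w hw
    simp [(hg2 w hw).2]
  · rw [img, compl_img, image_image]
    rw [show (fun z => g (f z)) '' Kᶜ = Kᶜ from ?_, compl_compl]
    rw [image_congr hg, image_id']

lemma comp (hK : IsCompact K) (hf : Sig K f) (hg : Sig (img K f) g) :
    Sig K (fun z => g (f z)) ∧ img K (fun z => g (f z)) = img (img K f) g := by
  refine ⟨⟨?_, ?_, ?_⟩, ?_⟩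
  · refine hg.diff.comp hf.diff fun z hz => ?_
    rw [compl_img]; exact ⟨z, hz, rfl⟩
  · intro z hz w hw h
    refine hf.inj hz hw (hg.inj ?_ ?_ h)
    · rw [compl_img]; exact ⟨z, hz, rfl⟩
    · rw [compl_img]; exact ⟨w, hw, rfl⟩
  · have := (hg.inf.comp (tendsto_cocompact_of_sub hf.inf)).add hf.inf
    simpa using this
  · rw [img, img, compl_img, image_image]

end Sig

/-! ### Boundary correspondence -/

namespace Sig

variable {ι : Type*} [Finite ι] {K : Set ℂ} {A : ι → Set ℂ} {f : ℂ → ℂ}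

lemma exists_cluster (hP : Pieces K A) (hc : IsPreconnected Kᶜ) (hf : Sig K f) :
    ∃ C : ι → Set ℂ, (∀ i, IsConnected (C i) ∧ C i ⊆ img K f ∧
      Tendsto f (𝓝ˢ (A i) ⊓ 𝓟 Kᶜ) (𝓝ˢ (C i))) ∧ frontier (img K f) ⊆ ⋃ i, C i := by
  obtain ⟨ε, hε, hcon⟩ := hP.exists_isConnected_thickening_diff hc
  have hK := hP.isCompact
  have hKo := hK.isClosed.isOpen_compl
  set δ : ℕ → ℝ := fun n => ε / (n + 1) with hδ
  have hδ0 : ∀ n, 0 < δ n := fun n => by positivity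
  have hδε : ∀ n, δ n ≤ ε := fun n => div_le_self hε.le (by linarith [Nat.cast_nonneg (α := ℝ) n])
  have hδa : Antitone δ := fun m n h => by
    simp only [hδ]; gcongr
  have hδt : Tendsto δ atTop (𝓝 0) := by
    have := tendsto_one_div_add_atTop_nhds_zero_nat (𝕜 := ℝ)
    simpa [hδ, div_eq_mul_inv] using this.const_mul ε
  set W : ι → ℕ → Set ℂ := fun i n => f '' (thickening (δ n) (A i) \ K) with hW
  have hsub : ∀ i n, thickening (δ n) (A i) \ K ⊆ Kᶜ := fun i n z hz => hz.2
  have hWc : ∀ i n, IsConnected (W i n) := fun i n =>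
    (hcon i (δ n) (hδ0 n) (hδε n)).1.image _ (hf.diff.continuousOn.mono (hsub i n))
  have hWa : ∀ i, Antitone (W i) := fun i m n h =>
    image_mono (diff_subset_diff_left (thickening_mono (hδa h) _))
  have hWb : ∀ i, Bornology.IsBounded (W i 0) := fun i => by
    obtain ⟨R, hR⟩ := ((hP.compact i).isBounded.thickening (δ := δ 0)).subset_closedBall 0
    obtain ⟨R', hR'⟩ := hf.exists_bound hK R
    refine (isBounded_closedBall (x := (0 : ℂ)) (r := R')).subset ?_
    rintro _ ⟨z, hz, rfl⟩
    rw [mem_closedBall_zero_iff]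
    exact hR' z hz.2 (by simpa using hR hz.1)
  have hevt : ∀ i (S : Set ℂ), IsCompact S → S ⊆ Kᶜ → ∃ n, Disjoint (thickening (δ n) (A i)) S := by
    intro i S hS hSK
    have hd : Disjoint (A i) S :=
      Set.disjoint_left.2 fun z hz hzS => hSK hzS (hP.subset i hz)
    obtain ⟨η, hη, hdis⟩ := hd.exists_thickenings (hP.compact i) hS.isClosed
    obtain ⟨n, hn⟩ := (hδt.eventually (gt_mem_nhds hη)).exists
    exact ⟨n, (hdis.mono (thickening_mono hn.le _) (self_subset_thickening hη _))⟩
  refine ⟨fun i => ⋂ n, closure (W i n), fun i =>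
    ⟨isPreconnected_iInter_closure (hWc i) (hWa i) (hWb i), ?_, ?_⟩, ?_⟩
  · rintro w hw ⟨z, hz, rfl⟩
    obtain ⟨r, hr, hrK⟩ := Metric.isOpen_iff.1 hKo z hz
    have hc1 : closedBall z (r / 2) ⊆ Kᶜ :=
      (closedBall_subset_ball (by linarith)).trans hrK
    obtain ⟨n, hn⟩ := hevt i _ (isCompact_closedBall z (r / 2)) hc1
    have hbK : ball z (r / 2) ⊆ Kᶜ := ball_subset_closedBall.trans hc1
    have hop : IsOpen (f '' ball z (r / 2)) :=
      isOpen_image_of_injOn isOpen_ball (hf.diff.mono hbK) (hf.inj.mono hbK)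
    obtain ⟨_, ⟨x, hx, rfl⟩, y, hy, hxy⟩ := mem_closure_iff.1 (mem_iInter.1 hw n) _ hop
      ⟨z, mem_ball_self (by positivity), rfl⟩
    have := hf.inj hy.2 (hbK hx) hxy
    subst this
    exact Set.disjoint_left.1 hn hy.1 (ball_subset_closedBall hx)
  · intro U hU
    obtain ⟨n, hn⟩ := exists_subset_nhds_of_isCompact' (V := fun n => closure (W i n))
      ((Antitone.directed_ge fun m n h => closure_mono (hWa i h)))
      (fun n => ((hWb i).subset (hWa i (Nat.zero_le n))).isCompact_closure)
      (fun n => isClosed_closure) (U := U) (fun x hx => mem_nhdsSet_iff_forall.1 hU x hx)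
    refine mem_map.2 (mem_inf_principal.2 ?_)
    filter_upwards [isOpen_thickening.mem_nhdsSet.2 (self_subset_thickening (hδ0 n) (A i))]
      with z hz hzK
    exact hn (subset_closure ⟨z, ⟨hz, hzK⟩, rfl⟩)
  · intro w hw
    rw [frontier_eq_closure_inter_closure] at hw
    have hcl : w ∈ closure (f '' Kᶜ) := by rw [← compl_img]; exact hw.2
    have hwK : w ∉ f '' Kᶜ := by
      have := (hf.isCompact_img hK).isClosed.closure_eq ▸ hw.1
      exact this
    by_contra hcon
    simp only [mem_iUnion, mem_iInter, not_exists, not_forall] at hcon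
    choose N hN using hcon
    set V := ⋃ i, thickening (δ (N i)) (A i) with hV
    have hVo : IsOpen V := isOpen_iUnion fun i => isOpen_thickening
    have hKV : K ⊆ V := by
      rw [← hP.union]
      exact iUnion_mono fun i => self_subset_thickening (hδ0 _) _
    obtain ⟨S, hS⟩ := mem_cocompact_iff_norm_gt.1
      ((tendsto_cocompact_of_sub hf.inf) ((isCompact_closedBall w 1).compl_mem_cocompact))
    have hT : IsCompact (closedBall (0 : ℂ) S ∩ Vᶜ) :=
      (isCompact_closedBall 0 S).inter_right hVo.isClosed_compl
    have hfT : IsClosed (f '' (closedBall (0 : ℂ) S ∩ Vᶜ)) := (hT.image_of_continuousOn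
      (hf.diff.continuousOn.mono fun z hz hzK => hz.2 (hKV hzK))).isClosed
    have hO : IsOpen ((f '' (closedBall (0 : ℂ) S ∩ Vᶜ))ᶜ ∩ ball w 1 ∩
        ⋂ i, (closure (W i (N i)))ᶜ) :=
      (hfT.isOpen_compl.inter isOpen_ball).inter
        (isOpen_iInter_of_finite fun i => isClosed_closure.isOpen_compl)
    obtain ⟨_, ⟨⟨h1, h2⟩, h3⟩, z, hz, rfl⟩ := mem_closure_iff.1 hcl _ hO
      ⟨⟨fun ⟨z, hz, h⟩ => hwK ⟨z, fun hzK => hz.2 (hKV hzK), h⟩, mem_ball_self one_pos⟩,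
        mem_iInter.2 hN⟩
    by_cases hzV : z ∈ V
    · obtain ⟨i, hi⟩ := mem_iUnion.1 hzV
      exact mem_iInter.1 h3 i (subset_closure ⟨z, ⟨hi, hz⟩, rfl⟩)
    · refine h1 ⟨z, ⟨?_, hzV⟩, rfl⟩
      rw [mem_closedBall_zero_iff]
      by_contra! h
      exact hS z h (ball_subset_closedBall h2)

lemma exists_components (hP : Pieces K A) (hc : IsPreconnected Kᶜ) (hf : Sig K f) :
    ∃ D : ι → Set ℂ, Pieces (img K f) (fun d : range D => (d : Set ℂ)) ∧
      ∀ i, Tendsto f (𝓝ˢ (A i) ⊓ 𝓟 Kᶜ) (𝓝ˢ (D i)) := by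
  obtain ⟨C, hC, hfr⟩ := exists_cluster hP hc hf
  have hK' := hf.isCompact_img hP.isCompact
  choose c hcC using fun i => (hC i).1.nonempty
  have hcK : ∀ i, c i ∈ img K f := fun i => (hC i).2.1 (hcC i)
  have hCD : ∀ i, C i ⊆ connectedComponentIn (img K f) (c i) := fun i =>
    (hC i).1.isPreconnected.subset_connectedComponentIn (hcC i) (hC i).2.1
  have hcpt : ∀ x ∈ img K f, IsCompact (connectedComponentIn (img K f) x) := fun x hx =>
    hK'.of_isClosed_subset (isClosed_of_closure_subset
      (isPreconnected_connectedComponentIn.closure.subset_connectedComponentIn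
        (subset_closure (mem_connectedComponentIn hx))
        (closure_minimal (connectedComponentIn_subset _ _) hK'.isClosed)))
      (connectedComponentIn_subset _ _)
  refine ⟨fun i => connectedComponentIn (img K f) (c i), ⟨?_, ?_, ?_, ?_⟩, fun i =>
    (hC i).2.2.mono_right (nhdsSet_mono (hCD i))⟩
  · rintro ⟨_, i, rfl⟩; exact hcpt _ (hcK i)
  · rintro ⟨_, i, rfl⟩; exact isConnected_connectedComponentIn_iff.2 (hcK i)
  · rintro ⟨_, i, rfl⟩ ⟨_, j, rfl⟩ hij
    refine Set.disjoint_left.2 fun x hx hy => hij (Subtype.ext ?_)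
    exact (connectedComponentIn_eq hx).trans (connectedComponentIn_eq hy).symm
  · refine Subset.antisymm (iUnion_subset ?_) fun x hx => ?_
    · rintro ⟨_, i, rfl⟩; exact connectedComponentIn_subset _ _
    · have : ¬ connectedComponentIn (img K f) x ⊆ interior (img K f) := fun hsub => by
        have hop : IsOpen (connectedComponentIn (img K f) x) := by
          rw [Metric.isOpen_iff]
          intro y hy
          obtain ⟨r, hr, hrs⟩ := Metric.isOpen_iff.1 isOpen_interior y (hsub hy)
          refine ⟨r, hr, ?_⟩
          rw [connectedComponentIn_eq hy]
          exact (convex_ball y r).isPreconnected.subset_connectedComponentIn (mem_ball_self hr)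
            (hrs.trans interior_subset)
        obtain ⟨z, h1, h2⟩ := not_subset_of_isOpen_of_isCompact (hcpt x hx) hop
          ⟨x, mem_connectedComponentIn hx⟩ Subset.rfl
        exact h2 h1
      obtain ⟨y, hy, hyi⟩ := not_subset.1 this
      have hyf : y ∈ frontier (img K f) :=
        ⟨subset_closure (connectedComponentIn_subset _ _ hy), hyi⟩
      obtain ⟨i, hi⟩ := mem_iUnion.1 (hfr hyf)
      refine mem_iUnion.2 ⟨⟨_, i, rfl⟩, ?_⟩
      have h1 := connectedComponentIn_eq (hCD i hi)
      have h2 := connectedComponentIn_eq hy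
      change x ∈ connectedComponentIn (img K f) (c i)
      rw [h1, ← h2]
      exact mem_connectedComponentIn hx

/-- The complementary components of the image correspond to those of the source. -/
theorem exists_pieces (hP : Pieces K A) (hc : IsPreconnected Kᶜ) (hf : Sig K f) :
    ∃ B : ι → Set ℂ, Pieces (img K f) B ∧
      ∀ i, Tendsto f (𝓝ˢ (A i) ⊓ 𝓟 Kᶜ) (𝓝ˢ (B i)) := by
  obtain ⟨D, hD, ht⟩ := exists_components hP hc hf
  obtain ⟨g, hg, hgK, -⟩ := hf.exists_inv hP.isCompact
  obtain ⟨D', hD', -⟩ := exists_components hD (hf.isPreconnected_compl_img hc) hg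
  rw [hgK] at hD'
  have h1 := hP.card_le hD'
  have h2 : Nat.card (range D') ≤ Nat.card (range D) :=
    Nat.card_le_card_of_surjective _ rangeFactorization_surjective
  have h3 := (rangeFactorization_surjective (f := D)).bijective_of_nat_card_le (h1.trans h2)
  refine ⟨D, ⟨fun i => hD.compact ⟨_, i, rfl⟩, fun i => hD.conn ⟨_, i, rfl⟩, fun i j hij =>
    hD.disj ⟨_, i, rfl⟩ ⟨_, j, rfl⟩ fun h => hij (h3.1 h), ?_⟩, ht⟩
  rw [← hD.union]
  ext x; simp

end Sig

/-! ### Integration over annuli -/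

lemma setIntegral_annulus {E : Type*} [NormedAddCommGroup E] [NormedSpace ℝ E] {g : ℂ → E}
    {r R : ℝ} (hr : 0 ≤ r) (hg : ContinuousOn g {z | r ≤ ‖z‖ ∧ ‖z‖ ≤ R}) :
    ∫ z in {z : ℂ | r < ‖z‖ ∧ ‖z‖ < R}, g z =
      ∫ ρ in Ioo r R, (ρ * (2 * π)) • Real.circleAverage g 0 ρ := by
  have hm : MeasurableSet {z : ℂ | r < ‖z‖ ∧ ‖z‖ < R} :=
    ((isOpen_lt continuous_const continuous_norm).inter
      (isOpen_lt continuous_norm continuous_const)).measurableSet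
  have hsymm : ∀ p : ℝ × ℝ, Complex.polarCoord.symm p = circleMap 0 p.1 p.2 := fun p => by
    rw [Complex.polarCoord_symm_apply, circleMap_zero, Complex.exp_mul_I]; simp
  rw [← integral_indicator hm, ← Complex.integral_comp_polarCoord_symm,
    show polarCoord.target = Ioi (0 : ℝ) ×ˢ Ioo (-π) π from rfl]
  have h1 : ∫ p in Ioi (0 : ℝ) ×ˢ Ioo (-π) π, p.1 • ({z : ℂ | r < ‖z‖ ∧ ‖z‖ < R}.indicator g
      (Complex.polarCoord.symm p)) = ∫ p in Ioo r R ×ˢ Ioo (-π) π, p.1 • g (circleMap 0 p.1 p.2) := by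
    rw [← integral_indicator (measurableSet_Ioi.prod measurableSet_Ioo),
      ← integral_indicator (measurableSet_Ioo.prod measurableSet_Ioo)]
    congr 1; ext p
    simp only [hsymm]
    by_cases hp : p ∈ Ioo r R ×ˢ Ioo (-π) π
    · have hp0 : 0 < p.1 := hr.trans_lt hp.1.1
      have hz : circleMap 0 p.1 p.2 ∈ {z : ℂ | r < ‖z‖ ∧ ‖z‖ < R} := by
        show r < _ ∧ _ < R
        rw [norm_circleMap_zero, abs_of_pos hp0]; exact hp.1
      rw [indicator_of_mem hp, indicator_of_mem (show p ∈ Ioi (0 : ℝ) ×ˢ Ioo (-π) π from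
        ⟨hp0, hp.2⟩), indicator_of_mem hz]
    · rw [indicator_of_notMem hp]
      by_cases hp2 : p ∈ Ioi (0 : ℝ) ×ˢ Ioo (-π) π
      · rw [indicator_of_mem hp2, indicator_of_notMem, smul_zero]
        intro hz
        have hz' : r < ‖circleMap 0 p.1 p.2‖ ∧ ‖circleMap 0 p.1 p.2‖ < R := hz
        rw [norm_circleMap_zero, abs_of_pos hp2.1] at hz'
        exact hp ⟨hz', hp2.2⟩
      · rw [indicator_of_notMem hp2]
  have hintg : IntegrableOn (fun p : ℝ × ℝ => p.1 • g (circleMap 0 p.1 p.2))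
      (Ioo r R ×ˢ Ioo (-π) π) (volume.prod volume) := by
    have hc : ContinuousOn (fun p : ℝ × ℝ => p.1 • g (circleMap 0 p.1 p.2))
        (Icc r R ×ˢ Icc (-π) π) := by
      refine continuousOn_fst.smul (hg.comp ?_ ?_)
      · unfold circleMap; fun_prop
      · rintro p ⟨h1, h2⟩
        show r ≤ _ ∧ _ ≤ R
        rw [norm_circleMap_zero, abs_of_nonneg (hr.trans h1.1)]; exact h1
    exact (hc.integrableOn_compact (isCompact_Icc.prod isCompact_Icc)).mono_set
      (prod_mono Ioo_subset_Icc_self Ioo_subset_Icc_self)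
  rw [h1, Measure.volume_eq_prod, setIntegral_prod _ hintg]
  refine setIntegral_congr_fun measurableSet_Ioo fun ρ hρ => ?_
  show ∫ θ in Ioo (-π) π, ρ • g (circleMap 0 ρ θ) = (ρ * (2 * π)) • Real.circleAverage g 0 ρ
  rw [integral_smul, Real.circleAverage, mul_smul, smul_smul (2 * π),
    mul_inv_cancel₀ (by positivity), one_smul, ← integral_Ioc_eq_integral_Ioo,
    ← intervalIntegral.integral_of_le (by linarith [Real.pi_pos])]
  have hp : Function.Periodic (fun θ => g (circleMap 0 ρ θ)) (2 * π) := fun θ => by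
    simp [periodic_circleMap 0 ρ θ]
  have := hp.intervalIntegral_add_eq (-π) 0
  rw [show -π + 2 * π = π by ring, zero_add] at this
  rw [this]

/-- The open annulus centred at the origin. -/
def ann (r R : ℝ) : Set ℂ := {z | r < ‖z‖ ∧ ‖z‖ < R}

lemma isOpen_ann (r R : ℝ) : IsOpen (ann r R) :=
  (isOpen_lt continuous_const continuous_norm).inter (isOpen_lt continuous_norm continuous_const)

lemma det_smul_one (a : ℂ) : (a • (1 : ℂ →L[ℝ] ℂ)).det = ‖a‖ ^ 2 := by
  have := Algebra.norm_complex_apply a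
  rw [Algebra.norm_apply, Complex.normSq_eq_norm_sq] at this
  rw [← this, ContinuousLinearMap.det]
  rfl

lemma volume_image_eq {f : ℂ → ℂ} {U s : Set ℂ} (hU : IsOpen U) (hf : DifferentiableOn ℂ f U)
    (hi : InjOn f U) (hs : MeasurableSet s) (hsU : s ⊆ U) :
    volume.real (f '' s) = ∫ z in s, ‖deriv f z‖ ^ 2 := by
  have h := integral_image_eq_integral_abs_det_fderiv_smul volume hs
    (f' := fun z => deriv f z • (1 : ℂ →L[ℝ] ℂ)) (fun z hz =>
      ((hf.differentiableAt (hU.mem_nhds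
        (hsU hz))).hasDerivAt.complexToReal_fderiv).hasFDerivWithinAt) (hi.mono hsU) (fun _ => (1 : ℝ))
  simpa [det_smul_one] using h

lemma inv_mem_compl_closedBall {u : ℂ} (hu : u ∈ ball (0 : ℂ) 1) (h0 : u ≠ 0) :
    u⁻¹ ∈ (closedBall (0 : ℂ) 1)ᶜ := by
  rw [mem_ball_zero_iff] at hu
  simpa using (one_lt_inv₀ (norm_pos_iff.2 h0)).2 hu

/-- Zero-free holomorphic functions on the disc have square roots. -/
lemma exists_sq_eq {V : ℂ → ℂ} (hV : DifferentiableOn ℂ V (ball 0 1)) (h0 : V 0 = 1)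
    (hn : ∀ u ∈ ball (0 : ℂ) 1, V u ≠ 0) : ∃ s : ℂ → ℂ, DifferentiableOn ℂ s (ball 0 1) ∧
      s 0 = 1 ∧ ∀ u ∈ ball (0 : ℂ) 1, s u ^ 2 = V u := by
  obtain ⟨L, hL⟩ := ((hV.deriv isOpen_ball).div hV hn).isExactOn_ball
  have hEd : ∀ u ∈ ball (0 : ℂ) 1, HasDerivAt (fun u => exp ((L u - L 0) / 2))
      (exp ((L u - L 0) / 2) * (deriv V u / V u / 2)) u := fun u hu =>
    (((hL u hu).sub_const (L 0)).div_const 2).cexp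
  refine ⟨fun u => exp ((L u - L 0) / 2),
    fun u hu => (hEd u hu).differentiableAt.differentiableWithinAt, by simp, fun u hu => ?_⟩
  have hd : ∀ u ∈ ball (0 : ℂ) 1,
      HasDerivAt (fun u => exp ((L u - L 0) / 2) ^ 2 / V u) 0 u := by
    intro u hu
    have h1 := (hV.differentiableAt (isOpen_ball.mem_nhds hu)).hasDerivAt
    refine (((hEd u hu).pow 2).div h1 (hn u hu)).congr_deriv ?_
    have := hn u hu
    simp only [Pi.pow_apply]
    field_simp
    ring
  have := isOpen_ball.is_const_of_deriv_eq_zero (convex_ball (0 : ℂ) 1).isPreconnected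
    (fun x hx => (hd x hx).differentiableAt.differentiableWithinAt) (fun x hx => (hd x hx).deriv)
    hu (mem_ball_self one_pos)
  rw [h0, sub_self, zero_div, exp_zero, one_pow, div_one] at this
  exact (div_eq_one_iff_eq (hn u hu)).1 this

namespace Sig

variable {f : ℂ → ℂ} {K : Set ℂ}

lemma tendsto_affine_cocompact (c : ℂ) {a : ℂ} (ha : a ≠ 0) :
    Tendsto (fun z : ℂ => c + a * z) (cocompact ℂ) (cocompact ℂ) :=
  ((Homeomorph.mulLeft₀ a ha).trans (Homeomorph.addLeft c)).isClosedEmbedding.tendsto_cocompact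

lemma affine (hf : Sig K f) (c : ℂ) {a : ℂ} (ha : a ≠ 0) :
    Sig ((fun z => c + a * z) ⁻¹' K) (fun z => (f (c + a * z) - c) / a) := by
  refine ⟨?_, ?_, ?_⟩
  · refine ((hf.diff.comp (s := ((fun z => c + a * z) ⁻¹' K)ᶜ) (f := fun z => c + a * z)
      (by fun_prop) fun z hz => hz).sub_const c).div_const a
  · intro z hz w hw h
    have h1 : f (c + a * z) = f (c + a * w) := by
      have := (div_left_inj' ha).1 h
      linear_combination this
    exact mul_left_cancel₀ ha (add_left_cancel (hf.inj hz hw h1))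
  · have := (hf.inf.comp (tendsto_affine_cocompact c ha)).div_const a
    rw [zero_div] at this
    refine this.congr fun z => ?_
    simp only [Function.comp]
    field_simp
    ring

lemma preimage_affine_closedBall (c : ℂ) {ρ : ℝ} (hρ : 0 < ρ) :
    (fun z : ℂ => c + (ρ : ℂ) * z) ⁻¹' closedBall c ρ = closedBall 0 1 := by
  ext z
  simp only [mem_preimage, mem_closedBall, dist_eq_norm, add_sub_cancel_left, norm_mul, sub_zero,
    norm_real, Real.norm_of_nonneg hρ.le]
  constructor
  · intro h; by_contra! h1; nlinarith
  · intro h; nlinarith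

lemma normalize {c : ℂ} {ρ : ℝ} (hρ : 0 < ρ) (hf : Sig (closedBall c ρ) f) :
    Sig (closedBall 0 1) (fun z => (f (c + ρ * z) - c) / ρ) := by
  have := hf.affine c (a := (ρ : ℂ)) (by exact_mod_cast hρ.ne')
  rwa [preimage_affine_closedBall c hρ] at this

lemma exists_mul_inv_sub (hf : Sig (closedBall 0 1) f) {w : ℂ} (hw : w ∈ img (closedBall 0 1) f) :
    ∃ v : ℂ → ℂ, DifferentiableOn ℂ v (ball 0 1) ∧ HasDerivAt v (-w) 0 ∧ v 0 = 1 ∧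
      (∀ u, u ≠ 0 → v u = u * (f u⁻¹ - w)) ∧ ∀ u ∈ ball (0 : ℂ) 1, v u ≠ 0 := by
  have hinv : Tendsto (fun u : ℂ => u⁻¹) (𝓝[≠] 0) (cocompact ℂ) := by
    rw [← Metric.cobounded_eq_cocompact]; exact tendsto_inv₀_nhdsNE_zero
  set v : ℂ → ℂ := Function.update (fun u => u * (f u⁻¹ - w)) 0 1 with hv
  have hv0 : v 0 = 1 := by simp [hv]
  have hvne : ∀ u, u ≠ 0 → v u = u * (f u⁻¹ - w) := fun u hu => by simp [hv, hu]
  have hslope : Tendsto (slope v 0) (𝓝[≠] 0) (𝓝 (-w)) := by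
    have h1 := (hf.inf.comp hinv).sub_const w
    rw [zero_sub] at h1
    refine h1.congr' ?_
    filter_upwards [self_mem_nhdsWithin] with u hu
    have hu' : u ≠ 0 := hu
    rw [slope_def_field, hvne u hu', hv0]
    simp only [Function.comp]
    field_simp
    ring
  have hvd0 : HasDerivAt v (-w) 0 := hasDerivAt_iff_tendsto_slope.2 hslope
  refine ⟨v, fun u hu => ?_, hvd0, hv0, hvne, fun u hu => ?_⟩
  · by_cases h0 : u = 0
    · rw [h0]; exact hvd0.differentiableAt.differentiableWithinAt
    · have h1 : DifferentiableAt ℂ (fun u => u * (f u⁻¹ - w)) u := by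
        have h2 := hf.diff.differentiableAt
          (isClosed_closedBall.isOpen_compl.mem_nhds (inv_mem_compl_closedBall hu h0))
        have h3 : DifferentiableAt ℂ (fun u => f u⁻¹) u :=
          DifferentiableAt.comp u h2 (differentiableAt_inv h0)
        exact differentiableAt_id.mul (h3.sub_const w)
      refine (h1.congr_of_eventuallyEq ?_).differentiableWithinAt
      filter_upwards [isOpen_ne.mem_nhds h0] with x hx using hvne x hx
  · by_cases h0 : u = 0
    · rw [h0, hv0]; exact one_ne_zero
    · rw [hvne u h0]
      exact mul_ne_zero h0 (sub_ne_zero.2 fun h => hw ⟨_, inv_mem_compl_closedBall hu h0, h⟩)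

lemma norm_sub_le_of_mem_img (hf : Sig (closedBall 0 1) f) {w w' : ℂ}
    (hw : w ∈ img (closedBall 0 1) f) (hw' : w' ∈ img (closedBall 0 1) f) : ‖w' - w‖ ≤ 40 := by
  have hK := isCompact_closedBall (0 : ℂ) 1
  obtain ⟨m, hm, hmax⟩ := (hf.isCompact_img hK).exists_isMaxOn ⟨w, hw⟩
    (f := fun p => ‖p - w‖) (by fun_prop)
  refine (hmax hw').trans ?_
  change ‖m - w‖ ≤ 40
  obtain ⟨v, hvd, hvd0, hv0, hvne, hvn⟩ := hf.exists_mul_inv_sub hw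
  obtain ⟨v', hvd', hvd0', hv0', hvne', hvn'⟩ := hf.exists_mul_inv_sub hm
  obtain ⟨s, hsd, hs0, hs⟩ := exists_sq_eq (hvd'.div hvd hvn) (by simp [hv0, hv0'])
    fun u hu => div_ne_zero (hvn' u hu) (hvn u hu)
  have h0 : (0 : ℂ) ∈ ball (0 : ℂ) 1 := mem_ball_self one_pos
  have hsq : ∀ u ∈ ball (0 : ℂ) 1, u ≠ 0 →
      f u⁻¹ - w ≠ 0 ∧ s u ^ 2 = 1 - (m - w) / (f u⁻¹ - w) := by
    intro u hu hu0
    have h1 := hvn u hu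
    rw [hvne u hu0] at h1
    have h2 := right_ne_zero_of_mul h1
    refine ⟨h2, ?_⟩
    rw [hs u hu, Pi.div_apply, hvne u hu0, hvne' u hu0, mul_div_mul_left _ _ hu0,
      eq_sub_iff_add_eq, ← add_div, sub_add_sub_cancel, div_self h2]
  obtain ⟨g, hg, -, hgf, hfg⟩ := hf.exists_inv hK
  have hout : ∀ q : ℂ, ‖m - w‖ < ‖q‖ → w + q ∈ (img (closedBall 0 1) f)ᶜ := fun q hq h => by
    have h1 : ‖w + q - w‖ ≤ ‖m - w‖ := hmax h
    rw [add_sub_cancel_left] at h1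
    exact absurd hq (not_lt.2 h1)
  have hgm : ∀ q : ℂ, ‖m - w‖ < ‖q‖ →
      (g (w + q))⁻¹ ∈ ball (0 : ℂ) 1 ∧ g (w + q) ≠ 0 ∧ f (g (w + q)) = w + q := fun q hq => by
    obtain ⟨h1, h2⟩ := hfg _ (hout q hq)
    have h3 : 1 < ‖g (w + q)‖ := by simpa using h1
    refine ⟨?_, norm_pos_iff.1 (one_pos.trans h3), h2⟩
    rw [mem_ball_zero_iff, norm_inv]
    exact inv_lt_one_of_one_lt₀ h3
  have hSc : ContinuousOn (fun q => (s (g (w + q))⁻¹).re) {q | ‖m - w‖ < ‖q‖} := by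
    have h1 : ContinuousOn (fun q => g (w + q)) {q | ‖m - w‖ < ‖q‖} :=
      hg.diff.continuousOn.comp (by fun_prop) hout
    exact continuous_re.comp_continuousOn
      (hsd.continuousOn.comp (h1.inv₀ fun q hq => (hgm q hq).2.1) fun q hq => (hgm q hq).1)
  have hre : ∀ q : ℂ, ‖m - w‖ < ‖q‖ → (s (g (w + q))⁻¹).re ≠ 0 := by
    intro q hq h
    obtain ⟨h1, h2, h3⟩ := hgm q hq
    have h4 := (hsq _ h1 (inv_ne_zero h2)).2
    rw [inv_inv, h3, add_sub_cancel_left] at h4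
    have h5 := congrArg re h4
    have h6 : ((m - w) / q).re < 1 := (re_le_norm _).trans_lt (by
      rw [norm_div]; exact (div_lt_one ((norm_nonneg _).trans_lt hq)).2 hq)
    rw [sq, mul_re, h, sub_re, one_re] at h5
    nlinarith [mul_self_nonneg (s (g (w + q))⁻¹).im]
  have hinv : Tendsto (fun u : ℂ => u⁻¹) (𝓝[≠] 0) (cocompact ℂ) := by
    rw [← Metric.cobounded_eq_cocompact]; exact tendsto_inv₀_nhdsNE_zero
  have hgu : ∀ u ∈ ball (0 : ℂ) 1, u ≠ 0 → (g (w + (f u⁻¹ - w)))⁻¹ = u := fun u hu hu0 => by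
    rw [add_sub_cancel, hgf _ (inv_mem_compl_closedBall hu hu0), inv_inv]
  have hsc : ContinuousAt s 0 := (hsd.differentiableAt (isOpen_ball.mem_nhds h0)).continuousAt
  obtain ⟨q₁, hq₁, hq₁'⟩ : ∃ q : ℂ, ‖m - w‖ < ‖q‖ ∧ 0 < (s (g (w + q))⁻¹).re := by
    have h1 : ∀ᶠ u in 𝓝[≠] (0 : ℂ), ‖m - w‖ < ‖f u⁻¹ - w‖ :=
      (tendsto_norm_cocompact_atTop.comp
        ((Homeomorph.subRight w).isClosedEmbedding.tendsto_cocompact.comp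
        ((tendsto_cocompact_of_sub hf.inf).comp hinv))).eventually_gt_atTop _
    have h2 : ∀ᶠ u in 𝓝[≠] (0 : ℂ), 0 < (s u).re :=
      ((continuous_re.continuousAt.comp hsc).eventually_const_lt
        (show 0 < (s 0).re by rw [hs0]; exact one_pos)).filter_mono nhdsWithin_le_nhds
    have h3 : ∀ᶠ u in 𝓝[≠] (0 : ℂ), u ∈ ball (0 : ℂ) 1 :=
      mem_nhdsWithin_of_mem_nhds (isOpen_ball.mem_nhds h0)
    obtain ⟨u, h1, h2, h3, h4⟩ := (h1.and (h2.and (h3.and self_mem_nhdsWithin))).exists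
    exact ⟨_, h1, by rwa [hgu u h3 h4]⟩
  have hpos : ∀ q : ℂ, ‖m - w‖ < ‖q‖ → 0 < (s (g (w + q))⁻¹).re := by
    intro q hq
    by_contra! h
    obtain ⟨q₂, h1, h2⟩ := ((isConnected_norm_gt _).isPreconnected.image _ hSc).Icc_subset
      ⟨q, hq, rfl⟩ ⟨q₁, hq₁, rfl⟩ ⟨h, hq₁'.le⟩
    exact hre q₂ h1 h2
  have hfar : ∀ u ∈ ball (0 : ℂ) 1, 2 / 5 ≤ ‖s u + 1‖ := by
    intro u hu
    by_contra! hlt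
    by_cases hu0 : u = 0
    · rw [hu0, hs0] at hlt
      norm_num at hlt
    obtain ⟨h1, h2⟩ := hsq u hu hu0
    have h3 : (m - w) / (f u⁻¹ - w) = -((s u + 1) * (s u + 1 - 2)) := by linear_combination h2
    have h4 : ‖(m - w) / (f u⁻¹ - w)‖ < 1 := by
      rw [h3, norm_neg, norm_mul]
      have h5 := norm_sub_le (s u + 1) 2
      rw [Complex.norm_ofNat] at h5
      nlinarith [norm_nonneg (s u + 1)]
    rw [norm_div, div_lt_one (norm_pos_iff.2 h1)] at h4
    have h5 := hpos _ h4
    rw [hgu u hu hu0] at h5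
    have h6 := re_le_norm (s u + 1)
    rw [add_re, one_re] at h6
    linarith
  have hne : ∀ u ∈ ball (0 : ℂ) 1, s u + 1 ≠ 0 := fun u hu h => by
    have := hfar u hu
    rw [h, norm_zero] at this
    linarith
  have hs' := (hsd.differentiableAt (isOpen_ball.mem_nhds h0)).hasDerivAt
  have hds : deriv s 0 = -(m - w) / 2 := by
    have h1 : HasDerivAt (fun u => s u ^ 2) _ 0 := (hvd0'.div hvd0 (hvn 0 h0)).congr_of_eventuallyEq
      (by filter_upwards [isOpen_ball.mem_nhds h0] with u hu using hs u hu)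
    have h2 := (hs'.pow 2).unique h1
    rw [hs0, hv0, hv0'] at h2
    norm_num at h2
    linear_combination h2 / 2
  have hh : HasDerivAt (fun u => (s u + 1)⁻¹) _ 0 := (hs'.add_const 1).inv (hne 0 h0)
  have hle := norm_deriv_le_of_forall_mem_sphere_norm_le (f := fun u => (s u + 1)⁻¹) (c := 0)
    (C := 5 / 2) (show (0 : ℝ) < 1 / 2 by norm_num)
    (DifferentiableOn.diffContOnCl (((hsd.add_const 1).inv hne).mono (by
      rw [closure_ball _ (by norm_num)]; exact closedBall_subset_ball (by norm_num))))
    fun u hu => by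
      have h1 := hfar u (sphere_subset_closedBall.trans (closedBall_subset_ball (by norm_num)) hu)
      rw [norm_inv]
      exact (inv_anti₀ (by norm_num) h1).trans (by norm_num)
  rw [hh.deriv, hs0, hds, norm_div, norm_neg, norm_div, norm_neg] at hle
  norm_num at hle
  linarith

lemma norm_le_of_mem_img (hf : Sig (closedBall 0 1) f) {w : ℂ}
    (hw : w ∈ img (closedBall 0 1) f) : ‖w‖ ≤ 80 := by
  have h12 : closedBall (0 : ℂ) 1 ⊆ closedBall 0 2 := closedBall_subset_closedBall one_le_two
  have hg := (hf.mono h12).normalize two_pos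
  have hout : ∀ y ∈ (closedBall (0 : ℂ) 1)ᶜ, (0 : ℂ) + (2 : ℝ) * y ∈ (closedBall (0 : ℂ) 2)ᶜ := by
    intro y hy
    rwa [← preimage_affine_closedBall 0 two_pos] at hy
  have hmem : ∀ q : ℂ, (∀ z ∈ (closedBall (0 : ℂ) 2)ᶜ, f z ≠ q) → (q - 0) / (2 : ℝ) ∈
      img (closedBall 0 1) (fun z => (f (0 + (2 : ℝ) * z) - 0) / (2 : ℝ)) := by
    rintro q hq ⟨y, hy, hyq⟩
    exact hq _ (hout y hy) (sub_left_injective ((div_left_inj' (by norm_num)).1 hyq))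
  obtain ⟨v, hvd, hvd0, -, hvne, -⟩ := hf.exists_mul_inv_sub hw
  have hle := norm_deriv_le_of_forall_mem_sphere_norm_le (f := v) (c := 0)
    (C := 40) (show (0 : ℝ) < 1 / 2 by norm_num)
    (DifferentiableOn.diffContOnCl (hvd.mono (by
      rw [closure_ball _ (by norm_num)]; exact closedBall_subset_ball (by norm_num))))
    fun u hu => by
      rw [mem_sphere_zero_iff_norm] at hu
      have hu0 : u ≠ 0 := norm_pos_iff.1 (by rw [hu]; norm_num)
      have hu2 : ‖u⁻¹‖ = 2 := by rw [norm_inv, hu]; norm_num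
      have h := hg.norm_sub_le_of_mem_img (hmem w fun z hz h => hw ⟨z, fun hz1 => hz (h12 hz1), h⟩)
        (hmem (f u⁻¹) fun z hz h => by
          have := hf.inj (fun hz1 => hz (h12 hz1)) (by simp [hu2]) h
          rw [this] at hz
          exact hz (by simp [hu2]))
      rw [sub_zero, sub_zero, ← _root_.sub_div, norm_div, norm_real, Real.norm_ofNat] at h
      rw [hvne u hu0, norm_mul, hu]
      linarith
  rw [hvd0.deriv, norm_neg] at hle
  linarith

lemma img_subset {R : ℝ} (hR : 0 < R) (hK : K ⊆ closedBall 0 R) (hf : Sig K f) :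
    img K f ⊆ closedBall 0 (80 * R) := by
  intro w hw
  have h1 := (hf.mono hK).normalize hR
  have hR' : (R : ℂ) ≠ 0 := by exact_mod_cast hR.ne'
  have h2 : w / R ∈ img (closedBall 0 1) (fun z => (f (0 + R * z) - 0) / R) := by
    rintro ⟨z, hz, hzw⟩
    rw [← preimage_affine_closedBall 0 hR] at hz
    refine hw ⟨0 + R * z, fun h => hz (hK h), ?_⟩
    have := (div_left_inj' hR').1 hzw
    rwa [sub_zero] at this
  have h3 := h1.norm_le_of_mem_img h2
  rw [norm_div, norm_real, Real.norm_of_nonneg hR.le, div_le_iff₀ hR] at h3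
  simpa using h3

lemma norm_le {R : ℝ} (hR : 0 < R) (hK : K ⊆ closedBall 0 R) (hf : Sig K f) {z : ℂ}
    (hz : z ∈ Kᶜ) (hzR : ‖z‖ ≤ R) : ‖f z‖ ≤ 80 * R := by
  have h : f z ∈ img (closedBall 0 R) f := by
    rintro ⟨y, hy, hyz⟩
    have := hf.inj (fun h => hy (hK h)) hz hyz
    rw [this] at hy
    exact hy (by simpa using hzR)
  simpa using (hf.mono hK).img_subset hR le_rfl h

end Sig

lemma norm_mul_le_of_sphere {h : ℂ → ℂ} {R ρ M : ℝ} (hd : DifferentiableOn ℂ h {z | R < ‖z‖})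
    (h0 : Tendsto h (cocompact ℂ) (𝓝 0)) (hρ : 0 < ρ) (hRρ : R < ρ)
    (hM : ∀ z : ℂ, ‖z‖ = ρ → ‖z * h z‖ ≤ M) {z : ℂ} (hz : ρ ≤ ‖z‖) : ‖z * h z‖ ≤ M := by
  obtain ⟨a, ha⟩ := exists_tendsto_mul hd h0
  have hinv : Tendsto (fun u : ℂ => u⁻¹) (𝓝[≠] 0) (cocompact ℂ) := by
    rw [← Metric.cobounded_eq_cocompact]; exact tendsto_inv₀_nhdsNE_zero
  set g : ℂ → ℂ := Function.update (fun u => u⁻¹ * h u⁻¹) 0 a with hg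
  have hgne : ∀ u, u ≠ 0 → g u = u⁻¹ * h u⁻¹ := fun u hu => by simp [hg, hu]
  have hopen : IsOpen {z : ℂ | R < ‖z‖} := isOpen_lt continuous_const continuous_norm
  have hρi : 0 < ρ⁻¹ := inv_pos.2 hρ
  have hgd1 : ∀ u : ℂ, u ≠ 0 → ‖u‖ ≤ ρ⁻¹ → DifferentiableAt ℂ g u := by
    intro u hu hun
    have h1 : u⁻¹ ∈ {z : ℂ | R < ‖z‖} := by
      change R < ‖u⁻¹‖
      rw [norm_inv]
      exact hRρ.trans_le ((le_inv_comm₀ (norm_pos_iff.2 hu) hρ).1 hun)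
    have h2 : DifferentiableAt ℂ (fun u => u⁻¹ * h u⁻¹) u :=
      (differentiableAt_inv hu).mul (DifferentiableAt.comp u
        (hd.differentiableAt (hopen.mem_nhds h1)) (differentiableAt_inv hu))
    refine h2.congr_of_eventuallyEq ?_
    filter_upwards [isOpen_ne.mem_nhds hu] with x hx using hgne x hx
  have hg0 : ContinuousAt g 0 := by
    rw [continuousAt_update_same]; exact ha.comp hinv
  have hgd0 : DifferentiableAt ℂ g 0 := by
    refine (analyticAt_of_differentiable_on_punctured_nhds_of_continuousAt ?_ hg0).differentiableAt
    filter_upwards [self_mem_nhdsWithin, mem_nhdsWithin_of_mem_nhds (closedBall_mem_nhds 0 hρi)]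
      with u hu hun
    exact hgd1 u hu (by simpa using hun)
  have hgd : DifferentiableOn ℂ g (closedBall 0 ρ⁻¹) := by
    intro u hu
    by_cases hu0 : u = 0
    · rw [hu0]; exact hgd0.differentiableWithinAt
    · exact (hgd1 u hu0 (by simpa using hu)).differentiableWithinAt
  have hdc : DiffContOnCl ℂ g (ball 0 ρ⁻¹) := by
    rw [← closure_ball _ hρi.ne'] at hgd
    exact hgd.diffContOnCl
  have hb : ∀ u ∈ frontier (ball (0 : ℂ) ρ⁻¹), ‖g u‖ ≤ M := by
    intro u hu
    rw [frontier_ball _ hρi.ne', mem_sphere_zero_iff_norm] at hu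
    have hu0 : u ≠ 0 := norm_pos_iff.1 (by rw [hu]; exact hρi)
    rw [hgne u hu0]
    exact hM _ (by rw [norm_inv, hu, inv_inv])
  have hz0 : z ≠ 0 := norm_pos_iff.1 (hρ.trans_le hz)
  have := norm_le_of_forall_mem_frontier_norm_le isBounded_ball hdc hb (z := z⁻¹) (by
    rw [closure_ball _ hρi.ne', mem_closedBall_zero_iff, norm_inv]
    exact inv_anti₀ hρ hz)
  rwa [hgne _ (inv_ne_zero hz0), inv_inv] at this

namespace Sig

variable {f : ℂ → ℂ} {K : Set ℂ}

lemma norm_mul_sub_le {R : ℝ} (hR : 0 < R) (hK : K ⊆ closedBall 0 R) (hf : Sig K f) {z : ℂ}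
    (hz : 2 * R ≤ ‖z‖) : ‖z * (f z - z)‖ ≤ 324 * R ^ 2 := by
  have hsub : {z : ℂ | R < ‖z‖} ⊆ Kᶜ := fun z hz h => by
    have h1 : ‖z‖ ≤ R := by simpa using hK h
    exact absurd h1 (not_le.2 hz)
  refine norm_mul_le_of_sphere (R := R) (ρ := 2 * R) ((hf.diff.mono hsub).sub differentiableOn_id)
    hf.inf (by positivity) (by linarith) (fun z hz => ?_) hz
  have h1 := hf.norm_le (R := 2 * R) (by positivity)
    (hK.trans (closedBall_subset_closedBall (by linarith)))
    (hsub (show R < ‖z‖ by linarith)) hz.le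
  have h2 : ‖f z - z‖ ≤ 162 * R := (norm_sub_le _ _).trans (by linarith)
  change ‖z * (f z - z)‖ ≤ _
  rw [norm_mul, hz]
  nlinarith

end Sig

section Limit

variable {ι : Type*} {U : Ultrafilter ι} {F : ι → ℂ → ℂ} {Kc : ι → Set ℂ} {K : Set ℂ}

/-- Compactness of the classes `Sig` for varying compact sets. -/
lemma exists_limit {R : ℝ} (hR : 0 < R) (hKR : ∀ i, Kc i ⊆ closedBall 0 R) (hF : ∀ i, Sig (Kc i) (F i)) (hK : IsCompact K)
    (hc : IsPreconnected Kᶜ) (hker : ∀ z ∈ Kᶜ, ∃ r > 0, ∀ᶠ i in (U : Filter ι), ball z r ⊆ (Kc i)ᶜ) :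
    ∃ f, Sig K f ∧ LocConv U F f (fun i => (Kc i)ᶜ) Kᶜ := by
  have hbdd : LocBdd U F (fun i => (Kc i)ᶜ) Kᶜ := by
    intro z hz
    obtain ⟨r, hr, h⟩ := hker z hz
    refine ⟨r, hr, 80 * (R + (‖z‖ + r)), h.mono fun i hi => ⟨hi, fun w hw => ?_⟩⟩
    have hw2 : ‖w‖ ≤ ‖z‖ + r := by
      have h1 := norm_add_le z (w - z)
      have h2 : ‖w - z‖ < r := by rw [← dist_eq_norm]; exact hw
      rw [add_sub_cancel] at h1
      linarith
    have := norm_nonneg w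
    exact (hF i).norm_le (by linarith) ((hKR i).trans (closedBall_subset_closedBall (by linarith)))
      (hi hw) (by linarith)
  obtain ⟨f, hf⟩ := hbdd.exists_locConv fun i => (hF i).diff
  have hKo := hK.isClosed.isOpen_compl
  have hfd : DifferentiableOn ℂ f Kᶜ := fun z hz =>
    (hf.differentiableAt (fun i => (hF i).diff) hz).differentiableWithinAt
  obtain ⟨R', hR'⟩ := mem_cocompact_iff_norm_gt.1 hK.compl_mem_cocompact
  have hinf : Tendsto (fun z => f z - z) (cocompact ℂ) (𝓝 0) := by
    have hinv : Tendsto (fun z : ℂ => 324 * R ^ 2 / ‖z‖) (cocompact ℂ) (𝓝 0) :=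
      tendsto_const_nhds.div_atTop tendsto_norm_cocompact_atTop
    refine squeeze_zero_norm' (mem_cocompact_iff_norm_gt.2 ⟨max R' (2 * R), fun z hz => ?_⟩) hinv
    have h1 : ‖z * (f z - z)‖ ≤ 324 * R ^ 2 :=
      le_of_tendsto ((((hf.tendsto (hR' z ((le_max_left _ _).trans_lt hz))).sub_const z).const_mul
        z).norm) (Eventually.of_forall fun i =>
        (hF i).norm_mul_sub_le hR (hKR i) ((le_max_right _ _).trans hz.le))
    rw [norm_mul, mul_comm] at h1
    exact (le_div_iff₀ (((by positivity : 0 < 2 * R).trans_le (le_max_right _ _)).trans hz)).2 h1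
  have hnc : ∃ x ∈ Kᶜ, ∃ y ∈ Kᶜ, f x ≠ f y := by
    obtain ⟨x, hx⟩ := Filter.nonempty_of_mem hK.compl_mem_cocompact
    refine ⟨x, hx, ?_⟩
    have h1 : f ⁻¹' {f x}ᶜ ∈ cocompact ℂ := tendsto_cocompact_of_sub hinf (isCompact_singleton (x := f x)).compl_mem_cocompact
    obtain ⟨y, hy1, hy2⟩ := Filter.nonempty_of_mem (inter_mem h1 hK.compl_mem_cocompact)
    exact ⟨y, hy2, fun h => hy1 h.symm⟩
  refine ⟨f, ⟨hfd, ?_, hinf⟩, hf⟩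
  exact hf.injOn (fun i => (hF i).diff) (fun i => (hF i).inj) hKo fun z hz =>
    eventually_ne_of_not_const hKo hc hfd hnc hz _

end Limit

/-- An injective holomorphic map near infinity with a pole at infinity can be normalized. -/
lemma exists_normalize {K : Set ℂ} (hK : IsCompact K) {F : ℂ → ℂ} (hd : DifferentiableOn ℂ F Kᶜ)
    (hi : InjOn F Kᶜ) (hinf : Tendsto F (cocompact ℂ) (cocompact ℂ)) :
    ∃ κ c : ℂ, κ ≠ 0 ∧ Tendsto (fun z => z * (F z)⁻¹) (cocompact ℂ) (𝓝 κ) ∧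
      Sig K (fun z => κ * F z + c) := by
  have hinv : Tendsto (fun u : ℂ => u⁻¹) (𝓝[≠] 0) (cocompact ℂ) := by
    rw [← Metric.cobounded_eq_cocompact]; exact tendsto_inv₀_nhdsNE_zero
  have hinv0 : Tendsto (fun z : ℂ => z⁻¹) (cocompact ℂ) (𝓝 0) := by
    rw [← Metric.cobounded_eq_cocompact]; exact tendsto_inv₀_cobounded
  have hinv' : Tendsto (fun z : ℂ => z⁻¹) (cocompact ℂ) (𝓝[≠] 0) :=
    tendsto_nhdsWithin_iff.2 ⟨hinv0, mem_cocompact_iff_norm_gt.2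
      ⟨0, fun z hz => inv_ne_zero (norm_pos_iff.1 hz)⟩⟩
  set G : ℂ → ℂ := Function.update (fun u => (F u⁻¹)⁻¹) 0 0 with hG
  have hG0 : G 0 = 0 := by simp [hG]
  have hGne : ∀ u, u ≠ 0 → G u = (F u⁻¹)⁻¹ := fun u hu => by simp [hG, hu]
  have hev : ∀ᶠ u in 𝓝[≠] (0 : ℂ), u⁻¹ ∈ Kᶜ ∧ F u⁻¹ ≠ 0 :=
    (hinv.eventually (show ∀ᶠ z in cocompact ℂ, z ∈ Kᶜ from hK.compl_mem_cocompact)).and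
      ((hinf.comp hinv).eventually (show ∀ᶠ z in cocompact ℂ, z ≠ 0 from (isCompact_singleton (x := (0 : ℂ))).compl_mem_cocompact))
  obtain ⟨r, hr, hball⟩ := Metric.mem_nhdsWithin_iff.1 hev
  have hb : ∀ u ∈ ball (0 : ℂ) r, u ≠ 0 → u⁻¹ ∈ Kᶜ ∧ F u⁻¹ ≠ 0 := fun u hu h0 => hball ⟨hu, h0⟩
  have hGd : DifferentiableOn ℂ G (ball 0 r) := by
    refine (differentiableOn_compl_singleton_and_continuousAt_iff (ball_mem_nhds 0 hr)).1 ⟨?_, ?_⟩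
    · rintro u ⟨hu, h0⟩
      have h0' : u ≠ 0 := h0
      obtain ⟨h1, h2⟩ := hb u hu h0'
      have h3 : DifferentiableAt ℂ (fun u => (F u⁻¹)⁻¹) u :=
        (DifferentiableAt.comp u (hd.differentiableAt (hK.isClosed.isOpen_compl.mem_nhds h1))
          (differentiableAt_inv h0')).inv h2
      refine (h3.congr_of_eventuallyEq ?_).differentiableWithinAt
      filter_upwards [isOpen_ne.mem_nhds h0'] with x hx using hGne x hx
    · rw [continuousAt_update_same]
      exact hinv0.comp (hinf.comp hinv)
  have hGi : InjOn G (ball 0 r) := by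
    intro x hx y hy hxy
    by_cases hx0 : x = 0
    · by_contra hne
      have hy0 : y ≠ 0 := fun h => hne (hx0.trans h.symm)
      rw [hx0, hG0, hGne y hy0] at hxy
      exact inv_ne_zero (hb y hy hy0).2 hxy.symm
    · by_cases hy0 : y = 0
      · rw [hy0, hG0, hGne x hx0] at hxy
        exact absurd hxy (inv_ne_zero (hb x hx hx0).2)
      · rw [hGne x hx0, hGne y hy0, inv_inj] at hxy
        exact inv_inj.1 (hi (hb x hx hx0).1 (hb y hy hy0).1 hxy)
  have h0b : (0 : ℂ) ∈ ball (0 : ℂ) r := mem_ball_self hr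
  have hα : deriv G 0 ≠ 0 := deriv_ne_zero_of_injOn isOpen_ball hGd hGi h0b
  set α := deriv G 0 with hαd
  set g1 := dslope G 0 with hg1
  have hg1d : DifferentiableOn ℂ g1 (ball 0 r) :=
    (Complex.differentiableOn_dslope (ball_mem_nhds 0 hr)).2 hGd
  have hg10 : g1 0 = α := dslope_same _ _
  have hg1c : Tendsto g1 (𝓝[≠] 0) (𝓝 α) := by
    rw [← hg10]
    exact ((hg1d.differentiableAt (ball_mem_nhds 0 hr)).continuousAt).tendsto.mono_left
      nhdsWithin_le_nhds
  have hg2c : Tendsto (dslope g1 0) (𝓝[≠] 0) (𝓝 (deriv g1 0)) := by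
    have h1 := ((Complex.differentiableOn_dslope (ball_mem_nhds (0 : ℂ) hr)).2 hg1d)
    have h2 := ((h1.differentiableAt (ball_mem_nhds 0 hr)).continuousAt).tendsto
    rw [dslope_same] at h2
    exact h2.mono_left nhdsWithin_le_nhds
  have e1 : ∀ u : ℂ, u ≠ 0 → u * g1 u = G u := fun u hu => by
    have := sub_smul_dslope G 0 u
    simpa [hG0] using this
  have e2 : ∀ u : ℂ, u ≠ 0 → u * dslope g1 0 u = g1 u - α := fun u hu => by
    have := sub_smul_dslope g1 0 u
    simpa [hg10] using this
  have hlim := ((hg2c.div (hg1c.const_mul α) (mul_ne_zero hα hα)).comp hinv').const_mul α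
  set c : ℂ := α * (deriv g1 0 / (α * α)) with hc
  refine ⟨α, c, hα, ?_, ?_, ?_, ?_⟩
  · refine (hg1c.comp hinv').congr' (mem_cocompact_iff_norm_gt.2 ⟨0, fun z hz => ?_⟩)
    have hz0 : z ≠ 0 := norm_pos_iff.1 hz
    have h1 := e1 z⁻¹ (inv_ne_zero hz0)
    rw [hGne _ (inv_ne_zero hz0), inv_inv] at h1
    change g1 z⁻¹ = z * (F z)⁻¹
    rw [← h1, mul_inv_cancel_left₀ hz0]
  · exact (hd.const_mul α).add_const c
  · intro x hx y hy hxy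
    exact hi hx hy (mul_left_cancel₀ hα (add_right_cancel hxy))
  · have h1 := hlim.const_sub c
    rw [sub_self] at h1
    refine h1.congr' ?_
    filter_upwards [hinv'.eventually hev, mem_cocompact_iff_norm_gt.2 ⟨0, fun z hz =>
      (show z ∈ {z : ℂ | z ≠ 0} from norm_pos_iff.1 hz)⟩] with z hz hz0
    have hz0' : z ≠ 0 := hz0
    rw [inv_inv] at hz
    have a1 := e1 z⁻¹ (inv_ne_zero hz0')
    have a2 := e2 z⁻¹ (inv_ne_zero hz0')
    rw [hGne _ (inv_ne_zero hz0'), inv_inv] at a1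
    have hF := hz.2
    have b1 : g1 z⁻¹ = z * (F z)⁻¹ := by rw [← a1, mul_inv_cancel_left₀ hz0']
    have b2 : dslope g1 0 z⁻¹ = z * (g1 z⁻¹ - α) := by rw [← a2, mul_inv_cancel_left₀ hz0']
    simp only [Function.comp, Pi.div_apply]
    rw [b2, b1]
    field_simp
    ring

section Riemann

variable {E : Set ℂ}

lemma Pieces.single (hE : IsCompact E) (hc : IsConnected E) : Pieces E (fun _ : Unit => E) :=
  ⟨fun _ => hE, fun _ => hc, fun i j h => absurd (Subsingleton.elim i j) h, iUnion_const E⟩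

/-- A log on the complement of a continuum gives a map omitting a disc. -/
lemma exists_ball_subset_img (hE : IsCompact E) (hc : IsConnected E) (hcc : IsPreconnected Eᶜ)
    (hnt : E.Nontrivial) : ∃ (f : ℂ → ℂ) (c : ℂ) (ρ : ℝ), 0 < ρ ∧ Sig E f ∧ ball c ρ ⊆ img E f := by
  obtain ⟨a, ha, b, hb, hab⟩ := hnt
  obtain ⟨L, hLd, hLe, hL0⟩ := exists_log_compl hE hc.isPreconnected hcc ha hb
  set s : ℂ → ℂ := fun z => exp (L z / 2) with hs
  have hne : ∀ z ∈ Eᶜ, z ≠ a ∧ z ≠ b := fun z hz =>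
    ⟨fun h => hz (h ▸ ha), fun h => hz (h ▸ hb)⟩
  have hs2 : ∀ z ∈ Eᶜ, s z ^ 2 = (z - a) / (z - b) := by
    intro z hz
    rw [← hLe z hz, hs, ← Complex.exp_nat_mul]
    congr 1
    push_cast; ring
  have hs1 : ∀ z ∈ Eᶜ, s z ^ 2 ≠ 1 := by
    intro z hz h
    rw [hs2 z hz, div_eq_one_iff_eq (sub_ne_zero.2 (hne z hz).2)] at h
    exact hab (sub_right_inj.1 h)
  have hs1' : ∀ z ∈ Eᶜ, s z - 1 ≠ 0 := fun z hz h => hs1 z hz (by rw [sub_eq_zero.1 h, one_pow])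
  have hinj2 : ∀ x ∈ Eᶜ, ∀ y ∈ Eᶜ, s x ^ 2 = s y ^ 2 → x = y := by
    intro x hx y hy h
    rw [hs2 x hx, hs2 y hy, div_eq_div_iff (sub_ne_zero.2 (hne x hx).2)
      (sub_ne_zero.2 (hne y hy).2)] at h
    have : (x - y) * (a - b) = 0 := by linear_combination h
    exact sub_eq_zero.1 ((mul_eq_zero.1 this).resolve_right (sub_ne_zero.2 hab))
  have hsd : DifferentiableOn ℂ s Eᶜ := (hLd.div_const 2).cexp
  have hst : Tendsto s (cocompact ℂ) (𝓝 1) := by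
    have h1 := (hL0.div_const 2)
    rw [zero_div] at h1
    have := (Complex.continuous_exp.tendsto 0).comp h1
    rwa [exp_zero] at this
  set F : ℂ → ℂ := fun z => (s z - 1)⁻¹ with hF
  have hFinf : Tendsto F (cocompact ℂ) (cocompact ℂ) := by
    have h1 := hst.sub_const 1
    rw [sub_self] at h1
    have h2 : Tendsto (fun z => s z - 1) (cocompact ℂ) (𝓝[≠] 0) := tendsto_nhdsWithin_iff.2
      ⟨h1, by filter_upwards [hE.compl_mem_cocompact] with z hz using hs1' z hz⟩
    have h3 := tendsto_inv₀_nhdsNE_zero (α := ℂ) |>.comp h2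
    rwa [Metric.cobounded_eq_cocompact] at h3
  have hFi : InjOn F Eᶜ := by
    intro x hx y hy h
    refine hinj2 x hx y hy ?_
    rw [sub_left_inj.1 (inv_inj.1 h)]
  have hFd : DifferentiableOn ℂ F Eᶜ := (hsd.sub_const 1).inv hs1'
  obtain ⟨κ, c, hκ, -, hsig⟩ := exists_normalize hE hFd hFi hFinf
  have hκ' : 0 < ‖κ‖ := norm_pos_iff.2 hκ
  obtain ⟨R, hR⟩ := hsig.exists_preimage hE 0
  have hout : ∀ w : ℂ, (R + ‖c‖) / ‖κ‖ < ‖w‖ → ∃ z ∈ Eᶜ, F z = w := by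
    intro w hw
    rw [div_lt_iff₀ hκ'] at hw
    obtain ⟨z, hz, -, h⟩ := hR (κ * w + c) (by
      have := norm_sub_le (κ * w + c) c
      rw [add_sub_cancel_right, norm_mul] at this
      linarith)
    exact ⟨z, hz, mul_left_cancel₀ hκ (add_right_cancel h)⟩
  have hlim : Tendsto (fun w : ℂ => (2 * w + 1) * (-w)⁻¹) (𝓝 (-(1 / 2))) (𝓝 0) := by
    have : ContinuousAt (fun w : ℂ => (2 * w + 1) * (-w)⁻¹) (-(1 / 2)) :=
      ContinuousAt.mul (by fun_prop) (continuousAt_id.neg.inv₀ (by simp))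
    have h := this.tendsto
    norm_num at h
    simpa using h
  have hev : ∀ᶠ w in 𝓝 (-(1 / 2) : ℂ), ‖(2 * w + 1) * (-w)⁻¹‖ * (|(R + ‖c‖) / ‖κ‖| + 1) < 1 := by
    have := (hlim.norm.mul_const (|(R + ‖c‖) / ‖κ‖| + 1))
    rw [norm_zero, zero_mul] at this
    exact this.eventually (gt_mem_nhds one_pos)
  obtain ⟨ε, hε, hball⟩ := Metric.eventually_nhds_iff_ball.1 hev
  refine ⟨_, κ * (-(1 / 2)) + c, ‖κ‖ * ε, by positivity, hsig, ?_⟩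
  rintro _ hw ⟨z, hz, rfl⟩
  have hwb : F z ∈ ball (-(1 / 2) : ℂ) ε := by
    rw [mem_ball, dist_eq_norm] at hw ⊢
    rw [add_sub_add_right_eq_sub, ← mul_sub, norm_mul] at hw
    exact lt_of_mul_lt_mul_left hw hκ'.le
  have hFz : F z ≠ 0 := inv_ne_zero (hs1' z hz)
  have hsz : s z = 1 + (F z)⁻¹ := by rw [hF, inv_inv]; ring
  by_cases h2 : 2 * F z + 1 = 0
  · refine hs1 z hz ?_
    have : F z = -(1 / 2) := by linear_combination h2 / 2
    rw [hsz, this]; norm_num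
  · have h3 := hball _ hwb
    obtain ⟨y, hy, hyw⟩ := hout (-F z / (2 * F z + 1)) (by
      have h4 : 0 < ‖(2 * F z + 1) * (-F z)⁻¹‖ := norm_pos_iff.2
        (mul_ne_zero h2 (inv_ne_zero (neg_ne_zero.2 hFz)))
      have h5 : ‖-F z / (2 * F z + 1)‖ = ‖(2 * F z + 1) * (-F z)⁻¹‖⁻¹ := by
        rw [← norm_inv, mul_inv, inv_inv, mul_comm (2 * F z + 1)⁻¹, div_eq_mul_inv]
      rw [h5]
      have h6 : |(R + ‖c‖) / ‖κ‖| + 1 < ‖(2 * F z + 1) * (-F z)⁻¹‖⁻¹ := by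
        rw [lt_inv_comm₀ (by positivity) h4, ← one_div (|_| + 1), lt_div_iff₀ (by positivity)]
        exact h3
      have := le_abs_self ((R + ‖c‖) / ‖κ‖)
      linarith)
    have hsy : s y = 1 + (F y)⁻¹ := by rw [hF, inv_inv]; ring
    have hneg : s y = - s z := by
      rw [hsy, hyw, hsz]
      field_simp
      ring
    have hyz := hinj2 y hy z hz (by rw [hneg, neg_sq])
    rw [hyz] at hneg
    have : s z = 0 := by linear_combination hneg / 2
    exact exp_ne_zero _ this

/-- If a continuum contains the closed unit disc strictly, the omitted disc can be enlarged. -/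
lemma exists_larger_ball (hE : IsCompact E) (hc : IsConnected E) (hcc : IsPreconnected Eᶜ)
    (h1 : closedBall 0 1 ⊆ E) {c : ℂ} (hcE : c ∈ E) (hc1 : 1 < ‖c‖) :
    ∃ (f : ℂ → ℂ) (b : ℂ) (ρ : ℝ), 1 < ρ ∧ Sig E f ∧ ball b ρ ⊆ img E f := by
  have hc0 : c ≠ 0 := norm_pos_iff.1 (by linarith)
  set p := c⁻¹ with hp
  have hp1 : ‖p‖ < 1 := by rw [hp, norm_inv]; exact inv_lt_one_of_one_lt₀ hc1
  have hp0 : p ≠ 0 := inv_ne_zero hc0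
  have hpE : conj p ∈ E := h1 (by rw [mem_closedBall_zero_iff, norm_conj]; exact hp1.le)
  obtain ⟨L, hLd, hLe, hL0⟩ := exists_log_compl hE hc.isPreconnected hcc hcE hpE
  obtain ⟨q, hq⟩ : ∃ q : ℂ, q ^ 2 = -p := IsAlgClosed.exists_pow_nat_eq _ two_pos
  have hq0 : q ≠ 0 := by rintro rfl; simp at hq; exact hp0 hq
  have hqn : ‖q‖ ^ 2 = ‖p‖ := by rw [← norm_pow, hq, norm_neg]
  have hq1 : ‖q‖ < 1 := by
    by_contra! h; nlinarith
  set s : ℂ → ℂ := fun w => q * exp (L w / 2) with hs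
  have hne : ∀ z ∈ Eᶜ, z ≠ c ∧ z - conj p ≠ 0 := fun z hz =>
    ⟨fun h => hz (h ▸ hcE), fun h => hz (sub_eq_zero.1 h ▸ hpE)⟩
  have hs2 : ∀ z ∈ Eᶜ, s z ^ 2 = (1 - p * z) / (z - conj p) := by
    intro z hz
    have h2 : exp (L z / 2) ^ 2 = (z - c) / (z - conj p) := by
      rw [← hLe z hz, ← Complex.exp_nat_mul]
      congr 1
      push_cast; ring
    simp only [hs]
    rw [mul_pow, h2, hq, ← mul_div_assoc]
    congr 1
    rw [hp]; field_simp; ring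
  have hsn : ∀ z ∈ Eᶜ, ‖s z‖ < 1 := by
    intro z hz
    have hz1 : 1 < ‖z‖ := by
      by_contra! h; exact hz (h1 (by simpa using h))
    have h3 : ‖1 - p * z‖ ^ 2 < ‖z - conj p‖ ^ 2 := by
      rw [← normSq_eq_norm_sq, ← normSq_eq_norm_sq]
      have e1 : normSq z > 1 := by rw [normSq_eq_norm_sq]; nlinarith
      have e2 : normSq p < 1 := by rw [normSq_eq_norm_sq]; nlinarith [norm_nonneg p]
      simp only [normSq_apply, sub_re, sub_im, mul_re, mul_im, conj_re, conj_im, one_re, one_im] at *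
      nlinarith
    have h4 : ‖s z‖ ^ 2 < 1 := by
      rw [← norm_pow, hs2 z hz, norm_div, div_lt_one (norm_pos_iff.2 (hne z hz).2)]
      exact lt_of_pow_lt_pow_left₀ 2 (norm_nonneg _) h3
    by_contra! h; nlinarith
  have hden : ∀ z ∈ Eᶜ, 1 - conj q * s z ≠ 0 := by
    intro z hz h
    have h5 : ‖conj q * s z‖ = 1 := by rw [← sub_eq_zero.1 h, norm_one]
    rw [norm_mul, norm_conj] at h5
    nlinarith [hsn z hz, norm_nonneg (s z), norm_nonneg q]
  have hinj2 : ∀ x ∈ Eᶜ, ∀ y ∈ Eᶜ, s x = s y → x = y := by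
    intro x hx y hy h
    have h2 : s x ^ 2 = s y ^ 2 := by rw [h]
    rw [hs2 x hx, hs2 y hy, div_eq_div_iff (hne x hx).2 (hne y hy).2] at h2
    have h6 : (x - y) * (p * conj p - 1) = 0 := by linear_combination h2
    refine sub_eq_zero.1 ((mul_eq_zero.1 h6).resolve_right fun h7 => ?_)
    rw [mul_conj, normSq_eq_norm_sq, sub_eq_zero] at h7
    have h8 : ‖p‖ ^ 2 = 1 := by exact_mod_cast h7
    nlinarith [norm_nonneg p]
  have hsq : ∀ z ∈ Eᶜ, s z - q ≠ 0 := by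
    intro z hz h
    have h2 : s z ^ 2 = -p := by rw [sub_eq_zero.1 h, hq]
    rw [hs2 z hz, div_eq_iff (hne z hz).2] at h2
    have h7 : p * conj p - 1 = 0 := by linear_combination -h2
    rw [mul_conj, normSq_eq_norm_sq, sub_eq_zero] at h7
    have h8 : ‖p‖ ^ 2 = 1 := by exact_mod_cast h7
    nlinarith [norm_nonneg p]
  have hsd : DifferentiableOn ℂ s Eᶜ := (hLd.div_const 2).cexp.const_mul q
  have hst : Tendsto s (cocompact ℂ) (𝓝 q) := by
    have h1 := (hL0.div_const 2)
    rw [zero_div] at h1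
    have := ((Complex.continuous_exp.tendsto 0).comp h1).const_mul q
    rwa [exp_zero, mul_one] at this
  set F : ℂ → ℂ := fun z => (1 - conj q * s z) / (s z - q) with hF
  have hqq : (1 : ℂ) - conj q * q ≠ 0 := by
    rw [mul_comm, mul_conj, normSq_eq_norm_sq, sub_ne_zero]
    intro h
    have h8 : 1 = ‖q‖ ^ 2 := by exact_mod_cast h
    nlinarith [norm_nonneg q]
  have hnumt : Tendsto (fun z => 1 - conj q * s z) (cocompact ℂ) (𝓝 (1 - conj q * q)) :=
    (hst.const_mul _).const_sub 1
  have hFinv : Tendsto (fun z => (F z)⁻¹) (cocompact ℂ) (𝓝[≠] 0) := by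
    have h2 := (hst.sub_const q).div hnumt hqq
    rw [sub_self, zero_div] at h2
    refine tendsto_nhdsWithin_iff.2 ⟨h2.congr fun z => ?_, ?_⟩
    · simp [hF]
    · filter_upwards [hE.compl_mem_cocompact] with z hz
      exact inv_ne_zero (div_ne_zero (hden z hz) (hsq z hz))
  have hFinf : Tendsto F (cocompact ℂ) (cocompact ℂ) := by
    have h3 := tendsto_inv₀_nhdsNE_zero (α := ℂ) |>.comp hFinv
    rw [Metric.cobounded_eq_cocompact] at h3
    exact h3.congr fun z => inv_inv _
  have hFi : InjOn F Eᶜ := by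
    intro x hx y hy h
    refine hinj2 x hx y hy ?_
    simp only [hF] at h
    rw [div_eq_div_iff (hsq x hx) (hsq y hy)] at h
    have h9 : (s x - s y) * (1 - conj q * q) = 0 := by linear_combination -h
    exact sub_eq_zero.1 ((mul_eq_zero.1 h9).resolve_right hqq)
  have hFd : DifferentiableOn ℂ F Eᶜ :=
    ((hsd.const_mul _).const_sub 1).div (hsd.sub_const q) hsq
  have hF1 : ∀ z ∈ Eᶜ, 1 < ‖F z‖ := by
    intro z hz
    have e1 := hsn z hz
    rw [hF, norm_div, one_lt_div (norm_pos_iff.2 (hsq z hz))]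
    refine lt_of_pow_lt_pow_left₀ 2 (norm_nonneg _) ?_
    have e2 : normSq (s z) < 1 := by rw [normSq_eq_norm_sq]; nlinarith [norm_nonneg (s z)]
    have e3 : normSq q < 1 := by rw [normSq_eq_norm_sq]; nlinarith [norm_nonneg q]
    rw [← normSq_eq_norm_sq, ← normSq_eq_norm_sq]
    simp only [normSq_apply, sub_re, sub_im, mul_re, mul_im, conj_re, conj_im, one_re, one_im] at *
    nlinarith
  obtain ⟨κ, b, hκ, hκt, hsig⟩ := exists_normalize hE hFd hFi hFinf
  have hκ' : 0 < ‖κ‖ := norm_pos_iff.2 hκ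
  have hκv : κ * (2 * q) = 1 + conj q * q := by
    have hzz : Tendsto (fun z : ℂ => z * (z - conj p)⁻¹) (cocompact ℂ) (𝓝 1) := by
      have := tendsto_div_sub_cocompact 0 (conj p)
      simpa [div_eq_mul_inv] using this
    have h2 := hκt.mul ((hst.add_const q).mul hnumt)
    have h3 : Tendsto (fun z => z * (F z)⁻¹ * ((s z + q) * (1 - conj q * s z))) (cocompact ℂ)
        (𝓝 (1 - p * conj p)) := by
      have h4 := hzz.const_mul (1 - p * conj p)
      rw [mul_one] at h4
      refine h4.congr' ?_
      filter_upwards [hE.compl_mem_cocompact] with z hz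
      have h5 := hs2 z hz
      have h6 := hden z hz
      have h7 := (hne z hz).2
      simp only [hF]
      have h8 : z * ((1 - conj q * s z) / (s z - q))⁻¹ * ((s z + q) * (1 - conj q * s z)) =
          z * (s z ^ 2 - q ^ 2) := by
        generalize 1 - conj q * s z = d at h6 ⊢
        rw [inv_div]
        field_simp
        ring
      rw [h8, h5, hq]
      field_simp
      ring
    have h9 := tendsto_nhds_unique h2 h3
    have h10 : p * conj p = (conj q * q) ^ 2 := by
      have : p = - q ^ 2 := by rw [hq, neg_neg]
      rw [this]; simp; ring
    rw [h10] at h9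
    have h11 : (κ * (2 * q) - (1 + conj q * q)) * (1 - conj q * q) = 0 := by linear_combination h9
    exact sub_eq_zero.1 ((mul_eq_zero.1 h11).resolve_right hqq)
  have hκ1 : 1 < ‖κ‖ := by
    have h2 : ‖κ‖ * (2 * ‖q‖) = 1 + ‖q‖ ^ 2 := by
      have := congrArg norm hκv
      rw [norm_mul, norm_mul, mul_comm (conj q), mul_conj, normSq_eq_norm_sq] at this
      rw [show (1 + ((‖q‖ ^ 2 : ℝ) : ℂ)) = ((1 + ‖q‖ ^ 2 : ℝ) : ℂ) by push_cast; ring, norm_real,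
        Real.norm_of_nonneg (by positivity)] at this
      simpa using this
    have h3 : 0 < ‖q‖ := norm_pos_iff.2 hq0
    by_contra! h
    nlinarith [mul_le_mul_of_nonneg_right h (by positivity : 0 ≤ 2 * ‖q‖),
      mul_pos (sub_pos.2 hq1) (sub_pos.2 hq1)]
  refine ⟨_, b, ‖κ‖, hκ1, hsig, ?_⟩
  rintro _ hw ⟨z, hz, rfl⟩
  rw [mem_ball, dist_eq_norm, add_sub_cancel_right, norm_mul] at hw
  nlinarith [hF1 z hz]

/-- The Riemann mapping theorem for the exterior of a continuum. -/
theorem exists_sig_closedBall (hE : IsCompact E) (hc : IsConnected E) (hcc : IsPreconnected Eᶜ)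
    (hnt : E.Nontrivial) : ∃ (f : ℂ → ℂ) (c : ℂ) (ρ : ℝ), 0 < ρ ∧ Sig E f ∧
      img E f = closedBall c ρ := by
  obtain ⟨R, hR, hER⟩ := hE.isBounded.subset_closedBall_lt 0 0
  set S : Set ℝ := {ρ | ∃ (f : ℂ → ℂ) (c : ℂ), 0 < ρ ∧ Sig E f ∧ ball c ρ ⊆ img E f} with hS
  have hSne : S.Nonempty := by
    obtain ⟨f, c, ρ, h1, h2, h3⟩ := exists_ball_subset_img hE hc hcc hnt
    exact ⟨ρ, f, c, h1, h2, h3⟩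
  have hball : ∀ (f : ℂ → ℂ) (c : ℂ) (ρ : ℝ), 0 < ρ → Sig E f → ball c ρ ⊆ img E f →
      ρ ≤ 80 * R ∧ ‖c‖ ≤ 80 * R := by
    intro f c ρ hρ hf hb
    have h1 := hb.trans (hf.img_subset hR hER)
    have h2 : closedBall c ρ ⊆ closedBall 0 (80 * R) := by
      rw [← closure_ball c hρ.ne']
      exact closure_minimal h1 isClosed_closedBall
    have h3 := Metric.diam_mono h2 isBounded_closedBall
    have h4 : c ∈ closedBall (0 : ℂ) (80 * R) := h2 (mem_closedBall_self hρ.le)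
    refine ⟨?_, by simpa using h4⟩
    have h5 : dist (c + ρ) (c - ρ) ≤ Metric.diam (closedBall (0 : ℂ) (80 * R)) :=
      (Metric.dist_le_diam_of_mem isBounded_closedBall (by simp [dist_eq_norm, abs_of_pos hρ])
        (by simp [dist_eq_norm, abs_of_pos hρ])).trans h3
    have h6 := Metric.diam_closedBall (x := (0 : ℂ)) (r := 80 * R) (by positivity)
    rw [dist_eq_norm, show c + ρ - (c - ρ) = ((2 * ρ : ℝ) : ℂ) by push_cast; ring, norm_real,
      Real.norm_of_nonneg (by positivity)] at h5
    linarith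
  have hSb : BddAbove S := ⟨80 * R, fun ρ ⟨f, c, h1, h2, h3⟩ => (hball f c ρ h1 h2 h3).1⟩
  obtain ⟨u, -, hut, huS⟩ := exists_seq_tendsto_sSup hSne hSb
  choose f c hρ hf hb using huS
  obtain ⟨ρ0, hρ0⟩ := hSne
  have hpos : 0 < sSup S := (show 0 < ρ0 by obtain ⟨_, _, h, -⟩ := hρ0; exact h).trans_le
    (le_csSup hSb hρ0)
  set U : Ultrafilter ℕ := hyperfilter ℕ
  have hU : (U : Filter ℕ) ≤ atTop := Nat.hyperfilter_le_atTop
  obtain ⟨c0, hc0⟩ := Ultrafilter.exists_tendsto_of_bdd (U := U) (u := c) (x := 0) (M := 80 * R)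
    (Eventually.of_forall fun i => by
      rw [dist_zero_right]; exact (hball _ _ _ (hρ i) (hf i) (hb i)).2)
  obtain ⟨F, hF, hconv⟩ := exists_limit (U := U) hR (fun _ : ℕ => hER) hf hE hcc
    (fun z hz => by
      obtain ⟨r, hr, h⟩ := Metric.isOpen_iff.1 hE.isClosed.isOpen_compl z hz
      exact ⟨r, hr, Eventually.of_forall fun _ => h⟩)
  have hEo := hE.isClosed.isOpen_compl
  have hFb : ball c0 (sSup S) ⊆ img E F := by
    rintro _ hw ⟨z, hz, rfl⟩
    obtain ⟨ε, hε, hev⟩ := hconv.ball_subset (fun i => (hf i).diff) hEo hz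
      (eventually_ne_of_injOn hEo hF.inj hz) one_pos
    have h1 : Tendsto (fun i => u i - dist (F z) (c i)) U (𝓝 (sSup S - dist (F z) c0)) :=
      (hut.mono_left hU).sub (tendsto_const_nhds.dist hc0)
    have h2 := h1.eventually (lt_mem_nhds (sub_pos.2 hw))
    obtain ⟨i, hi, hi2⟩ := (hev.and h2).exists
    obtain ⟨y, hy, hyz⟩ := hi.2 (mem_ball_self hε)
    exact hb i (show F z ∈ ball (c i) (u i) from sub_pos.1 hi2) ⟨y, hy.2, hyz⟩
  refine ⟨F, c0, sSup S, hpos, hF, ?_⟩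
  have hcl : closedBall c0 (sSup S) ⊆ img E F := by
    rw [← closure_ball c0 hpos.ne']
    exact closure_minimal hFb (hF.isCompact_img hE).isClosed
  refine Subset.antisymm (fun w hw => ?_) hcl
  by_contra hwc
  obtain ⟨B, hB, -⟩ := hF.exists_pieces (Pieces.single hE hc) hcc
  have hBeq : img E F = B () := by rw [← hB.union]; exact iUnion_const (B ())
  set σ := sSup S with hσ
  have hσ' : (σ : ℂ) ≠ 0 := by exact_mod_cast hpos.ne'
  set φ : ℂ ≃ₜ ℂ := (Homeomorph.mulLeft₀ (σ : ℂ) hσ').trans (Homeomorph.addLeft c0) with hφ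
  have hφv : ∀ z, φ z = c0 + σ * z := fun z => rfl
  have hconn : IsConnected (img E F) := by rw [hBeq]; exact hB.conn ()
  set E' : Set ℂ := (fun z => c0 + (σ : ℂ) * z) ⁻¹' img E F with hE'
  have hE'eq : E' = φ ⁻¹' img E F := rfl
  obtain ⟨g, b, ρ, hρ1, hg, hgb⟩ := exists_larger_ball (E := E') (c := (w - c0) / σ)
    (by rw [hE'eq]; exact φ.isCompact_preimage.2 (hF.isCompact_img hE))
    (by rw [hE'eq]; exact φ.isConnected_preimage.2 hconn)
    (by rw [hE'eq, ← preimage_compl]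
        exact φ.isPreconnected_preimage.2 (hF.isPreconnected_compl_img hcc))
    (by rw [hE', ← Sig.preimage_affine_closedBall c0 hpos]; exact preimage_mono hcl)
    (by rw [hE', mem_preimage, mul_div_cancel₀ _ hσ', add_sub_cancel]; exact hw)
    (by rw [norm_div, norm_real, Real.norm_of_nonneg hpos.le, lt_div_iff₀ hpos, one_mul,
          ← dist_eq_norm]
        simpa using hwc)
  have hg2 : Sig (img E F) (fun z => (g (-(c0 / σ) + (σ : ℂ)⁻¹ * z) - -(c0 / σ)) / (σ : ℂ)⁻¹) := by
    have := hg.affine (-(c0 / σ)) (inv_ne_zero hσ')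
    rw [hE', ← preimage_comp] at this
    convert this using 1
    convert preimage_id.symm using 2
    ext z
    simp only [Function.comp, id]
    field_simp
    ring
  obtain ⟨h1, h2⟩ := hF.comp hE hg2
  have hmem : σ * ρ ∈ S := by
    refine ⟨_, c0 + σ * b, by positivity, h1, ?_⟩
    rw [h2]
    rintro _ hy ⟨z, hz, rfl⟩
    refine hgb (show g (-(c0 / σ) + (σ : ℂ)⁻¹ * z) ∈ ball b ρ from ?_) ⟨_, ?_, rfl⟩
    · rw [mem_ball, dist_eq_norm] at hy ⊢
      simp only [div_inv_eq_mul] at hy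
      have h3 : (g (-(c0 / σ) + (σ : ℂ)⁻¹ * z) - -(c0 / σ)) * σ - (c0 + σ * b) =
          σ * (g (-(c0 / σ) + (σ : ℂ)⁻¹ * z) - b) := by field_simp; ring
      rw [h3, norm_mul, norm_real, Real.norm_of_nonneg hpos.le] at hy
      exact lt_of_mul_lt_mul_left hy hpos.le
    · intro h
      refine hz ?_
      rw [hE', mem_preimage] at h
      convert h using 1
      field_simp
      ring
  have := le_csSup hSb hmem
  nlinarith

end Riemann

section Nontrivial

lemma nonempty_inter_frontier {X : Type*} [TopologicalSpace X] {S A : Set X}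
    (hS : IsPreconnected S) (h1 : (S ∩ A).Nonempty) (h2 : (S ∩ Aᶜ).Nonempty) :
    (S ∩ frontier A).Nonempty := by
  by_contra hne
  rw [not_nonempty_iff_eq_empty] at hne
  have hf : ∀ z ∈ S, z ∉ frontier A := fun z hz hz' => by
    have : z ∈ S ∩ frontier A := ⟨hz, hz'⟩
    rw [hne] at this
    exact this
  have hin : ∀ z ∈ S, z ∈ A → z ∈ interior A := fun z hz hA => by
    by_contra h
    exact hf z hz ⟨subset_closure hA, h⟩
  have hout : ∀ z ∈ S, z ∉ A → z ∈ (closure A)ᶜ := fun z hz hA hcl =>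
    hf z hz ⟨hcl, fun h => hA (interior_subset h)⟩
  obtain ⟨x, hx, hxA⟩ := h1
  obtain ⟨y, hy, hyA⟩ := h2
  have := hS.subset_left_of_subset_union isOpen_interior isClosed_closure.isOpen_compl
    (disjoint_left.2 fun z hz hz' => hz' (subset_closure (interior_subset hz)))
    (fun z hz => (em (z ∈ A)).imp (hin z hz) (hout z hz)) ⟨x, hx, hin x hx hxA⟩ hy
  exact hyA (interior_subset this)

variable {ι : Type*} [Finite ι] {K : Set ℂ} {A B : ι → Set ℂ} {f g : ℂ → ℂ}

lemma Pieces.frontier_subset_closure (hP : Pieces K A) (i : ι) : frontier (A i) ⊆ closure Kᶜ := by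
  obtain ⟨ε, hε, hd⟩ := hP.exists_thickening
  intro x hx
  have hxA : x ∈ A i := (hP.compact i).isClosed.frontier_subset hx
  rw [mem_closure_iff_nhds]
  intro N hN
  have h1 : N ∩ thickening ε (A i) ∈ 𝓝 x :=
    inter_mem hN (isOpen_thickening.mem_nhds (self_subset_thickening hε _ hxA))
  rw [frontier_eq_closure_inter_closure] at hx
  obtain ⟨y, ⟨hyN, hyT⟩, hyA⟩ := mem_closure_iff_nhds.1 hx.2 _ h1
  refine ⟨y, hyN, fun hyK => ?_⟩
  obtain ⟨j, hj⟩ := hP.mem hyK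
  by_cases hij : i = j
  · exact hyA (hij ▸ hj)
  · exact disjoint_left.1 (hd i j hij) hyT (self_subset_thickening hε _ hj)

lemma Pieces.mem_nhdsSet_union (hP : Pieces K A) (i : ι) :
    A i ∪ Kᶜ ∈ 𝓝ˢ (A i) := by
  obtain ⟨ε, hε, hd⟩ := hP.exists_thickening
  refine mem_of_superset (isOpen_thickening.mem_nhdsSet.2 (self_subset_thickening hε (A i)))
    fun y hyT => ?_
  by_cases hyK : y ∈ K
  · obtain ⟨j, hj⟩ := hP.mem hyK
    by_cases hij : i = j
    · exact Or.inl (hij ▸ hj)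
    · exact absurd (self_subset_thickening hε _ hj) (disjoint_left.1 (hd i j hij) hyT)
  · exact Or.inr hyK

/-- A univalent function does not collapse a nondegenerate boundary component to a point. -/
lemma Sig.nontrivial_of_pieces (hP : Pieces K A) (hf : Sig K f)
    (hB : Pieces (img K f) B) {i : ι} (ht : Tendsto f (𝓝ˢ (A i) ⊓ 𝓟 Kᶜ) (𝓝ˢ (B i)))
    (hA : (A i).Nontrivial) : (B i).Nontrivial := by
  by_contra hBi
  rw [not_nontrivial_iff] at hBi
  obtain ⟨b, hb⟩ := (hB.conn i).nonempty
  have hBb : B i = {b} := hBi.eq_singleton_of_mem hb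
  obtain ⟨g, hg, hgK, hgf, hfg⟩ := hf.exists_inv hP.isCompact
  have hmem := hB.mem_nhdsSet_union i
  rw [hBb, nhdsSet_singleton] at hmem
  have hpun : (img K f)ᶜ ∈ 𝓝[≠] b := by
    filter_upwards [nhdsWithin_le_nhds hmem, self_mem_nhdsWithin] with z hz hzb
    exact hz.resolve_left hzb
  have hop : IsOpen (img K f)ᶜ := (hB.isCompact).isClosed.isOpen_compl
  obtain ⟨M, hM⟩ := hg.exists_bound hB.isCompact (‖b‖ + 1)
  have hlim := tendsto_limUnder_of_differentiable_on_punctured_nhds_of_bounded_under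
    (f := g) (c := b) (by
      filter_upwards [hpun] with z hz
      exact (hg.diff z hz).differentiableAt (hop.mem_nhds hz))
    ⟨M + ‖g b‖, by
      rw [eventually_map]
      filter_upwards [hpun, nhdsWithin_le_nhds (ball_mem_nhds b one_pos)] with z hz hzb
      refine (norm_sub_le _ _).trans (add_le_add_left (hM z hz ?_) _)
      have := norm_le_norm_add_norm_sub' z b
      rw [mem_ball, dist_eq_norm] at hzb
      linarith⟩
  set a := limUnder (𝓝[≠] b) g
  have hta : 𝓝ˢ (A i) ⊓ 𝓟 Kᶜ ≤ 𝓝 a := by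
    have h1 : Tendsto f (𝓝ˢ (A i) ⊓ 𝓟 Kᶜ) (𝓝[≠] b) := by
      refine tendsto_nhdsWithin_iff.2 ⟨by simpa [hBb] using ht, ?_⟩
      filter_upwards [mem_inf_of_right (mem_principal_self _)] with z hz h
      have h2 : f z ∈ (img K f)ᶜ := by rw [compl_img]; exact mem_image_of_mem _ hz
      exact h2 (hB.subset i (h ▸ hb))
    suffices h : Tendsto (fun z => z) (𝓝ˢ (A i) ⊓ 𝓟 Kᶜ) (𝓝 a) from h
    refine (hlim.comp h1).congr' ?_
    filter_upwards [mem_inf_of_right (mem_principal_self _)] with z hz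
    exact hgf z hz
  have hfr : frontier (A i) ⊆ {a} := by
    intro x hx
    have hxA : x ∈ A i := (hP.compact i).isClosed.frontier_subset hx
    have := mem_closure_iff_clusterPt.1 (hP.frontier_subset_closure i hx)
    have : (𝓝 x ⊓ 𝓟 Kᶜ).NeBot := this
    refine tendsto_nhds_unique (f := fun z => z) (l := 𝓝 x ⊓ 𝓟 Kᶜ) inf_le_left ?_
    exact (inf_le_inf_right _ (nhds_le_nhdsSet hxA)).trans hta
  obtain ⟨x, hx, hxa⟩ := hA.exists_ne a
  obtain ⟨y, -, hy⟩ := not_subset_of_isOpen_of_isCompact ((hP.compact i).insert a)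
    isOpen_univ (insert_nonempty _ _) (subset_univ _)
  rw [mem_insert_iff, not_or] at hy
  obtain ⟨z, hz, hz'⟩ := nonempty_inter_frontier
    (isConnected_compl_singleton_of_one_lt_rank (by simp) a).isPreconnected
    ⟨x, hxa, hx⟩ ⟨y, hy.1, hy.2⟩
  exact hz (hfr hz')

end Nontrivial

section Area

variable {ψ : ℂ → ℂ} {G : Set ℂ}

lemma lintegral_image_holomorphic {f : ℂ → ℂ} {U s : Set ℂ} (hU : IsOpen U)
    (hf : DifferentiableOn ℂ f U) (hi : InjOn f U) (hs : MeasurableSet s) (hsU : s ⊆ U)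
    (F : ℂ → ℝ≥0∞) : ∫⁻ x in f '' s, F x = ∫⁻ x in s, ‖deriv f x‖ₑ ^ 2 * F (f x) := by
  have h := lintegral_image_eq_lintegral_abs_det_fderiv_mul volume hs
    (f' := fun z => deriv f z • (1 : ℂ →L[ℝ] ℂ)) (fun z hz =>
      ((hf.differentiableAt (hU.mem_nhds
        (hsU hz))).hasDerivAt.complexToReal_fderiv).hasFDerivWithinAt) (hi.mono hsU) F
  rw [h]
  refine lintegral_congr fun z => ?_
  rw [det_smul_one, abs_of_nonneg (by positivity), ENNReal.ofReal_pow (norm_nonneg _),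
    ofReal_norm_eq_enorm]

lemma deriv_sq_le_volume (hG : IsOpen G) (hf : DifferentiableOn ℂ ψ G) (hi : InjOn ψ G)
    {x : ℂ} {δ : ℝ} (hδ : 0 < δ) (hx : closedBall x δ ⊆ G) :
    ENNReal.ofReal (π * δ ^ 2 * ‖deriv ψ x‖ ^ 2) ≤ volume (ψ '' G) := by
  have hd : DifferentiableOn ℂ (deriv ψ) G := hf.deriv hG
  set g : ℂ → ℂ := fun z => deriv ψ (x + z) ^ 2 with hg
  have hmem : ∀ z ∈ closedBall (0 : ℂ) δ, x + z ∈ G := fun z hz => hx (by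
    rw [mem_closedBall_zero_iff] at hz
    simpa [mem_closedBall, dist_eq_norm] using hz)
  have hcb : {z : ℂ | 0 ≤ ‖z‖ ∧ ‖z‖ ≤ δ} = closedBall 0 δ := by
    ext z; simp
  have hgd : DifferentiableOn ℂ g (closedBall 0 δ) :=
    ((hd.comp (by fun_prop : DifferentiableOn ℂ (fun z => x + z) (closedBall 0 δ)) hmem)).pow 2
  have h1 := setIntegral_annulus (g := g) (R := δ) le_rfl (by rw [hcb]; exact hgd.continuousOn)
  have h2 : ∀ ρ ∈ Ioo 0 δ, Real.circleAverage g 0 ρ = deriv ψ x ^ 2 := fun ρ hρ => by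
    have := DiffContOnCl.circleAverage (f := g) (c := 0) (R := ρ) (by
      rw [abs_of_pos hρ.1]
      refine (hgd.mono ?_).diffContOnCl
      exact closure_ball_subset_closedBall.trans (closedBall_subset_closedBall hρ.2.le))
    rw [this, hg]; simp
  rw [setIntegral_congr_fun (g := fun ρ => (ρ * (2 * π)) • deriv ψ x ^ 2) measurableSet_Ioo
    (fun ρ hρ => by simp only [h2 ρ hρ]), ← integral_Ioc_eq_integral_Ioo,
    ← intervalIntegral.integral_of_le hδ.le, intervalIntegral.integral_smul_const,
    intervalIntegral.integral_mul_const, integral_id] at h1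
  have hsub : ann 0 δ ⊆ closedBall 0 δ := fun z hz => by
    rw [mem_closedBall_zero_iff]; exact hz.2.le
  have h3 := norm_integral_le_integral_norm (μ := volume.restrict (ann 0 δ)) g
  change ∫ z in ann 0 δ, g z = _ at h1
  rw [h1] at h3
  have hopen : IsOpen ((fun z => x + z) ⁻¹' G) := hG.preimage (by fun_prop)
  have hfc : DifferentiableOn ℂ (fun z => ψ (x + z)) ((fun z => x + z) ⁻¹' G) :=
    hf.comp (by fun_prop) (mapsTo_preimage _ _)
  have hic : InjOn (fun z => ψ (x + z)) ((fun z => x + z) ⁻¹' G) := fun a ha b hb hab =>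
    add_left_cancel (hi ha hb hab)
  have h4 := volume_image_eq hopen hfc hic (isOpen_ann 0 δ).measurableSet
    fun z hz => hmem z (hsub hz)
  have h5 : ∀ z, deriv (fun z => ψ (x + z)) z = deriv ψ (x + z) := fun z =>
    deriv_comp_const_add _ _ _
  simp only [h5] at h4
  simp only [hg, norm_pow] at h3
  rw [← h4, norm_smul, norm_pow] at h3
  have h6 : π * δ ^ 2 * ‖deriv ψ x‖ ^ 2 ≤
      volume.real ((fun z => ψ (x + z)) '' ann 0 δ) := by
    refine le_trans (le_of_eq ?_) h3
    rw [Real.norm_eq_abs, abs_of_nonneg (by have := Real.pi_pos; nlinarith [sq_nonneg δ])]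
    ring
  refine (ENNReal.ofReal_le_ofReal h6).trans (ENNReal.ofReal_toReal_le.trans (measure_mono ?_))
  rintro _ ⟨z, hz, rfl⟩
  exact ⟨x + z, hmem z (hsub hz), rfl⟩

/-- The oscillation of a univalent function on a compact set is controlled by the area of its
image. -/
lemma exists_osc_le (hG : IsOpen G) (hGc : IsPreconnected G) {Q : Set ℂ} (hQ : IsCompact Q)
    (hQG : Q ⊆ G) : ∃ M : ℝ≥0, 0 < M ∧ ∀ ψ : ℂ → ℂ, DifferentiableOn ℂ ψ G → InjOn ψ G →
      ∀ x ∈ Q, ∀ y ∈ Q, ‖ψ x - ψ y‖ₑ ^ 2 ≤ M * volume (ψ '' G) := by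
  -- local estimate
  have hloc : ∀ x ∈ G, ∃ δ > 0, ∃ M : ℝ≥0, 0 < M ∧ ball x δ ⊆ G ∧
      ∀ ψ : ℂ → ℂ, DifferentiableOn ℂ ψ G → InjOn ψ G →
        ∀ y ∈ ball x δ, ∀ y' ∈ ball x δ, ‖ψ y - ψ y'‖ₑ ^ 2 ≤ M * volume (ψ '' G) := by
    intro x hx
    obtain ⟨ε, hε, hεG⟩ := nhds_basis_closedBall.mem_iff.1 (hG.mem_nhds hx)
    have hδ : 0 < ε / 2 := by positivity
    refine ⟨ε / 2, hδ, Real.toNNReal (4 / π), by simp; positivity,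
      (ball_subset_closedBall.trans (closedBall_subset_closedBall (by linarith))).trans hεG,
      fun ψ hψ hi y hy y' hy' => ?_⟩
    by_cases htop : volume (ψ '' G) = ⊤
    · rw [htop, ENNReal.mul_top (by simp; positivity)]; exact le_top
    set A := (volume (ψ '' G)).toReal with hA
    have hA0 : 0 ≤ A := ENNReal.toReal_nonneg
    have hbd : ∀ z ∈ ball x (ε / 2), ‖deriv ψ z‖ ≤ √(A / (π * (ε / 2) ^ 2)) := fun z hz => by
      have := deriv_sq_le_volume hG hψ hi hδ (x := z) (fun w hw => hεG (by
        rw [mem_closedBall] at *; rw [mem_ball] at hz; linarith [dist_triangle w z x]))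
      rw [ENNReal.ofReal_le_iff_le_toReal htop] at this
      apply Real.le_sqrt_of_sq_le
      rw [le_div_iff₀ (by positivity)]; linarith
    have hconv := (convex_ball x (ε / 2)).norm_image_sub_le_of_norm_deriv_le (𝕜 := ℂ) (f := ψ)
      (fun z hz => hψ.differentiableAt (hG.mem_nhds (hεG (by
        rw [mem_closedBall]; rw [mem_ball] at hz; linarith)))) hbd hy' hy
    have hdist : ‖y - y'‖ ≤ ε := by
      rw [← dist_eq_norm]; rw [mem_ball] at hy hy'
      linarith [dist_triangle_right y y' x]
    have hfin : ‖ψ y - ψ y'‖ ^ 2 ≤ 4 / π * A := by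
      have h1 : ‖ψ y - ψ y'‖ ≤ √(A / (π * (ε / 2) ^ 2)) * ε :=
        hconv.trans (by gcongr)
      calc ‖ψ y - ψ y'‖ ^ 2 ≤ (√(A / (π * (ε / 2) ^ 2)) * ε) ^ 2 := by gcongr
        _ = 4 / π * A := by
          rw [mul_pow, Real.sq_sqrt (by positivity)]; field_simp; ring
    rw [← ofReal_norm_eq_enorm, ← ENNReal.ofReal_pow (norm_nonneg _),
      ← ENNReal.ofReal_toReal htop, ENNReal.coe_nnreal_eq, Real.coe_toNNReal _ (by positivity),
      ← ENNReal.ofReal_mul (by positivity)]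
    exact ENNReal.ofReal_le_ofReal hfin
  have htri : ∀ a b c : ℂ, ∀ m m' V : ℝ≥0∞, ‖a - b‖ₑ ^ 2 ≤ m * V → ‖b - c‖ₑ ^ 2 ≤ m' * V →
      ‖a - c‖ₑ ^ 2 ≤ (2 * (m + m')) * V := by
    intro a b c m m' V h1 h2
    calc ‖a - c‖ₑ ^ 2 ≤ (‖a - b‖ₑ + ‖b - c‖ₑ) ^ 2 := by
          gcongr; rw [← sub_add_sub_cancel a b c]; exact enorm_add_le _ _
      _ ≤ 2 * (‖a - b‖ₑ ^ 2 + ‖b - c‖ₑ ^ 2) := by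
          have := ENNReal.rpow_add_le_mul_rpow_add_rpow ‖a - b‖ₑ ‖b - c‖ₑ (p := 2) (by norm_num)
          rw [show (2 : ℝ) - 1 = 1 by norm_num, ENNReal.rpow_one] at this
          exact_mod_cast this
      _ ≤ 2 * (m * V + m' * V) := by gcongr
      _ = _ := by ring
  rcases Q.eq_empty_or_nonempty with rfl | ⟨q, hq⟩
  · exact ⟨1, one_pos, by simp⟩
  have hall : ∀ x ∈ G, ∃ M : ℝ≥0, ∀ ψ : ℂ → ℂ, DifferentiableOn ℂ ψ G → InjOn ψ G →
      ‖ψ q - ψ x‖ₑ ^ 2 ≤ M * volume (ψ '' G) := by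
    set S : Set ℂ := {x | ∃ M : ℝ≥0, ∀ ψ : ℂ → ℂ, DifferentiableOn ℂ ψ G → InjOn ψ G →
      ‖ψ q - ψ x‖ₑ ^ 2 ≤ M * volume (ψ '' G)} with hS
    have hstep : ∀ x ∈ G, ∃ δ > 0, ∀ y ∈ ball x δ, ∀ y' ∈ ball x δ, y ∈ S → y' ∈ S := by
      intro x hx
      obtain ⟨δ, hδ, M, -, -, hM⟩ := hloc x hx
      refine ⟨δ, hδ, fun y hy y' hy' ⟨m, hm⟩ => ⟨2 * (m + M), fun ψ h1 h2 => ?_⟩⟩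
      exact_mod_cast htri _ _ _ _ _ _ (hm ψ h1 h2) (hM ψ h1 h2 y hy y' hy')
    have := hGc.subset_of_closure_inter_subset (u := interior S) isOpen_interior
      ⟨q, hQG hq, by
        obtain ⟨δ, hδ, h⟩ := hstep q (hQG hq)
        exact mem_interior_iff_mem_nhds.2 (mem_of_superset (ball_mem_nhds q hδ) fun y hy =>
          h q (mem_ball_self hδ) y hy ⟨0, fun ψ _ _ => by simp⟩)⟩ ?_
    · exact fun x hx => interior_subset (s := S) (this hx)
    · rintro x ⟨hx, hxG⟩
      obtain ⟨δ, hδ, h⟩ := hstep x hxG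
      obtain ⟨y, hy, hyS⟩ := mem_closure_iff_nhds.1 hx _ (ball_mem_nhds x hδ)
      exact mem_interior_iff_mem_nhds.2 (mem_of_superset (ball_mem_nhds x hδ) fun y' hy' =>
        h y hy y' hy' (interior_subset hyS))
  have hunif : ∃ M : ℝ≥0, ∀ x ∈ Q, ∀ ψ : ℂ → ℂ, DifferentiableOn ℂ ψ G → InjOn ψ G →
      ‖ψ q - ψ x‖ₑ ^ 2 ≤ M * volume (ψ '' G) := by
    refine hQ.induction_on (p := fun s => ∃ M : ℝ≥0, ∀ x ∈ s, ∀ ψ : ℂ → ℂ,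
      DifferentiableOn ℂ ψ G → InjOn ψ G → ‖ψ q - ψ x‖ₑ ^ 2 ≤ M * volume (ψ '' G))
      ⟨0, by simp⟩ (fun s t hst ⟨M, hM⟩ => ⟨M, fun x hx => hM x (hst hx)⟩) ?_ ?_
    · rintro s t ⟨M, hM⟩ ⟨N, hN⟩
      refine ⟨max M N, fun x hx ψ h1 h2 => ?_⟩
      rcases hx with hx | hx
      · refine (hM x hx ψ h1 h2).trans ?_
        gcongr; exact le_max_left _ _
      · refine (hN x hx ψ h1 h2).trans ?_
        gcongr; exact le_max_right _ _
    · intro x hx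
      obtain ⟨δ, hδ, M, -, -, hM⟩ := hloc x (hQG hx)
      obtain ⟨m, hm⟩ := hall x (hQG hx)
      refine ⟨ball x δ, mem_nhdsWithin_of_mem_nhds (ball_mem_nhds x hδ), 2 * (m + M),
        fun y hy ψ h1 h2 => ?_⟩
      exact_mod_cast htri _ _ _ _ _ _ (hm ψ h1 h2) (hM ψ h1 h2 x (mem_ball_self hδ) y hy)
  obtain ⟨M, hM⟩ := hunif
  refine ⟨2 * (M + M) + 1, by positivity, fun ψ h1 h2 x hx y hy => ?_⟩
  have := htri (ψ x) (ψ q) (ψ y) M M _ (by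
    rw [← enorm_neg, neg_sub]; exact hM x hx ψ h1 h2) (hM y hy ψ h1 h2)
  refine this.trans ?_
  gcongr
  push_cast
  exact le_self_add

end Area

/-- Twice the Wirtinger derivative `∂w/∂z̄`, up to the factor `i`. -/
def dbar (w : ℂ → ℂ) (z : ℂ) : ℂ := I * fderiv ℝ w z 1 - fderiv ℝ w z I

section Dbar

variable {w g : ℂ → ℂ} {z : ℂ}

lemma dbar_congr {w' : ℂ → ℂ} (h : w =ᶠ[𝓝 z] w') : dbar w z = dbar w' z := by
  rw [dbar, dbar, h.fderiv_eq]

lemma dbar_eq_zero (h : DifferentiableAt ℂ w z) : dbar w z = 0 := by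
  rw [dbar, h.fderiv_restrictScalars ℝ]
  simp only [ContinuousLinearMap.coe_restrictScalars']
  have : fderiv ℂ w z I = I * fderiv ℂ w z 1 := by
    rw [← smul_eq_mul, ← map_smul, smul_eq_mul, mul_one]
  rw [this, sub_self]

lemma map_mul_real (T : ℂ →L[ℝ] ℂ) (a : ℂ) : I * T a - T (a * I) = conj a * (I * T 1 - T I) := by
  have h1 : T a = a.re * T 1 + a.im * T I := by
    conv_lhs => rw [show a = a.re • (1 : ℂ) + a.im • I by simp [Complex.re_add_im]]
    rw [map_add, map_smul, map_smul, Complex.real_smul, Complex.real_smul]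
  have h2 : T (a * I) = a.re * T I - a.im * T 1 := by
    conv_lhs => rw [show a * I = a.re • I + (-a.im) • (1 : ℂ) by
      apply Complex.ext <;> simp]
    rw [map_add, map_smul, map_smul, Complex.real_smul, Complex.real_smul]
    push_cast; ring
  have h3 : conj a = a.re - a.im * I := by apply Complex.ext <;> simp
  rw [h1, h2, h3]
  linear_combination (-a.im * T 1 * 0 + 0 * T I) * Complex.I_sq + (-(a.im : ℂ) * T 1) * (-Complex.I_sq)

lemma dbar_comp (hw : DifferentiableAt ℝ w (g z)) (hg : DifferentiableAt ℂ g z) :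
    dbar (fun z => w (g z)) z = conj (deriv g z) * dbar w (g z) := by
  have h := hw.hasFDerivAt.comp z (hg.hasDerivAt.complexToReal_fderiv)
  have h' : fderiv ℝ (fun z => w (g z)) z = _ := h.fderiv
  rw [dbar, h', dbar]
  simp only [ContinuousLinearMap.comp_apply, FunLike.coe_smul, Pi.smul_apply,
    ContinuousLinearMap.one_apply, smul_eq_mul, mul_one]
  exact map_mul_real _ _

lemma dbar_conj (hw : DifferentiableAt ℝ w (conj z)) :
    dbar (fun z => conj (w (conj z))) z = -conj (dbar w (conj z)) := by
  have h := (Complex.conjCLE.hasFDerivAt (x := w (conj z))).comp z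
    (HasFDerivAt.comp z (g := w) (f := fun z => conj z) (by exact hw.hasFDerivAt)
      (Complex.conjCLE.hasFDerivAt (x := z)))
  have h' : fderiv ℝ (fun z => conj (w (conj z))) z = _ := h.fderiv
  rw [dbar, h', dbar]
  simp
  ring

lemma dbar_sub_mul {η ψ : ℂ → ℂ} {b : ℂ} (hη : DifferentiableAt ℝ η z)
    (hψ : DifferentiableAt ℂ ψ z) :
    dbar (fun z => ψ z - η z * (ψ z - b)) z = -(ψ z - b) * dbar η z := by
  have hψ' : DifferentiableAt ℝ ψ z := hψ.restrictScalars ℝ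
  have h0 := dbar_eq_zero hψ
  rw [dbar] at h0
  have h := (hψ'.hasFDerivAt.sub (hη.hasFDerivAt.mul (hψ'.hasFDerivAt.sub_const b)))
  have h' : fderiv ℝ (fun z => ψ z - η z * (ψ z - b)) z = _ := h.fderiv
  rw [dbar, h', dbar]
  simp
  linear_combination (1 - η z) * h0

end Dbar

/-- A neighbourhood `V` of a compact set `C ⊇ L` such that `C` occupies at most the proportion `t`
of the area of each univalent image of `V`, and univalent functions on `V \ L` can be modified on
`C` to functions on `V` whose `∂̄`-energy is at most `M` times the area of the image. -/
structure Cell (M t : ℝ≥0∞) (V L C : Set ℂ) : Prop where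
  isOpen : IsOpen V
  isCompact_left : IsCompact L
  isCompact : IsCompact C
  subset_interior : L ⊆ interior C
  subset : C ⊆ V
  area : ∀ φ : ℂ → ℂ, DifferentiableOn ℂ φ V → InjOn φ V → volume (φ '' C) ≤ t * volume (φ '' V)
  ext : ∀ ψ : ℂ → ℂ, DifferentiableOn ℂ ψ (V \ L) → InjOn ψ (V \ L) →
    ∃ w : ℂ → ℂ, ContDiffOn ℝ 1 w V ∧ (∀ z ∈ V \ C, w z = ψ z) ∧
      ∫⁻ z in C, ‖dbar w z‖ₑ ^ 2 ≤ M * volume (ψ '' (V \ L))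

namespace Cell

variable {M t : ℝ≥0∞} {V L C : Set ℂ}

lemma left_subset (h : Cell M t V L C) : L ⊆ V :=
  (h.subset_interior.trans interior_subset).trans h.subset

lemma mono {t' : ℝ≥0∞} (h : Cell M t V L C) (ht : t ≤ t') : Cell M t' V L C :=
  { h with area := fun φ h1 h2 => (h.area φ h1 h2).trans (by gcongr) }

lemma contDiffOn_of_holomorphic {g : ℂ → ℂ} {U : Set ℂ} (hU : IsOpen U)
    (hg : DifferentiableOn ℂ g U) : ContDiffOn ℝ 1 g U :=
  (hg.contDiffOn hU).restrict_scalars ℝ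

lemma image (h : Cell M t V L C) {g : ℂ → ℂ} (hg : DifferentiableOn ℂ g V) (hi : InjOn g V) :
    Cell M t (g '' V) (g '' L) (g '' C) := by
  obtain ⟨k, hk⟩ : ∃ k : ℂ → ℂ, ∀ z ∈ V, k (g z) = z :=
    ⟨Function.invFunOn g V, fun z hz => hi.leftInvOn_invFunOn hz⟩
  have hkd := differentiableOn_leftInverse h.isOpen hg hi hk
  have hopen : IsOpen (g '' V) := isOpen_image_of_injOn h.isOpen hg hi
  have hCo : IsOpen (g '' interior C) := isOpen_image_of_injOn isOpen_interior
    (hg.mono (interior_subset.trans h.subset)) (hi.mono (interior_subset.trans h.subset))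
  have hdiff : g '' V \ g '' L = g '' (V \ L) := by
    rw [hi.image_diff_subset h.left_subset]
  have hdiffC : g '' V \ g '' C = g '' (V \ C) := by
    rw [hi.image_diff_subset h.subset]
  refine ⟨hopen, h.isCompact_left.image_of_continuousOn (hg.continuousOn.mono h.left_subset),
    h.isCompact.image_of_continuousOn (hg.continuousOn.mono h.subset),
    (image_mono h.subset_interior).trans (interior_maximal (image_mono interior_subset) hCo),
    image_mono h.subset, fun φ hφ hφi => ?_, fun ψ hψ hψi => ?_⟩
  · have := h.area (fun z => φ (g z)) (hφ.comp hg (mapsTo_image g V))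
      (fun x hx y hy hxy => hi hx hy (hφi (mem_image_of_mem g hx) (mem_image_of_mem g hy) hxy))
    rwa [← image_image φ g, ← image_image φ g] at this
  · rw [hdiff] at hψ hψi ⊢
    obtain ⟨w, hw, hwψ, hE⟩ := h.ext (fun z => ψ (g z))
      (hψ.comp (hg.mono diff_subset) (mapsTo_image g _))
      (fun x hx y hy hxy => hi hx.1 hy.1 (hψi (mem_image_of_mem g hx) (mem_image_of_mem g hy) hxy))
    refine ⟨fun z => w (k z), hw.comp (contDiffOn_of_holomorphic hopen hkd) ?_, ?_, ?_⟩
    · rintro _ ⟨z, hz, rfl⟩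
      rw [hk z hz]; exact hz
    · rw [hdiffC]
      rintro _ ⟨z, hz, rfl⟩
      change w (k (g z)) = _; rw [hk z hz.1, hwψ z hz]
    · rw [image_image ψ g, lintegral_image_holomorphic h.isOpen hg hi h.isCompact.measurableSet h.subset]
      refine le_trans (le_of_eq (setLIntegral_congr_fun h.isCompact.measurableSet fun z hz => ?_)) hE
      have hzV := h.subset hz
      have hgz : DifferentiableAt ℂ g z := hg.differentiableAt (h.isOpen.mem_nhds hzV)
      have h1 : dbar w z = dbar (fun z => (fun z => w (k z)) (g z)) z :=
        dbar_congr (by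
          filter_upwards [h.isOpen.mem_nhds hzV] with y hy
          rw [hk y hy])
      have hwk : DifferentiableAt ℝ (fun z => w (k z)) (g z) := by
        have hkz : DifferentiableAt ℝ k (g z) :=
          (hkd.differentiableAt (hopen.mem_nhds (mem_image_of_mem g hzV))).restrictScalars ℝ
        have hwz : DifferentiableAt ℝ w (k (g z)) := by
          rw [hk z hzV]
          exact (hw.differentiableOn (by simp)).differentiableAt (h.isOpen.mem_nhds hzV)
        exact hwz.comp _ hkz
      rw [h1, dbar_comp hwk hgz, enorm_mul, mul_pow]
      congr 2
      rw [← ofReal_norm_eq_enorm, ← ofReal_norm_eq_enorm, Complex.norm_conj]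

lemma image_conj (h : Cell M t V L C) :
    Cell M t ((fun z => conj z) '' V) ((fun z => conj z) '' L) ((fun z => conj z) '' C) := by
  have himg : ∀ S : Set ℂ, (fun z : ℂ => conj z) '' S = (fun z => conj z) ⁻¹' S := fun S =>
    congrFun (image_eq_preimage_of_inverse (fun z => Complex.conj_conj z)
      (fun z => Complex.conj_conj z)) S
  have hvol : ∀ S : Set ℂ, volume ((fun z : ℂ => conj z) '' S) = volume S := fun S => by
    rw [himg]
    exact Complex.conjLIE.measurePreserving.measure_preimage_equiv
      (f := Complex.conjLIE.toHomeomorph.toMeasurableEquiv) S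
  have hcd : ∀ {f : ℂ → ℂ} {U : Set ℂ}, IsOpen U →
      DifferentiableOn ℂ f ((fun z => conj z) '' U) →
      DifferentiableOn ℂ (fun z => conj (f (conj z))) U := by
    intro f U hU hf z hz
    have hU' : IsOpen ((fun z : ℂ => conj z) '' U) := by
      rw [himg]; exact hU.preimage Complex.continuous_conj
    have h1 : DifferentiableAt ℂ f (conj z) := hf.differentiableAt (hU'.mem_nhds ⟨z, hz, rfl⟩)
    have h2 := h1.conj_conj
    rw [Complex.conj_conj] at h2
    exact h2.differentiableWithinAt
  have hci : ∀ {f : ℂ → ℂ} {U : Set ℂ}, InjOn f ((fun z => conj z) '' U) →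
      InjOn (fun z => conj (f (conj z))) U := by
    intro f U hf x hx y hy hxy
    exact Complex.conjCLE.injective
      (hf ⟨x, hx, rfl⟩ ⟨y, hy, rfl⟩ (Complex.conjCLE.injective hxy))
  have hinj : Function.Injective (fun z : ℂ => conj z) := Complex.conjCLE.injective
  refine ⟨?_, h.isCompact_left.image Complex.continuous_conj,
    h.isCompact.image Complex.continuous_conj, ?_, image_mono h.subset, fun φ hφ hφi => ?_,
    fun ψ hψ hψi => ?_⟩
  · rw [himg]; exact h.isOpen.preimage Complex.continuous_conj
  · refine (image_mono h.subset_interior).trans (interior_maximal (image_mono interior_subset) ?_)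
    rw [himg]; exact isOpen_interior.preimage Complex.continuous_conj
  · have := h.area _ (hcd h.isOpen hφ) (hci hφi)
    have e : ∀ S : Set ℂ, (fun z => conj (φ (conj z))) '' S =
        (fun z => conj z) '' (φ '' ((fun z => conj z) '' S)) := fun S => by
      rw [image_image, image_image]
    rwa [e, e, hvol, hvol] at this
  · rw [← image_diff hinj, ← image_diff hinj]
    rw [← image_diff hinj] at hψ hψi
    obtain ⟨w, hw, hwψ, hE⟩ := h.ext _ (hcd (h.isOpen.sdiff h.isCompact_left.isClosed) hψ) (hci hψi)
    have hcc : ContDiff ℝ 1 (fun z : ℂ => conj z) := Complex.conjCLE.contDiff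
    refine ⟨fun z => conj (w (conj z)), ?_, ?_, ?_⟩
    · refine hcc.comp_contDiffOn (hw.comp hcc.contDiffOn ?_)
      rw [himg]; exact mapsTo_preimage _ _
    · rintro _ ⟨z, hz, rfl⟩
      simp only [Complex.conj_conj, hwψ z hz]
    · have e : (fun z => conj (ψ (conj z))) '' (V \ L) =
          (fun z => conj z) '' (ψ '' ((fun z => conj z) '' (V \ L))) := by
        rw [image_image, image_image]
      rw [e, hvol] at hE
      refine le_trans (le_of_eq ?_) hE
      have hmp : MeasurePreserving (fun z : ℂ => conj z) := Complex.conjLIE.measurePreserving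
      have hme : MeasurableEmbedding (fun z : ℂ => conj z) :=
        Complex.conjLIE.toHomeomorph.measurableEmbedding
      rw [himg]
      have h1 := hmp.setLIntegral_comp_preimage_emb hme (fun z => ‖dbar w z‖ₑ ^ 2) C
      rw [← h1]
      refine setLIntegral_congr_fun ((hme.measurable h.isCompact.measurableSet)) fun z hz => ?_
      have hzV : conj z ∈ V := h.subset hz
      have hwz : DifferentiableAt ℝ w (conj z) :=
        (hw.differentiableOn (by simp)).differentiableAt (h.isOpen.mem_nhds hzV)
      rw [dbar_conj hwz, enorm_neg, ← ofReal_norm_eq_enorm, ← ofReal_norm_eq_enorm,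
        Complex.norm_conj]

/-- Disjoint cells inside a common set. -/
lemma iUnion {ι : Type*} [Finite ι] {V L C : ι → Set ℂ} (h : ∀ i, Cell M t (V i) (L i) (C i))
    (hV : ∀ i j, i ≠ j → Disjoint (V i) (V j)) {q : ℝ≥0∞} {D U : Set ℂ} (hU : IsOpen U)
    (hVD : ∀ i, V i ⊆ D) (hDU : D ⊆ U)
    (harea : ∀ φ : ℂ → ℂ, DifferentiableOn ℂ φ U → InjOn φ U →
      volume (φ '' D) ≤ q * volume (φ '' U)) :
    Cell M (q * t) U (⋃ i, L i) (⋃ i, C i) := by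
  have := Fintype.ofFinite ι
  have hVU : ∀ i, V i ⊆ U := fun i => (hVD i).trans hDU
  have hCU : ⋃ i, C i ⊆ U := iUnion_subset fun i => (h i).subset.trans (hVU i)
  have hsum : ∀ (f : ℂ → ℂ) (S : ι → Set ℂ) (W : Set ℂ), IsOpen W → DifferentiableOn ℂ f W →
      InjOn f W → (∀ i, IsOpen (S i)) → (∀ i, S i ⊆ W) → (∀ i j, i ≠ j → Disjoint (S i) (S j)) →
      ∑ i, volume (f '' S i) = volume (f '' ⋃ i, S i) := by
    intro f S W hW hf hi hS hSW hd
    rw [image_iUnion, measure_iUnion _ fun i => (isOpen_image_of_injOn (hS i) (hf.mono (hSW i))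
      (hi.mono (hSW i))).measurableSet, tsum_fintype]
    intro i j hij
    rw [Function.onFun, disjoint_left]
    rintro _ ⟨x, hx, rfl⟩ ⟨y, hy, hxy⟩
    exact disjoint_left.1 (hd i j hij) hx (hi (hSW j hy) (hSW i hx) hxy ▸ hy)
  refine ⟨hU, isCompact_iUnion fun i => (h i).isCompact_left,
    isCompact_iUnion fun i => (h i).isCompact, iUnion_subset fun i =>
      (h i).subset_interior.trans (interior_mono (subset_iUnion _ i)), hCU, fun φ hφ hφi => ?_,
    fun ψ hψ hψi => ?_⟩
  · calc volume (φ '' ⋃ i, C i) ≤ ∑ i, volume (φ '' C i) := by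
          rw [image_iUnion]; exact measure_iUnion_fintype_le _ _
      _ ≤ ∑ i, t * volume (φ '' V i) := Finset.sum_le_sum fun i _ =>
          (h i).area φ (hφ.mono (hVU i)) (hφi.mono (hVU i))
      _ = t * volume (φ '' ⋃ i, V i) := by
          rw [← Finset.mul_sum, hsum φ V U hU hφ hφi (fun i => (h i).isOpen) hVU hV]
      _ ≤ t * volume (φ '' D) := by gcongr; exact iUnion_subset hVD
      _ ≤ t * (q * volume (φ '' U)) := by gcongr; exact harea φ hφ hφi
      _ = _ := by ring
  · have hsub : ∀ i, V i \ L i ⊆ U \ ⋃ i, L i := fun i z hz => ⟨hVU i hz.1, fun hzL => by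
      obtain ⟨j, hj⟩ := mem_iUnion.1 hzL
      rcases eq_or_ne i j with rfl | hij
      · exact hz.2 hj
      · exact disjoint_left.1 (hV i j hij) hz.1 ((h j).left_subset hj)⟩
    choose w hw hwψ hE using fun i => (h i).ext ψ (hψ.mono (hsub i)) (hψi.mono (hsub i))
    classical
    set W : ℂ → ℂ := fun z => if hz : ∃ i, z ∈ V i then w hz.choose z else ψ z with hWdef
    have hWV : ∀ i, ∀ z ∈ V i, W z = w i z := fun i z hz => by
      have hex : ∃ i, z ∈ V i := ⟨i, hz⟩
      have : hex.choose = i := by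
        by_contra hne
        exact disjoint_left.1 (hV _ _ hne) hex.choose_spec hz
      simp only [hWdef, dif_pos hex, this]
    have hWC : ∀ z ∈ U \ ⋃ i, C i, W z = ψ z := fun z hz => by
      by_cases hex : ∃ i, z ∈ V i
      · obtain ⟨i, hi⟩ := hex
        rw [hWV i z hi, hwψ i z ⟨hi, fun hc => hz.2 (mem_iUnion.2 ⟨i, hc⟩)⟩]
      · simp only [hWdef, dif_neg hex]
    have hCcl : IsClosed (⋃ i, C i) := (isCompact_iUnion fun i => (h i).isCompact).isClosed
    refine ⟨W, fun z hz => ?_, hWC, ?_⟩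
    · by_cases hex : ∃ i, z ∈ C i
      · obtain ⟨i, hi⟩ := hex
        have hzV := (h i).subset hi
        have hnh := (h i).isOpen.mem_nhds hzV
        refine (((hw i).contDiffAt hnh).congr_of_eventuallyEq ?_).contDiffWithinAt
        filter_upwards [hnh] with y hy using hWV i y hy
      · have hzC : z ∈ U \ ⋃ i, C i := ⟨hz, fun hc => hex (mem_iUnion.1 hc)⟩
        have hopen : IsOpen (U \ ⋃ i, C i) := hU.sdiff hCcl
        have hLC : U \ ⋃ i, C i ⊆ U \ ⋃ i, L i := diff_subset_diff_right
          (iUnion_mono fun i => (h i).subset_interior.trans interior_subset)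
        refine (((contDiffOn_of_holomorphic hopen (hψ.mono hLC)).contDiffAt
          (hopen.mem_nhds hzC)).congr_of_eventuallyEq ?_).contDiffWithinAt
        filter_upwards [hopen.mem_nhds hzC] with y hy using hWC y hy
    · have hopenVL : ∀ i, IsOpen (V i \ L i) := fun i =>
        (h i).isOpen.sdiff (h i).isCompact_left.isClosed
      calc ∫⁻ z in ⋃ i, C i, ‖dbar W z‖ₑ ^ 2 ≤ ∑ i, ∫⁻ z in C i, ‖dbar W z‖ₑ ^ 2 := by
            rw [← tsum_fintype (L := SummationFilter.unconditional ι)]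
            exact lintegral_iUnion_le _ _
        _ = ∑ i, ∫⁻ z in C i, ‖dbar (w i) z‖ₑ ^ 2 := by
            refine Finset.sum_congr rfl fun i _ =>
              setLIntegral_congr_fun (h i).isCompact.measurableSet fun z hz => ?_
            rw [dbar_congr (w' := w i)]
            filter_upwards [(h i).isOpen.mem_nhds ((h i).subset hz)] with y hy using hWV i y hy
        _ ≤ ∑ i, M * volume (ψ '' (V i \ L i)) := Finset.sum_le_sum fun i _ => hE i
        _ = M * volume (ψ '' ⋃ i, (V i \ L i)) := by
            rw [← Finset.mul_sum, hsum ψ _ (U \ ⋃ i, L i)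
              (hU.sdiff (isCompact_iUnion fun i => (h i).isCompact_left).isClosed) hψ hψi hopenVL
              hsub fun i j hij => (hV i j hij).mono diff_subset diff_subset]
        _ ≤ _ := by gcongr; exact iUnion_subset hsub

end Cell

lemma Cell.of_isCompact {V A : Set ℂ} (hV : IsOpen V) (hA : IsCompact A) (hAV : A ⊆ V)
    (hc : IsPreconnected (V \ A)) : ∃ (M : ℝ≥0) (C : Set ℂ), Cell M 1 V A C := by
  obtain ⟨C, hC, hAC, hCV⟩ := exists_compact_between hA hV hAV
  obtain ⟨N, hN, hAN, hNC⟩ := exists_compact_between hA isOpen_interior hAC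
  obtain ⟨η, hη1, hη0, -⟩ := exists_contMDiffMap_one_nhds_of_subset_interior (n := 1)
    (modelWithCornersSelf ℝ ℂ) hN.isClosed hNC
  have hηs : ContDiff ℝ 1 (fun z => (η z : ℂ)) := by
    have h1 : ContDiff ℝ 1 (fun z => η z) := η.contMDiff.contDiff
    exact Complex.ofRealCLM.contDiff.comp h1
  have hdc : Continuous (dbar fun z => (η z : ℂ)) := by
    have h1 := hηs.continuous_fderiv (by simp)
    exact (continuous_const.mul (h1.clm_apply continuous_const)).sub (h1.clm_apply continuous_const)
  obtain ⟨B, hB⟩ := hC.exists_bound_of_continuousOn hdc.continuousOn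
  have hG : IsOpen (V \ A) := hV.sdiff hA.isClosed
  have hQ : IsCompact (C \ interior N) := hC.diff isOpen_interior
  obtain ⟨M, -, hM⟩ := exists_osc_le hG hc hQ
    (fun z hz => ⟨hCV hz.1, fun h => hz.2 (hAN h)⟩)
  refine ⟨(B.toNNReal ^ 2 * M) * (volume C).toNNReal, C, hV, hA, hC, hAC, hCV,
    fun φ _ _ => by rw [one_mul]; gcongr, fun ψ hψ hψi => ?_⟩
  obtain ⟨b, hb⟩ : ∃ b, ∀ z ∈ C \ interior N, ‖ψ z - b‖ₑ ^ 2 ≤ M * volume (ψ '' (V \ A)) := by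
    by_cases hne : (C \ interior N).Nonempty
    · obtain ⟨x, hx⟩ := hne
      exact ⟨ψ x, fun z hz => hM ψ hψ hψi z hz x hx⟩
    · exact ⟨0, fun z hz => absurd ⟨z, hz⟩ hne⟩
  classical
  set w : ℂ → ℂ := fun z => if z ∈ N then b else ψ z - η z * (ψ z - b) with hw
  have hwN : ∀ z ∈ N, w =ᶠ[𝓝 z] fun _ => b := fun z hz => by
    filter_upwards [(_root_.eventually_nhdsSet_iff_forall.1 hη1) z hz]
      with y hy
    by_cases hyN : y ∈ N
    · simp [hw, hyN]
    · simp [hw, hyN, hy]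
  have hwO : ∀ z, z ∉ N → w =ᶠ[𝓝 z] fun z => ψ z - η z * (ψ z - b) := fun z hz => by
    filter_upwards [hN.isClosed.isOpen_compl.mem_nhds hz] with y hy
    simp only [hw, if_neg hy]
  have hNA : ∀ z ∈ V, z ∉ N → z ∈ V \ A := fun z hz hzN =>
    ⟨hz, fun h => hzN (interior_subset (hAN h))⟩
  refine ⟨w, fun z hz => ?_, fun z hz => ?_, ?_⟩
  · by_cases hzN : z ∈ N
    · exact (contDiffAt_const.congr_of_eventuallyEq (hwN z hzN)).contDiffWithinAt
    · have h1 : ContDiffAt ℝ 1 ψ z := (Cell.contDiffOn_of_holomorphic hG hψ).contDiffAt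
        (hG.mem_nhds (hNA z hz hzN))
      exact ((h1.sub (hηs.contDiffAt.mul (h1.sub contDiffAt_const))).congr_of_eventuallyEq
        (hwO z hzN)).contDiffWithinAt
  · have hzN : z ∉ N := fun h => hz.2 (interior_subset (hNC h))
    simp [hw, hzN, hη0 z hz.2]
  · have hpt : ∀ z ∈ C, ‖dbar w z‖ₑ ^ 2 ≤
        ((B.toNNReal ^ 2 * M : ℝ≥0) : ℝ≥0∞) * volume (ψ '' (V \ A)) := fun z hz => by
      by_cases hzN : z ∈ N
      · rw [dbar_congr (hwN z hzN), dbar_eq_zero (differentiableAt_const b)]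
        simp
      · rw [dbar_congr (hwO z hzN), dbar_sub_mul (hηs.differentiable (by simp) z)
          (hψ.differentiableAt (hG.mem_nhds (hNA z (hCV hz) hzN))), enorm_mul, mul_pow, enorm_neg,
          mul_comm]
        have h1 : ‖dbar (fun z => (η z : ℂ)) z‖ₑ ≤ B.toNNReal := by
          rw [← ofReal_norm_eq_enorm]
          exact ENNReal.ofReal_le_ofReal (hB z hz)
        have h2 := hb z ⟨hz, fun h => hzN (interior_subset h)⟩
        calc ‖dbar (fun z => (η z : ℂ)) z‖ₑ ^ 2 * ‖ψ z - b‖ₑ ^ 2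
            ≤ (B.toNNReal : ℝ≥0∞) ^ 2 * (M * volume (ψ '' (V \ A))) := by gcongr
          _ = _ := by push_cast; ring
    calc ∫⁻ z in C, ‖dbar w z‖ₑ ^ 2
        ≤ ∫⁻ _ in C, ((B.toNNReal ^ 2 * M : ℝ≥0) : ℝ≥0∞) * volume (ψ '' (V \ A)) :=
          setLIntegral_mono measurable_const hpt
      _ = _ := by
          rw [setLIntegral_const, ENNReal.coe_mul _ (volume C).toNNReal,
            ENNReal.coe_toNNReal hC.measure_lt_top.ne]
          ring

/-- The two points realizing the diameter of a compact set lie on its frontier. -/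
lemma IsCompact.exists_dist_le_frontier {X : Set ℂ} (hX : IsCompact X) (hne : X.Nonempty) :
    ∃ x ∈ frontier X, ∃ y ∈ frontier X, ∀ z ∈ X, ∀ w ∈ X, dist z w ≤ dist x y := by
  obtain ⟨⟨x, y⟩, ⟨hx, hy⟩, hm⟩ := (hX.prod hX).exists_isMaxOn (hne.prod hne)
    (f := fun p : ℂ × ℂ => dist p.1 p.2) continuous_dist.continuousOn
  have hm' : ∀ z ∈ X, ∀ w ∈ X, dist z w ≤ dist x y := fun z hz w hw => hm (mk_mem_prod hz hw)
  have key : ∀ x ∈ X, ∀ y, (∀ z ∈ X, dist z y ≤ dist x y) → x ∈ frontier X := by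
    intro x hx y h
    refine ⟨subset_closure hx, fun hxi => ?_⟩
    obtain ⟨ε, hε, hb⟩ := Metric.isOpen_iff.1 isOpen_interior x hxi
    have hb' : closedBall x (ε / 2) ⊆ X := (closedBall_subset_ball (by linarith)).trans
      (hb.trans interior_subset)
    by_cases hxy : x = y
    · subst hxy
      have := h (x + (ε / 2 : ℝ)) (hb' (by simp [abs_of_pos hε]))
      rw [dist_self, dist_eq_norm, add_sub_cancel_left, Complex.norm_real, Real.norm_eq_abs,
        abs_of_pos (by positivity)] at this
      linarith
    · have hd : 0 < ‖x - y‖ := norm_pos_iff.2 (sub_ne_zero.2 hxy)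
      have h1 := h (x + (ε / 2 / ‖x - y‖ : ℝ) • (x - y)) (hb' (by
        rw [mem_closedBall, dist_eq_norm, add_sub_cancel_left, norm_smul, Real.norm_eq_abs,
          abs_of_pos (by positivity), div_mul_cancel₀ _ hd.ne']))
      rw [dist_eq_norm, dist_eq_norm, show x + (ε / 2 / ‖x - y‖ : ℝ) • (x - y) - y =
        (1 + ε / 2 / ‖x - y‖ : ℝ) • (x - y) by rw [add_smul, one_smul]; ring, norm_smul,
        Real.norm_eq_abs, abs_of_pos (by positivity), add_mul, one_mul,
        div_mul_cancel₀ _ hd.ne'] at h1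
      linarith
  exact ⟨x, key x hx y fun z hz => hm' z hz y hy, y, key y hy x fun z hz => by
    rw [dist_comm, dist_comm y]; exact hm' x hx z hz, hm'⟩

lemma ENNReal.le_ratio_mul {a b : ℝ≥0∞} {m : ℝ≥0} (h : a ≤ m * b) :
    a ≤ (m / (1 + m) : ℝ≥0) * (a + b) := by
  have h1 : (1 + m : ℝ≥0) ≠ 0 := by positivity
  rw [ENNReal.coe_div h1, ← ENNReal.mul_div_right_comm, ENNReal.le_div_iff_mul_le (by simp) (by simp)]
  push_cast
  calc a * (1 + m) = a + m * a := by ring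
    _ ≤ m * b + m * a := by gcongr
    _ = _ := by ring

/-- If a set `E` is surrounded by a univalent image of a fixed ring, then its proportion of area is
bounded away from `1` in each univalent image. -/
lemma exists_area_ratio {V A N : Set ℂ} (hV : IsOpen V) (hA : IsCompact A)
    (hc : IsPreconnected (V \ A)) (hN : IsCompact N) (hAN : A ⊆ interior N) (hNV : N ⊆ V) :
    ∃ q : ℝ≥0, q < 1 ∧ ∀ (E : Set ℂ) (f φ : ℂ → ℂ), DifferentiableOn ℂ f (V \ A) →
      InjOn f (V \ A) → Disjoint E (f '' (V \ A)) → IsCompact (E ∪ f '' (N \ A)) →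
      IsOpen (E ∪ f '' (interior N \ A)) → IsOpen (E ∪ f '' (V \ A)) → E.Nonempty →
      DifferentiableOn ℂ φ (E ∪ f '' (V \ A)) → InjOn φ (E ∪ f '' (V \ A)) →
      volume (φ '' E) ≤ q * volume (φ '' (E ∪ f '' (V \ A))) := by
  have hG : IsOpen (V \ A) := hV.sdiff hA.isClosed
  have hQ : IsCompact (N \ interior N) := hN.diff isOpen_interior
  have hQG : N \ interior N ⊆ V \ A := fun z hz => ⟨hNV hz.1, fun h => hz.2 (hAN h)⟩
  obtain ⟨M, -, hM⟩ := exists_osc_le hG hc hQ hQG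
  refine ⟨NNReal.pi * M / (1 + NNReal.pi * M), ?_, ?_⟩
  · rw [div_lt_one (by positivity)]; exact lt_one_add _
  intro E f φ hf hfi hdis hX hO hU hEne hφ hφi
  have hNA : N \ A ⊆ V \ A := diff_subset_diff_left hNV
  have hXU : E ∪ f '' (N \ A) ⊆ E ∪ f '' (V \ A) := union_subset_union_right _ (image_mono hNA)
  have hφX : IsCompact (φ '' (E ∪ f '' (N \ A))) :=
    hX.image_of_continuousOn (hφ.continuousOn.mono hXU)
  have hφO : IsOpen (φ '' (E ∪ f '' (interior N \ A))) := by
    have : E ∪ f '' (interior N \ A) ⊆ E ∪ f '' (V \ A) :=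
      union_subset_union_right _ (image_mono (diff_subset_diff_left (interior_subset.trans hNV)))
    exact isOpen_image_of_injOn hO (hφ.mono this) (hφi.mono this)
  have hfr : frontier (φ '' (E ∪ f '' (N \ A))) ⊆ (fun z => φ (f z)) '' (N \ interior N) := by
    rintro w ⟨hw, hw'⟩
    rw [hφX.isClosed.closure_eq] at hw
    obtain ⟨y, hy, rfl⟩ := hw
    have hy' : y ∉ E ∪ f '' (interior N \ A) := fun h => hw' (interior_maximal
      (image_mono (union_subset_union_right _ (image_mono (diff_subset_diff_left
        interior_subset)))) hφO (mem_image_of_mem φ h))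
    rcases hy with hy | ⟨z, hz, rfl⟩
    · exact absurd (Or.inl hy) hy'
    · exact ⟨z, ⟨hz.1, fun h => hy' (Or.inr ⟨z, ⟨h, hz.2⟩, rfl⟩)⟩, rfl⟩
  have hcd : DifferentiableOn ℂ (fun z => φ (f z)) (V \ A) :=
    hφ.comp hf fun z hz => Or.inr (mem_image_of_mem f hz)
  have hci : InjOn (fun z => φ (f z)) (V \ A) := fun x hx y hy hxy => hfi hx hy
    (hφi (Or.inr (mem_image_of_mem f hx)) (Or.inr (mem_image_of_mem f hy)) hxy)
  obtain ⟨x, hx, y, hy, hxy⟩ := hφX.exists_dist_le_frontier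
    ((hEne.mono subset_union_left).image φ)
  obtain ⟨x', hx', rfl⟩ := hfr hx
  obtain ⟨y', hy', rfl⟩ := hfr hy
  have hosc := hM _ hcd hci x' hx' y' hy'
  simp only at hxy hosc
  obtain ⟨e, he⟩ := hEne
  have hsub : φ '' E ⊆ closedBall (φ e) (dist (φ (f x')) (φ (f y'))) := by
    rintro _ ⟨z, hz, rfl⟩
    exact hxy _ (mem_image_of_mem φ (Or.inl hz)) _ (mem_image_of_mem φ (Or.inl he))
  have hfG : IsOpen (f '' (V \ A)) := isOpen_image_of_injOn hG hf hfi
  have hadd : volume (φ '' (E ∪ f '' (V \ A))) =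
      volume (φ '' E) + volume ((fun z => φ (f z)) '' (V \ A)) := by
    rw [image_union, image_image, measure_union]
    · rw [disjoint_left]
      rintro _ ⟨z, hz, rfl⟩ ⟨z', hz', h⟩
      have := hφi (Or.inr (mem_image_of_mem f hz')) (Or.inl hz) h
      exact disjoint_left.1 hdis hz (this ▸ mem_image_of_mem f hz')
    · exact (isOpen_image_of_injOn hG hcd hci).measurableSet
  rw [hadd]
  refine ENNReal.le_ratio_mul ((measure_mono hsub).trans ?_)
  rw [Complex.volume_closedBall, dist_eq_norm, ofReal_norm_eq_enorm]
  calc _ ≤ (M * volume ((fun z => φ (f z)) '' (V \ A))) * NNReal.pi := by gcongr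
    _ = _ := by push_cast; ring

namespace Sig

variable {ι : Type*} [Finite ι] {K : Set ℂ} {A B : ι → Set ℂ} {f : ℂ → ℂ}

/-- Punctured neighbourhoods of a piece are mapped to punctured neighbourhoods of the
corresponding piece. -/
lemma mem_nhdsSet_image (hP : Pieces K A) (hf : Sig K f) (hB : Pieces (img K f) B)
    (ht : ∀ i, Tendsto f (𝓝ˢ (A i) ⊓ 𝓟 Kᶜ) (𝓝ˢ (B i))) {i : ι} {N : Set ℂ}
    (hN : N ∈ 𝓝ˢ (A i)) : B i ∪ f '' (N \ K) ∈ 𝓝ˢ (B i) := by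
  obtain ⟨ε, hε, hd⟩ := hB.exists_thickening
  have h1 : ∀ j, ∃ O : Set ℂ, IsOpen O ∧ A j ⊆ O ∧ (∀ z ∈ O \ K, f z ∈ thickening ε (B j)) ∧
      (j = i → O ⊆ N) := by
    intro j
    have h2 := ht j (isOpen_thickening.mem_nhdsSet.2 (self_subset_thickening hε (B j)))
    rw [mem_map, mem_inf_principal] at h2
    have h3 : {z | j = i → z ∈ N} ∈ 𝓝ˢ (A j) := by
      by_cases hji : j = i
      · subst hji; simpa using hN
      · simp [hji]
    obtain ⟨O, hO, hAO, hON⟩ := mem_nhdsSet_iff_exists.1 (inter_mem h2 h3)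
    exact ⟨O, hO, hAO, fun z hz => (hON hz.1).1 hz.2, fun hji z hz => (hON hz).2 hji⟩
  choose O hO hAO hOt hON using h1
  have hKO : Kᶜ \ ⋃ j, O j = (⋃ j, O j)ᶜ := by
    rw [← hP.union, diff_eq, ← compl_union, union_eq_self_of_subset_left (iUnion_mono hAO)]
  have hcl : IsClosed (f '' (Kᶜ \ ⋃ j, O j)) := hf.isClosed_image (by
    rw [hKO]; exact (isOpen_iUnion hO).isClosed_compl) diff_subset
  have hS : (f '' (Kᶜ \ ⋃ j, O j))ᶜ ∈ 𝓝ˢ (B i) := hcl.isOpen_compl.mem_nhdsSet.2 fun w hw h => by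
    obtain ⟨z, hz, rfl⟩ := h
    exact hB.subset i hw (mem_image_of_mem f hz.1)
  filter_upwards [hS, hB.mem_nhdsSet_union i,
    isOpen_thickening.mem_nhdsSet.2 (self_subset_thickening hε (B i))] with w h2 h3 h4
  rcases h3 with h3 | h3
  · exact Or.inl h3
  rw [compl_img] at h3
  obtain ⟨z, hz, rfl⟩ := h3
  have hzO : z ∈ ⋃ j, O j := by
    by_contra h; exact h2 (mem_image_of_mem f ⟨hz, h⟩)
  obtain ⟨j, hj⟩ := mem_iUnion.1 hzO
  have hji : j = i := by
    by_contra hne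
    exact disjoint_left.1 (hd j i hne) (hOt j z ⟨hj, hz⟩) h4
  exact Or.inr (mem_image_of_mem f ⟨hON j hji hj, hz⟩)

lemma isOpen_union_image (hP : Pieces K A) (hf : Sig K f) (hB : Pieces (img K f) B)
    (ht : ∀ i, Tendsto f (𝓝ˢ (A i) ⊓ 𝓟 Kᶜ) (𝓝ˢ (B i))) {i : ι} {N : Set ℂ} (hN : IsOpen N)
    (hAN : A i ⊆ N) : IsOpen (B i ∪ f '' (N \ K)) := by
  have hop : IsOpen (f '' (N \ K)) := isOpen_image_of_injOn (hN.sdiff hP.isCompact.isClosed)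
    (hf.diff.mono fun z hz => hz.2) (hf.inj.mono fun z hz => hz.2)
  rw [isOpen_iff_mem_nhds]
  rintro w (hw | hw)
  · exact mem_nhdsSet_iff_forall.1 (mem_nhdsSet_image hP hf hB ht (hN.mem_nhdsSet.2 hAN)) w hw
  · exact mem_of_superset (hop.mem_nhds hw) subset_union_right

lemma isCompact_union_image (hP : Pieces K A) (hf : Sig K f) (hB : Pieces (img K f) B)
    (ht : ∀ i, Tendsto f (𝓝ˢ (A i) ⊓ 𝓟 Kᶜ) (𝓝ˢ (B i))) {i : ι} {N : Set ℂ} (hN : IsCompact N)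
    (hAN : A i ⊆ interior N) {W : Set ℂ} (hNW : N ⊆ W) (hW : ∀ j, j ≠ i → Disjoint (A j) W) :
    IsCompact (B i ∪ f '' (N \ K)) := by
  obtain ⟨R, hR⟩ := hN.isBounded.subset_closedBall 0
  obtain ⟨R', hR'⟩ := hf.exists_bound hP.isCompact R
  have hbd : Bornology.IsBounded (B i ∪ f '' (N \ K)) := by
    refine (hB.compact i).isBounded.union (isBounded_iff_forall_norm_le.2 ⟨R', ?_⟩)
    rintro _ ⟨z, hz, rfl⟩
    exact hR' z hz.2 (by simpa using hR hz.1)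
  refine Metric.isCompact_of_isClosed_isBounded ?_ hbd
  have hNj : ∀ j, j ≠ i → A j ⊆ Nᶜ := fun j hj z hz hzN => disjoint_left.1 (hW j hj) hz (hNW hzN)
  have e : (B i ∪ f '' (N \ K))ᶜ = f '' (Kᶜ \ N) ∪ ⋃ j : {j // j ≠ i}, (B j ∪ f '' (Nᶜ \ K)) := by
    ext w
    by_cases hw : w ∈ img K f
    · obtain ⟨k, hk⟩ := hB.mem hw
      have hnf : ∀ S ⊆ Kᶜ, w ∉ f '' S := fun S hS h => hw (image_mono hS h)
      simp only [mem_compl_iff, mem_union, hnf (N \ K) (fun z hz => hz.2), or_false,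
        hnf (Kᶜ \ N) diff_subset, hnf (Nᶜ \ K) (fun z hz => hz.2), false_or, mem_iUnion]
      constructor
      · intro h
        exact ⟨⟨k, fun hki => h (hki ▸ hk)⟩, hk⟩
      · rintro ⟨⟨j, hj⟩, hjw⟩ h
        exact disjoint_left.1 (hB.disj j i hj) hjw h
    · have hw' : w ∈ f '' Kᶜ := by rwa [← compl_img]
      obtain ⟨z, hz, rfl⟩ := hw'
      have hnB : ∀ j, f z ∉ B j := fun j h => hB.subset j h ⟨z, hz, rfl⟩
      have hm : ∀ S ⊆ Kᶜ, (f z ∈ f '' S ↔ z ∈ S) := fun S hS => hf.inj.mem_image_iff hS hz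
      have hz' : z ∉ K := hz
      simp only [mem_compl_iff, mem_union, hnB, false_or, hm (N \ K) (fun z hz => hz.2),
        hm (Kᶜ \ N) diff_subset, hm (Nᶜ \ K) (fun z hz => hz.2), mem_iUnion, mem_diff, hz',
        not_false_eq_true, and_true, true_and, exists_const_iff]
      tauto
  rw [← isOpen_compl_iff, e]
  refine IsOpen.union (isOpen_image_of_injOn (hP.isCompact.isClosed.isOpen_compl.sdiff hN.isClosed)
    (hf.diff.mono diff_subset) (hf.inj.mono diff_subset)) (isOpen_iUnion fun j =>
      isOpen_union_image hP hf hB ht hN.isClosed.isOpen_compl (hNj j j.2))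

end Sig

lemma dbar_mul {u v : ℂ → ℂ} {z : ℂ} (hu : DifferentiableAt ℝ u z) (hv : DifferentiableAt ℂ v z) :
    dbar (fun z => u z * v z) z = v z * dbar u z := by
  have hv' : DifferentiableAt ℝ v z := hv.restrictScalars ℝ
  have h0 := dbar_eq_zero hv
  rw [dbar] at h0
  have h' : fderiv ℝ (fun z => u z * v z) z = _ := (hu.hasFDerivAt.mul hv'.hasFDerivAt).fderiv
  rw [dbar, h', dbar]
  simp
  linear_combination u z * h0

lemma continuous_dbar {w : ℂ → ℂ} (hw : ContDiff ℝ 1 w) : Continuous (dbar w) := by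
  have h1 := hw.continuous_fderiv (by simp)
  exact (continuous_const.mul (h1.clm_apply continuous_const)).sub (h1.clm_apply continuous_const)

/-- Boundary integral of a function over a large square, in terms of its `∂̄`-derivative. -/
lemma enorm_boundary_dslope_le {G : ℂ → ℂ} (hG : ContDiff ℝ 1 G)
    (hol : ∀ z, ‖z‖ < 1 → DifferentiableAt ℂ G z) {s : ℝ} (hs : 0 < s) :
    ‖((∫ x : ℝ in -s..s, dslope G 0 (x + (-s : ℝ) * I)) - ∫ x : ℝ in -s..s, dslope G 0 (x + s * I)) +
      I • (∫ y : ℝ in -s..s, dslope G 0 (s + y * I)) -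
      I • ∫ y : ℝ in -s..s, dslope G 0 ((-s : ℝ) + y * I)‖ₑ ≤ ∫⁻ z in {z | 1 ≤ ‖z‖}, ‖dbar G z‖ₑ := by
  classical
  set f' : ℂ → ℂ →L[ℝ] ℂ := fun z => if z = 0 then 0 else fderiv ℝ (dslope G 0) z with hf'
  have hd : ∀ z ≠ 0, DifferentiableAt ℝ (dslope G 0) z ∧ dbar (dslope G 0) z = z⁻¹ * dbar G z := by
    intro z hz
    have e : dslope G 0 =ᶠ[𝓝 z] fun z => (G z - G 0) * z⁻¹ := by
      filter_upwards [isOpen_ne.mem_nhds hz] with y hy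
      rw [dslope_of_ne _ hy, slope_def_field, sub_zero, div_eq_mul_inv]
    have h1 : DifferentiableAt ℝ (fun z => G z - G 0) z :=
      (hG.differentiable (by simp) z).sub_const _
    have h2 : DifferentiableAt ℂ (fun z : ℂ => z⁻¹) z := differentiableAt_inv hz
    refine ⟨(h1.mul (h2.restrictScalars ℝ)).congr_of_eventuallyEq e, ?_⟩
    rw [dbar_congr e, dbar_mul h1 h2, dbar, dbar, fderiv_sub_const]
  have hk : ∀ z, I • f' z 1 - f' z I = z⁻¹ * dbar G z := fun z => by
    by_cases hz : z = 0
    · simp [hf', hz]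
    · rw [← (hd z hz).2]; simp [hf', hz, dbar]
  have hz0 : ∀ z, ‖z‖ < 1 → z⁻¹ * dbar G z = 0 := fun z hz => by rw [dbar_eq_zero (hol z hz), mul_zero]
  have hkc : Continuous fun z => z⁻¹ * dbar G z := by
    rw [continuous_iff_continuousAt]
    intro z
    by_cases hz : z = 0
    · have : (fun z => z⁻¹ * dbar G z) =ᶠ[𝓝 z] fun _ => 0 := by
        rw [hz]
        filter_upwards [ball_mem_nhds (0 : ℂ) one_pos] with y hy
        exact hz0 y (by simpa using hy)
      exact continuousAt_const.congr this.symm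
    · exact (continuousAt_inv₀ hz).mul (continuous_dbar hG).continuousAt
  have hcont : Continuous (dslope G 0) := by
    rw [continuous_iff_continuousAt]
    intro z
    by_cases hz : z = 0
    · rw [hz, continuousAt_dslope_same]; exact hol 0 (by simp)
    · exact (hd z hz).1.continuousAt
  have hintg := integral_boundary_rect_of_hasFDerivAt_real_off_countable (dslope G 0) f'
    (⟨-s, -s⟩ : ℂ) (⟨s, s⟩ : ℂ) {0} (countable_singleton 0) hcont.continuousOn
    (fun z hz => by
      have hz0 : z ≠ 0 := hz.2
      simp only [hf', if_neg hz0]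
      exact (hd z hz0).1.hasFDerivAt) (by
      simp_rw [hk]
      exact hkc.continuousOn.integrableOn_compact (isCompact_uIcc.reProdIm isCompact_uIcc))
  simp only at hintg
  rw [hintg]
  simp_rw [hk]
  have hss : -s ≤ s := by linarith
  have hm : Measurable fun z : ℂ => ‖z⁻¹ * dbar G z‖ₑ := hkc.measurable.enorm
  calc ‖∫ x : ℝ in -s..s, ∫ y : ℝ in -s..s, ((x + y * I : ℂ))⁻¹ * dbar G (x + y * I)‖ₑ
      ≤ ∫⁻ x : ℝ, ∫⁻ y : ℝ, ‖((x + y * I : ℂ))⁻¹ * dbar G (x + y * I)‖ₑ := by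
        rw [intervalIntegral.integral_of_le hss]
        refine (enorm_integral_le_lintegral_enorm _).trans
          ((setLIntegral_le_lintegral _ _).trans (lintegral_mono fun x => ?_))
        rw [intervalIntegral.integral_of_le hss]
        exact (enorm_integral_le_lintegral_enorm _).trans (setLIntegral_le_lintegral _ _)
    _ = ∫⁻ z : ℂ, ‖z⁻¹ * dbar G z‖ₑ := by
        rw [← (Complex.volume_preserving_equiv_real_prod.symm).lintegral_comp_emb
          (Complex.measurableEquivRealProd.symm.measurableEmbedding), Measure.volume_eq_prod,
          lintegral_prod _ (by
            exact (hm.comp Complex.measurableEquivRealProd.symm.measurable).aemeasurable)]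
        simp only [Complex.measurableEquivRealProd_symm_apply, Complex.mk_eq_add_mul_I]
    _ = ∫⁻ z in {z | 1 ≤ ‖z‖}, ‖z⁻¹ * dbar G z‖ₑ := by
        have hms : MeasurableSet {z : ℂ | 1 ≤ ‖z‖} :=
          (isClosed_le continuous_const continuous_norm).measurableSet
        rw [← lintegral_indicator hms]
        refine lintegral_congr fun z => ?_
        by_cases hz : 1 ≤ ‖z‖
        · rw [indicator_of_mem (by exact hz)]
        · rw [indicator_of_notMem (by exact hz), hz0 z (not_le.1 hz), enorm_zero]
    _ ≤ _ := by
        refine setLIntegral_mono (continuous_dbar hG).measurable.enorm fun z hz => ?_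
        rw [enorm_mul]
        refine mul_le_of_le_one_left zero_le ?_
        rw [← ofReal_norm_eq_enorm, norm_inv, ENNReal.ofReal_le_one]
        exact inv_le_one_of_one_le₀ hz

lemma norm_le_of_dbar {G : ℂ → ℂ} (hG : ContDiff ℝ 1 G)
    (hol : ∀ z, ‖z‖ < 1 → DifferentiableAt ℂ G z) (hinf : Tendsto G (cocompact ℂ) (𝓝 0)) :
    ‖G 0‖ₑ ≤ ∫⁻ z in {z | 1 ≤ ‖z‖}, ‖dbar G z‖ₑ := by
  by_cases htop : ∫⁻ z in {z | 1 ≤ ‖z‖}, ‖dbar G z‖ₑ = ∞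
  · rw [htop]; exact le_top
  rw [← ENNReal.toReal_le_toReal (by simp) htop, toReal_enorm]
  set J := (∫⁻ z in {z | 1 ≤ ‖z‖}, ‖dbar G z‖ₑ).toReal
  have key : ∀ ε > 0, 4 * ‖G 0‖ ≤ J + 8 * ε := by
    intro ε hε
    obtain ⟨R, hR⟩ := mem_cocompact_iff_norm_gt.1 (hinf (closedBall_mem_nhds 0 hε))
    set s := max R 0 + 1 with hs
    have hs0 : 0 < s := by positivity
    have hsR : R < s := by rw [hs]; linarith [le_max_left R 0]
    have hb := enorm_boundary_dslope_le hG hol hs0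
    rw [← ENNReal.toReal_le_toReal (by simp) htop, toReal_enorm] at hb
    have hcont : ContinuousOn (dslope G 0) {0}ᶜ := fun z hz =>
      ((continuousAt_dslope_of_ne hz).2 hG.continuous.continuousAt).continuousWithinAt
    have hne : ∀ (z : ℂ), (z.re = s ∨ z.re = -s ∨ z.im = s ∨ z.im = -s) → z ∈ ({0}ᶜ : Set ℂ) := by
      rintro z hz rfl
      simp at hz
      rcases hz with h | h | h | h <;> linarith
    have hi : ∀ u : ℝ → ℂ, Continuous u → (∀ x, (u x).re = s ∨ (u x).re = -s ∨ (u x).im = s ∨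
        (u x).im = -s) → IntervalIntegrable (fun x => dslope G 0 (u x)) volume (-s) s :=
      fun u hu hus => (hcont.comp_continuous hu fun x => hne _ (hus x)).intervalIntegrable _ _
    have h1 := hi (fun x => x + (-s : ℝ) * I) (by fun_prop) (fun x => by simp)
    have h2 := hi (fun x => x + s * I) (by fun_prop) (fun x => by simp)
    have h3 := hi (fun y => s + y * I) (by fun_prop) (fun x => by simp)
    have h4 := hi (fun y => (-s : ℝ) + y * I) (by fun_prop) (fun x => by simp)
    have h12 : IntervalIntegrable (fun x : ℝ => dslope G 0 (x + (-s : ℝ) * I) -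
        dslope G 0 (x + s * I)) volume (-s) s := h1.sub h2
    have h3' : IntervalIntegrable (fun x : ℝ => I • dslope G 0 (s + x * I)) volume (-s) s :=
      h3.smul I
    have h4' : IntervalIntegrable (fun x : ℝ => I • dslope G 0 ((-s : ℝ) + x * I)) volume (-s) s :=
      h4.smul I
    have h123 : IntervalIntegrable (fun x : ℝ => dslope G 0 (x + (-s : ℝ) * I) -
        dslope G 0 (x + s * I) + I • dslope G 0 (s + x * I)) volume (-s) s := h12.add h3'
    rw [← intervalIntegral.integral_sub h1 h2, ← intervalIntegral.integral_smul,
      ← intervalIntegral.integral_add h12 h3', ← intervalIntegral.integral_smul,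
      ← intervalIntegral.integral_sub h123 h4'] at hb
    set E : ℝ → ℂ := fun x => dslope G 0 (x + (-s : ℝ) * I) - dslope G 0 (x + s * I) +
      I • dslope G 0 (s + x * I) - I • dslope G 0 ((-s : ℝ) + x * I) with hE
    have hEi : IntervalIntegrable E volume (-s) s := h123.sub h4'
    have hpos : ∀ x : ℝ, 0 < x ^ 2 + s ^ 2 := fun x => by positivity
    have hkc : Continuous fun x : ℝ => 4 * s / (x ^ 2 + s ^ 2) :=
      Continuous.div (by fun_prop) (by fun_prop) fun x => (hpos x).ne'
    have hki : IntervalIntegrable (fun x : ℝ => G 0 * (((4 * s / (x ^ 2 + s ^ 2) : ℝ) : ℂ) * I)) volume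
        (-s) s := Continuous.intervalIntegrable (by fun_prop) _ _
    have hsmall : ∀ x ∈ Set.uIoc (-s) s,
        ‖E x + G 0 * (((4 * s / (x ^ 2 + s ^ 2) : ℝ) : ℂ) * I)‖ ≤ 4 * (ε / s) := by
      intro x hx
      have hq : ∀ z : ℂ, (z.re = s ∨ z.re = -s ∨ z.im = s ∨ z.im = -s) → z ≠ 0 ∧ ‖G z / z‖ ≤ ε / s := by
        intro z hz
        have hzs : s ≤ ‖z‖ := by
          have e1 := Complex.abs_re_le_norm z
          have e2 := Complex.abs_im_le_norm z
          rcases hz with h | h | h | h <;> simp only [h] at e1 e2 <;>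
            simp only [abs_neg, abs_of_pos hs0] at e1 e2 <;> assumption
        have hGz : ‖G z‖ ≤ ε := by simpa using hR z (hsR.trans_le hzs)
        refine ⟨hne z hz, ?_⟩
        rw [norm_div]; gcongr
      obtain ⟨a1, b1⟩ := hq (x + (-s : ℝ) * I) (by simp)
      obtain ⟨a2, b2⟩ := hq (x + s * I) (by simp)
      obtain ⟨a3, b3⟩ := hq (s + x * I) (by simp)
      obtain ⟨a4, b4⟩ := hq ((-s : ℝ) + x * I) (by simp)
      have e : E x + G 0 * (((4 * s / (x ^ 2 + s ^ 2) : ℝ) : ℂ) * I) =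
          G (x + (-s : ℝ) * I) / (x + (-s : ℝ) * I) - G (x + s * I) / (x + s * I) +
          I * (G (s + x * I) / (s + x * I)) - I * (G ((-s : ℝ) + x * I) / ((-s : ℝ) + x * I)) := by
        have hx0 : ((x : ℂ) ^ 2 + s ^ 2) ≠ 0 := by exact_mod_cast (hpos x).ne'
        have f1 : ((x : ℂ) + (-s : ℝ) * I)⁻¹ = (x + s * I) / (x ^ 2 + s ^ 2) := by
          rw [eq_div_iff hx0, inv_mul_eq_iff_eq_mul₀ a1]; push_cast
          linear_combination (s : ℂ) ^ 2 * Complex.I_sq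
        have f2 : ((x : ℂ) + s * I)⁻¹ = (x - s * I) / (x ^ 2 + s ^ 2) := by
          rw [eq_div_iff hx0, inv_mul_eq_iff_eq_mul₀ a2]
          linear_combination (s : ℂ) ^ 2 * Complex.I_sq
        have f3 : ((s : ℂ) + x * I)⁻¹ = (s - x * I) / (x ^ 2 + s ^ 2) := by
          rw [eq_div_iff hx0, inv_mul_eq_iff_eq_mul₀ a3]
          linear_combination (x : ℂ) ^ 2 * Complex.I_sq
        have f4 : ((-s : ℝ) + (x : ℂ) * I)⁻¹ = (-s - x * I) / (x ^ 2 + s ^ 2) := by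
          rw [eq_div_iff hx0, inv_mul_eq_iff_eq_mul₀ a4]; push_cast
          linear_combination (x : ℂ) ^ 2 * Complex.I_sq
        simp only [hE, smul_eq_mul]
        rw [dslope_of_ne _ a1, dslope_of_ne _ a2, dslope_of_ne _ a3, dslope_of_ne _ a4]
        simp only [slope_def_field, sub_zero, div_eq_mul_inv, f1, f2, f3, f4]
        push_cast
        field_simp
        linear_combination (0 : ℂ) * Complex.I_sq
      rw [e]
      refine (norm_sub_le _ _).trans ?_
      have n1 := norm_add_le (G (x + (-s : ℝ) * I) / (x + (-s : ℝ) * I) - G (x + s * I) / (x + s * I))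
        (I * (G (s + x * I) / (s + x * I)))
      have n2 := norm_sub_le (G (x + (-s : ℝ) * I) / (x + (-s : ℝ) * I)) (G (x + s * I) / (x + s * I))
      rw [norm_mul, Complex.norm_I, one_mul] at n1 ⊢
      linarith
    have h5 := intervalIntegral.norm_integral_le_of_norm_le_const hsmall
    rw [intervalIntegral.integral_add hEi hki, intervalIntegral.integral_const_mul,
      intervalIntegral.integral_mul_const, intervalIntegral.integral_ofReal,
      show |s - -s| = 2 * s by rw [sub_neg_eq_add, ← two_mul, abs_of_pos (by positivity)],
      show 4 * (ε / s) * (2 * s) = 8 * ε by field_simp; norm_num] at h5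
    have h6 : 4 ≤ ∫ x in -s..s, 4 * s / (x ^ 2 + s ^ 2) := by
      calc (4 : ℝ) = ∫ x in -s..s, 2 / s := by
            rw [intervalIntegral.integral_const, smul_eq_mul]; field_simp; norm_num
        _ ≤ _ := by
            refine intervalIntegral.integral_mono_on (by linarith) (by simp)
              (hkc.intervalIntegrable _ _) fun x hx => ?_
            rw [div_le_div_iff₀ hs0 (hpos x)]
            nlinarith [abs_le.2 hx, sq_abs x, abs_nonneg x, sq_le_sq' hx.1 hx.2]
    have h7 : 4 * ‖G 0‖ ≤ ‖G 0 * (((∫ x in -s..s, 4 * s / (x ^ 2 + s ^ 2) : ℝ) : ℂ) * I)‖ := by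
      rw [norm_mul, norm_mul, Complex.norm_I, mul_one, Complex.norm_real, Real.norm_eq_abs, mul_comm]
      gcongr
      exact h6.trans (le_abs_self _)
    have h8 := norm_sub_le ((∫ x in -s..s, E x) +
      G 0 * (((∫ x in -s..s, 4 * s / (x ^ 2 + s ^ 2) : ℝ) : ℂ) * I)) (∫ x in -s..s, E x)
    rw [add_sub_cancel_left] at h8
    linarith
  have h := le_of_forall_pos_le_add (a := 4 * ‖G 0‖) (b := J) fun ε hε => by
    have := key (ε / 8) (by positivity); linarith
  have hJ : 0 ≤ J := ENNReal.toReal_nonneg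
  linarith

/-- A univalent function normalized at infinity is close to the identity far away when its
singularities lie in a cell with small area ratio. -/
lemma Sig.enorm_sub_le {M t : ℝ≥0∞} {V L C : Set ℂ} {F : ℂ → ℂ} {R : ℝ} (hR : 0 < R)
    (hc : Cell M t V L C) (hV : V ⊆ closedBall 0 R) (hF : Sig L F) {z : ℂ} (hz : R + 1 ≤ ‖z‖) :
    ‖F z - z‖ₑ ≤ (M * volume (closedBall (0 : ℂ) (80 * R))) ^ (1 / 2 : ℝ) *
      (t * volume (closedBall (0 : ℂ) R)) ^ (1 / 2 : ℝ) := by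
  obtain ⟨w, hw, hwF, hE⟩ := hc.ext F (hF.diff.mono fun z hz => hz.2) (hF.inj.mono fun z hz => hz.2)
  classical
  set W : ℂ → ℂ := fun z => if z ∈ V then w z else F z with hW
  have hLC : L ⊆ C := hc.subset_interior.trans interior_subset
  have hCo : IsOpen Cᶜ := hc.isCompact.isClosed.isOpen_compl
  have hWC : ∀ z ∈ Cᶜ, W z = F z := fun z hz => by
    by_cases hzV : z ∈ V
    · simp only [hW, if_pos hzV, hwF z ⟨hzV, hz⟩]
    · simp only [hW, if_neg hzV]
  have hWd : ∀ z ∈ Cᶜ, DifferentiableAt ℂ W z := fun z hz =>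
    ((hF.diff.mono (compl_subset_compl.2 hLC)).differentiableAt
      (hCo.mem_nhds hz)).congr_of_eventuallyEq (by
        filter_upwards [hCo.mem_nhds hz] with y hy using hWC y hy)
  have hWV : ∀ z ∈ V, W =ᶠ[𝓝 z] w := fun z hz => by
    filter_upwards [hc.isOpen.mem_nhds hz] with y hy
    simp only [hW, if_pos hy]
  have hWs : ContDiff ℝ 1 W := contDiff_iff_contDiffAt.2 fun z => by
    by_cases hz : z ∈ C
    · exact (hw.contDiffAt (hc.isOpen.mem_nhds (hc.subset hz))).congr_of_eventuallyEq
        (hWV z (hc.subset hz))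
    · have hd : DifferentiableOn ℂ W Cᶜ := fun z hz => (hWd z hz).differentiableWithinAt
      exact (Cell.contDiffOn_of_holomorphic hCo hd).contDiffAt (hCo.mem_nhds hz)
  have hCR : ∀ y ∈ C, ‖y‖ ≤ R := fun y hy => by simpa using hV (hc.subset hy)
  have hfar : ∀ y : ℂ, ‖y‖ < 1 → y + z ∈ Cᶜ := fun y hy h => by
    have h1 := hCR _ h
    have h2 := norm_sub_le (y + z) y
    rw [add_sub_cancel_left] at h2
    linarith
  set G : ℂ → ℂ := fun y => W (y + z) - (y + z) with hG
  have hGs : ContDiff ℝ 1 G := (hWs.comp (contDiff_id.add contDiff_const)).sub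
    (contDiff_id.add contDiff_const)
  have hol : ∀ y, ‖y‖ < 1 → DifferentiableAt ℂ G y := fun y hy => by
    have h1 : DifferentiableAt ℂ (fun y => W (y + z)) y :=
      (hWd _ (hfar y hy)).comp y (differentiableAt_id.add_const z)
    exact h1.sub (differentiableAt_id.add_const z)
  have hinf : Tendsto G (cocompact ℂ) (𝓝 0) := by
    have h1 : Tendsto (fun y => F y - y) (cocompact ℂ) (𝓝 0) := hF.inf
    have h2 : Tendsto (fun y => W y - y) (cocompact ℂ) (𝓝 0) := h1.congr' (by
      filter_upwards [hc.isCompact.compl_mem_cocompact] with y hy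
      rw [hWC y hy])
    exact h2.comp (Homeomorph.addRight z).isClosedEmbedding.tendsto_cocompact
  have hdG : ∀ y, dbar G y = dbar W (y + z) := fun y => by
    have h1 : DifferentiableAt ℝ (fun y => W (y + z)) y :=
      (hWs.comp (contDiff_id.add contDiff_const)).differentiable (by simp) y
    have h2 : DifferentiableAt ℂ (fun y => y + z) y := differentiableAt_id.add_const z
    have h3 := dbar_eq_zero h2
    have h4 := dbar_comp (z := y) (hWs.differentiable (by simp) (y + z)) h2
    simp only [deriv_add_const, deriv_id'', map_one, one_mul] at h4
    rw [← h4, dbar, dbar, show fderiv ℝ G y = _ from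
      fderiv_sub h1 (h2.restrictScalars ℝ)]
    rw [dbar] at h3
    simp only [FunLike.coe_sub, Pi.sub_apply]
    linear_combination -h3
  have h0 := norm_le_of_dbar hGs hol hinf
  have hG0 : G 0 = F z - z := by
    simp only [hG, zero_add]
    rw [hWC z (by simpa using hfar 0 (by simp))]
  rw [hG0] at h0
  refine h0.trans ((setLIntegral_le_lintegral _ _).trans ?_)
  simp_rw [hdG]
  rw [lintegral_add_right_eq_self (fun y => ‖dbar W y‖ₑ) z]
  have hms := hc.isCompact.measurableSet
  have hz0 : ∀ y ∉ C, ‖dbar W y‖ₑ = 0 := fun y hy => by rw [dbar_eq_zero (hWd y hy), enorm_zero]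
  have h1 : ∫⁻ y, ‖dbar W y‖ₑ = ∫⁻ y in C, ‖dbar W y‖ₑ * 1 := by
    rw [← lintegral_indicator hms]
    refine lintegral_congr fun y => ?_
    by_cases hy : y ∈ C
    · rw [indicator_of_mem hy, mul_one]
    · rw [indicator_of_notMem hy, hz0 y hy]
  rw [h1]
  have hhold := ENNReal.lintegral_mul_le_Lp_mul_Lq (volume.restrict C)
    (Real.HolderConjugate.two_two) (f := fun y => ‖dbar W y‖ₑ) (g := fun _ => 1)
    (continuous_dbar hWs).measurable.enorm.aemeasurable aemeasurable_const
  refine hhold.trans ?_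
  gcongr ?_ ^ (1 / 2 : ℝ) * ?_ ^ (1 / 2 : ℝ)
  · calc ∫⁻ y in C, ‖dbar W y‖ₑ ^ (2 : ℝ) = ∫⁻ y in C, ‖dbar w y‖ₑ ^ 2 := by
          refine setLIntegral_congr_fun hms fun y hy => ?_
          rw [dbar_congr (hWV y (hc.subset hy))]
          exact ENNReal.rpow_two _
      _ ≤ M * volume (F '' (V \ L)) := hE
      _ ≤ _ := by
        gcongr
        rintro _ ⟨y, hy, rfl⟩
        have := hF.norm_le hR (hc.left_subset.trans hV) hy.2 (by simpa using hV hy.1)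
        simpa using this
  · simp only [ENNReal.one_rpow, lintegral_const, one_mul, Measure.restrict_apply_univ]
    have h2 := hc.area (fun z => z) differentiableOn_id (injOn_id _)
    simp only [image_id'] at h2
    exact h2.trans (by gcongr)

section Reflection

lemma differentiableAt_cauchy {f : ℂ → ℂ} {s : ℝ} (hs : 0 < s) (hf : ContinuousOn f (sphere 0 s))
    {z : ℂ} (hz : ‖z‖ ≠ s) :
    DifferentiableAt ℂ (fun z => ∮ ζ in C(0, s), (ζ - z)⁻¹ * f ζ) z := by
  set d := |‖z‖ - s| with hd
  have hd0 : 0 < d := abs_pos.2 (sub_ne_zero.2 hz)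
  have hmem : ∀ θ, circleMap 0 s θ ∈ sphere (0 : ℂ) s := circleMap_mem_sphere 0 hs.le
  have hfc : Continuous fun θ => f (circleMap 0 s θ) :=
    hf.comp_continuous (continuous_circleMap 0 s) hmem
  have hfar : ∀ w ∈ ball z (d / 2), ∀ θ, d / 2 ≤ ‖circleMap 0 s θ - w‖ := by
    intro w hw θ
    have h1 : ‖circleMap 0 s θ‖ = s := by simpa using hmem θ
    have h2 : d ≤ ‖circleMap 0 s θ - z‖ := by
      have := abs_norm_sub_norm_le (circleMap 0 s θ) z
      rwa [h1, abs_sub_comm] at this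
    have h3 : ‖z - w‖ < d / 2 := by rwa [mem_ball, dist_comm, dist_eq_norm] at hw
    have h4 : ‖circleMap 0 s θ - z‖ ≤ ‖circleMap 0 s θ - w‖ + ‖z - w‖ := by
      have := norm_sub_le (circleMap 0 s θ - w) (z - w)
      rwa [sub_sub_sub_cancel_right] at this
    linarith
  have hne : ∀ w ∈ ball z (d / 2), ∀ θ, circleMap 0 s θ - w ≠ 0 := fun w hw θ h => by
    have := hfar w hw θ
    rw [h, norm_zero] at this
    linarith
  have hcont : ∀ w ∈ ball z (d / 2), Continuous fun θ =>
      (circleMap 0 s θ * I) * ((circleMap 0 s θ - w)⁻¹ * f (circleMap 0 s θ)) := fun w hw =>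
    ((continuous_circleMap 0 s).mul continuous_const).mul
      ((((continuous_circleMap 0 s).sub continuous_const).inv₀ (hne w hw)).mul hfc)
  have hzz : z ∈ ball z (d / 2) := mem_ball_self (by positivity)
  have hcont' : Continuous fun θ =>
      (circleMap 0 s θ * I) * (((circleMap 0 s θ - z) ^ 2)⁻¹ * f (circleMap 0 s θ)) :=
    ((continuous_circleMap 0 s).mul continuous_const).mul
      (((((continuous_circleMap 0 s).sub continuous_const).pow 2).inv₀
        (fun θ => pow_ne_zero 2 (hne z hzz θ))).mul hfc)
  have key := intervalIntegral.hasDerivAt_integral_of_dominated_loc_of_deriv_le (𝕜 := ℂ)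
    (μ := volume) (a := 0) (b := 2 * π) (s := ball z (d / 2)) (x₀ := z)
    (F := fun w θ => (circleMap 0 s θ * I) * ((circleMap 0 s θ - w)⁻¹ * f (circleMap 0 s θ)))
    (F' := fun w θ => (circleMap 0 s θ * I) *
      (((circleMap 0 s θ - w) ^ 2)⁻¹ * f (circleMap 0 s θ)))
    (bound := fun θ => s * (((d / 2) ^ 2)⁻¹ * ‖f (circleMap 0 s θ)‖))
    (ball_mem_nhds z (by positivity))
    ((eventually_mem_set.2 (ball_mem_nhds z (half_pos hd0))).mono fun w hw =>
      (hcont w hw).aestronglyMeasurable)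
    ((hcont z hzz).intervalIntegrable _ _) hcont'.aestronglyMeasurable
    (.of_forall fun θ _ w hw => ?_) ?_ (.of_forall fun θ _ w hw => ?_)
  · refine key.2.differentiableAt.congr_of_eventuallyEq (.of_forall fun w => ?_)
    simp [circleIntegral]
  · have h1 : ‖circleMap 0 s θ‖ = s := by simpa using hmem θ
    have h2 := hfar w hw θ
    rw [norm_mul, norm_mul, norm_mul, norm_I, mul_one, h1, norm_inv, norm_pow]
    gcongr
  · exact (continuous_const.mul (continuous_const.mul hfc.norm)).intervalIntegrable _ _
  · have h1 : HasDerivAt (fun w => (circleMap 0 s θ - w)⁻¹) (((circleMap 0 s θ - w) ^ 2)⁻¹) w := by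
      have := ((hasDerivAt_id w).const_sub (circleMap 0 s θ)).inv (hne w hw θ)
      simp only [id_eq, neg_neg, one_div] at this
      exact this
    exact (h1.mul_const _).const_mul _

lemma circleIntegral_inv_sub_eq_zero {s : ℝ} (hs : 0 < s) {z : ℂ} (hz : s < ‖z‖) :
    ∮ ζ in C(0, s), (ζ - z)⁻¹ = 0 := by
  refine circleIntegral_eq_zero_of_differentiable_on_off_countable hs.le countable_empty ?_ ?_
  · refine ContinuousOn.inv₀ (by fun_prop) fun w hw h => ?_
    rw [sub_eq_zero.1 h, mem_closedBall_zero_iff] at hw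
    linarith
  · intro w hw
    refine DifferentiableAt.inv (by fun_prop) fun h => ?_
    have := hw.1
    rw [sub_eq_zero.1 h, mem_ball_zero_iff] at this
    linarith

lemma cauchy_annulus {f : ℂ → ℂ} {r s : ℝ} {U : Set ℂ} (hU : IsOpen U) (hr : 0 < r) (hrs : r ≤ s)
    (hsub : ∀ z : ℂ, r ≤ ‖z‖ → ‖z‖ ≤ s → z ∈ U) (hf : DifferentiableOn ℂ f U) {z : ℂ}
    (h1 : r < ‖z‖) (h2 : ‖z‖ < s) :
    (∮ ζ in C(0, s), (ζ - z)⁻¹ * f ζ) = 2 * π * I * f z + ∮ ζ in C(0, r), (ζ - z)⁻¹ * f ζ := by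
  have hs : 0 < s := hr.trans_le hrs
  have hzU : U ∈ 𝓝 z := hU.mem_nhds (hsub z h1.le h2.le)
  have hd : DifferentiableOn ℂ (dslope f z) U := (differentiableOn_dslope hzU).2 hf
  have e := circleIntegral_eq_of_differentiable_on_annulus_off_countable (c := 0) hr hrs
    (f := dslope f z) countable_empty
    (hd.continuousOn.mono fun w hw => hsub w (by simpa using hw.2) (by simpa using hw.1))
    (fun w hw => hd.differentiableAt (hU.mem_nhds (hsub w
      (not_le.1 fun h => hw.1.2 (mem_closedBall_zero_iff.2 h)).le (mem_ball_zero_iff.1 hw.1.1).le)))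
  have key : ∀ t, 0 < t → r ≤ t → t ≤ s → ‖z‖ ≠ t → (∮ ζ in C(0, t), dslope f z ζ) =
      (∮ ζ in C(0, t), (ζ - z)⁻¹ * f ζ) - (∮ ζ in C(0, t), (ζ - z)⁻¹) * f z := by
    intro t ht hrt hts hzt
    have hne : ∀ ζ ∈ sphere (0 : ℂ) t, ζ - z ≠ 0 := fun ζ hζ h => hzt <| by
      rw [← sub_eq_zero.1 h]; simpa using hζ
    have hc : ContinuousOn (fun ζ : ℂ => (ζ - z)⁻¹) (sphere 0 t) :=
      ContinuousOn.inv₀ (by fun_prop) hne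
    have hfc : ContinuousOn f (sphere 0 t) := hf.continuousOn.mono fun w hw => by
      have : ‖w‖ = t := by simpa using hw
      exact hsub w (by linarith) (by linarith)
    have h3 : (∮ ζ in C(0, t), (ζ - z)⁻¹) * f z = ∮ ζ in C(0, t), (ζ - z)⁻¹ * f z := by
      simpa [mul_comm, smul_eq_mul] using
        (circleIntegral.integral_const_mul (f z) (fun ζ : ℂ => (ζ - z)⁻¹) 0 t).symm
    have i1 : CircleIntegrable (fun ζ => (ζ - z)⁻¹ * f ζ) 0 t := (hc.mul hfc).circleIntegrable ht.le
    have i2 : CircleIntegrable (fun ζ => (ζ - z)⁻¹ * f z) 0 t :=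
      (hc.mul continuousOn_const).circleIntegrable ht.le
    rw [h3, ← circleIntegral.integral_sub i1 i2]
    refine circleIntegral.integral_congr ht.le fun ζ hζ => ?_
    rw [dslope_of_ne _ (sub_ne_zero.1 (hne ζ hζ)), slope_def_field]
    change _ = (ζ - z)⁻¹ * f ζ - (ζ - z)⁻¹ * f z
    ring
  rw [key s hs hrs le_rfl h2.ne, key r hr le_rfl hrs h1.ne', circleIntegral_inv_sub_eq_zero hr h1,
    circleIntegral.integral_sub_inv_of_mem_ball (by simpa using h2)] at e
  linear_combination e

lemma cauchy_annulus_eq {f : ℂ → ℂ} {r s : ℝ} {U : Set ℂ} (hU : IsOpen U) (hr : 0 < r)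
    (hrs : r ≤ s) (hsub : ∀ z : ℂ, r ≤ ‖z‖ → ‖z‖ ≤ s → z ∈ U) (hf : DifferentiableOn ℂ f U) {z : ℂ}
    (hz : z ∉ closedBall (0 : ℂ) s \ ball 0 r) :
    (∮ ζ in C(0, s), (ζ - z)⁻¹ * f ζ) = ∮ ζ in C(0, r), (ζ - z)⁻¹ * f ζ := by
  have hne : ∀ ζ ∈ closedBall (0 : ℂ) s \ ball 0 r, ζ - z ≠ 0 := fun ζ hζ h =>
    hz (sub_eq_zero.1 h ▸ hζ)
  refine circleIntegral_eq_of_differentiable_on_annulus_off_countable hr hrs countable_empty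
    (ContinuousOn.mul (ContinuousOn.inv₀ (by fun_prop) hne) (hf.continuousOn.mono fun w hw =>
      hsub w (by simpa using hw.2) (by simpa using hw.1))) fun w hw => ?_
  refine DifferentiableAt.mul (DifferentiableAt.inv (by fun_prop)
    (hne w ⟨ball_subset_closedBall hw.1.1, fun h => hw.1.2 (ball_subset_closedBall h)⟩))
    (hf.differentiableAt (hU.mem_nhds (hsub w
      (not_le.1 fun h => hw.1.2 (mem_closedBall_zero_iff.2 h)).le (mem_ball_zero_iff.1 hw.1.1).le)))

end Reflection

section Glue

lemma kernel_identity {p q z : ℂ} (hp : p - z ≠ 0) (hq : q - z ≠ 0) (a b : ℂ) :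
    p * ((p - z)⁻¹ * a) - q * ((q - z)⁻¹ * b) =
      z * (q - p) * ((p - z)⁻¹ * (q - z)⁻¹) * a + q * (q - z)⁻¹ * (a - b) := by
  field_simp
  ring

lemma norm_sub_kernel_le {ρ M d ε : ℝ} {e z a b : ℂ} (hρ : 1 < ρ) (he : ‖e‖ = 1) (hd : 0 < d)
    (h1 : d ≤ ‖ρ * e - z‖) (h2 : d ≤ ‖(ρ⁻¹ : ℝ) * e - z‖) (ha : ‖a‖ ≤ M) (hab : ‖a - b‖ ≤ ε) :
    ‖ρ * e * ((ρ * e - z)⁻¹ * a) - (ρ⁻¹ : ℝ) * e * (((ρ⁻¹ : ℝ) * e - z)⁻¹ * b)‖ ≤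
      ‖z‖ * (ρ - ρ⁻¹) * (d⁻¹ * d⁻¹) * M + d⁻¹ * ε := by
  have n1 : ρ * e - z ≠ 0 := norm_pos_iff.1 (hd.trans_le h1)
  have n2 : ((ρ⁻¹ : ℝ) : ℂ) * e - z ≠ 0 := norm_pos_iff.1 (hd.trans_le h2)
  have hρ1 : ρ⁻¹ ≤ 1 := inv_le_one_of_one_le₀ hρ.le
  have hρ0 : 0 ≤ ρ⁻¹ := by positivity
  have e1 : ρ * e * ((ρ * e - z)⁻¹ * a) - (ρ⁻¹ : ℝ) * e * (((ρ⁻¹ : ℝ) * e - z)⁻¹ * b) =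
      z * (e * ((ρ⁻¹ - ρ : ℝ) : ℂ)) * ((ρ * e - z)⁻¹ * ((ρ⁻¹ : ℝ) * e - z)⁻¹) * a +
        ((ρ⁻¹ : ℝ) * e) * ((ρ⁻¹ : ℝ) * e - z)⁻¹ * (a - b) := by
    have := kernel_identity n1 n2 a b
    rw [this, Complex.ofReal_sub]
    ring
  rw [e1]
  refine (norm_add_le _ _).trans ?_
  simp only [norm_mul, norm_inv, he, mul_one, one_mul, norm_real]
  have i1 := inv_anti₀ hd h1
  have i2 := inv_anti₀ hd h2
  have hn : ‖ρ⁻¹ - ρ‖ = ρ - ρ⁻¹ := by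
    rw [Real.norm_eq_abs, abs_sub_comm, abs_of_nonneg]; linarith
  have hn' : ‖ρ‖ = ρ := Real.norm_of_nonneg (by linarith)
  rw [hn, hn']
  have hpos : 0 ≤ ρ - ρ⁻¹ := by linarith
  gcongr
  · calc ρ⁻¹ * ‖((ρ⁻¹ : ℝ) : ℂ) * e - z‖⁻¹ ≤ 1 * d⁻¹ := by gcongr
      _ = d⁻¹ := one_mul _

lemma tendsto_circleIntegral_sub {u : ℂ → ℂ} {R : ℝ} (hR : 1 < R)
    (hu : ContinuousOn u (ann R⁻¹ R \ sphere 0 1)) {M : ℝ}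
    (hM : ∀ᶠ ρ : ℝ in 𝓝[>] 1, ∀ e : ℂ, ‖e‖ = 1 → ‖u (ρ * e)‖ ≤ M)
    (hd : ∀ ε > 0, ∀ᶠ ρ : ℝ in 𝓝[>] 1, ∀ e : ℂ, ‖e‖ = 1 → ‖u (ρ * e) - u ((ρ⁻¹ : ℝ) * e)‖ ≤ ε)
    {z : ℂ} (hz : ‖z‖ ≠ 1) :
    Tendsto (fun ρ : ℝ => (∮ ζ in C(0, ρ), (ζ - z)⁻¹ * u ζ) - ∮ ζ in C(0, ρ⁻¹), (ζ - z)⁻¹ * u ζ)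
      (𝓝[>] 1) (𝓝 0) := by
  set d := |‖z‖ - 1| / 2 with hdd
  have hd0 : 0 < d := half_pos (abs_pos.2 (sub_ne_zero.2 hz))
  have hc1 : Tendsto (fun ρ : ℝ => ρ) (𝓝[>] 1) (𝓝 1) := nhdsWithin_le_nhds
  have hc2 : Tendsto (fun ρ : ℝ => ρ⁻¹) (𝓝[>] 1) (𝓝 1) := by
    simpa using hc1.inv₀ one_ne_zero
  have hc3 : Tendsto (fun ρ : ℝ => ‖z‖ * (ρ - ρ⁻¹) * (d⁻¹ * d⁻¹) * M) (𝓝[>] 1) (𝓝 0) := by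
    have := (((hc1.sub hc2).const_mul ‖z‖).mul_const (d⁻¹ * d⁻¹)).mul_const M
    simpa using this
  have hfar : ∀ {t : ℝ} {e : ℂ}, 0 < t → dist t 1 < d → ‖e‖ = 1 → d ≤ ‖t * e - z‖ := by
    intro t e ht htd he
    have h1 : ‖t * e‖ = t := by rw [norm_mul, he, mul_one, norm_real, Real.norm_of_nonneg ht.le]
    have h2 := abs_norm_sub_norm_le (t * e) z
    rw [h1] at h2
    rw [Real.dist_eq] at htd
    have h3 := abs_sub_abs_le_abs_sub (‖z‖ - 1) (t - 1)
    have h4 : |‖z‖ - 1 - (t - 1)| = |t - ‖z‖| := by rw [abs_sub_comm]; ring_nf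
    rw [h4] at h3
    linarith
  rw [Metric.tendsto_nhds]
  intro η hη
  set ε := η / (4 * π * (1 + d⁻¹)) with hε
  have hε0 : 0 < ε := by positivity
  filter_upwards [hM, hd ε hε0, hc3.eventually (gt_mem_nhds hε0), self_mem_nhdsWithin,
    hc1.eventually (ball_mem_nhds _ hd0), hc2.eventually (ball_mem_nhds _ hd0),
    hc1.eventually (gt_mem_nhds hR)] with ρ h1 h2 h3 h4 h5 h6 h7
  rw [mem_Ioi] at h4
  have hρ0 : 0 < ρ := by linarith
  have hcm : ∀ (t θ : ℝ), circleMap 0 t θ = t * circleMap 0 1 θ := fun t θ => by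
    simp [circleMap]
  have hn1 : ∀ θ, ‖circleMap 0 1 θ‖ = 1 := fun θ => by simp
  have hintg : ∀ t : ℝ, 0 < t → R⁻¹ < t → t < R → t ≠ 1 → dist t 1 < d →
      Continuous (fun θ : ℝ => t * circleMap 0 1 θ * I *
        ((t * circleMap 0 1 θ - z)⁻¹ * u (t * circleMap 0 1 θ))) := by
    intro t ht htR1 htR2 ht1 htd
    have hcont : Continuous fun θ : ℝ => (t : ℂ) * circleMap 0 1 θ :=
      continuous_const.mul (continuous_circleMap 0 1)
    have hnt : ∀ θ : ℝ, ‖(t : ℂ) * circleMap 0 1 θ‖ = t := fun θ => by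
      rw [norm_mul, hn1, mul_one, norm_real, Real.norm_of_nonneg ht.le]
    refine (hcont.mul continuous_const).mul (((hcont.sub continuous_const).inv₀ fun θ => ?_).mul
      (hu.comp_continuous hcont fun θ => ⟨?_, ?_⟩))
    · exact norm_pos_iff.1 (hd0.trans_le (hfar ht htd (hn1 θ)))
    · exact ⟨by rw [hnt]; exact htR1, by rw [hnt]; exact htR2⟩
    · rw [mem_sphere_zero_iff_norm, hnt]; exact ht1
  have hinv1 : ρ⁻¹ < 1 := inv_lt_one_of_one_lt₀ h4
  have hR1 : R⁻¹ < 1 := inv_lt_one_of_one_lt₀ hR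
  rw [dist_zero_right]
  simp only [circleIntegral, deriv_circleMap, smul_eq_mul]
  simp only [hcm ρ, hcm ρ⁻¹]
  rw [← intervalIntegral.integral_sub
    ((hintg ρ hρ0 (by linarith) h7 h4.ne' h5).intervalIntegrable _ _)
    ((hintg ρ⁻¹ (by positivity) (inv_strictAnti₀ hρ0 h7) (by linarith) hinv1.ne
      h6).intervalIntegrable _ _)]
  refine (intervalIntegral.norm_integral_le_of_norm_le_const (C := ε * (1 + d⁻¹))
    fun θ _ => ?_).trans_lt ?_
  · have hk := norm_sub_kernel_le h4 (hn1 θ) hd0 (hfar hρ0 h5 (hn1 θ))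
      (hfar (by positivity) h6 (hn1 θ)) (h1 _ (hn1 θ)) (h2 _ (hn1 θ))
    calc _ = ‖I * (ρ * circleMap 0 1 θ * ((ρ * circleMap 0 1 θ - z)⁻¹ * u (ρ * circleMap 0 1 θ)) -
          (ρ⁻¹ : ℝ) * circleMap 0 1 θ * (((ρ⁻¹ : ℝ) * circleMap 0 1 θ - z)⁻¹ *
            u ((ρ⁻¹ : ℝ) * circleMap 0 1 θ)))‖ := by congr 1; ring
      _ ≤ _ := by rw [norm_mul, norm_I, one_mul]; linarith
  · rw [sub_zero, abs_of_pos (by positivity), hε]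
    have : η / (4 * π * (1 + d⁻¹)) * (1 + d⁻¹) * (2 * π) = η / 2 := by
      have : 1 + d⁻¹ ≠ 0 := by positivity
      field_simp
      ring
    linarith

theorem exists_glue {u : ℂ → ℂ} {R : ℝ} (hR : 1 < R)
    (hu : DifferentiableOn ℂ u (ann R⁻¹ R \ sphere 0 1)) {M : ℝ}
    (hM : ∀ᶠ ρ : ℝ in 𝓝[>] 1, ∀ e : ℂ, ‖e‖ = 1 → ‖u (ρ * e)‖ ≤ M)
    (hd : ∀ ε > 0, ∀ᶠ ρ : ℝ in 𝓝[>] 1, ∀ e : ℂ, ‖e‖ = 1 →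
      ‖u (ρ * e) - u ((ρ⁻¹ : ℝ) * e)‖ ≤ ε) :
    ∃ P : ℂ → ℂ, DifferentiableOn ℂ P (ann R⁻¹ R) ∧ EqOn P u (ann R⁻¹ R \ sphere 0 1) := by
  have hR0 : 0 < R := by linarith
  set t := (1 + R) / 2 with ht
  have ht1 : 1 < t := by linarith
  have ht0 : 0 < t := by linarith
  have htR : t < R := by linarith
  have hti : t⁻¹ < 1 := inv_lt_one_of_one_lt₀ ht1
  have htRi : R⁻¹ < t⁻¹ := inv_strictAnti₀ ht0 htR
  have hU : IsOpen (ann R⁻¹ R \ sphere (0 : ℂ) 1) := (isOpen_ann _ _).sdiff isClosed_sphere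
  set Q : ℂ → ℂ := fun z => (2 * π * I)⁻¹ *
    ((∮ ζ in C(0, t), (ζ - z)⁻¹ * u ζ) - ∮ ζ in C(0, t⁻¹), (ζ - z)⁻¹ * u ζ) with hQ
  have hpi : (2 * π * I : ℂ) ≠ 0 := by simp [Real.pi_ne_zero]
  have hcs : ∀ s : ℝ, R⁻¹ < s → s < R → s ≠ 1 → ContinuousOn u (sphere 0 s) := fun s h1 h2 h3 =>
    hu.continuousOn.mono fun z hz => by
      have hz' : ‖z‖ = s := by simpa using hz
      exact ⟨⟨hz'.symm ▸ h1, hz'.symm ▸ h2⟩, by simpa [hz'] using h3⟩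
  have hQd : ∀ z ∈ ann t⁻¹ t, DifferentiableAt ℂ Q z := fun z hz =>
    ((differentiableAt_cauchy ht0 (hcs t (by linarith) htR ht1.ne') hz.2.ne).sub
      (differentiableAt_cauchy (by positivity) (hcs t⁻¹ htRi (by linarith) hti.ne)
        hz.1.ne')).const_mul _
  have hc1 : Tendsto (fun ρ : ℝ => ρ) (𝓝[>] 1) (𝓝 1) := nhdsWithin_le_nhds
  have hc2 : Tendsto (fun ρ : ℝ => ρ⁻¹) (𝓝[>] 1) (𝓝 1) := by
    simpa using hc1.inv₀ one_ne_zero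
  have hQu : ∀ z ∈ ann t⁻¹ t, ‖z‖ ≠ 1 → Q z = u z := by
    intro z hz hz1
    have hlim := tendsto_circleIntegral_sub hR hu.continuousOn hM hd hz1
    have hconst : ∀ᶠ ρ : ℝ in 𝓝[>] 1, (∮ ζ in C(0, ρ), (ζ - z)⁻¹ * u ζ) -
        (∮ ζ in C(0, ρ⁻¹), (ζ - z)⁻¹ * u ζ) = 2 * π * I * (Q z - u z) := by
      have hQz : 2 * π * I * Q z = (∮ ζ in C(0, t), (ζ - z)⁻¹ * u ζ) -
          ∮ ζ in C(0, t⁻¹), (ζ - z)⁻¹ * u ζ := by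
        rw [hQ, mul_inv_cancel_left₀ hpi]
      have hout : ∀ ρ : ℝ, 1 < ρ → ∀ w : ℂ, ρ ≤ ‖w‖ → ‖w‖ ≤ t → w ∈ ann R⁻¹ R \ sphere 0 1 :=
        fun ρ hρ w h1 h2 => ⟨⟨by linarith, by linarith⟩, fun h => by
          rw [mem_sphere_zero_iff_norm] at h; linarith⟩
      have hin : ∀ ρ : ℝ, 1 < ρ → ∀ w : ℂ, t⁻¹ ≤ ‖w‖ → ‖w‖ ≤ ρ⁻¹ → w ∈ ann R⁻¹ R \ sphere 0 1 :=
        fun ρ hρ w h1 h2 => by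
          have := inv_lt_one_of_one_lt₀ hρ
          exact ⟨⟨by linarith, by linarith⟩, fun h => by
            rw [mem_sphere_zero_iff_norm] at h; linarith⟩
      rcases lt_or_gt_of_ne hz1 with h | h
      · filter_upwards [self_mem_nhdsWithin, hc2.eventually (lt_mem_nhds h),
          hc1.eventually (gt_mem_nhds ht1)] with ρ h1 h2 h3
        rw [mem_Ioi] at h1
        have hi1 : ρ⁻¹ < 1 := inv_lt_one_of_one_lt₀ h1
        have e1 := cauchy_annulus_eq hU (by linarith) h3.le (hout ρ h1) hu (z := z)
          (fun hz => hz.2 (by simpa using h.trans h1))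
        have e2 := cauchy_annulus hU (by positivity) (inv_anti₀ (by linarith) h3.le) (hin ρ h1) hu
          hz.1 h2
        linear_combination -e1 - hQz - e2
      · filter_upwards [self_mem_nhdsWithin, hc1.eventually (gt_mem_nhds h),
          hc1.eventually (gt_mem_nhds ht1)] with ρ h1 h2 h3
        rw [mem_Ioi] at h1
        have hi1 : ρ⁻¹ < 1 := inv_lt_one_of_one_lt₀ h1
        have e1 := cauchy_annulus hU (by linarith) h3.le (hout ρ h1) hu h2 hz.2
        have e2 := cauchy_annulus_eq hU (by positivity) (inv_anti₀ (by linarith) h3.le) (hin ρ h1)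
          hu (z := z) (fun hz => by
            have : ‖z‖ ≤ ρ⁻¹ := by simpa using hz.1
            linarith)
        linear_combination -e1 - hQz - e2
    have h0 := tendsto_nhds_unique (hlim.congr' hconst) tendsto_const_nhds
    exact sub_eq_zero.1 ((mul_eq_zero.1 h0.symm).resolve_left hpi)
  classical
  refine ⟨fun z => if ‖z‖ = 1 then Q z else u z, fun z hz => ?_, fun z hz => ?_⟩
  · refine DifferentiableAt.differentiableWithinAt ?_
    by_cases h1 : ‖z‖ = 1
    · have hza : z ∈ ann t⁻¹ t := ⟨h1.symm ▸ hti, h1.symm ▸ ht1⟩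
      refine (hQd z hza).congr_of_eventuallyEq ?_
      filter_upwards [(isOpen_ann _ _).mem_nhds hza] with w hw
      split_ifs with hw1
      · rfl
      · exact (hQu w hw hw1).symm
    · have hzU : z ∈ ann R⁻¹ R \ sphere 0 1 := ⟨hz, by simpa using h1⟩
      refine (hu.differentiableAt (hU.mem_nhds hzU)).congr_of_eventuallyEq ?_
      filter_upwards [hU.mem_nhds hzU] with w hw
      rw [if_neg (by simpa using hw.2)]
  · exact if_neg (by simpa using hz.2)

end Glue

section Schwarz

/-- Reflection in the circle with centre `c` and radius `r`; the centre is fixed by convention. -/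
def cRefl (c : ℂ) (r : ℝ) (z : ℂ) : ℂ := c + r ^ 2 / conj (z - c)

@[simp] lemma cRefl_center (c : ℂ) (r : ℝ) : cRefl c r c = c := by simp [cRefl]

lemma norm_cRefl_sub (c : ℂ) (r : ℝ) (z : ℂ) : ‖cRefl c r z - c‖ = r ^ 2 / ‖z - c‖ := by
  simp only [cRefl, add_sub_cancel_left, norm_div, Complex.norm_conj, norm_pow, norm_real,
    Real.norm_eq_abs, sq_abs]

lemma cRefl_cRefl {c : ℂ} {r : ℝ} (hr : r ≠ 0) (z : ℂ) : cRefl c r (cRefl c r z) = z := by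
  rcases eq_or_ne z c with rfl | hz
  · simp
  have h1 : z - c ≠ 0 := sub_ne_zero.2 hz
  have h2 : (r : ℂ) ≠ 0 := by exact_mod_cast hr
  simp only [cRefl, add_sub_cancel_left, map_div₀, map_pow, conj_ofReal, conj_conj]
  field_simp
  ring

lemma cRefl_injective {c : ℂ} {r : ℝ} (hr : r ≠ 0) : Function.Injective (cRefl c r) :=
  Function.LeftInverse.injective (cRefl_cRefl hr)

lemma cRefl_ne_center {c : ℂ} {r : ℝ} (hr : r ≠ 0) {z : ℂ} (hz : z ≠ c) : cRefl c r z ≠ c :=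
  fun h => hz <| by rw [← cRefl_cRefl hr z, h, cRefl_center]

lemma continuousAt_cRefl {c : ℂ} {r : ℝ} {z : ℂ} (hz : z ≠ c) : ContinuousAt (cRefl c r) z := by
  refine continuousAt_const.add (continuousAt_const.div ?_ ?_)
  · exact (Complex.continuous_conj.comp (continuous_id.sub continuous_const)).continuousAt
  · exact (map_ne_zero (starRingEnd ℂ)).2 (sub_ne_zero.2 hz)

lemma tendsto_cRefl_cocompact (c : ℂ) {r : ℝ} (hr : r ≠ 0) :
    Tendsto (cRefl c r) (𝓝[≠] c) (cocompact ℂ) := by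
  have h1 : Tendsto (fun z : ℂ => conj (z - c)) (𝓝[≠] c) (𝓝[≠] 0) := by
    refine tendsto_nhdsWithin_iff.2 ⟨?_, ?_⟩
    · have : Tendsto (fun z : ℂ => conj (z - c)) (𝓝 c) (𝓝 (conj (c - c))) :=
        ((Complex.continuous_conj.comp (continuous_id.sub continuous_const)).tendsto c)
      simpa using this.mono_left nhdsWithin_le_nhds
    · filter_upwards [self_mem_nhdsWithin] with z hz
      exact (map_ne_zero (starRingEnd ℂ)).2 (sub_ne_zero.2 hz)
  have h2 : Tendsto (fun z : ℂ => z⁻¹) (𝓝[≠] 0) (cocompact ℂ) := by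
    rw [← Metric.cobounded_eq_cocompact]; exact tendsto_inv₀_nhdsNE_zero
  have h3 := h2.comp h1
  have h4 : (r : ℂ) ^ 2 ≠ 0 := pow_ne_zero 2 (by exact_mod_cast hr)
  have := ((Homeomorph.mulLeft₀ _ h4).trans (Homeomorph.addLeft c)).isClosedEmbedding.tendsto_cocompact.comp h3
  refine this.congr fun z => ?_
  simp [cRefl, div_eq_mul_inv]

lemma differentiableAt_cRefl_comp {c c₀ : ℂ} {r r₀ : ℝ} {ψ : ℂ → ℂ} {z : ℂ} (hz : z ≠ c₀)
    (hψ : DifferentiableAt ℂ ψ (cRefl c₀ r₀ z)) (h0 : ψ (cRefl c₀ r₀ z) ≠ c) :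
    DifferentiableAt ℂ (fun z => cRefl c r (ψ (cRefl c₀ r₀ z))) z := by
  set ψ' : ℂ → ℂ := fun w => conj (ψ (conj w)) with hψ'
  have h1 : DifferentiableAt ℂ ψ' (conj (cRefl c₀ r₀ z)) := by
    have := DifferentiableAt.conj_conj (𝕜 := ℂ) (f := ψ) (x := cRefl c₀ r₀ z) hψ
    exact this
  have h2 : ∀ w, conj (cRefl c₀ r₀ w) = conj c₀ + r₀ ^ 2 / (w - c₀) := fun w => by simp [cRefl]
  have h3 : DifferentiableAt ℂ (fun w => conj (cRefl c₀ r₀ w)) z := by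
    simp only [h2]
    exact (differentiableAt_const _).add ((differentiableAt_const _).div (by fun_prop)
      (sub_ne_zero.2 hz))
  have h4 : DifferentiableAt ℂ (fun w => ψ' (conj (cRefl c₀ r₀ w))) z :=
    DifferentiableAt.comp (g := ψ') z h1 h3
  have h5 : (fun w => cRefl c r (ψ (cRefl c₀ r₀ w))) =
      fun w => c + r ^ 2 / (ψ' (conj (cRefl c₀ r₀ w)) - conj c) := by
    funext w; simp [cRefl, hψ']
  rw [h5]
  refine (differentiableAt_const _).add ((differentiableAt_const _).div (h4.sub_const _) ?_)
  simp only [hψ', conj_conj, ← map_sub]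
  exact (map_ne_zero (starRingEnd ℂ)).2 (sub_ne_zero.2 h0)

/-- **Schwarz reflection** across the unit circle. -/
theorem exists_reflection {ψ : ℂ → ℂ} {R : ℝ} (hR : 1 < R) (hψ : DifferentiableOn ℂ ψ (ann 1 R))
    (hlim : Tendsto (fun z => ‖ψ z‖) (𝓝ˢ (closedBall 0 1) ⊓ 𝓟 (closedBall 0 1)ᶜ) (𝓝 1))
    (h0 : ∀ z ∈ ann 1 R, ψ z ≠ 0) :
    ∃ P : ℂ → ℂ, DifferentiableOn ℂ P (ann R⁻¹ R) ∧ EqOn P ψ (ann 1 R) ∧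
      (∀ z ∈ ann R⁻¹ 1, P z = cRefl 0 1 (ψ (cRefl 0 1 z))) ∧ ∀ z, ‖z‖ = 1 → ‖P z‖ = 1 := by
  classical
  have hR0 : 0 < R := by linarith
  have hRi : R⁻¹ < 1 := inv_lt_one_of_one_lt₀ hR
  have hr0 : ∀ z, cRefl 0 1 z = (conj z)⁻¹ := fun z => by simp [cRefl]
  have hrn : ∀ z, ‖cRefl 0 1 z‖ = ‖z‖⁻¹ := fun z => by rw [hr0, norm_inv, Complex.norm_conj]
  set u : ℂ → ℂ := fun z => if 1 < ‖z‖ then ψ z else cRefl 0 1 (ψ (cRefl 0 1 z)) with hu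
  have hlim' : ∀ ε > 0, ∀ᶠ ρ : ℝ in 𝓝[>] 1, ∀ e : ℂ, ‖e‖ = 1 → |‖ψ (ρ * e)‖ - 1| < ε := by
    intro ε hε
    have h1 := hlim.eventually (ball_mem_nhds 1 hε)
    rw [eventually_inf_principal] at h1
    obtain ⟨δ, hδ, hsub⟩ := (hasBasis_nhdsSet_thickening (isCompact_closedBall (0 : ℂ) 1)).mem_iff.1 h1
    rw [thickening_closedBall hδ zero_le_one] at hsub
    have : ∀ᶠ ρ : ℝ in 𝓝[>] 1, ρ < δ + 1 :=
      nhdsWithin_le_nhds (Iio_mem_nhds (by linarith))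
    filter_upwards [this, self_mem_nhdsWithin] with ρ h2 h3 e he
    rw [mem_Ioi] at h3
    have hn : ‖(ρ : ℂ) * e‖ = ρ := by
      rw [norm_mul, he, mul_one, norm_real, Real.norm_of_nonneg (by linarith)]
    have := hsub (show (ρ : ℂ) * e ∈ ball 0 (δ + 1) by rw [mem_ball_zero_iff, hn]; exact h2)
    exact this (by rw [mem_compl_iff, mem_closedBall_zero_iff, hn, not_le]; exact h3)
  have hR1 : ∀ᶠ ρ : ℝ in 𝓝[>] 1, ρ < R :=
    nhdsWithin_le_nhds (Iio_mem_nhds hR)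
  have hnorm : ∀ {ρ : ℝ} {e : ℂ}, 1 < ρ → ‖e‖ = 1 → ‖(ρ : ℂ) * e‖ = ρ := fun {ρ e} h he => by
    rw [norm_mul, he, mul_one, norm_real, Real.norm_of_nonneg (by linarith)]
  have huout : ∀ {ρ : ℝ} {e : ℂ}, 1 < ρ → ‖e‖ = 1 → u (ρ * e) = ψ (ρ * e) := fun {ρ e} h he => by
    rw [hu]; exact if_pos (by rw [hnorm h he]; exact h)
  have huin : ∀ {ρ : ℝ} {e : ℂ}, 1 < ρ → ‖e‖ = 1 →
      u ((ρ⁻¹ : ℝ) * e) = cRefl 0 1 (ψ (ρ * e)) := fun {ρ e} h he => by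
    have h1 : cRefl 0 1 ((ρ⁻¹ : ℝ) * e) = ρ * e := by
      have : (conj e)⁻¹ = e := by
        rw [Complex.inv_def, conj_conj, Complex.normSq_conj, Complex.normSq_eq_norm_sq, he]; simp
      rw [hr0, map_mul, conj_ofReal, mul_inv, this]
      simp
    have h2 : ¬ 1 < ‖((ρ⁻¹ : ℝ) : ℂ) * e‖ := by
      rw [norm_mul, he, mul_one, norm_real, Real.norm_of_nonneg (by positivity), not_lt]
      exact inv_le_one_of_one_le₀ h.le
    rw [hu]
    exact (if_neg h2).trans (by rw [h1])
  have hud : DifferentiableOn ℂ u (ann R⁻¹ R \ sphere 0 1) := by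
    rintro z ⟨hz, hz1⟩
    rw [mem_sphere_zero_iff_norm] at hz1
    refine DifferentiableAt.differentiableWithinAt ?_
    rcases lt_or_gt_of_ne hz1 with h | h
    · have hz0 : z ≠ 0 := by
        rintro rfl
        have := hz.1
        rw [norm_zero] at this
        linarith [inv_pos.2 hR0]
      have hz0' : 0 < ‖z‖ := norm_pos_iff.2 hz0
      have hm : cRefl 0 1 z ∈ ann 1 R := ⟨by rw [hrn]; exact (one_lt_inv₀ hz0').2 h,
        by rw [hrn]; exact inv_lt_of_inv_lt₀ hR0 hz.1⟩
      refine (differentiableAt_cRefl_comp (c := 0) (r := 1) hz0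
        (hψ.differentiableAt ((isOpen_ann _ _).mem_nhds hm)) (h0 _ hm)).congr_of_eventuallyEq ?_
      filter_upwards [(isOpen_lt continuous_norm continuous_const).mem_nhds h] with w hw
      exact if_neg (not_lt.2 (le_of_lt hw))
    · refine (hψ.differentiableAt ((isOpen_ann _ _).mem_nhds ⟨h, hz.2⟩)).congr_of_eventuallyEq ?_
      filter_upwards [(isOpen_lt continuous_const continuous_norm).mem_nhds h] with w hw
      exact if_pos hw
  have hM : ∀ᶠ ρ : ℝ in 𝓝[>] 1, ∀ e : ℂ, ‖e‖ = 1 → ‖u (ρ * e)‖ ≤ 2 := by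
    filter_upwards [hlim' 1 one_pos, self_mem_nhdsWithin] with ρ h1 h2 e he
    rw [huout h2 he]
    have := abs_lt.1 (h1 e he)
    linarith
  have hd : ∀ ε > 0, ∀ᶠ ρ : ℝ in 𝓝[>] 1, ∀ e : ℂ, ‖e‖ = 1 →
      ‖u (ρ * e) - u ((ρ⁻¹ : ℝ) * e)‖ ≤ ε := by
    intro ε hε
    filter_upwards [hlim' (min (1 / 2) (ε / 5)) (by positivity), self_mem_nhdsWithin]
      with ρ h1 h2 e he
    rw [huout h2 he, huin h2 he, hr0]
    set a := ψ (ρ * e)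
    have h3 := abs_lt.1 ((h1 e he).trans_le (min_le_left _ _))
    have h4 := (h1 e he).trans_le (min_le_right _ _)
    have ha0 : 0 < ‖a‖ := by linarith
    have ha : conj a ≠ 0 := by simpa using norm_pos_iff.1 ha0
    have e1 : a - (conj a)⁻¹ = ((‖a‖ ^ 2 - 1 : ℝ) : ℂ) / conj a := by
      rw [eq_div_iff ha, sub_mul, inv_mul_cancel₀ ha, Complex.mul_conj, Complex.normSq_eq_norm_sq]
      push_cast; ring
    rw [e1, norm_div, Complex.norm_conj, norm_real, Real.norm_eq_abs, div_le_iff₀ ha0,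
      show ‖a‖ ^ 2 - 1 = (‖a‖ - 1) * (‖a‖ + 1) by ring, abs_mul, abs_of_pos (by linarith : 0 < ‖a‖ + 1)]
    calc |‖a‖ - 1| * (‖a‖ + 1) ≤ ε / 5 * (‖a‖ + 1) := by gcongr
      _ ≤ ε / 5 * (5 * ‖a‖) := by gcongr; linarith
      _ = ε * ‖a‖ := by ring
  obtain ⟨P, hP, hPu⟩ := exists_glue hR hud hM hd
  have hPψ : EqOn P ψ (ann 1 R) := fun z hz => by
    rw [hPu ⟨⟨hRi.trans hz.1, hz.2⟩, by simpa using hz.1.ne'⟩]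
    exact if_pos hz.1
  refine ⟨P, hP, hPψ, fun z hz => ?_, fun z hz => ?_⟩
  · rw [hPu ⟨⟨hz.1, hz.2.trans hR⟩, by simpa using hz.2.ne⟩]
    exact if_neg (not_lt.2 hz.2.le)
  · have hc : Tendsto (fun ρ : ℝ => ‖P (ρ * z)‖) (𝓝[>] 1) (𝓝 ‖P z‖) := by
      have h1 : ContinuousAt P z := (hP.differentiableAt ((isOpen_ann _ _).mem_nhds
        ⟨by rw [hz]; exact hRi, by rw [hz]; exact hR⟩)).continuousAt
      have h2 : Tendsto (fun ρ : ℝ => (ρ : ℂ) * z) (𝓝[>] 1) (𝓝 z) := by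
        have : Tendsto (fun ρ : ℝ => (ρ : ℂ) * z) (𝓝 1) (𝓝 ((1 : ℝ) * z)) :=
          (Continuous.tendsto (by fun_prop) 1)
        simpa using this.mono_left nhdsWithin_le_nhds
      exact (h1.tendsto.comp h2).norm
    refine tendsto_nhds_unique hc (Metric.tendsto_nhds.2 fun ε hε => ?_)
    filter_upwards [hlim' ε hε, hR1, self_mem_nhdsWithin] with ρ h1 h2 h3
    rw [hPψ ⟨by rw [hnorm h3 hz]; exact h3, by rw [hnorm h3 hz]; exact h2⟩, Real.dist_eq]
    exact h1 z hz

end Schwarz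

section SchwarzSig

lemma add_mul_cRefl_zero_one (c : ℂ) {r : ℝ} (hr : r ≠ 0) (z : ℂ) :
    c + r * cRefl 0 1 ((z - c) / r) = cRefl c r z := by
  have h2 : (r : ℂ) ≠ 0 := by exact_mod_cast hr
  rcases eq_or_ne z c with rfl | hz
  · simp [cRefl]
  have h1 : conj (z - c) ≠ 0 := (map_ne_zero (starRingEnd ℂ)).2 (sub_ne_zero.2 hz)
  simp only [cRefl, sub_zero, zero_add, map_div₀, conj_ofReal]
  field_simp
  simp

lemma mem_image_cRefl {c : ℂ} {r : ℝ} (hr : r ≠ 0) {H : Set ℂ} {z : ℂ} :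
    z ∈ cRefl c r '' H ↔ cRefl c r z ∈ H :=
  ⟨fun ⟨w, hw, h⟩ => by rw [← h, cRefl_cRefl hr]; exact hw, fun h => ⟨_, h, cRefl_cRefl hr z⟩⟩

/-- A holomorphic map which is injective outside a closed disc, whose values there lie outside
another closed disc and approach its boundary circle, is injective on the separating circle. -/
lemma injOn_sphere_of_injOn_compl {Q ψ : ℂ → ℂ} {G : Set ℂ} {c₀ c : ℂ} {ρ₀ r : ℝ}
    (hρ : 0 < ρ₀) (hr : 0 < r) (hG : IsOpen G) (hS : sphere c₀ ρ₀ ⊆ G) (hQ : DifferentiableOn ℂ Q G)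
    (heq : EqOn Q ψ (G \ closedBall c₀ ρ₀)) (hψ : InjOn ψ (G \ closedBall c₀ ρ₀))
    (hin : ∀ z ∈ G, z ∈ closedBall c₀ ρ₀ → ‖Q z - c‖ ≤ r) (hsph : ∀ z ∈ sphere c₀ ρ₀, ‖Q z - c‖ = r) :
    InjOn Q (sphere c₀ ρ₀) := by
  intro z₁ h₁ z₂ h₂ h12
  by_contra hne
  obtain ⟨u, v, hu, hv, hzu, hzv, huv⟩ := t2_separation hne
  have key : ∀ z ∈ sphere c₀ ρ₀, 𝓝 (Q z) ≤ map Q (𝓝 z) := by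
    intro z hz
    refine (((analyticAt_of_mem hG hQ (hS hz)).eventually_constant_or_nhds_le_map_nhds).resolve_left
      fun hcon => ?_)
    have hz0 : z ∈ closure (closedBall c₀ ρ₀)ᶜ := by
      rw [closure_compl, interior_closedBall _ hρ.ne', mem_compl_iff, mem_ball, not_lt]
      exact (mem_sphere.1 hz).ge
    obtain ⟨W, hWs, hW, hzW⟩ := _root_.mem_nhds_iff.1 (inter_mem hcon (hG.mem_nhds (hS hz)))
    obtain ⟨a, haW, ha⟩ := mem_closure_iff.1 hz0 W hW hzW
    have hWa : W ∩ (closedBall c₀ ρ₀)ᶜ ∈ 𝓝 a :=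
      (hW.inter isClosed_closedBall.isOpen_compl).mem_nhds ⟨haW, ha⟩
    obtain ⟨b, ⟨hbW, hb⟩, hba⟩ := (eventually_nhdsWithin_of_eventually_nhds hWa
      |>.and (self_mem_nhdsWithin : {a}ᶜ ∈ 𝓝[≠] a)).exists
    refine hba (hψ ⟨(hWs hbW).2, hb⟩ ⟨(hWs haW).2, ha⟩ ?_)
    rw [← heq ⟨(hWs hbW).2, hb⟩, ← heq ⟨(hWs haW).2, ha⟩]
    exact (hWs hbW).1.trans (hWs haW).1.symm
  have m1 : Q '' (u ∩ G) ∈ 𝓝 (Q z₁) :=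
    key z₁ h₁ (image_mem_map ((hu.inter hG).mem_nhds ⟨hzu, hS h₁⟩))
  have m2 : Q '' (v ∩ G) ∈ 𝓝 (Q z₁) := by
    rw [h12]; exact key z₂ h₂ (image_mem_map ((hv.inter hG).mem_nhds ⟨hzv, hS h₂⟩))
  have hcl : Q z₁ ∈ closure (closedBall c r)ᶜ := by
    rw [closure_compl, interior_closedBall _ hr.ne', mem_compl_iff, mem_ball, not_lt, dist_eq_norm]
    exact (hsph z₁ h₁).ge
  obtain ⟨w, ⟨⟨a, ⟨hau, haG⟩, rfl⟩, b, ⟨hbv, hbG⟩, hba⟩, hw⟩ :=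
    mem_closure_iff_nhds.1 hcl _ (inter_mem m1 m2)
  rw [mem_compl_iff, mem_closedBall, dist_eq_norm] at hw
  have ha : a ∉ closedBall c₀ ρ₀ := fun h => hw (hin a haG h)
  have hb : b ∉ closedBall c₀ ρ₀ := fun h => hw (by rw [← hba]; exact hin b hbG h)
  have : b = a := hψ ⟨hbG, hb⟩ ⟨haG, ha⟩ (by rw [← heq ⟨hbG, hb⟩, ← heq ⟨haG, ha⟩, hba])
  exact disjoint_left.1 huv hau (this ▸ hbv)

theorem Sig.exists_cRefl {H : Set ℂ} {c₀ c : ℂ} {ρ₀ r : ℝ} {ψ : ℂ → ℂ} (hH : IsCompact H)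
    (hρ : 0 < ρ₀) (hd : Disjoint (closedBall c₀ ρ₀) H) (hψ : Sig (closedBall c₀ ρ₀ ∪ H) ψ)
    (hr : 0 < r) (hav : ∀ z ∈ (closedBall c₀ ρ₀ ∪ H)ᶜ, ψ z ∉ closedBall c r)
    (hlim : Tendsto (fun z => ‖ψ z - c‖) (𝓝ˢ (closedBall c₀ ρ₀) ⊓ 𝓟 (closedBall c₀ ρ₀ ∪ H)ᶜ) (𝓝 r)) :
    ∃ u : ℂ → ℂ, Sig (H ∪ cRefl c₀ ρ₀ '' H) u ∧ EqOn u ψ (closedBall c₀ ρ₀ ∪ H)ᶜ ∧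
      ∀ z ∈ closedBall c₀ ρ₀ \ cRefl c₀ ρ₀ '' H, u z ∈ closedBall c r ∧
        u z ∈ sphere c r ∪ {c} ∪ cRefl c r '' (ψ '' (closedBall c₀ ρ₀ ∪ H)ᶜ) := by
  classical
  set D := closedBall c₀ ρ₀ with hD
  have hdomo : IsOpen (D ∪ H)ᶜ := (isClosed_closedBall.union hH.isClosed).isOpen_compl
  have hcn : Continuous fun z : ℂ => ‖z - c₀‖ := by fun_prop
  have hρC : (ρ₀ : ℂ) ≠ 0 := by exact_mod_cast hρ.ne'
  have hrC : (r : ℂ) ≠ 0 := by exact_mod_cast hr.ne'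
  obtain ⟨δ, hδ, hδH⟩ := (isCompact_closedBall c₀ ρ₀).exists_thickening_subset_open
    hH.isClosed.isOpen_compl (subset_compl_iff_disjoint_right.2 hd)
  rw [thickening_closedBall hδ hρ.le] at hδH
  set R := 1 + δ / ρ₀ with hRdef
  have hR : 1 < R := by have := div_pos hδ hρ; linarith
  have hR0 : 0 < R := by linarith
  have hRi : R⁻¹ < 1 := inv_lt_one_of_one_lt₀ hR
  have hRδ : R * ρ₀ = δ + ρ₀ := by rw [hRdef]; field_simp; ring
  have hs : ∀ z : ℂ, ‖c₀ + ρ₀ * z - c₀‖ = ρ₀ * ‖z‖ := fun z => by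
    rw [add_sub_cancel_left, norm_mul, norm_real, Real.norm_of_nonneg hρ.le]
  have hs' : ∀ z : ℂ, ‖(z - c₀) / ρ₀‖ = ‖z - c₀‖ / ρ₀ := fun z => by
    rw [norm_div, norm_real, Real.norm_of_nonneg hρ.le]
  have hss : ∀ z : ℂ, c₀ + ρ₀ * ((z - c₀) / ρ₀) = z := fun z => by field_simp; ring
  have hmD : ∀ z, z ∈ D ↔ ‖z - c₀‖ ≤ ρ₀ := fun z => by rw [hD, mem_closedBall, dist_eq_norm]
  have hdom : ∀ z, ρ₀ < ‖z - c₀‖ → ‖z - c₀‖ < δ + ρ₀ → z ∈ (D ∪ H)ᶜ := by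
    rintro z h1 h2 (h | h)
    · exact absurd ((hmD z).1 h) (not_le.2 h1)
    · exact hδH (by rw [mem_ball, dist_eq_norm]; exact h2) h
  have hsdom : ∀ z ∈ ann 1 R, c₀ + ρ₀ * z ∈ (D ∪ H)ᶜ := fun z hz =>
    hdom _ (by rw [hs]; nlinarith [hz.1]) (by rw [hs, ← hRδ, mul_comm]; exact mul_lt_mul_of_pos_right hz.2 hρ)
  have hav' : ∀ z ∈ (D ∪ H)ᶜ, r < ‖ψ z - c‖ := fun z hz => by
    have := hav z hz; rwa [mem_closedBall, dist_eq_norm, not_le] at this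
  set ψ₁ : ℂ → ℂ := fun z => (ψ (c₀ + ρ₀ * z) - c) / r with hψ₁
  obtain ⟨P, hP, hPψ, hPin, hPs⟩ := exists_reflection (ψ := ψ₁) hR
    (fun z hz => by
      have h1 := hψ.diff.differentiableAt (hdomo.mem_nhds (hsdom z hz))
      have h2 : DifferentiableAt ℂ (fun z : ℂ => c₀ + ρ₀ * z) z := by fun_prop
      exact (((DifferentiableAt.comp (g := ψ) z h1 h2).sub_const c).div_const
        (r : ℂ)).differentiableWithinAt)
    (by
      have h1 : Tendsto (fun z : ℂ => c₀ + ρ₀ * z) (𝓝ˢ (closedBall 0 1) ⊓ 𝓟 (closedBall 0 1)ᶜ)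
          (𝓝ˢ D ⊓ 𝓟 (D ∪ H)ᶜ) := by
        refine tendsto_inf.2 ⟨?_, tendsto_principal.2 ?_⟩
        · refine Tendsto.mono_left ?_ inf_le_left
          refine (show Continuous fun z : ℂ => c₀ + ρ₀ * z by fun_prop).tendsto_nhdsSet fun z hz => ?_
          rw [hmD, hs]
          exact mul_le_of_le_one_right hρ.le (mem_closedBall_zero_iff.1 hz)
        · rw [eventually_inf_principal]
          have : ball (0 : ℂ) R ∈ 𝓝ˢ (closedBall 0 1) :=
            isOpen_ball.mem_nhdsSet.2 (closedBall_subset_ball hR)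
          filter_upwards [this] with z hz hz1
          exact hsdom z ⟨by simpa using hz1, by simpa using hz⟩
      have h2 := (hlim.comp h1).div_const r
      rw [div_self hr.ne'] at h2
      refine h2.congr fun z => ?_
      simp only [hψ₁, norm_div, norm_real, Real.norm_of_nonneg hr.le, Function.comp])
    (fun z hz => div_ne_zero (norm_pos_iff.1 (hr.trans (hav' _ (hsdom z hz)))) hrC)
  set Q : ℂ → ℂ := fun z => c + r * P ((z - c₀) / ρ₀) with hQ
  set G : Set ℂ := {z | R⁻¹ * ρ₀ < ‖z - c₀‖ ∧ ‖z - c₀‖ < δ + ρ₀} with hG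
  have hGo : IsOpen G := (isOpen_lt continuous_const hcn).inter (isOpen_lt hcn continuous_const)
  have hGann : ∀ z ∈ G, (z - c₀) / ρ₀ ∈ ann R⁻¹ R := fun z hz =>
    ⟨by rw [hs', lt_div_iff₀ hρ]; exact hz.1, by rw [hs', div_lt_iff₀ hρ, hRδ]; exact hz.2⟩
  have hQd : DifferentiableOn ℂ Q G := fun z hz => by
    have h1 := hP.differentiableAt ((isOpen_ann _ _).mem_nhds (hGann z hz))
    have h2 : DifferentiableAt ℂ (fun z : ℂ => (z - c₀) / ρ₀) z := by fun_prop
    exact (((DifferentiableAt.comp (g := P) z h1 h2).const_mul (r : ℂ)).const_add c).differentiableWithinAt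
  have hQout : EqOn Q ψ (G \ D) := fun z hz => by
    have h1 : ρ₀ < ‖z - c₀‖ := not_le.1 fun h => hz.2 ((hmD z).2 h)
    have h2 : P ((z - c₀) / ρ₀) = ψ₁ ((z - c₀) / ρ₀) :=
      hPψ ⟨by rw [hs', lt_div_iff₀ hρ, one_mul]; exact h1, (hGann z hz.1).2⟩
    simp only [hQ, h2, hψ₁, hss]
    field_simp; ring
  have hQin : ∀ z ∈ G, ‖z - c₀‖ < ρ₀ → Q z = cRefl c r (ψ (cRefl c₀ ρ₀ z)) := fun z hz h => by
    have h2 := hPin _ ⟨(hGann z hz).1, by rw [hs', div_lt_one hρ]; exact h⟩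
    simp only [hQ, h2]
    rw [← add_mul_cRefl_zero_one c hr.ne', ← add_mul_cRefl_zero_one c₀ hρ.ne' z]
  have hSG : sphere c₀ ρ₀ ⊆ G := fun z hz => by
    rw [mem_sphere, dist_eq_norm] at hz
    exact ⟨by rw [hz]; exact mul_lt_of_lt_one_left hρ hRi, by rw [hz]; linarith⟩
  have hQs : ∀ z ∈ sphere c₀ ρ₀, ‖Q z - c‖ = r := fun z hz => by
    rw [mem_sphere, dist_eq_norm] at hz
    have := hPs ((z - c₀) / ρ₀) (by rw [hs', hz, div_self hρ.ne'])
    simp only [hQ, add_sub_cancel_left, norm_mul, norm_real, this, Real.norm_of_nonneg hr.le, mul_one]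
  have hσn : ∀ z, z ≠ c₀ → ‖z - c₀‖ < ρ₀ → ρ₀ < ‖cRefl c₀ ρ₀ z - c₀‖ := fun z h0 h => by
    have h0' : 0 < ‖z - c₀‖ := norm_pos_iff.2 (sub_ne_zero.2 h0)
    rw [norm_cRefl_sub, lt_div_iff₀ h0', sq]
    exact mul_lt_mul_of_pos_left h hρ
  have hσdom : ∀ z, z ∉ cRefl c₀ ρ₀ '' H → z ≠ c₀ → ‖z - c₀‖ < ρ₀ → cRefl c₀ ρ₀ z ∈ (D ∪ H)ᶜ := by
    rintro z hz h0 h (h1 | h1)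
    · exact absurd ((hmD _).1 h1) (not_le.2 (hσn z h0 h))
    · exact hz ((mem_image_cRefl hρ.ne').2 h1)
  have hσlt : ∀ w ∈ (D ∪ H)ᶜ, ‖cRefl c r (ψ w) - c‖ < r := fun w hw => by
    have := hav' w hw
    rw [norm_cRefl_sub, div_lt_iff₀ (hr.trans this), sq]
    exact mul_lt_mul_of_pos_left this hr
  set u : ℂ → ℂ := fun z => if ‖z - c₀‖ < ρ₀ then
    (if z = c₀ then c else cRefl c r (ψ (cRefl c₀ ρ₀ z)))
    else if ‖z - c₀‖ = ρ₀ then Q z else ψ z with hu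
  have u_c : u c₀ = c := by simp [hu, hρ]
  have u_in : ∀ z, z ≠ c₀ → ‖z - c₀‖ < ρ₀ → u z = cRefl c r (ψ (cRefl c₀ ρ₀ z)) := fun z h0 h => by
    simp only [hu]; rw [if_pos h, if_neg h0]
  have u_s : ∀ z, ‖z - c₀‖ = ρ₀ → u z = Q z := fun z h => by
    simp only [hu]; rw [if_neg (not_lt.2 h.ge), if_pos h]
  have u_out : ∀ z, ρ₀ < ‖z - c₀‖ → u z = ψ z := fun z h => by
    simp only [hu]; rw [if_neg (not_lt.2 h.le), if_neg h.ne']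
  have uQ : EqOn u Q G := fun z hz => by
    rcases lt_trichotomy ‖z - c₀‖ ρ₀ with h | h | h
    · rw [u_in z ?_ h, hQin z hz h]
      rintro rfl
      have := hz.1
      rw [sub_self, norm_zero] at this
      exact absurd this (not_lt.2 (by positivity))
    · exact u_s z h
    · rw [u_out z h, hQout ⟨hz, fun h' => absurd ((hmD z).1 h') (not_le.2 h)⟩]
  have n_out : ∀ z ∈ (H ∪ cRefl c₀ ρ₀ '' H)ᶜ, ρ₀ < ‖z - c₀‖ → r < ‖u z - c‖ := fun z hz h => by
    rw [u_out z h]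
    exact hav' z fun h' => h'.elim (fun h1 => absurd ((hmD z).1 h1) (not_le.2 h))
      fun h1 => hz (Or.inl h1)
  have n_s : ∀ z, ‖z - c₀‖ = ρ₀ → ‖u z - c‖ = r := fun z h => by
    rw [u_s z h]; exact hQs z (by rw [mem_sphere, dist_eq_norm]; exact h)
  have n_in : ∀ z, z ∉ cRefl c₀ ρ₀ '' H → ‖z - c₀‖ < ρ₀ → ‖u z - c‖ < r := fun z hz h => by
    rcases eq_or_ne z c₀ with rfl | h0
    · rw [u_c]; simpa using hr
    · rw [u_in z h0 h]
      exact hσlt _ (hσdom z hz h0 h)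
  have hψc : Tendsto ψ (cocompact ℂ) (cocompact ℂ) := tendsto_cocompact_of_sub hψ.inf
  have hc₀H : c₀ ∉ cRefl c₀ ρ₀ '' H := fun h => by
    rw [mem_image_cRefl hρ.ne', cRefl_center] at h
    exact disjoint_left.1 hd (mem_closedBall_self hρ.le) h
  have hHs : IsCompact (cRefl c₀ ρ₀ '' H) := hH.image_of_continuousOn fun z hz =>
    (continuousAt_cRefl (by
      rintro rfl
      exact disjoint_left.1 hd (mem_closedBall_self hρ.le) hz)).continuousWithinAt
  have hdiff1 : ∀ z, z ≠ c₀ → z ∉ cRefl c₀ ρ₀ '' H → ‖z - c₀‖ < ρ₀ → DifferentiableAt ℂ u z := by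
    intro z h0 hz h
    have hm := hσdom z hz h0 h
    refine (differentiableAt_cRefl_comp (c := c) (r := r) h0
      (hψ.diff.differentiableAt (hdomo.mem_nhds hm)) fun h' => ?_).congr_of_eventuallyEq ?_
    · have := hav' _ hm
      rw [h', sub_self, norm_zero] at this
      exact absurd this (not_lt.2 hr.le)
    · filter_upwards [(isOpen_lt hcn continuous_const).mem_nhds h,
        isOpen_ne.mem_nhds h0] with w h1 h2
      exact u_in w h2 h1
  refine ⟨u, ⟨?_, ?_, ?_⟩, ?_, ?_⟩
  · intro z hz
    refine DifferentiableAt.differentiableWithinAt ?_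
    rcases lt_trichotomy ‖z - c₀‖ ρ₀ with h | h | h
    · rcases eq_or_ne z c₀ with rfl | h0
      · refine (analyticAt_of_differentiable_on_punctured_nhds_of_continuousAt ?_ ?_).differentiableAt
        · have h1 : ∀ᶠ w in 𝓝 z, w ∉ cRefl z ρ₀ '' H := hHs.isClosed.isOpen_compl.mem_nhds hc₀H
          have h2 : ∀ᶠ w in 𝓝 z, ‖w - z‖ < ρ₀ :=
            (isOpen_lt hcn continuous_const).mem_nhds h
          filter_upwards [nhdsWithin_le_nhds h1, nhdsWithin_le_nhds h2, self_mem_nhdsWithin]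
            with w h3 h4 h5
          exact hdiff1 w h5 h3 h4
        · rw [continuousAt_iff_punctured_nhds, u_c]
          have h1 := hψc.comp (tendsto_cRefl_cocompact z hρ.ne')
          have h2 : Tendsto (fun w => ‖ψ (cRefl z ρ₀ w) - c‖) (𝓝[≠] z) atTop := by
            have h3 := (tendsto_norm_cocompact_atTop (E := ℂ)).comp
              (((Homeomorph.subRight c).isClosedEmbedding.tendsto_cocompact).comp h1)
            exact h3
          have h3 : Tendsto (fun w => r ^ 2 / ‖ψ (cRefl z ρ₀ w) - c‖) (𝓝[≠] z) (𝓝 0) :=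
            h2.const_div_atTop _
          rw [tendsto_iff_norm_sub_tendsto_zero]
          refine h3.congr' ?_
          have h2 : ∀ᶠ w in 𝓝 z, ‖w - z‖ < ρ₀ :=
            (isOpen_lt hcn continuous_const).mem_nhds h
          filter_upwards [nhdsWithin_le_nhds h2, self_mem_nhdsWithin] with w h4 h5
          rw [u_in w h5 h4, norm_cRefl_sub]
      · exact hdiff1 z h0 (fun h' => hz (Or.inr h')) h
    · have hzG : z ∈ G := hSG (by rw [mem_sphere, dist_eq_norm]; exact h)
      exact (hQd.differentiableAt (hGo.mem_nhds hzG)).congr_of_eventuallyEq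
        (uQ.eventuallyEq_of_mem (hGo.mem_nhds hzG))
    · have hzd : z ∈ (D ∪ H)ᶜ := fun h' => h'.elim
        (fun h1 => absurd ((hmD z).1 h1) (not_le.2 h)) fun h1 => hz (Or.inl h1)
      refine (hψ.diff.differentiableAt (hdomo.mem_nhds hzd)).congr_of_eventuallyEq ?_
      filter_upwards [(isOpen_lt continuous_const hcn).mem_nhds h] with w h1
      exact u_out w h1
  · intro z hz w hw hzw
    have hz' : z ∉ cRefl c₀ ρ₀ '' H := fun h' => hz (Or.inr h')
    have hw' : w ∉ cRefl c₀ ρ₀ '' H := fun h' => hw (Or.inr h')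
    rcases lt_trichotomy ‖z - c₀‖ ρ₀ with h | h | h <;>
      rcases lt_trichotomy ‖w - c₀‖ ρ₀ with h' | h' | h'
    · rcases eq_or_ne z c₀ with h0 | h0 <;> rcases eq_or_ne w c₀ with h0' | h0'
      · rw [h0, h0']
      · have := (hav' _ (hσdom w hw' h0' h'))
        rw [h0, u_c, u_in w h0' h'] at hzw
        refine absurd hzw.symm (cRefl_ne_center hr.ne' fun h1 => ?_)
        rw [h1, sub_self, norm_zero] at this
        exact absurd this (not_lt.2 hr.le)
      · have := (hav' _ (hσdom z hz' h0 h))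
        rw [h0', u_c, u_in z h0 h] at hzw
        refine absurd hzw (cRefl_ne_center hr.ne' fun h1 => ?_)
        rw [h1, sub_self, norm_zero] at this
        exact absurd this (not_lt.2 hr.le)
      · rw [u_in z h0 h, u_in w h0' h'] at hzw
        exact cRefl_injective hρ.ne' (hψ.inj (hσdom z hz' h0 h) (hσdom w hw' h0' h')
          (cRefl_injective hr.ne' hzw))
    · have h1 := n_in z hz' h
      rw [hzw, n_s w h'] at h1; exact absurd h1 (lt_irrefl _)
    · have h1 := (n_in z hz' h).trans (n_out w hw h')
      rw [hzw] at h1; exact absurd h1 (lt_irrefl _)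
    · have h1 := n_in w hw' h'
      rw [← hzw, n_s z h] at h1; exact absurd h1 (lt_irrefl _)
    · rw [u_s z h, u_s w h'] at hzw
      refine injOn_sphere_of_injOn_compl (ψ := ψ) (c := c) hρ hr hGo hSG hQd hQout
        (hψ.inj.mono fun x hx => ?_) (fun x hx hxD => ?_) hQs
        (by rw [mem_sphere, dist_eq_norm]; exact h) (by rw [mem_sphere, dist_eq_norm]; exact h') hzw
      · exact hdom x (not_le.1 fun h1 => hx.2 ((hmD x).2 h1)) hx.1.2
      · rw [← uQ hx]
        rcases ((hmD x).1 hxD).lt_or_eq with h1 | h1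
        · refine (n_in x (fun h2 => ?_) h1).le
          rw [mem_image_cRefl hρ.ne'] at h2
          refine hδH ?_ h2
          have hx0 : 0 < ‖x - c₀‖ := lt_of_le_of_lt (by positivity) hx.1
          rw [mem_ball, dist_eq_norm, norm_cRefl_sub, div_lt_iff₀ hx0, ← hRδ]
          have := mul_lt_mul_of_pos_left hx.1 (mul_pos hR0 hρ)
          calc ρ₀ ^ 2 = R * ρ₀ * (R⁻¹ * ρ₀) := by field_simp
            _ < _ := this
        · exact (n_s x h1).le
    · have h1 := n_out w hw h'
      rw [← hzw, n_s z h] at h1; exact absurd h1 (lt_irrefl _)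
    · have h1 := (n_in w hw' h').trans (n_out z hz h)
      rw [hzw] at h1; exact absurd h1 (lt_irrefl _)
    · have h1 := n_out z hz h
      rw [hzw, n_s w h'] at h1; exact absurd h1 (lt_irrefl _)
    · rw [u_out z h, u_out w h'] at hzw
      refine hψ.inj (fun h1 => ?_) (fun h1 => ?_) hzw
      · exact h1.elim (fun h1 => absurd ((hmD z).1 h1) (not_le.2 h)) fun h1 => hz (Or.inl h1)
      · exact h1.elim (fun h1 => absurd ((hmD w).1 h1) (not_le.2 h')) fun h1 => hw (Or.inl h1)
  · refine hψ.inf.congr' ?_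
    filter_upwards [(isCompact_closedBall c₀ ρ₀).compl_mem_cocompact] with z hz
    rw [u_out z (not_le.1 fun h => hz ((hmD z).2 h))]
  · intro z hz
    exact u_out z (not_le.1 fun h => hz (Or.inl ((hmD z).2 h)))
  · rintro z ⟨hz, hzH⟩
    rcases ((hmD z).1 hz).lt_or_eq with h | h
    · refine ⟨by rw [mem_closedBall, dist_eq_norm]; exact (n_in z hzH h).le, ?_⟩
      rcases eq_or_ne z c₀ with rfl | h0
      · exact Or.inl (Or.inr u_c)
      · exact Or.inr ⟨_, ⟨_, hσdom z hzH h0 h, rfl⟩, (u_in z h0 h).symm⟩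
    · have := n_s z h
      exact ⟨by rw [mem_closedBall, dist_eq_norm]; exact this.le,
        Or.inl (Or.inl (by rw [mem_sphere, dist_eq_norm]; exact this))⟩

end SchwarzSig

section State

variable {ι : Type*} {K : Set ℂ} {A V N E L C : ι → Set ℂ} {f g : ℂ → ℂ} {q : ℝ≥0} {M : ℝ≥0∞}
  {ε : ι → ℝ≥0∞}

lemma Cell.mono_left {M M' t : ℝ≥0∞} {V L C : Set ℂ} (h : Cell M t V L C) (hM : M ≤ M') :
    Cell M' t V L C :=
  { h with
    ext := fun ψ h1 h2 => (h.ext ψ h1 h2).imp fun w h3 => ⟨h3.1, h3.2.1, h3.2.2.trans (by gcongr)⟩ }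

/-- A conformal collar `V \ A` of `A` makes whatever it surrounds occupy at most the
proportion `q` of the area, whatever univalent map is applied. -/
def AreaRatio (q : ℝ≥0) (V A N : Set ℂ) : Prop :=
  ∀ (E : Set ℂ) (f φ : ℂ → ℂ), DifferentiableOn ℂ f (V \ A) →
    InjOn f (V \ A) → Disjoint E (f '' (V \ A)) → IsCompact (E ∪ f '' (N \ A)) →
    IsOpen (E ∪ f '' (interior N \ A)) → IsOpen (E ∪ f '' (V \ A)) → E.Nonempty →
    DifferentiableOn ℂ φ (E ∪ f '' (V \ A)) → InjOn φ (E ∪ f '' (V \ A)) →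
    volume (φ '' E) ≤ q * volume (φ '' (E ∪ f '' (V \ A)))

lemma AreaRatio.mono {q q' : ℝ≥0} {V A N : Set ℂ} (h : AreaRatio q V A N) (hq : q ≤ q') :
    AreaRatio q' V A N := fun E f φ h1 h2 h3 h4 h5 h6 h7 h8 h9 =>
  (h E f φ h1 h2 h3 h4 h5 h6 h7 h8 h9).trans (by gcongr)

/-- Disjoint neighbourhoods of the pieces with definite collars. -/
structure Collars (A V N : ι → Set ℂ) (q : ℝ≥0) : Prop where
  isOpen : ∀ i, IsOpen (V i)
  compact : ∀ i, IsCompact (N i)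
  subset_interior : ∀ i, A i ⊆ interior (N i)
  subset : ∀ i, N i ⊆ V i
  disj : ∀ i j, i ≠ j → Disjoint (V i) (V j)
  area : ∀ i, AreaRatio q (V i) (A i) (N i)

lemma Collars.left_subset (h : Collars A V N q) (i : ι) : A i ⊆ V i :=
  ((h.subset_interior i).trans interior_subset).trans (h.subset i)

lemma Collars.diff_eq (h : Collars A V N q) (hP : Pieces K A) (i : ι) {W : Set ℂ} (hW : W ⊆ V i) :
    W \ K = W \ A i := by
  refine Subset.antisymm (diff_subset_diff_right (hP.subset i)) fun z hz => ⟨hz.1, fun hK => ?_⟩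
  obtain ⟨j, hj⟩ := hP.mem hK
  rcases eq_or_ne i j with rfl | hij
  · exact hz.2 hj
  · exact disjoint_left.1 (h.disj i j hij) (hW hz.1) (h.left_subset j hj)

lemma Pieces.exists_collars [Finite ι] (hP : Pieces K A) (hc : IsPreconnected Kᶜ) :
    ∃ (V N : ι → Set ℂ) (q M : ℝ≥0), q < 1 ∧ Collars A V N q ∧
      ∀ i, Bornology.IsBounded (V i) ∧ ∃ C, Cell M 1 (V i) (A i) C := by
  have := Fintype.ofFinite ι
  obtain ⟨ε₁, hε₁, h1⟩ := hP.exists_thickening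
  obtain ⟨ε₂, hε₂, h2⟩ := hP.exists_isConnected_thickening_diff hc
  set δ := min ε₁ ε₂ with hδ
  have hδ0 : 0 < δ := lt_min hε₁ hε₂
  set V : ι → Set ℂ := fun i => thickening δ (A i) with hV
  set N : ι → Set ℂ := fun i => cthickening (δ / 2) (A i) with hN
  have hVo : ∀ i, IsOpen (V i) := fun i => isOpen_thickening
  have hVc : ∀ i, IsPreconnected (V i \ A i) := fun i => by
    have := h2 i δ hδ0 (min_le_right _ _)
    rw [← this.2]; exact this.1.isPreconnected
  have hNc : ∀ i, IsCompact (N i) := fun i => (hP.compact i).cthickening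
  have hAN : ∀ i, A i ⊆ interior (N i) := fun i =>
    (self_subset_thickening (half_pos hδ0) _).trans (thickening_subset_interior_cthickening _ _)
  have hNV : ∀ i, N i ⊆ V i := fun i => cthickening_subset_thickening' hδ0 (half_lt_self hδ0) _
  choose q hq1 hq using fun i => exists_area_ratio (hVo i) (hP.compact i) (hVc i) (hNc i) (hAN i) (hNV i)
  choose M C hC using fun i => Cell.of_isCompact (hVo i) (hP.compact i)
    (self_subset_thickening hδ0 (A i)) (hVc i)
  refine ⟨V, N, Finset.univ.sup q, Finset.univ.sup M, (Finset.sup_lt_iff (by simp)).2 fun i _ => hq1 i,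
    ⟨hVo, hNc, hAN, hNV, fun i j hij => ?_, fun i => ?_⟩, fun i =>
      ⟨(hP.compact i).isBounded.thickening, C i, (hC i).mono_left ?_⟩⟩
  · exact (h1 i j hij).mono (thickening_mono (min_le_left _ _) _) (thickening_mono (min_le_left _ _) _)
  · exact AreaRatio.mono (q := q i) (hq i) (Finset.le_sup (Finset.mem_univ i))
  · exact ENNReal.coe_le_coe.2 (Finset.le_sup (Finset.mem_univ i))

/-- A stage of the Koebe iteration. The sets `L i ⊆ E i` are the parts of the complementary pieces
to which maps have not yet been extended by reflection. -/
structure State (K : Set ℂ) (A V : ι → Set ℂ) (M : ℝ≥0∞) (f : ℂ → ℂ) (E L C : ι → Set ℂ)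
    (ε : ι → ℝ≥0∞) : Prop where
  sig : Sig K f
  pieces : Pieces (img K f) E
  lab : ∀ i, Tendsto f (𝓝ˢ (A i) ⊓ 𝓟 Kᶜ) (𝓝ˢ (E i))
  cell : ∀ i, Cell M (ε i) (E i ∪ f '' (V i \ K)) (L i) (C i)
  sub : ∀ i, L i ⊆ E i

/-- The union of all the sets but the `i`-th one. -/
def rest (L : ι → Set ℂ) (i : ι) : Set ℂ := ⋃ l : {l // l ≠ i}, L l

lemma mem_rest {L : ι → Set ℂ} {i : ι} {z : ℂ} : z ∈ rest L i ↔ ∃ l, l ≠ i ∧ z ∈ L l := by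
  simp [rest]

lemma isCompact_rest [Finite ι] {L : ι → Set ℂ} (hL : ∀ l, IsCompact (L l)) (i : ι) :
    IsCompact (rest L i) := isCompact_iUnion fun l => hL l

lemma Sig.tendsto_nhdsSet_img (hK : IsCompact K) (hK' : IsConnected K) (hc : IsPreconnected Kᶜ)
    (hf : Sig K f) : Tendsto f (𝓝ˢ K ⊓ 𝓟 Kᶜ) (𝓝ˢ (img K f)) := by
  obtain ⟨B, hB, ht⟩ := hf.exists_pieces (Pieces.single hK hK') hc
  have : B () = img K f := by rw [← hB.union]; exact (iUnion_const (B ())).symm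
  rw [← this]; exact ht ()

lemma State.initial (hP : Pieces K A) (hV : Collars A V N q) (hC : ∀ i, Cell M 1 (V i) (A i) (C i)) :
    State K A V M (fun z => z) A A C (fun _ => 1) where
  sig := Sig.id K
  pieces := by rwa [img_id]
  lab i := tendsto_id.mono_left inf_le_left
  cell i := by
    rw [image_id', hV.diff_eq hP i Subset.rfl, union_diff_cancel (hV.left_subset i)]
    exact hC i
  sub i := Subset.rfl

namespace State

lemma disjoint_image (h : State K A V M f E L C ε) (i : ι) (S : Set ℂ) :
    Disjoint (E i) (f '' (S \ K)) := by
  rw [disjoint_left]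
  rintro _ hz ⟨w, hw, rfl⟩
  exact h.pieces.subset i hz ⟨w, hw.2, rfl⟩

lemma disjoint_nbhd (h : State K A V M f E L C ε) (hV : Collars A V N q) {i j : ι} (hij : i ≠ j) :
    Disjoint (E i ∪ f '' (V i \ K)) (E j ∪ f '' (V j \ K)) := by
  rw [disjoint_union_left, disjoint_union_right, disjoint_union_right]
  refine ⟨⟨h.pieces.disj i j hij, h.disjoint_image i _⟩, (h.disjoint_image j _).symm, ?_⟩
  rw [disjoint_left]
  rintro _ ⟨z, hz, rfl⟩ ⟨w, hw, hzw⟩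
  rw [h.sig.inj hw.2 hz.2 hzw] at hw
  exact disjoint_left.1 (hV.disj i j hij) hz.1 hw.1

lemma sig_comp (h : State K A V M f E L C ε) [Finite ι] (hP : Pieces K A) {j : ι} (hg : Sig (E j) g) :
    Sig K (fun z => g (f z)) :=
  (h.sig.comp hP.isCompact (hg.mono (h.pieces.subset j))).1

section Step

variable [DecidableEq ι] {j : ι} {c : ℂ} {ρ : ℝ}

lemma pieces_comp [Finite ι] (h : State K A V M f E L C ε) (hP : Pieces K A) (hg : Sig (E j) g)
    (hρ : 0 < ρ) (hD : img (E j) g = closedBall c ρ) :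
    Pieces (img K (fun z => g (f z))) (Function.update (fun l => g '' E l) j (closedBall c ρ)) := by
  have hsub : ∀ l, l ≠ j → E l ⊆ (E j)ᶜ := fun l hl =>
    subset_compl_iff_disjoint_right.2 (h.pieces.disj l j hl)
  have hdD : ∀ l, l ≠ j → Disjoint (g '' E l) (closedBall c ρ) := fun l hl => by
    rw [← subset_compl_iff_disjoint_right, ← hD, compl_img]
    exact image_mono (hsub l hl)
  have hcont : ∀ l, l ≠ j → ContinuousOn g (E l) := fun l hl => hg.diff.continuousOn.mono (hsub l hl)
  refine ⟨fun i => ?_, fun i => ?_, fun i l hil => ?_, ?_⟩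
  · rcases eq_or_ne i j with rfl | hi
    · rw [Function.update_self]; exact isCompact_closedBall _ _
    · rw [Function.update_of_ne hi]; exact (h.pieces.compact i).image_of_continuousOn (hcont i hi)
  · rcases eq_or_ne i j with rfl | hi
    · rw [Function.update_self]
      exact ⟨⟨c, mem_closedBall_self hρ.le⟩, (convex_closedBall _ _).isPreconnected⟩
    · rw [Function.update_of_ne hi]; exact (h.pieces.conn i).image _ (hcont i hi)
  · rcases eq_or_ne i j with rfl | hi
    · rw [Function.update_self, Function.update_of_ne hil.symm]; exact (hdD l hil.symm).symm
    · rcases eq_or_ne l j with rfl | hl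
      · rw [Function.update_self, Function.update_of_ne hi]; exact hdD i hi
      · rw [Function.update_of_ne hi, Function.update_of_ne hl]
        exact (h.pieces.disj i l hil).image (u := (E j)ᶜ) hg.inj (hsub i hi) (hsub l hl)
  · rw [(h.sig.comp hP.isCompact (hg.mono (h.pieces.subset j))).2]
    ext w
    rw [mem_iUnion]
    constructor
    · rintro ⟨i, hi⟩ ⟨z, hz, rfl⟩
      rcases eq_or_ne i j with rfl | hij
      · rw [Function.update_self, ← hD] at hi
        exact hi ⟨z, fun h' => hz (h.pieces.subset i h'), rfl⟩
      · rw [Function.update_of_ne hij] at hi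
        obtain ⟨y, hy, hyz⟩ := hi
        rw [hg.inj (hsub i hij hy) (fun h' => hz (h.pieces.subset j h')) hyz] at hy
        exact hz (h.pieces.subset i hy)
    · intro hw
      by_cases hwD : w ∈ closedBall c ρ
      · exact ⟨j, by rwa [Function.update_self]⟩
      · rw [← hD, ← mem_compl_iff, compl_img] at hwD
        obtain ⟨z, hz, rfl⟩ := hwD
        by_cases hzK : z ∈ img K f
        · obtain ⟨i, hi⟩ := h.pieces.mem hzK
          have hij : i ≠ j := by rintro rfl; exact hz hi
          exact ⟨i, by rw [Function.update_of_ne hij]; exact ⟨z, hi, rfl⟩⟩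
        · exact absurd ⟨z, hzK, rfl⟩ hw

lemma lab_comp [Finite ι] (h : State K A V M f E L C ε) (hc : IsPreconnected Kᶜ)
    (hP : Pieces K A) (hg : Sig (E j) g)
    (hD : img (E j) g = closedBall c ρ) (i : ι) :
    Tendsto (fun z => g (f z)) (𝓝ˢ (A i) ⊓ 𝓟 Kᶜ)
      (𝓝ˢ (Function.update (fun l => g '' E l) j (closedBall c ρ) i)) := by
  rcases eq_or_ne i j with rfl | hi
  · rw [Function.update_self, ← hD]
    refine (hg.tendsto_nhdsSet_img (h.pieces.compact i) (h.pieces.conn i)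
      (h.pieces.isPreconnected_compl (h.sig.isPreconnected_compl_img hc) i)).comp
      (tendsto_inf.2 ⟨h.lab i, tendsto_principal.2 ?_⟩)
    filter_upwards [mem_inf_of_right (mem_principal_self _)] with z hz hfz
    exact h.pieces.subset i hfz ⟨z, hz, rfl⟩
  · rw [Function.update_of_ne hi]
    have h1 : Tendsto g (𝓝ˢ (E i)) (𝓝ˢ (g '' E i)) := by
      refine fun U hU => ?_
      rw [mem_map, mem_nhdsSet_iff_forall]
      intro z hz
      have hzj : z ∈ (E j)ᶜ := fun h' => hi (h.pieces.eq_of_mem hz h')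
      exact (hg.diff.continuousOn.continuousAt ((h.pieces.compact j).isClosed.isOpen_compl.mem_nhds hzj))
        (mem_nhdsSet_iff_forall.1 hU _ ⟨z, hz, rfl⟩)
    exact h1.comp (h.lab i)

/-- Rounding the `j`-th piece: the state after composition with the map `g`. -/
theorem step [Finite ι] (h : State K A V M f E L C ε) (hV : Collars A V N q)
    (hc : IsPreconnected Kᶜ) (hP : Pieces K A)
    (hg : Sig (E j) g) (hρ : 0 < ρ) (hD : img (E j) g = closedBall c ρ) {t : ℝ≥0∞}
    (ht : ∀ l, l ≠ j → ε l ≤ t) :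
    State K A V M (fun z => g (f z)) (Function.update (fun l => g '' E l) j (closedBall c ρ))
      (Function.update (fun l => g '' L l) j (cRefl c ρ '' rest (fun l => g '' L l) j))
      (Function.update (fun l => g '' C l) j (cRefl c ρ '' rest (fun l => g '' C l) j))
      (Function.update ε j (q * t)) := by
  have hsig := h.sig_comp hP hg
  have hpc := h.pieces_comp hP hg hρ hD
  have hlab := h.lab_comp hc hP hg hD
  have hnb : ∀ l, l ≠ j → E l ∪ f '' (V l \ K) ⊆ (E j)ᶜ := fun l hl =>
    subset_compl_iff_disjoint_right.2 ((h.disjoint_nbhd hV hl).mono_right subset_union_left)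
  have hcell : ∀ l, l ≠ j → Cell M (ε l) (g '' (E l ∪ f '' (V l \ K))) (g '' L l) (g '' C l) :=
    fun l hl => (h.cell l).image (hg.diff.mono (hnb l hl)) (hg.inj.mono (hnb l hl))
  have hDn : ∀ l, l ≠ j → ∀ z ∈ g '' (E l ∪ f '' (V l \ K)), ρ < ‖z - c‖ := fun l hl z hz => by
    have : z ∈ (img (E j) g)ᶜ := by
      rw [compl_img]; exact image_mono (hnb l hl) hz
    rwa [hD, mem_compl_iff, mem_closedBall, dist_eq_norm, not_le] at this
  refine ⟨hsig, hpc, hlab, fun i => ?_, fun i => ?_⟩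
  · rcases eq_or_ne i j with rfl | hi
    · simp only [Function.update_self]
      have hinv : ∀ l : {l // l ≠ i}, Cell M t
          (cRefl c ρ '' (g '' (E l ∪ f '' (V l \ K)))) (cRefl c ρ '' (g '' L l))
          (cRefl c ρ '' (g '' C l)) := by
        rintro ⟨l, hl⟩
        have h1 := ((hcell l hl).mono (ht l hl)).image_conj
        set m : ℂ → ℂ := fun w => c + ρ ^ 2 / (w - conj c) with hm
        have hmn : ∀ w ∈ (fun z => conj z) '' (g '' (E l ∪ f '' (V l \ K))), w - conj c ≠ 0 := by
          rintro _ ⟨z, hz, rfl⟩ h0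
          have h2 := hDn l hl z hz
          rw [← map_sub, map_eq_zero] at h0
          rw [h0, norm_zero] at h2
          linarith
        have h2 := h1.image (g := m) (fun w hw => DifferentiableAt.differentiableWithinAt
          ((differentiableAt_const _).add ((differentiableAt_const _).div (by fun_prop) (hmn w hw))))
          (fun z hz w hw hzw => by
            have hρ' : (ρ : ℂ) ≠ 0 := by exact_mod_cast hρ.ne'
            have h3 := add_left_cancel hzw
            rw [div_eq_div_iff (hmn z hz) (hmn w hw)] at h3
            have := mul_left_cancel₀ (pow_ne_zero 2 hρ') h3
            exact (sub_left_injective this).symm)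
        have h3 : ∀ S : Set ℂ, m '' ((fun z => conj z) '' S) = cRefl c ρ '' S := fun S => by
          rw [Set.image_image m (fun z => conj z)]
          exact image_congr fun z _ => by simp [hm, cRefl]
        rwa [h3, h3, h3] at h2
      have hi1 := hpc.compact
      have hUo : IsOpen (closedBall c ρ ∪ (fun z => g (f z)) '' (V i \ K)) := by
        have := hsig.isOpen_union_image hP hpc hlab (hV.isOpen i) (hV.left_subset i)
        rwa [Function.update_self] at this
      have hres := Cell.iUnion (q := q) hinv ?_ (D := closedBall c ρ) hUo ?_ subset_union_left ?_
      · simp only [rest, image_iUnion (f := cRefl c ρ)]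
        exact hres
      · rintro ⟨l, hl⟩ ⟨l', hl'⟩ hne
        refine disjoint_image_of_injective (cRefl_injective hρ.ne') ?_
        exact (h.disjoint_nbhd hV fun h' => hne (Subtype.ext h')).image hg.inj (hnb l hl) (hnb l' hl')
      · rintro ⟨l, hl⟩ _ ⟨z, hz, rfl⟩
        have h2 := hDn l hl z hz
        rw [mem_closedBall, dist_eq_norm, norm_cRefl_sub, div_le_iff₀ (hρ.trans h2), sq]
        exact mul_le_mul_of_nonneg_left h2.le hρ.le
      · intro φ hφ hφi
        have hVK := hV.diff_eq hP i Subset.rfl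
        have hNK := hV.diff_eq hP i (hV.subset i)
        have hNK' := hV.diff_eq hP i (interior_subset.trans (hV.subset i))
        have hV' : V i \ A i ⊆ Kᶜ := by rw [← hVK]; exact fun z hz => hz.2
        have h5 := hsig.isCompact_union_image hP hpc hlab (hV.compact i) (hV.subset_interior i)
          (hV.subset i) fun l hl => (hV.disj l i hl).mono_left (hV.left_subset l)
        have h6 := hsig.isOpen_union_image hP hpc hlab isOpen_interior (hV.subset_interior i)
        rw [Function.update_self] at h5 h6
        have key := hV.area i (closedBall c ρ) (fun z => g (f z)) φ (hsig.diff.mono hV') (hsig.inj.mono hV')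
          (by
            rw [disjoint_left]
            rintro _ hz ⟨w, hw, rfl⟩
            refine hpc.subset i ?_ ⟨w, hV' hw, rfl⟩
            rwa [Function.update_self])
          (by rwa [← hNK]) (by rwa [← hNK']) (by rwa [← hVK]) ⟨c, mem_closedBall_self hρ.le⟩
          (by rwa [← hVK]) (by rwa [← hVK])
        rwa [← hVK] at key
    · simp only [Function.update_of_ne hi]
      have := hcell i hi
      rwa [image_union, Set.image_image g f] at this
  · rcases eq_or_ne i j with rfl | hi
    · simp only [Function.update_self]
      rintro _ ⟨z, hz, rfl⟩
      obtain ⟨l, hl, hz⟩ := mem_rest.1 hz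
      have h2 := hDn l hl z (image_mono ((h.sub l).trans subset_union_left) hz)
      rw [mem_closedBall, dist_eq_norm, norm_cRefl_sub, div_le_iff₀ (hρ.trans h2), sq]
      exact mul_le_mul_of_nonneg_left h2.le hρ.le
    · simp only [Function.update_of_ne hi]
      exact image_mono (h.sub i)

end Step

end State

end State

section Extension

variable {ι : Type*} {K : Set ℂ} {A V N E L C : ι → Set ℂ} {f g : ℂ → ℂ} {q : ℝ≥0} {M : ℝ≥0∞}
  {ε : ι → ℝ≥0∞}

/-- Maps rounding the `i`-th piece extend across it, up to the set `L i`. -/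
def Extends (E L : ι → Set ℂ) (i : ι) : Prop :=
  ∀ (ψ : ℂ → ℂ) (c : ℂ) (r : ℝ), Sig (E i ∪ rest L i) ψ → 0 < r →
    (∀ z ∈ (E i ∪ rest L i)ᶜ, ψ z ∉ closedBall c r) →
    Tendsto (fun z => ‖ψ z - c‖) (𝓝ˢ (E i) ⊓ 𝓟 (E i ∪ rest L i)ᶜ) (𝓝 r) →
    ∃ u : ℂ → ℂ, Sig (⋃ j, L j) u ∧ EqOn u ψ (E i ∪ rest L i)ᶜ ∧ ∀ z ∈ E i \ L i,
      u z ∈ closedBall c r ∧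
        u z ∈ sphere c r ∪ {c} ∪ cRefl c r '' (ψ '' (E i ∪ rest L i)ᶜ)

lemma union_rest (L : ι → Set ℂ) (i : ι) : L i ∪ rest L i = ⋃ j, L j := by
  ext z
  simp only [mem_union, mem_rest, mem_iUnion]
  constructor
  · rintro (h | ⟨l, -, h⟩)
    exacts [⟨i, h⟩, ⟨l, h⟩]
  · rintro ⟨l, h⟩
    rcases eq_or_ne l i with rfl | hl
    exacts [Or.inl h, Or.inr ⟨l, hl, h⟩]

lemma Extends.initial (A : ι → Set ℂ) (i : ι) : Extends A A i := fun ψ c r hψ _ _ _ =>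
  ⟨ψ, by rwa [← union_rest A i], fun _ _ => rfl, fun z hz => absurd hz.1 hz.2⟩

lemma rest_update [DecidableEq ι] (L : ι → Set ℂ) (j : ι) (S : Set ℂ) :
    rest (Function.update L j S) j = rest L j := by
  ext z
  simp only [mem_rest]
  exact exists_congr fun l => and_congr_right fun h => by rw [Function.update_of_ne h]

lemma Sig.comp_of_mapsTo {K K' : Set ℂ} {f g : ℂ → ℂ} (hf : Sig K f) (hg : Sig K' g)
    (h : MapsTo f Kᶜ K'ᶜ) : Sig K (fun z => g (f z)) := by
  refine ⟨hg.diff.comp hf.diff h, hg.inj.comp hf.inj h, ?_⟩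
  have := (hg.inf.comp (tendsto_cocompact_of_sub hf.inf)).add hf.inf
  rw [zero_add] at this
  refine this.congr fun z => ?_
  simp

lemma tendsto_norm_sub_nhdsSet_closedBall {l : Filter ℂ} {ψ : ℂ → ℂ} {c : ℂ} {r : ℝ} (hr : 0 ≤ r)
    (h : Tendsto ψ l (𝓝ˢ (closedBall c r))) (h' : ∀ᶠ z in l, ψ z ∉ closedBall c r) :
    Tendsto (fun z => ‖ψ z - c‖) l (𝓝 r) := by
  rw [Metric.tendsto_nhds]
  intro δ hδ
  have h1 : ball c (δ + r) ∈ 𝓝ˢ (closedBall c r) :=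
    isOpen_ball.mem_nhdsSet.2 (closedBall_subset_ball (by linarith))
  filter_upwards [h h1, h'] with z h2 h3
  rw [mem_preimage, mem_ball, dist_eq_norm] at h2
  rw [mem_closedBall, dist_eq_norm, not_le] at h3
  rw [Real.dist_eq, abs_lt]
  constructor <;> linarith

lemma Sig.notMem_closedBall {E : Set ℂ} {c : ℂ} {ρ : ℝ} (hD : img E g = closedBall c ρ) {z : ℂ}
    (hz : z ∈ Eᶜ) : g z ∉ closedBall c ρ := by
  rw [← hD, ← mem_compl_iff, compl_img]; exact ⟨z, hz, rfl⟩

namespace State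

variable [DecidableEq ι] {j : ι} {c : ℂ} {ρ : ℝ}

lemma sub_compl (h : State K A V M f E L C ε) {l j : ι} (hl : l ≠ j) : E l ⊆ (E j)ᶜ :=
  subset_compl_iff_disjoint_right.2 (h.pieces.disj l j hl)

/-- The rounding map of a piece extends by reflection. -/
lemma exists_ext [Finite ι] (h : State K A V M f E L C ε) (hP : Pieces K A) (hc : IsPreconnected Kᶜ)
    (hx : Extends E L j) (hg : Sig (E j) g) (hρ : 0 < ρ) (hD : img (E j) g = closedBall c ρ) :
    ∃ u : ℂ → ℂ, Sig (⋃ j, L j) u ∧ EqOn u g (E j ∪ rest L j)ᶜ ∧ ∀ z ∈ E j \ L j,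
      u z ∈ closedBall c ρ ∧
        u z ∈ sphere c ρ ∪ {c} ∪ cRefl c ρ '' (g '' (E j ∪ rest L j)ᶜ) := by
  have hav : ∀ z ∈ (E j ∪ rest L j)ᶜ, g z ∉ closedBall c ρ := fun z hz =>
    Sig.notMem_closedBall hD fun h' => hz (Or.inl h')
  refine hx g c ρ (hg.mono subset_union_left) hρ hav ?_
  refine tendsto_norm_sub_nhdsSet_closedBall hρ.le ?_ (mem_inf_of_right hav)
  have := hg.tendsto_nhdsSet_img (h.pieces.compact j) (h.pieces.conn j)
      (h.pieces.isPreconnected_compl (h.sig.isPreconnected_compl_img hc) j)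
  rw [hD] at this
  exact this.mono_left (inf_le_inf_left _ (principal_mono.2 (compl_subset_compl.2 subset_union_left)))

/-- The extension property passes to the next state. -/
theorem step_ext [Finite ι] (h : State K A V M f E L C ε) (hV : Collars A V N q)
    (hc : IsPreconnected Kᶜ) (hP : Pieces K A) (hx : ∀ i, Extends E L i)
    (hg : Sig (E j) g) (hρ : 0 < ρ) (hD : img (E j) g = closedBall c ρ) (i : ι) :
    Extends (Function.update (fun l => g '' E l) j (closedBall c ρ))
      (Function.update (fun l => g '' L l) j (cRefl c ρ '' rest (fun l => g '' L l) j)) i := by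
  have hav : ∀ z ∈ (E j)ᶜ, g z ∉ closedBall c ρ := fun z hz => Sig.notMem_closedBall hD hz
  have hgE : ∀ l, l ≠ j → ∀ z ∈ g '' E l, z ∉ closedBall c ρ := by
    rintro l hl _ ⟨w, hw, rfl⟩
    exact hav w (h.sub_compl hl hw)
  have hLc : ∀ l, IsCompact (L l) := fun l => (h.cell l).isCompact_left
  have hgLc : IsCompact (rest (fun l => g '' L l) j) :=
    isCompact_iUnion fun l => (hLc l).image_of_continuousOn
      (hg.diff.continuousOn.mono ((h.sub l).trans (h.sub_compl l.2)))
  have hdH : Disjoint (closedBall c ρ) (rest (fun l => g '' L l) j) := by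
    rw [disjoint_right]
    intro z hz
    obtain ⟨l, hl, hz⟩ := mem_rest.1 hz
    exact hgE l hl z (image_mono (h.sub l) hz)
  rcases eq_or_ne i j with rfl | hij
  · intro ψ c' r hψ hr hav' hlim
    rw [Function.update_self, rest_update] at hψ hav' hlim
    obtain ⟨u, hu, hue, huD⟩ := Sig.exists_cRefl hgLc hρ hdH hψ hr hav' hlim
    refine ⟨u, ?_, ?_, ?_⟩
    · rw [← union_rest _ i, Function.update_self, rest_update, union_comm]
      exact hu
    · rwa [Function.update_self, rest_update]
    · rwa [Function.update_self, Function.update_self, rest_update]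
  obtain ⟨v, hv, hve, hvD⟩ := h.exists_ext hP hc (hx j) hg hρ hD
  intro ψ c' r hψ hr hav' hlim
  set L' := Function.update (fun l => g '' L l) j (cRefl c ρ '' rest (fun l => g '' L l) j) with hL'
  have hL'j : L' j = cRefl c ρ '' rest (fun l => g '' L l) j := Function.update_self _ _ _
  have hL'l : ∀ l, l ≠ j → L' l = g '' L l := fun l hl => Function.update_of_ne hl _ _
  rw [Function.update_of_ne hij] at hψ hav' hlim
  rw [Function.update_of_ne hij]
  have hL'D : L' j ⊆ closedBall c ρ := by
    rw [hL'j]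
    rintro _ ⟨z, hz, rfl⟩
    have h2 : ρ < ‖z - c‖ := by
      have := disjoint_right.1 hdH hz
      rwa [mem_closedBall, dist_eq_norm, not_le] at this
    rw [mem_closedBall, dist_eq_norm, norm_cRefl_sub, div_le_iff₀ (hρ.trans h2), sq]
    exact mul_le_mul_of_nonneg_left h2.le hρ.le
  have hdom1 : ∀ z ∈ (E i ∪ rest L i)ᶜ, z ∉ E j → z ∈ (E j ∪ rest L j)ᶜ := by
    rintro z hz hzj (h1 | h1)
    · exact hzj h1
    · obtain ⟨l, hl, hzl⟩ := mem_rest.1 h1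
      rcases eq_or_ne l i with rfl | hli
      · exact hz (Or.inl (h.sub l hzl))
      · exact hz (Or.inr (mem_rest.2 ⟨l, hli, hzl⟩))
  have hinjE : ∀ {z l}, l ≠ j → z ∉ E j → g z ∈ g '' E l → z ∈ E l := by
    rintro z l hl hz ⟨w, hw, hwz⟩
    rwa [← hg.inj (h.sub_compl hl hw) hz hwz]
  have hinjL : ∀ {z l}, l ≠ j → z ∉ E j → g z ∈ g '' L l → z ∈ L l := by
    rintro z l hl hz ⟨w, hw, hwz⟩
    rwa [← hg.inj (h.sub_compl hl (h.sub l hw)) hz hwz]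
  have hmaps : MapsTo v (E i ∪ rest L i)ᶜ (g '' E i ∪ rest L' i)ᶜ := by
    intro z hz
    by_cases hzj : z ∈ E j
    · have hzL : z ∉ L j := fun h' => hz (Or.inr (mem_rest.2 ⟨j, hij.symm, h'⟩))
      obtain ⟨h1, h2⟩ := hvD z ⟨hzj, hzL⟩
      rintro (h3 | h3)
      · exact hgE i hij _ h3 h1
      · obtain ⟨l, hl, hzl⟩ := mem_rest.1 h3
        rcases eq_or_ne l j with rfl | hlj
        · rw [hL'j, mem_image_cRefl hρ.ne'] at hzl
          have h5 := disjoint_right.1 hdH hzl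
          rw [mem_closedBall, dist_eq_norm, norm_cRefl_sub, not_le] at h5
          rcases h2 with (h2 | h2) | ⟨_, ⟨w, hw, rfl⟩, h2⟩
          · rw [mem_sphere, dist_eq_norm] at h2
            rw [h2, sq, mul_div_cancel_right₀ _ hρ.ne'] at h5
            exact lt_irrefl _ h5
          · rw [mem_singleton_iff.1 h2] at h5
            simp only [sub_self, norm_zero, _root_.div_zero] at h5
            exact absurd h5 (not_lt.2 hρ.le)
          · rw [← h2, cRefl_cRefl hρ.ne'] at hzl
            obtain ⟨m, hm, hwm⟩ := mem_rest.1 hzl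
            exact hw (Or.inr (mem_rest.2 ⟨m, hm, hinjL hm (fun h' => hw (Or.inl h')) hwm⟩))
        · rw [hL'l l hlj] at hzl
          exact hgE l hlj _ (image_mono (h.sub l) hzl) h1
    · rw [hve (hdom1 z hz hzj)]
      rintro (h3 | h3)
      · exact hz (Or.inl (hinjE hij hzj h3))
      · obtain ⟨l, hl, hzl⟩ := mem_rest.1 h3
        rcases eq_or_ne l j with rfl | hlj
        · exact hav z hzj (hL'D hzl)
        · rw [hL'l l hlj] at hzl
          exact hz (Or.inr (mem_rest.2 ⟨l, hl, hinjL hlj hzj hzl⟩))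
  have hLi : (⋃ l, L l) ⊆ E i ∪ rest L i := by
    rw [← union_rest L i]; exact union_subset_union_left _ (h.sub i)
  have hθ : Sig (E i ∪ rest L i) (fun z => ψ (v z)) := (hv.mono hLi).comp_of_mapsTo hψ hmaps
  have hEjo : IsOpen (E j)ᶜ := (h.pieces.compact j).isClosed.isOpen_compl
  have hlimv : Tendsto v (𝓝ˢ (E i) ⊓ 𝓟 (E i ∪ rest L i)ᶜ)
      (𝓝ˢ (g '' E i) ⊓ 𝓟 (g '' E i ∪ rest L' i)ᶜ) := by
    refine tendsto_inf.2 ⟨?_, tendsto_principal.2 (mem_inf_of_right hmaps)⟩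
    have h1 : Tendsto g (𝓝ˢ (E i)) (𝓝ˢ (g '' E i)) := by
      refine fun U hU => ?_
      rw [mem_map, mem_nhdsSet_iff_forall]
      intro z hz
      exact (hg.diff.continuousOn.continuousAt (hEjo.mem_nhds (h.sub_compl hij hz)))
        (mem_nhdsSet_iff_forall.1 hU _ ⟨z, hz, rfl⟩)
    refine (h1.mono_left inf_le_left).congr' ?_
    filter_upwards [mem_inf_of_left (hEjo.mem_nhdsSet.2 (h.sub_compl hij)),
      mem_inf_of_right (mem_principal_self _)] with z h2 h3
    exact (hve (hdom1 z h3 h2)).symm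
  obtain ⟨θ, hθS, hθe, hθD⟩ := hx i (fun z => ψ (v z)) c' r hθ hr (fun z hz => hav' _ (hmaps hz))
    (hlim.comp hlimv)
  obtain ⟨k, hk, -, hkg, hgk⟩ := hg.exists_inv (h.pieces.compact j)
  rw [hD] at hgk hk
  have hkE : ∀ {l z}, l ≠ j → z ∉ closedBall c ρ → (k z ∈ E l ↔ z ∈ g '' E l) := by
    intro l z hl hz
    constructor
    · exact fun h' => ⟨k z, h', (hgk z hz).2⟩
    · rintro ⟨w, hw, rfl⟩
      rwa [hkg w (h.sub_compl hl hw)]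
  have hkL : ∀ {l z}, l ≠ j → z ∉ closedBall c ρ → (k z ∈ L l ↔ z ∈ g '' L l) := by
    intro l z hl hz
    constructor
    · exact fun h' => ⟨k z, h', (hgk z hz).2⟩
    · rintro ⟨w, hw, rfl⟩
      rwa [hkg w (h.sub_compl hl (h.sub l hw))]
  have hgEc : IsCompact (g '' E i) := (h.pieces.compact i).image_of_continuousOn
    (hg.diff.continuousOn.mono (h.sub_compl hij))
  have hL'c : ∀ l, IsCompact (L' l) := by
    intro l
    rcases eq_or_ne l j with rfl | hl
    · rw [hL'j]
      refine hgLc.image_of_continuousOn fun z hz => (continuousAt_cRefl ?_).continuousWithinAt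
      rintro rfl
      exact disjoint_right.1 hdH hz (mem_closedBall_self hρ.le)
    · rw [hL'l l hl]
      exact (hLc l).image_of_continuousOn
        (hg.diff.continuousOn.mono ((h.sub l).trans (h.sub_compl hl)))
  have hdomo : IsOpen (g '' E i ∪ rest L' i)ᶜ :=
    (hgEc.union (isCompact_rest hL'c i)).isClosed.isOpen_compl
  classical
  set u : ℂ → ℂ := fun z => if z ∈ g '' E i then θ (k z) else ψ z with hu
  have u1 : ∀ z ∈ g '' E i, u z = θ (k z) := fun z hz => if_pos hz
  have u2 : ∀ z, z ∉ g '' E i → u z = ψ z := fun z hz => if_neg hz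
  have hcase : ∀ z ∈ (⋃ l, L' l)ᶜ, z ∉ g '' E i → z ∈ (g '' E i ∪ rest L' i)ᶜ := by
    rintro z hz h1 (h2 | h2)
    · exact h1 h2
    · exact hz (by rw [← union_rest L' i]; exact Or.inr h2)
  have hkL' : ∀ z ∈ (⋃ l, L' l)ᶜ, z ∈ g '' E i → k z ∈ E i \ L i ∧ k z ∈ (⋃ l, L l)ᶜ := by
    intro z hz h1
    have hzD := hgE i hij z h1
    have h2 := (hkE hij hzD).2 h1
    have h3 : k z ∉ L i := fun h' => hz (mem_iUnion.2 ⟨i, by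
      rw [hL'l i hij]; exact (hkL hij hzD).1 h'⟩)
    refine ⟨⟨h2, h3⟩, fun h' => ?_⟩
    obtain ⟨l, hl⟩ := mem_iUnion.1 h'
    rw [h.pieces.eq_of_mem (h.sub l hl) h2] at hl
    exact h3 hl
  have hkdiff : ∀ z, z ∉ closedBall c ρ → DifferentiableAt ℂ k z := fun z hz =>
    hk.diff.differentiableAt (isClosed_closedBall.isOpen_compl.mem_nhds hz)
  have hθnear : ∀ z, z ∉ closedBall c ρ → k z ∈ (E i ∪ rest L i)ᶜ → θ (k z) = ψ z := by
    intro z hz h1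
    refine (hθe h1).trans ?_
    change ψ (v (k z)) = ψ z
    rw [hve (hdom1 _ h1 (hgk z hz).1), (hgk z hz).2]
  refine ⟨u, ⟨?_, ?_, ?_⟩, ?_, ?_⟩
  · intro z hz
    refine DifferentiableAt.differentiableWithinAt ?_
    by_cases h1 : z ∈ g '' E i
    · have hzD := hgE i hij z h1
      obtain ⟨h2, h3⟩ := hkL' z hz h1
      have hLo : IsOpen (⋃ l, L l)ᶜ := (isCompact_iUnion hLc).isClosed.isOpen_compl
      have hd1 := hθS.diff.differentiableAt (hLo.mem_nhds h3)
      refine (DifferentiableAt.comp (g := θ) z hd1 (hkdiff z hzD)).congr_of_eventuallyEq ?_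
      have hro : k z ∈ (rest L i)ᶜ := fun h' => h3 (by rw [← union_rest L i]; exact Or.inr h')
      filter_upwards [isClosed_closedBall.isOpen_compl.mem_nhds hzD, (hkdiff z hzD).continuousAt
        ((isCompact_rest hLc i).isClosed.isOpen_compl.mem_nhds hro)] with w hw1 hw2
      by_cases hwE : w ∈ g '' E i
      · exact u1 w hwE
      · rw [u2 w hwE]
        refine (hθnear w hw1 ?_).symm
        rintro (h4 | h4)
        · exact hwE ((hkE hij hw1).1 h4)
        · exact hw2 h4
    · refine (hψ.diff.differentiableAt (hdomo.mem_nhds (hcase z hz h1))).congr_of_eventuallyEq ?_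
      filter_upwards [hgEc.isClosed.isOpen_compl.mem_nhds h1] with w hw
      exact u2 w hw
  · intro z hz w hw hzw
    by_cases h1 : z ∈ g '' E i <;> by_cases h2 : w ∈ g '' E i
    · rw [u1 z h1, u1 w h2] at hzw
      have := hθS.inj (hkL' z hz h1).2 (hkL' w hw h2).2 hzw
      exact hk.inj (hgE i hij z h1) (hgE i hij w h2) this
    · rw [u1 z h1, u2 w h2] at hzw
      exact absurd (hzw ▸ (hθD _ (hkL' z hz h1).1).1) (hav' w (hcase w hw h2))
    · rw [u2 z h1, u1 w h2] at hzw
      exact absurd (hzw.symm ▸ (hθD _ (hkL' w hw h2).1).1) (hav' z (hcase z hz h1))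
    · rw [u2 z h1, u2 w h2] at hzw
      exact hψ.inj (hcase z hz h1) (hcase w hw h2) hzw
  · refine hψ.inf.congr' ?_
    filter_upwards [hgEc.compl_mem_cocompact] with z hz
    rw [u2 z hz]
  · exact fun z hz => u2 z fun h' => hz (Or.inl h')
  · rintro z ⟨hz, hzL⟩
    have hzU : z ∈ (⋃ l, L' l)ᶜ := by
      intro h'
      obtain ⟨l, hl⟩ := mem_iUnion.1 h'
      rcases eq_or_ne l j with rfl | hlj
      · exact hgE i hij z hz (hL'D hl)
      · rw [hL'l l hlj] at hl
        have h5 := (hkE hij (hgE i hij z hz)).2 hz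
        have h6 := (hkL hlj (hgE i hij z hz)).2 hl
        rw [h.pieces.eq_of_mem (h.sub l h6) h5] at hl
        exact hzL (by rw [hL'l i hij]; exact hl)
    obtain ⟨h1, h2⟩ := hθD _ (hkL' z hzU hz).1
    rw [u1 z hz]
    refine ⟨h1, h2.imp_right ?_⟩
    rintro ⟨_, ⟨w, hw, rfl⟩, h3⟩
    exact ⟨_, ⟨v w, hmaps hw, rfl⟩, h3⟩

end State

end Extension

section Iterate

variable {ι : Type*} {K : Set ℂ} {A V N E L C : ι → Set ℂ} {f g : ℂ → ℂ} {q : ℝ≥0} {M : ℝ≥0∞}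
  {ε : ι → ℝ≥0∞}

/-- The displacement of a map defined off cells of total relative size `t`. -/
def shift (M : ℝ≥0∞) (R : ℝ) (t : ℝ≥0∞) : ℝ≥0∞ :=
  (M * volume (closedBall (0 : ℂ) (80 * (80 * R)))) ^ (1 / 2 : ℝ) *
    (t * volume (closedBall (0 : ℂ) (80 * R))) ^ (1 / 2 : ℝ)

lemma tendsto_shift {M q : ℝ≥0} (hq : q < 1) (R : ℝ) (n : ℕ) :
    Tendsto (fun k : ℕ => n * shift M R ((q : ℝ≥0∞) ^ k)) atTop (𝓝 0) := by
  have hB : ∀ r, volume (closedBall (0 : ℂ) r) ≠ ∞ := fun r => measure_closedBall_lt_top.ne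
  have h1 : Tendsto (fun k : ℕ => (q : ℝ≥0∞) ^ k) atTop (𝓝 0) :=
    ENNReal.tendsto_pow_atTop_nhds_zero_of_lt_one (by exact_mod_cast hq)
  have h2 := ENNReal.Tendsto.mul_const (b := volume (closedBall (0 : ℂ) (80 * R))) h1 (Or.inr (hB _))
  have h3 := (ENNReal.continuous_rpow_const (y := (1 / 2 : ℝ))).tendsto _ |>.comp h2
  rw [zero_mul, ENNReal.zero_rpow_of_pos (by norm_num)] at h3
  have hc : (M * volume (closedBall (0 : ℂ) (80 * (80 * R)))) ^ (1 / 2 : ℝ) ≠ ∞ :=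
    ENNReal.rpow_ne_top_of_nonneg (by norm_num) (ENNReal.mul_ne_top (by simp) (hB _))
  have h4 := ENNReal.Tendsto.const_mul (a := (n : ℝ≥0∞)) (ENNReal.Tendsto.const_mul h3 (Or.inr hc))
    (Or.inr (ENNReal.natCast_ne_top n))
  rw [mul_zero, mul_zero] at h4
  exact h4

namespace State

lemma enorm_sub_le [Finite ι] (h : State K A V M f E L C ε) (hV : Collars A V N q) {R : ℝ}
    (hR : 0 < R) (hKR : K ⊆ closedBall 0 R) (hVR : ∀ i, V i ⊆ closedBall 0 R) {t : ℝ≥0∞}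
    (ht : ∀ i, ε i ≤ t) {u : ℂ → ℂ} (hu : Sig (⋃ i, L i) u) {w : ℂ} (hw : 80 * R + 1 ≤ ‖w‖) :
    ‖u w - w‖ₑ ≤ shift M R t := by
  have hc := Cell.iUnion (fun i => (h.cell i).mono (ht i)) (fun i j hij => h.disjoint_nbhd hV hij)
    (q := 1) (D := ⋃ i, (E i ∪ f '' (V i \ K))) (U := ⋃ i, (E i ∪ f '' (V i \ K)))
    (isOpen_iUnion fun i => (h.cell i).isOpen) (fun i => subset_iUnion (fun i => E i ∪ f '' (V i \ K)) i) Subset.rfl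
    fun _ _ _ => by rw [one_mul]
  rw [one_mul] at hc
  refine Sig.enorm_sub_le (by linarith) hc (iUnion_subset fun i => union_subset ?_ ?_) hu hw
  · exact (h.pieces.subset i).trans (Sig.img_subset hR hKR h.sig)
  · rintro _ ⟨z, hz, rfl⟩
    have := hVR i hz.1
    rw [mem_closedBall_zero_iff] at this ⊢
    exact h.sig.norm_le hR hKR hz.2 this

lemma le_norm (h : State K A V M f E L C ε) (hK : IsCompact K) {R : ℝ}
    (hR : 0 < R) (hKR : K ⊆ closedBall 0 R) {z : ℂ} (hz : 6400 * R + 81 ≤ ‖z‖) : 80 * R + 1 ≤ ‖f z‖ := by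
  obtain ⟨g, hg, -, hgf, -⟩ := h.sig.exists_inv hK
  have hzK : z ∈ Kᶜ := fun h' => by
    have := hKR h'
    rw [mem_closedBall_zero_iff] at this
    linarith
  by_contra! hcon
  have h1 := hg.norm_le (R := 80 * R + 1) (by linarith)
    ((Sig.img_subset hR hKR h.sig).trans (closedBall_subset_closedBall (by linarith)))
    (z := f z) (by rw [compl_img]; exact ⟨z, hzK, rfl⟩) hcon.le
  rw [hgf z hzK] at h1
  linarith

end State

/-- The `i`-th complementary piece of the image of `f` is a disc. -/
def RoundAt (K : Set ℂ) (A : ι → Set ℂ) (f : ℂ → ℂ) (i : ι) : Prop :=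
  ∃ E : ι → Set ℂ, Pieces (img K f) E ∧ (∀ l, Tendsto f (𝓝ˢ (A l) ⊓ 𝓟 Kᶜ) (𝓝ˢ (E l))) ∧
    ∃ c ρ, 0 < ρ ∧ E i = closedBall c ρ

/-- The map `f` is reached by the Koebe iteration, with cells of relative size `t`, and `q * t` for
the pieces in `s`. -/
def Reached (K : Set ℂ) (A V : ι → Set ℂ) (M q t : ℝ≥0∞) (s : Finset ι) (f : ℂ → ℂ) : Prop :=
  ∃ (E L C : ι → Set ℂ) (ε : ι → ℝ≥0∞), State K A V M f E L C ε ∧ (∀ i, Extends E L i) ∧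
    (∀ i, ε i ≤ t) ∧ ∀ i ∈ s, ε i ≤ q * t

namespace Reached

variable [Finite ι] {t : ℝ≥0∞} {s : Finset ι} {R : ℝ}

lemma sig (h : Reached K A V M q t s f) : Sig K f := by
  obtain ⟨E, L, C, ε, h, -⟩ := h; exact h.sig

lemma step [DecidableEq ι] (h : Reached K A V M q t s f) (hV : Collars A V N q) (hq : q ≤ 1)
    (hc : IsPreconnected Kᶜ) (hP : Pieces K A) (hA : ∀ i, (A i).Nontrivial) (hR : 0 < R)
    (hKR : K ⊆ closedBall 0 R) (hVR : ∀ i, V i ⊆ closedBall 0 R) (j : ι) :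
    ∃ F, Reached K A V M q t (insert j s) F ∧ RoundAt K A F j ∧
      ∀ z, 6400 * R + 81 ≤ ‖z‖ → ‖F z - f z‖ₑ ≤ shift M R t := by
  obtain ⟨E, L, C, ε, h, hx, ht, hs⟩ := h
  obtain ⟨g, c, ρ, hρ, hg, hD⟩ := exists_sig_closedBall (h.pieces.compact j) (h.pieces.conn j)
    (h.pieces.isPreconnected_compl (h.sig.isPreconnected_compl_img hc) j)
    (Sig.nontrivial_of_pieces hP h.sig h.pieces (h.lab j) (hA j))
  have h' := h.step hV hc hP hg hρ hD (t := t) fun l _ => ht l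
  have hqt : (q : ℝ≥0∞) * t ≤ t := mul_le_of_le_one_left' (by exact_mod_cast hq)
  refine ⟨fun z => g (f z), ⟨_, _, _, _, h', h.step_ext hV hc hP hx hg hρ hD, fun i => ?_,
    fun i hi => ?_⟩, ⟨_, h'.pieces, h'.lab, c, ρ, hρ, Function.update_self _ _ _⟩, fun z hz => ?_⟩
  · rcases eq_or_ne i j with rfl | hij
    · rwa [Function.update_self]
    · rw [Function.update_of_ne hij]; exact ht i
  · rcases eq_or_ne i j with rfl | hij
    · rw [Function.update_self]
    · rw [Function.update_of_ne hij]; exact hs i ((Finset.mem_insert.1 hi).resolve_left hij)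
  · obtain ⟨u, hu, hue, -⟩ := h.exists_ext hP hc (hx j) hg hρ hD
    have h1 := h.le_norm hP.isCompact hR hKR hz
    have h2 : f z ∈ (E j ∪ rest L j)ᶜ := by
      have h3 : E j ∪ rest L j ⊆ img K f := union_subset (h.pieces.subset j)
        (iUnion_subset fun l => (h.sub l).trans (h.pieces.subset l))
      intro h4
      have := Sig.img_subset hR hKR h.sig (h3 h4)
      rw [mem_closedBall_zero_iff] at this
      linarith
    change ‖g (f z) - f z‖ₑ ≤ _
    rw [← hue h2]
    exact h.enorm_sub_le hV hR hKR hVR ht hu h1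

lemma cycle (h : Reached K A V M q t ∅ f) (hV : Collars A V N q) (hq : q ≤ 1)
    (hc : IsPreconnected Kᶜ) (hP : Pieces K A) (hA : ∀ i, (A i).Nontrivial) (hR : 0 < R)
    (hKR : K ⊆ closedBall 0 R) (hVR : ∀ i, V i ⊆ closedBall 0 R) (s : Finset ι) :
    ∃ F, Reached K A V M q t s F ∧
      (∀ z, 6400 * R + 81 ≤ ‖z‖ → ‖F z - f z‖ₑ ≤ s.card * shift M R t) ∧
      ∀ i ∈ s, ∃ G, Sig K G ∧ RoundAt K A G i ∧
        ∀ z, 6400 * R + 81 ≤ ‖z‖ → ‖G z - f z‖ₑ ≤ s.card * shift M R t := by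
  classical
  induction s using Finset.induction_on with
  | empty => exact ⟨f, h, fun z _ => by simp, by simp⟩
  | insert j s hj ih =>
    obtain ⟨F, hF, hFf, hG⟩ := ih
    obtain ⟨F', hF', hr, hd⟩ := hF.step hV hq hc hP hA hR hKR hVR j
    have hcard : (((insert j s).card : ℕ) : ℝ≥0∞) * shift M R t =
        shift M R t + s.card * shift M R t := by
      rw [Finset.card_insert_of_notMem hj]; push_cast; ring
    have hd' : ∀ z, 6400 * R + 81 ≤ ‖z‖ →
        ‖F' z - f z‖ₑ ≤ ((insert j s).card : ℕ) * shift M R t := fun z hz => by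
      rw [hcard, ← sub_add_sub_cancel _ (F z)]
      exact (enorm_add_le _ _).trans (add_le_add (hd z hz) (hFf z hz))
    refine ⟨F', hF', hd', fun i hi => ?_⟩
    rcases Finset.mem_insert.1 hi with rfl | hi
    · exact ⟨F', hF'.sig, hr, hd'⟩
    · obtain ⟨G, hG1, hG2, hG3⟩ := hG i hi
      exact ⟨G, hG1, hG2, fun z hz => (hG3 z hz).trans (by rw [hcard]; exact le_add_self)⟩

end Reached

/-- There are maps close to one another, each of which rounds one of the pieces. -/
theorem exists_roundAt [Finite ι] (hP : Pieces K A) (hc : IsPreconnected Kᶜ)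
    (hA : ∀ i, (A i).Nontrivial) : ∃ R : ℝ, ∀ δ > 0, ∃ f, Sig K f ∧ ∀ i, ∃ G, Sig K G ∧
      RoundAt K A G i ∧ ∀ z, R ≤ ‖z‖ → ‖G z - f z‖ ≤ δ := by
  have := Fintype.ofFinite ι
  obtain ⟨V, N, q, M, hq, hV, hVC⟩ := hP.exists_collars hc
  choose hVb C hC using hVC
  obtain ⟨R, hR, hKV⟩ := (hP.isCompact.isBounded.union
    (Bornology.isBounded_iUnion.2 hVb)).subset_closedBall_lt 0 0
  have hKR := subset_union_left.trans hKV
  have hVR : ∀ i, V i ⊆ closedBall 0 R := fun i =>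
    (subset_iUnion V i).trans (subset_union_right.trans hKV)
  refine ⟨6400 * R + 81, fun δ hδ => ?_⟩
  have h0 : ∀ k : ℕ, ∃ f, Reached K A V M q ((q : ℝ≥0∞) ^ k) ∅ f := by
    intro k
    induction k with
    | zero => exact ⟨_, _, _, _, _, State.initial hP hV hC, Extends.initial A, by simp, by simp⟩
    | succ k ih =>
      obtain ⟨f, hf⟩ := ih
      obtain ⟨F, ⟨E, L, C', ε, h1, h2, -, h3⟩, -⟩ :=
        hf.cycle hV hq.le hc hP hA hR hKR hVR Finset.univ
      exact ⟨F, E, L, C', ε, h1, h2, fun i => by rw [pow_succ']; exact h3 i (Finset.mem_univ i),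
        by simp⟩
  have hlim := tendsto_shift (M := M) hq R (Finset.univ : Finset ι).card
  obtain ⟨k, hk⟩ := (hlim.eventually (ge_mem_nhds (ENNReal.ofReal_pos.2 hδ))).exists
  obtain ⟨f, hf⟩ := h0 k
  obtain ⟨F, -, -, hG⟩ := hf.cycle hV hq.le hc hP hA hR hKR hVR Finset.univ
  refine ⟨f, hf.sig, fun i => ?_⟩
  obtain ⟨G, hG1, hG2, hG3⟩ := hG i (Finset.mem_univ i)
  refine ⟨G, hG1, hG2, fun z hz => ?_⟩
  have := (hG3 z hz).trans hk
  rwa [← ofReal_norm, ENNReal.ofReal_le_ofReal_iff hδ.le] at this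

end Iterate

section Parameter

variable {ι : Type*} [Finite ι] {K : Set ℂ} {A : ι → Set ℂ}

/-- A one-sided neighbourhood of a complementary piece is parametrized by a round annulus. -/
lemma Pieces.exists_param (hP : Pieces K A) (hc : IsPreconnected Kᶜ) {i : ι}
    (hA : (A i).Nontrivial) : ∃ R₁ > 1, ∃ (κ ζ : ℂ → ℂ) (R : ℝ), 0 < R ∧ K ⊆ closedBall 0 R ∧
      DifferentiableOn ℂ κ (ann 1 R₁) ∧ MapsTo κ (ann 1 R₁) (Kᶜ ∩ closedBall 0 R) ∧
      Tendsto κ (𝓝ˢ (closedBall 0 1) ⊓ 𝓟 (closedBall 0 1)ᶜ) (𝓝ˢ (A i) ⊓ 𝓟 Kᶜ) ∧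
      Tendsto (fun z => ‖ζ z‖) (𝓝ˢ (A i) ⊓ 𝓟 Kᶜ) (𝓝 1) ∧
      ∀ᶠ z in 𝓝ˢ (A i) ⊓ 𝓟 Kᶜ, ζ z ∈ ann 1 R₁ ∧ κ (ζ z) = z := by
  have hcA := hP.isPreconnected_compl hc i
  obtain ⟨χ, c, ρ, hρ, hχ, hD⟩ := exists_sig_closedBall (hP.compact i) (hP.conn i) hcA hA
  obtain ⟨k, hk, hkA, hkχ, hχk⟩ := hχ.exists_inv (hP.compact i)
  rw [hD] at hk hkA hχk
  have hBc : IsPreconnected (closedBall c ρ)ᶜ := by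
    rw [← hD]; exact hχ.isPreconnected_compl_img hcA
  have hBn : IsConnected (closedBall c ρ) :=
    ⟨⟨c, mem_closedBall_self hρ.le⟩, (convex_closedBall c ρ).isPreconnected⟩
  have hk1 := hk.tendsto_nhdsSet_img (isCompact_closedBall c ρ) hBn hBc
  rw [hkA] at hk1
  have hk2 : Tendsto k (𝓝ˢ (closedBall c ρ) ⊓ 𝓟 (closedBall c ρ)ᶜ) (𝓝ˢ (A i) ⊓ 𝓟 Kᶜ) := by
    refine tendsto_inf.2 ⟨hk1, tendsto_principal.2 ?_⟩
    filter_upwards [hk1 (hP.mem_nhdsSet_union i), mem_inf_of_right (mem_principal_self _)]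
      with w h1 h2
    exact h1.resolve_left (hχk w h2).1
  have hχ1 := hχ.tendsto_nhdsSet_img (hP.compact i) (hP.conn i) hcA
  rw [hD] at hχ1
  have hKA : (Kᶜ : Set ℂ) ⊆ (A i)ᶜ := compl_subset_compl.2 (hP.subset i)
  have hχout : ∀ z ∈ (A i)ᶜ, χ z ∈ (closedBall c ρ)ᶜ := fun z hz => Sig.notMem_closedBall hD hz
  set a : ℂ → ℂ := fun ζ => c + ρ * ζ with ha
  set b : ℂ → ℂ := fun w => (w - c) / ρ with hb
  have hρ' : (ρ : ℂ) ≠ 0 := ofReal_ne_zero.2 hρ.ne'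
  have hab : ∀ w, a (b w) = w := fun w => by simp only [ha, hb]; field_simp; ring
  have hnorm : ∀ ζ, ‖a ζ - c‖ = ρ * ‖ζ‖ := fun ζ => by
    simp only [ha, add_sub_cancel_left, norm_mul, norm_real, Real.norm_of_nonneg hρ.le]
  have ha1 : Tendsto a (𝓝ˢ (closedBall 0 1) ⊓ 𝓟 (closedBall 0 1)ᶜ)
      (𝓝ˢ (closedBall c ρ) ⊓ 𝓟 (closedBall c ρ)ᶜ) := by
    refine tendsto_inf.2 ⟨?_, tendsto_principal.2 (mem_inf_of_right fun z hz => ?_)⟩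
    · have hac : Continuous a := by fun_prop
      refine (hac.tendsto_nhdsSet fun z hz => ?_).mono_left inf_le_left
      rw [mem_closedBall_zero_iff] at hz
      rw [mem_closedBall, dist_eq_norm, hnorm]
      nlinarith
    · rw [mem_compl_iff, mem_closedBall_zero_iff, not_le] at hz
      change a z ∈ (closedBall c ρ)ᶜ
      rw [mem_compl_iff, mem_closedBall, dist_eq_norm, hnorm, not_le]
      nlinarith
  have hev := (hk2.comp ha1) (inter_mem_inf Filter.univ_mem (mem_principal_self _))
  rw [univ_inter, mem_map, mem_inf_principal] at hev
  obtain ⟨δ, hδ, hev⟩ := (hasBasis_nhdsSet_thickening (isCompact_closedBall (0 : ℂ) 1)).mem_iff.1 hev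
  obtain ⟨R₀, hR₀⟩ := hk.exists_bound (isCompact_closedBall c ρ) (‖c‖ + ρ * (1 + δ))
  obtain ⟨R, hR, hKR⟩ := hP.isCompact.isBounded.subset_closedBall_lt 0 0
  have hann : ∀ ζ ∈ ann 1 (1 + δ), a ζ ∈ (closedBall c ρ)ᶜ := fun ζ hζ => by
    rw [mem_compl_iff, mem_closedBall, dist_eq_norm, hnorm, not_le]
    nlinarith [hζ.1]
  refine ⟨1 + δ, by linarith, fun ζ => k (a ζ), fun z => b (χ z), max R R₀, lt_max_of_lt_left hR,
    hKR.trans (closedBall_subset_closedBall (le_max_left _ _)), ?_, fun ζ hζ => ⟨?_, ?_⟩,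
    hk2.comp ha1, ?_, ?_⟩
  · refine hk.diff.comp (t := (closedBall c ρ)ᶜ) ?_ hann
    exact ((differentiable_const c).add (differentiable_id.const_mul _)).differentiableOn
  · refine hev ?_ ?_
    · rw [thickening_closedBall hδ zero_le_one, mem_ball_zero_iff, add_comm]; exact hζ.2
    · rw [mem_compl_iff, mem_closedBall_zero_iff, not_le]; exact hζ.1
  · rw [mem_closedBall_zero_iff]
    refine (hR₀ _ (hann ζ hζ) ?_).trans (le_max_right _ _)
    have := norm_add_le c (a ζ - c)
    rw [add_sub_cancel, hnorm] at this
    nlinarith [hζ.2]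
  · have h1 := (tendsto_norm_sub_nhdsSet_closedBall hρ.le hχ1 (mem_inf_of_right hχout)).div_const ρ
    rw [div_self hρ.ne'] at h1
    refine (h1.mono_left (inf_le_inf_left _ (principal_mono.2 hKA))).congr fun z => ?_
    simp only [hb, norm_div, norm_real, Real.norm_of_nonneg hρ.le]
  · have h1 : ball c (ρ * (1 + δ)) ∈ 𝓝ˢ (closedBall c ρ) :=
      isOpen_ball.mem_nhdsSet.2 (closedBall_subset_ball (by nlinarith))
    filter_upwards [(hχ1.mono_left (inf_le_inf_left _ (principal_mono.2 hKA))) h1,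
      mem_inf_of_right (mem_principal_self _)] with z h2 h3
    have h4 := hχout z (hKA h3)
    rw [mem_preimage, mem_ball, dist_eq_norm, ← hab (χ z), hnorm] at h2
    rw [mem_compl_iff, mem_closedBall, dist_eq_norm, ← hab (χ z), hnorm, not_le] at h4
    refine ⟨⟨?_, lt_of_mul_lt_mul_left h2 hρ.le⟩, ?_⟩
    · exact lt_of_mul_lt_mul_left (by rwa [mul_one]) hρ.le
    · change k (a (b (χ z))) = z
      rw [hab, hkχ z (hKA h3)]

end Parameter

section RoundLimit

variable {ι : Type*} [Finite ι] {K : Set ℂ} {A E B : ι → Set ℂ} {F f κ : ℂ → ℂ} {R₁ R ρ : ℝ} {c : ℂ}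
  {i : ι}

lemma norm_le_of_closedBall_subset (hρ : 0 ≤ ρ) {S : ℝ} (h : closedBall c ρ ⊆ closedBall 0 S) :
    ‖c‖ ≤ S ∧ ρ ≤ 2 * S := by
  have h1 := mem_closedBall_zero_iff.1 (h (mem_closedBall_self hρ))
  have h2 : c + ρ ∈ closedBall c ρ := by
    rw [mem_closedBall, dist_eq_norm, add_sub_cancel_left, norm_real, Real.norm_of_nonneg hρ]
  have h3 := mem_closedBall_zero_iff.1 (h h2)
  refine ⟨h1, ?_⟩
  have h4 := norm_sub_le (c + ρ) c
  rw [add_sub_cancel_left, norm_real, Real.norm_of_nonneg hρ] at h4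
  linarith

/-- A map which rounds a piece extends by reflection to the annulus parametrizing the piece. -/
lemma Sig.exists_extension_param (hF : Sig K F) (hE : Pieces (img K F) E)
    (ht : Tendsto F (𝓝ˢ (A i) ⊓ 𝓟 Kᶜ) (𝓝ˢ (E i))) (hρ : 0 < ρ) (hEi : E i = closedBall c ρ)
    (hR₁ : 1 < R₁) (hR : 0 < R) (hKR : K ⊆ closedBall 0 R) (hκ : DifferentiableOn ℂ κ (ann 1 R₁))
    (hκm : MapsTo κ (ann 1 R₁) (Kᶜ ∩ closedBall 0 R))
    (hκt : Tendsto κ (𝓝ˢ (closedBall 0 1) ⊓ 𝓟 (closedBall 0 1)ᶜ) (𝓝ˢ (A i) ⊓ 𝓟 Kᶜ)) :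
    ∃ Q : ℂ → ℂ, DifferentiableOn ℂ Q (ann R₁⁻¹ R₁) ∧ (∀ z ∈ ann 1 R₁, Q z = F (κ z)) ∧
      (∀ z, ‖z‖ = 1 → ‖Q z - c‖ = ρ) ∧ ∀ z ∈ ann R₁⁻¹ R₁, ‖Q z‖ ≤ 240 * R := by
  have hout : ∀ z ∈ Kᶜ, F z ∉ closedBall c ρ := fun z hz h =>
    hE.subset i (hEi ▸ h) ⟨z, hz, rfl⟩
  have hcρ := norm_le_of_closedBall_subset hρ.le
    ((hEi ▸ hE.subset i).trans (Sig.img_subset hR hKR hF))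
  set ψ : ℂ → ℂ := fun z => (F (κ z) - c) / ρ with hψ
  have hρ' : (ρ : ℂ) ≠ 0 := ofReal_ne_zero.2 hρ.ne'
  have hψn : ∀ z, ‖ψ z‖ = ‖F (κ z) - c‖ / ρ := fun z => by
    simp only [hψ, norm_div, norm_real, Real.norm_of_nonneg hρ.le]
  have hψ1 : ∀ z ∈ ann 1 R₁, 1 < ‖ψ z‖ := fun z hz => by
    have := hout _ (hκm hz).1
    rw [mem_closedBall, dist_eq_norm, not_le] at this
    rwa [hψn, one_lt_div hρ]
  have hlim : Tendsto (fun z => ‖ψ z‖) (𝓝ˢ (closedBall 0 1) ⊓ 𝓟 (closedBall 0 1)ᶜ) (𝓝 1) := by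
    rw [hEi] at ht
    have h1 := ((tendsto_norm_sub_nhdsSet_closedBall hρ.le ht (mem_inf_of_right hout)).comp
      hκt).div_const ρ
    rw [div_self hρ.ne'] at h1
    exact h1.congr fun z => (hψn z).symm
  have hψd : DifferentiableOn ℂ ψ (ann 1 R₁) :=
    ((hF.diff.comp hκ fun z hz => (hκm hz).1).sub_const c).div_const _
  obtain ⟨P, hP, hPψ, hPr, hP1⟩ := exists_reflection hR₁ hψd hlim fun z hz h => by
    have := hψ1 z hz
    rw [h, norm_zero] at this
    linarith
  have hQe : ∀ z ∈ ann 1 R₁, c + ρ * P z = F (κ z) := fun z hz => by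
    rw [hPψ hz]
    simp only [hψ]
    field_simp
    ring
  have hPle : ∀ z, ‖P z‖ ≤ 1 → ‖c + ρ * P z‖ ≤ 240 * R := fun z hz => by
    refine (norm_add_le _ _).trans ?_
    rw [norm_mul, norm_real, Real.norm_of_nonneg hρ.le]
    nlinarith
  refine ⟨fun z => c + ρ * P z, (hP.const_mul _).const_add c, hQe, fun z hz => ?_, fun z hz => ?_⟩
  · rw [add_sub_cancel_left, norm_mul, hP1 z hz, norm_real, Real.norm_of_nonneg hρ.le, mul_one]
  · rcases lt_trichotomy ‖z‖ 1 with h1 | h1 | h1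
    · refine hPle z ?_
      have h0 : 0 < ‖z‖ := (inv_pos.2 (by linarith)).trans hz.1
      have h2 : ‖cRefl 0 1 z‖ = ‖z‖⁻¹ := by
        have := norm_cRefl_sub 0 1 z
        rwa [sub_zero, sub_zero, one_pow, one_div] at this
      have h3 : cRefl 0 1 z ∈ ann 1 R₁ := by
        refine ⟨?_, ?_⟩
        · rw [h2]; exact (one_lt_inv₀ h0).2 h1
        · rw [h2]; exact inv_lt_of_inv_lt₀ (by linarith) hz.1
      have h4 := norm_cRefl_sub 0 1 (ψ (cRefl 0 1 z))
      rw [sub_zero, sub_zero, one_pow, one_div] at h4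
      rw [hPr z ⟨hz.1, h1⟩, h4]
      exact inv_le_one_of_one_le₀ (hψ1 _ h3).le
    · exact hPle z (hP1 z h1).le
    · have h2 : z ∈ ann 1 R₁ := ⟨h1, hz.2⟩
      change ‖c + ρ * P z‖ ≤ _
      rw [hQe z h2]
      refine (hF.norm_le hR hKR (hκm h2).1 (mem_closedBall_zero_iff.1 (hκm h2).2)).trans ?_
      linarith

/-- Limits of maps rounding a piece approach a circle along that piece. -/
lemma exists_tendsto_circle {U : Ultrafilter ℕ} {F : ℕ → ℂ → ℂ} {E : ℕ → ι → Set ℂ} {c : ℕ → ℂ}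
    {ρ : ℕ → ℝ} (hP : Pieces K A) (hc : IsPreconnected Kᶜ) (hA : (A i).Nontrivial)
    (hF : ∀ n, Sig K (F n)) (hE : ∀ n, Pieces (img K (F n)) (E n))
    (ht : ∀ n, Tendsto (F n) (𝓝ˢ (A i) ⊓ 𝓟 Kᶜ) (𝓝ˢ (E n i))) (hρ : ∀ n, 0 < ρ n)
    (hEi : ∀ n, E n i = closedBall (c n) (ρ n))
    (hf : ∀ z ∈ Kᶜ, Tendsto (fun n => F n z) U (𝓝 (f z))) :
    ∃ (a : ℂ) (r : ℝ), 0 ≤ r ∧ (∀ z ∈ Kᶜ, f z ∉ ball a r) ∧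
      Tendsto (fun z => ‖f z - a‖) (𝓝ˢ (A i) ⊓ 𝓟 Kᶜ) (𝓝 r) := by
  obtain ⟨R₁, hR₁, κ, ζ, R, hR, hKR, hκd, hκm, hκt, hζ, hκζ⟩ := hP.exists_param hc hA
  choose Q hQd hQF hQ1 hQR using fun n => (hF n).exists_extension_param (hE n) (ht n) (hρ n) (hEi n)
    hR₁ hR hKR hκd hκm hκt
  have hcρ := fun n => norm_le_of_closedBall_subset (hρ n).le
    ((hEi n ▸ (hE n).subset i).trans (Sig.img_subset hR hKR (hF n)))
  obtain ⟨a, ha⟩ := Ultrafilter.exists_tendsto_of_bdd (U := U) (u := c) (x := (0 : ℂ)) (M := 80 * R)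
    (Eventually.of_forall fun n => by simpa using (hcρ n).1)
  obtain ⟨r, hr⟩ := Ultrafilter.exists_tendsto_of_bdd (U := U) (u := ρ) (x := (0 : ℝ))
    (M := 2 * (80 * R)) (Eventually.of_forall fun n => by
      rw [Real.dist_eq, sub_zero, abs_of_pos (hρ n)]; exact (hcρ n).2)
  have hr0 : 0 ≤ r := ge_of_tendsto hr (Eventually.of_forall fun n => (hρ n).le)
  obtain ⟨q, hq⟩ := LocBdd.exists_locConv (U := U) (F := Q) (Dom := fun _ => ann R₁⁻¹ R₁)
    (D := ann R₁⁻¹ R₁) (fun z hz => by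
      obtain ⟨s, hs, h⟩ := Metric.isOpen_iff.1 (isOpen_ann _ _) z hz
      exact ⟨s, hs, 240 * R, Eventually.of_forall fun n => ⟨h, fun w hw => hQR n w (h hw)⟩⟩) hQd
  have hRi : R₁⁻¹ < 1 := inv_lt_one_of_one_lt₀ hR₁
  have hann : ∀ z, ‖z‖ = 1 → z ∈ ann R₁⁻¹ R₁ := fun z hz => ⟨hz ▸ hRi, hz ▸ hR₁⟩
  have hq1 : ∀ z, ‖z‖ = 1 → ‖q z - a‖ = r := fun z hz =>
    tendsto_nhds_unique (((hq.tendsto (hann z hz)).sub ha).norm.congr fun n => hQ1 n z hz) hr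
  have hqf : ∀ z ∈ ann 1 R₁, q z = f (κ z) := fun z hz =>
    tendsto_nhds_unique ((hq.tendsto ⟨hRi.trans hz.1, hz.2⟩).congr fun n => hQF n z hz)
      (hf _ (hκm hz).1)
  refine ⟨a, r, hr0, fun z hz h => ?_, ?_⟩
  · rw [mem_ball, dist_eq_norm] at h
    obtain ⟨n, hn⟩ := ((((hf z hz).sub ha).norm).eventually_lt hr h).exists
    refine (hE n).subset i (?_ : F n z ∈ E n i) ⟨z, hz, rfl⟩
    rw [hEi, mem_closedBall, dist_eq_norm]
    exact hn.le
  · rw [tendsto_iff_ultrafilter]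
    intro 𝒱 h𝒱
    have hζ' := hζ.mono_left h𝒱
    obtain ⟨w, hw⟩ := Ultrafilter.exists_tendsto_of_bdd (U := 𝒱) (u := ζ) (x := (0 : ℂ)) (M := 2)
      ((hζ'.eventually (ge_mem_nhds (by norm_num : (1 : ℝ) < 2))).mono fun z hz => by simpa using hz)
    have hw1 : ‖w‖ = 1 := tendsto_nhds_unique hw.norm hζ'
    have hqw : ContinuousAt q w := (hq.differentiableAt hQd (hann w hw1)).continuousAt
    have h1 := ((hqw.tendsto.comp hw).sub_const a).norm
    rw [hq1 w hw1] at h1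
    refine h1.congr' ?_
    filter_upwards [h𝒱 hκζ] with z hz
    change ‖q (ζ z) - a‖ = _
    rw [hqf _ hz.1, hz.2]

/-- A piece along which the map approaches a circle is a disc. -/
lemma eq_closedBall_of_tendsto_circle (hP : Pieces K A) (hf : Sig K f) (hB : Pieces (img K f) B)
    (ht : ∀ l, Tendsto f (𝓝ˢ (A l) ⊓ 𝓟 Kᶜ) (𝓝ˢ (B l))) (hA : (A i).Nontrivial) {a : ℂ} {r : ℝ}
    (hr : 0 ≤ r) (hout : ∀ z ∈ Kᶜ, f z ∉ ball a r)
    (h : Tendsto (fun z => ‖f z - a‖) (𝓝ˢ (A i) ⊓ 𝓟 Kᶜ) (𝓝 r)) :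
    0 < r ∧ B i = closedBall a r := by
  have hK := hP.isCompact
  obtain ⟨g, hg, -, hgf, -⟩ := hf.exists_inv hK
  have hfr : frontier (B i) ⊆ sphere a r := by
    intro b hb
    have hbB : b ∈ B i := (hB.compact i).isClosed.frontier_subset hb
    have hb' := hB.frontier_subset_closure i hb
    rw [compl_img, mem_closure_iff_clusterPt, ClusterPt] at hb'
    have hne : (comap f (𝓝 b) ⊓ 𝓟 Kᶜ).NeBot := by
      rw [← map_neBot_iff f, Filter.push_pull']
      rwa [map_principal]
    obtain ⟨𝒱, h𝒱⟩ := Ultrafilter.exists_le (comap f (𝓝 b) ⊓ 𝓟 Kᶜ)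
    have hfb : Tendsto f 𝒱 (𝓝 b) := tendsto_comap.mono_left (h𝒱.trans inf_le_left)
    have h𝒱K : Kᶜ ∈ (𝒱 : Filter ℂ) := h𝒱 (mem_inf_of_right (mem_principal_self _))
    obtain ⟨S, hS⟩ := hg.exists_bound (hf.isCompact_img hK) (‖b‖ + 1)
    obtain ⟨z, hz⟩ := Ultrafilter.exists_tendsto_of_bdd (U := 𝒱) (u := fun z => z) (x := (0 : ℂ))
      (M := S) (by
        filter_upwards [h𝒱K, hfb.norm.eventually (ge_mem_nhds (lt_add_one ‖b‖))] with w h1 h2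
        rw [dist_zero_right, ← hgf w h1]
        exact hS _ (by rw [compl_img]; exact ⟨w, h1, rfl⟩) h2)
    have hz' : (𝒱 : Filter ℂ) ≤ 𝓝 z := hz
    have hzK : z ∈ K := by
      by_contra hzK
      have h1 := (hf.diff.differentiableAt (hK.isClosed.isOpen_compl.mem_nhds hzK)).continuousAt
      have h2 := tendsto_nhds_unique (h1.tendsto.mono_left hz') hfb
      exact hB.subset i hbB ⟨z, hzK, h2⟩
    obtain ⟨l, hl⟩ := hP.mem hzK
    have h𝒱A : (𝒱 : Filter ℂ) ≤ 𝓝ˢ (A l) ⊓ 𝓟 Kᶜ :=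
      le_inf (hz'.trans (nhds_le_nhdsSet hl)) (le_principal_iff.2 h𝒱K)
    have hli : l = i := by
      by_contra hli
      obtain ⟨s, hs, hsB⟩ := Metric.isOpen_iff.1 (hB.compact l).isClosed.isOpen_compl b
        (disjoint_right.1 (hB.disj l i hli) hbB)
      have h1 : (closedBall b (s / 2))ᶜ ∈ 𝓝ˢ (B l) := isClosed_closedBall.isOpen_compl.mem_nhdsSet.2
        fun x hx hx' => hsB (closedBall_subset_ball (half_lt_self hs) hx') hx
      obtain ⟨x, hx1, hx2⟩ := (((ht l).mono_left h𝒱A) h1 |> fun h2 => 𝒱.inter_mem_iff.2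
        ⟨h2, hfb (closedBall_mem_nhds b (half_pos hs))⟩ |> 𝒱.nonempty_of_mem)
      exact hx1 hx2
    rw [hli] at h𝒱A
    rw [mem_sphere, dist_eq_norm]
    exact tendsto_nhds_unique ((hfb.sub_const a).norm) (h.mono_left h𝒱A)
  have hBsub : B i ⊆ closedBall a r := by
    intro b hb
    by_contra hbr
    rw [mem_closedBall, dist_eq_norm, not_le] at hbr
    have hcon : IsPreconnected ((fun z => z + a) '' {z : ℂ | r < ‖z‖}) :=
      (isConnected_norm_gt r).isPreconnected.image _ (by fun_prop)
    have hmem : ∀ z, z ∈ (fun z => z + a) '' {z : ℂ | r < ‖z‖} ↔ r < ‖z - a‖ := fun z =>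
      ⟨by rintro ⟨w, hw, rfl⟩; simpa using hw, fun h => ⟨z - a, h, by simp⟩⟩
    have hsub : (fun z => z + a) '' {z : ℂ | r < ‖z‖} ⊆ B i := by
      by_contra hcon'
      rw [not_subset] at hcon'
      obtain ⟨y, hy, hyB⟩ := hcon'
      obtain ⟨w, hw1, hw2⟩ := nonempty_inter_frontier hcon ⟨b, (hmem b).2 hbr, hb⟩ ⟨y, hy, hyB⟩
      have h1 := hfr hw2
      rw [mem_sphere, dist_eq_norm] at h1
      exact absurd ((hmem w).1 hw1) h1.not_gt
    obtain ⟨S, hS⟩ := (hB.compact i).isBounded.subset_closedBall a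
    have h1 : a + ((max r S + 1 : ℝ) : ℂ) ∈ closedBall a S := hS (hsub ((hmem _).2 (by
      rw [add_sub_cancel_left, norm_real]
      exact (lt_of_le_of_lt (le_max_left r S) (lt_add_one _)).trans_le (le_abs_self _))))
    rw [mem_closedBall, dist_eq_norm, add_sub_cancel_left, norm_real] at h1
    linarith [le_abs_self (max r S + 1), le_max_right r S, Real.norm_eq_abs (max r S + 1)]
  have hr0 : 0 < r := by
    refine lt_of_le_of_ne hr fun h0 => ?_
    rw [← h0, closedBall_zero] at hBsub
    exact not_nontrivial_iff.2 (subsingleton_singleton.anti hBsub)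
      (Sig.nontrivial_of_pieces hP hf hB (ht i) hA)
  refine ⟨hr0, hBsub.antisymm ?_⟩
  have hball : ball a r ⊆ img K f := fun z hz ⟨w, hw, hwz⟩ => hout w hw (hwz ▸ hz)
  obtain ⟨l, hl⟩ := hB.mem (hball (mem_ball_self hr0))
  have h1 := hB.subset_of_isPreconnected (convex_ball a r).isPreconnected hball
    (mem_ball_self hr0) hl
  have h2 : closedBall a r ⊆ B l := by
    rw [← closure_ball a hr0.ne']
    exact closure_minimal h1 (hB.compact l).isClosed
  obtain ⟨b, hb⟩ := (hB.conn i).nonempty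
  rwa [hB.eq_of_mem hb (h2 (hBsub hb))]

end RoundLimit

section Existence

variable {ι : Type*} [Finite ι] {K : Set ℂ} {A B : ι → Set ℂ} {f g F : ℂ → ℂ}

/-- Two maps agreeing far away agree. -/
lemma Sig.eqOn_of_far (hK : IsCompact K) (hc : IsPreconnected Kᶜ) (hf : DifferentiableOn ℂ f Kᶜ)
    (hg : DifferentiableOn ℂ g Kᶜ) {R : ℝ} (h : ∀ z, R ≤ ‖z‖ → f z = g z) : EqOn f g Kᶜ := by
  have hKo := hK.isClosed.isOpen_compl
  obtain ⟨z₀, hz₀, hfar⟩ : ∃ z₀ ∈ Kᶜ, ∀ᶠ z in 𝓝 z₀, f z = g z := by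
    have h1 : {z : ℂ | R < ‖z‖} ∈ cocompact ℂ := mem_cocompact_iff_norm_gt.2 ⟨R, fun _ h => h⟩
    obtain ⟨z, hz1, hz2⟩ := (inter_mem hK.compl_mem_cocompact h1 |> Filter.nonempty_of_mem)
    refine ⟨z, hz1, ?_⟩
    filter_upwards [(isOpen_lt continuous_const continuous_norm).mem_nhds hz2] with w hw
    exact h w (le_of_lt hw)
  exact (hf.analyticOnNhd hKo).eqOn_of_preconnected_of_eventuallyEq (hg.analyticOnNhd hKo) hc hz₀ hfar

/-- Koebe uniformization when no complementary piece is a point. -/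
theorem exists_sig_discs (hP : Pieces K A) (hc : IsPreconnected Kᶜ) (hA : ∀ i, (A i).Nontrivial) :
    ∃ (f : ℂ → ℂ) (B : ι → Set ℂ), Sig K f ∧ Pieces (img K f) B ∧
      ∀ i, ∃ c r, 0 < r ∧ B i = closedBall c r := by
  obtain ⟨R, hR⟩ := exists_roundAt hP hc hA
  choose f hf hG using fun n : ℕ => hR (1 / ((n : ℝ) + 1)) (by positivity)
  choose G hG hr hGf using hG
  have hK := hP.isCompact
  have hKo := hK.isClosed.isOpen_compl
  obtain ⟨S, hS, hKS⟩ := hK.isBounded.subset_closedBall_lt 0 0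
  set U : Ultrafilter ℕ := hyperfilter ℕ
  have hker : ∀ z ∈ Kᶜ, ∃ r > 0, ∀ᶠ n in (U : Filter ℕ), ball z r ⊆ Kᶜ := fun z hz => by
    obtain ⟨r, hr, h⟩ := Metric.isOpen_iff.1 hKo z hz
    exact ⟨r, hr, Eventually.of_forall fun _ => h⟩
  obtain ⟨φ, hφ, hφ1⟩ := exists_limit (U := U) (Kc := fun _ => K) hS (fun _ => hKS)
    hf hK hc hker
  obtain ⟨B, hB, ht⟩ := hφ.exists_pieces hP hc
  refine ⟨φ, B, hφ, hB, fun i => ?_⟩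
  obtain ⟨γ, hγ, hγ1⟩ := exists_limit (U := U) (Kc := fun _ => K) (F := fun n => G n i) hS
    (fun _ => hKS) (fun n => hG n i) hK hc hker
  have heq : EqOn γ φ Kᶜ := by
    refine Sig.eqOn_of_far hK hc hγ.diff hφ.diff (R := max R (S + 1)) fun z hz => ?_
    have hzK : z ∈ Kᶜ := fun h' => by
      have := mem_closedBall_zero_iff.1 (hKS h')
      linarith [le_max_right R (S + 1)]
    refine tendsto_nhds_unique (hγ1.tendsto hzK) ?_
    have h1 : Tendsto (fun n => G n i z - f n z) U (𝓝 0) := by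
      have h2 := (tendsto_one_div_add_atTop_nhds_zero_nat (𝕜 := ℝ)).mono_left
        (Nat.hyperfilter_le_atTop : (U : Filter ℕ) ≤ atTop)
      exact squeeze_zero_norm (fun n => hGf n i z ((le_max_left _ _).trans hz)) h2
    have h3 := h1.add (hφ1.tendsto hzK)
    rw [zero_add] at h3
    exact h3.congr fun n => by simp
  choose E hE hEt c ρ hρ hEi using fun n => hr n i
  obtain ⟨a, r, hr0, hout, hcirc⟩ := exists_tendsto_circle (f := φ) hP hc (hA i) (fun n => hG n i) hE
    (fun n => hEt n i) hρ hEi fun z hz => by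
      have := hγ1.tendsto hz
      rwa [heq hz] at this
  obtain ⟨h1, h2⟩ := eq_closedBall_of_tendsto_circle hP hφ hB ht (hA i) hr0 hout hcirc
  exact ⟨a, r, h1, h2⟩

end Existence

section Rigidity

variable {ι : Type*} [Finite ι] {K : Set ℂ} {A B : ι → Set ℂ} {F : ℂ → ℂ}

/-- A map between complements of discs, extended by reflections up to cells of relative size `t`,
and `q * t` for the pieces in `s`. -/
def Reflected (K : Set ℂ) (A V B : ι → Set ℂ) (F : ℂ → ℂ) (M q t : ℝ≥0∞) (s : Finset ι) : Prop :=
  ∃ (L C : ι → Set ℂ) (ε : ι → ℝ≥0∞) (u : ℂ → ℂ), State K A V M (fun z => z) A L C ε ∧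
    (∀ i, ε i ≤ t) ∧ (∀ i ∈ s, ε i ≤ q * t) ∧ Sig (⋃ i, L i) u ∧ EqOn u F Kᶜ ∧
    ∀ i, ∀ z ∈ A i \ L i, u z ∈ B i

lemma Reflected.step [DecidableEq ι] {V N : ι → Set ℂ} {q M : ℝ≥0} {t : ℝ≥0∞} {s : Finset ι}
    (h : Reflected K A V B F M q t s) (hV : Collars A V N q) (hq : q ≤ 1)
    (hP : Pieces K A) (hc : IsPreconnected Kᶜ) (hB : Pieces (img K F) B)
    (ht : ∀ i, Tendsto F (𝓝ˢ (A i) ⊓ 𝓟 Kᶜ) (𝓝ˢ (B i)))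
    (hA : ∀ i, ∃ c r, 0 < r ∧ A i = closedBall c r) (hBd : ∀ i, ∃ c r, 0 < r ∧ B i = closedBall c r)
    (j : ι) : Reflected K A V B F M q t (insert j s) := by
  obtain ⟨L, C, ε, u, h, hε, hs, hu, huF, huB⟩ := h
  obtain ⟨c, ρ, hρ, hAj⟩ := hA j
  obtain ⟨c', r, hr, hBj⟩ := hBd j
  have hqt : (q : ℝ≥0∞) * t ≤ t := mul_le_of_le_one_left' (by exact_mod_cast hq)
  have h' := h.step hV hc hP (Sig.id (A j)) hρ (by rw [img_id, hAj]) (t := t) fun l _ => hε l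
  simp only [image_id'] at h'
  rw [← hAj, Function.update_eq_self] at h'
  have hLc : ∀ l, IsCompact (L l) := fun l => (h.cell l).isCompact_left
  have hdH : Disjoint (closedBall c ρ) (rest L j) := by
    rw [← hAj, disjoint_left]
    rintro z hz hz'
    obtain ⟨l, hl, hzl⟩ := mem_rest.1 hz'
    exact hl (hP.eq_of_mem (h.sub l hzl) hz)
  have hsub : ⋃ i, L i ⊆ closedBall c ρ ∪ rest L j := by
    rw [← union_rest L j, ← hAj]; exact union_subset_union_left _ (h.sub j)
  have hKo : ∀ z ∈ (closedBall c ρ ∪ rest L j)ᶜ, z ∈ Kᶜ ∨ ∃ l, l ≠ j ∧ z ∈ A l \ L l := by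
    intro z hz
    refine or_iff_not_imp_left.2 fun hzK => ?_
    obtain ⟨l, hl⟩ := hP.mem (not_not.1 hzK)
    have hlj : l ≠ j := by
      rintro rfl
      exact hz (Or.inl (hAj ▸ hl))
    exact ⟨l, hlj, hl, fun h' => hz (Or.inr (mem_rest.2 ⟨l, hlj, h'⟩))⟩
  have hFout : ∀ z ∈ Kᶜ, ∀ l, F z ∉ B l := fun z hz l h => hB.subset l h ⟨z, hz, rfl⟩
  have hav : ∀ z ∈ (closedBall c ρ ∪ rest L j)ᶜ, u z ∉ closedBall c' r := by
    intro z hz hzB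
    rw [← hBj] at hzB
    rcases hKo z hz with h1 | ⟨l, hl, h1⟩
    · rw [huF h1] at hzB; exact hFout z h1 j hzB
    · exact hl (hB.eq_of_mem (huB l z h1) hzB)
  have hlim : Tendsto (fun z => ‖u z - c'‖) (𝓝ˢ (closedBall c ρ) ⊓ 𝓟 (closedBall c ρ ∪ rest L j)ᶜ)
      (𝓝 r) := by
    have h1 := ht j
    rw [hBj] at h1
    have h2 := tendsto_norm_sub_nhdsSet_closedBall hr.le h1 (mem_inf_of_right fun z hz => by
      rw [mem_ofPred_eq, ← hBj]; exact hFout z hz j)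
    have h3 : ∀ᶠ z in 𝓝ˢ (closedBall c ρ) ⊓ 𝓟 (closedBall c ρ ∪ rest L j)ᶜ, z ∈ Kᶜ := by
      filter_upwards [mem_inf_of_left (hAj ▸ hP.mem_nhdsSet_union j),
        mem_inf_of_right (mem_principal_self _)] with z h4 h5
      exact h4.resolve_left fun h6 => h5 (Or.inl (hAj ▸ h6))
    rw [hAj] at h2
    refine (h2.mono_left (le_inf inf_le_left (le_principal_iff.2 h3))).congr' ?_
    filter_upwards [h3] with z hz
    rw [huF hz]
  obtain ⟨u', hu', hue, huD⟩ := Sig.exists_cRefl (isCompact_rest hLc j) hρ hdH (hu.mono hsub) hr hav hlim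
  have hKsub : (Kᶜ : Set ℂ) ⊆ (closedBall c ρ ∪ rest L j)ᶜ := by
    rw [← hAj]
    exact compl_subset_compl.2 (union_subset (hP.subset j)
      (iUnion_subset fun l => (h.sub l).trans (hP.subset l)))
  refine ⟨_, _, _, u', h', fun i => ?_, fun i hi => ?_, ?_, fun z hz => ?_, fun i z hz => ?_⟩
  · rcases eq_or_ne i j with rfl | hij
    · rwa [Function.update_self]
    · rw [Function.update_of_ne hij]; exact hε i
  · rcases eq_or_ne i j with rfl | hij
    · rw [Function.update_self]
    · rw [Function.update_of_ne hij]; exact hs i ((Finset.mem_insert.1 hi).resolve_left hij)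
  · rw [← union_rest _ j, Function.update_self, rest_update, union_comm]
    exact hu'
  · rw [hue (hKsub hz), huF hz]
  · rcases eq_or_ne i j with rfl | hij
    · rw [Function.update_self, hAj] at hz
      rw [hBj]; exact (huD z hz).1
    · rw [Function.update_of_ne hij] at hz
      rw [hue]
      · exact huB i z hz
      · rintro (h1 | h1)
        · rw [← hAj] at h1
          exact hij (hP.eq_of_mem hz.1 h1)
        · obtain ⟨l, hl, hzl⟩ := mem_rest.1 h1
          rw [hP.eq_of_mem (h.sub l hzl) hz.1] at hzl
          exact hz.2 hzl

/-- A normalized map between complements of finitely many discs is the identity. -/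
theorem Sig.eqOn_id_of_discs (hF : Sig K F) (hP : Pieces K A) (hc : IsPreconnected Kᶜ)
    (hB : Pieces (img K F) B) (ht : ∀ i, Tendsto F (𝓝ˢ (A i) ⊓ 𝓟 Kᶜ) (𝓝ˢ (B i)))
    (hA : ∀ i, ∃ c r, 0 < r ∧ A i = closedBall c r)
    (hBd : ∀ i, ∃ c r, 0 < r ∧ B i = closedBall c r) : EqOn F (fun z => z) Kᶜ := by
  classical
  have := Fintype.ofFinite ι
  obtain ⟨V, N, q, M, hq, hV, hVC⟩ := hP.exists_collars hc
  choose hVb C hC using hVC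
  obtain ⟨R, hR, hKV⟩ := (hP.isCompact.isBounded.union
    (Bornology.isBounded_iUnion.2 hVb)).subset_closedBall_lt 0 0
  have hKR := subset_union_left.trans hKV
  have hVR : ∀ i, V i ⊆ closedBall 0 R := fun i =>
    (subset_iUnion V i).trans (subset_union_right.trans hKV)
  have h0 : ∀ k : ℕ, Reflected K A V B F M q ((q : ℝ≥0∞) ^ k) ∅ := by
    intro k
    induction k with
    | zero =>
      exact ⟨_, _, _, F, State.initial hP hV hC, by simp, by simp, by rwa [hP.union],
        fun _ _ => rfl, fun i z hz => absurd hz.1 hz.2⟩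
    | succ k ih =>
      have h1 : ∀ s : Finset ι, Reflected K A V B F M q ((q : ℝ≥0∞) ^ k) s := fun s => by
        induction s using Finset.induction_on with
        | empty => exact ih
        | insert j s _ ih' => exact ih'.step hV hq.le hP hc hB ht hA hBd j
      obtain ⟨L, C', ε, u, h2, -, h3, h4⟩ := h1 Finset.univ
      exact ⟨L, C', ε, u, h2, fun i => by rw [pow_succ']; exact h3 i (Finset.mem_univ i), by simp, h4⟩
  refine Sig.eqOn_of_far hP.isCompact hc hF.diff differentiableOn_id (R := 80 * R + 1) fun z hz => ?_
  have hzK : z ∈ Kᶜ := fun h' => by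
    have := mem_closedBall_zero_iff.1 (hKR h')
    linarith
  have h1 : ∀ k : ℕ, ‖F z - z‖ₑ ≤ (1 : ℕ) * shift M R ((q : ℝ≥0∞) ^ k) := fun k => by
    obtain ⟨L, C', ε, u, h2, h3, -, h4, h5, -⟩ := h0 k
    rw [← h5 hzK, Nat.cast_one, one_mul]
    exact h2.enorm_sub_le hV hR hKR hVR h3 h4 hz
  have h2 := le_of_tendsto_of_tendsto' tendsto_const_nhds (tendsto_shift (M := M) hq R 1) h1
  exact sub_eq_zero.1 (enorm_eq_zero.1 (le_zero_iff.1 h2))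

end Rigidity

section PointPieces

variable {ι : Type*} [Finite ι] {K L : Set ℂ} {A B B' : ι → Set ℂ} {f g : ℂ → ℂ}

lemma Pieces.neBot (hP : Pieces K A) (i : ι) : (𝓝ˢ (A i) ⊓ 𝓟 Kᶜ).NeBot := by
  obtain ⟨y, -, hy⟩ := not_subset_of_isOpen_of_isCompact (hP.compact i)
    isOpen_univ (hP.conn i).nonempty (subset_univ _)
  obtain ⟨x, hx⟩ := nonempty_frontier_iff.2 ⟨(hP.conn i).nonempty, fun h => hy (h ▸ mem_univ y)⟩
  have h1 : (𝓝 x ⊓ 𝓟 Kᶜ).NeBot := mem_closure_iff_clusterPt.1 (hP.frontier_subset_closure i hx)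
  exact h1.mono (inf_le_inf_right _ (nhds_le_nhdsSet ((hP.compact i).isClosed.frontier_subset hx)))

lemma Pieces.eq_of_tendsto (hP : Pieces K A) (hB : Pieces L B) (hB' : Pieces L B')
    (h : ∀ i, Tendsto f (𝓝ˢ (A i) ⊓ 𝓟 Kᶜ) (𝓝ˢ (B i)))
    (h' : ∀ i, Tendsto f (𝓝ˢ (A i) ⊓ 𝓟 Kᶜ) (𝓝ˢ (B' i))) : B = B' := by
  have key : ∀ {C C' : ι → Set ℂ}, Pieces L C → Pieces L C' →
      (∀ i, Tendsto f (𝓝ˢ (A i) ⊓ 𝓟 Kᶜ) (𝓝ˢ (C i))) →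
      (∀ i, Tendsto f (𝓝ˢ (A i) ⊓ 𝓟 Kᶜ) (𝓝ˢ (C' i))) → ∀ i, C' i ⊆ C i := by
    intro C C' hC hC' h h' i
    obtain ⟨x, hx⟩ := (hC'.conn i).nonempty
    obtain ⟨j, hj⟩ := hC.mem (hC'.subset i hx)
    have hsub := hC.subset_of_isPreconnected (hC'.conn i).isPreconnected (hC'.subset i) hx hj
    by_cases hij : j = i
    · exact hij ▸ hsub
    · exfalso
      obtain ⟨ε, hε, hd⟩ := hC.exists_thickening
      have := hP.neBot i
      obtain ⟨z, hz, hz'⟩ := (((h i).eventually_mem (isOpen_thickening.mem_nhdsSet.2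
        (self_subset_thickening hε (C i)))).and ((h' i).eventually_mem
        (isOpen_thickening.mem_nhdsSet.2
        (hsub.trans (self_subset_thickening hε (C j)))))).exists
      exact disjoint_left.1 (hd j i hij) hz' hz
  exact funext fun i => Subset.antisymm (key hB' hB h' h i) (key hB hB' h h' i)

lemma Pieces.nontrivialPieces (hP : Pieces K A) (hc : IsPreconnected Kᶜ) :
    Pieces (⋃ j : {i // (A i).Nontrivial}, A j) (fun j : {i // (A i).Nontrivial} => A j) ∧
      IsPreconnected (⋃ j : {i // (A i).Nontrivial}, A j)ᶜ := by
  refine ⟨⟨fun j => hP.compact j, fun j => hP.conn j,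
    fun i j hij => hP.disj _ _ fun h => hij (Subtype.ext h), rfl⟩, ?_⟩
  refine hc.subset_closure (compl_subset_compl.2 (iUnion_subset fun j => hP.subset j))
    fun z hz => ?_
  by_cases hzK : z ∈ K
  · obtain ⟨i, hi⟩ := hP.mem hzK
    have hi1 : ¬ (A i).Nontrivial := fun h => hz (mem_iUnion.2 ⟨⟨i, h⟩, hi⟩)
    have hi2 : A i = {z} := (not_nontrivial_iff.1 hi1).eq_singleton_of_mem hi
    refine hP.frontier_subset_closure i ?_
    rw [hi2, frontier, interior_singleton, closure_singleton, sdiff_empty]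
    rfl
  · exact subset_closure hzK

lemma exists_sig_discs_or_points (hP : Pieces K A) (hc : IsPreconnected Kᶜ) :
    ∃ (f : ℂ → ℂ) (B : ι → Set ℂ), Sig K f ∧ Pieces (img K f) B ∧
      ∀ i, ∃ c r, 0 ≤ r ∧ B i = closedBall c r := by
  classical
  obtain ⟨hP', hc'⟩ := hP.nontrivialPieces hc
  obtain ⟨f, B, hf, hB, hd⟩ := exists_sig_discs hP' hc' fun j => j.2
  set K' := ⋃ j : {i // (A i).Nontrivial}, A j with hK'
  have hsub : K' ⊆ K := iUnion_subset fun j => hP.subset j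
  have hpt : ∀ i, ¬ (A i).Nontrivial → ∃ a ∈ K'ᶜ, A i = {a} := fun i hi => by
    obtain ⟨a, ha⟩ := (hP.conn i).nonempty
    refine ⟨a, fun h => ?_, (not_nontrivial_iff.1 hi).eq_singleton_of_mem ha⟩
    obtain ⟨j, hj⟩ := mem_iUnion.1 h
    exact hi (hP.eq_of_mem ha hj ▸ j.2)
  have hBf : ∀ j, ∀ z ∈ K'ᶜ, f z ∉ B j := fun j z hz h => by
    have := hB.subset j h
    exact this (mem_image_of_mem f hz)
  refine ⟨f, fun i => if h : (A i).Nontrivial then B ⟨i, h⟩ else f '' A i, hf.mono hsub, ⟨?_, ?_,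
    ?_, ?_⟩, ?_⟩
  · intro i
    by_cases h : (A i).Nontrivial
    · simpa [h] using hB.compact _
    · obtain ⟨a, -, ha⟩ := hpt i h
      simp [ha]
  · intro i
    by_cases h : (A i).Nontrivial
    · simpa [h] using hB.conn _
    · obtain ⟨a, -, ha⟩ := hpt i h
      simp [ha, isConnected_singleton]
  · intro i j hij
    by_cases h : (A i).Nontrivial <;> by_cases h' : (A j).Nontrivial <;>
      simp only [h, h', dif_pos, dif_neg, not_false_eq_true]
    · exact hB.disj _ _ fun h => hij (congrArg Subtype.val h)
    · obtain ⟨a, ha', ha⟩ := hpt j h'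
      rw [ha, image_singleton, disjoint_singleton_right]
      exact hBf _ _ ha'
    · obtain ⟨a, ha', ha⟩ := hpt i h
      rw [ha, image_singleton, disjoint_singleton_left]
      exact hBf _ _ ha'
    · obtain ⟨a, ha', ha⟩ := hpt i h
      obtain ⟨b, hb', hb⟩ := hpt j h'
      rw [ha, hb, image_singleton, image_singleton, disjoint_singleton]
      intro hab
      have := hf.inj ha' hb' hab
      exact hij (hP.eq_of_mem (z := a) (by simp [ha]) (by simp [hb, this]))
  · refine Subset.antisymm (iUnion_subset fun i => ?_) fun w hw => ?_
    · by_cases h : (A i).Nontrivial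
      · simp only [h, dif_pos]
        exact (hB.subset _).trans (compl_subset_compl.2 (image_mono (compl_subset_compl.2 hsub)))
      · simp only [h, dif_neg, not_false_eq_true]
        obtain ⟨a, ha', ha⟩ := hpt i h
        rw [ha, image_singleton, singleton_subset_iff]
        rintro ⟨z, hz, hza⟩
        have := hf.inj (compl_subset_compl.2 hsub hz) ha' hza
        exact hz (hP.subset i (by simp [ha, this]))
    · by_cases hw' : w ∈ img K' f
      · obtain ⟨j, hj⟩ := hB.mem hw'
        refine mem_iUnion.2 ⟨j.1, ?_⟩
        simpa [j.2] using hj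
      · obtain ⟨z, hz, rfl⟩ := not_not.1 hw'
        by_cases hzK : z ∈ K
        · obtain ⟨i, hi⟩ := hP.mem hzK
          refine mem_iUnion.2 ⟨i, ?_⟩
          have h : ¬ (A i).Nontrivial := fun h => hz (mem_iUnion.2 ⟨⟨i, h⟩, hi⟩)
          simpa [h] using ⟨z, hi, rfl⟩
        · exact absurd (mem_image_of_mem f hzK) hw
  · intro i
    by_cases h : (A i).Nontrivial
    · obtain ⟨c, r, hr, hcr⟩ := hd ⟨i, h⟩
      exact ⟨c, r, hr.le, by simpa [h] using hcr⟩
    · obtain ⟨a, -, ha⟩ := hpt i h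
      exact ⟨f a, 0, le_rfl, by simp [ha]⟩

lemma Sig.nontrivial_iff_of_pieces (hP : Pieces K A) (hf : Sig K f)
    (hB : Pieces (img K f) B) (ht : ∀ i, Tendsto f (𝓝ˢ (A i) ⊓ 𝓟 Kᶜ) (𝓝ˢ (B i)))
    (hc : IsPreconnected Kᶜ) (i : ι) :
    (A i).Nontrivial ↔ (B i).Nontrivial := by
  refine ⟨hf.nontrivial_of_pieces hP hB (ht i), fun hBi => ?_⟩
  obtain ⟨g, hg, hgK, hgf, hfg⟩ := hf.exists_inv hP.isCompact
  obtain ⟨A', hA', ht'⟩ := hg.exists_pieces hB (hf.isPreconnected_compl_img hc)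
  have hA := hg.nontrivial_of_pieces hB hA' (ht' i) hBi
  rw [hgK] at hA'
  have hev : ∀ i, Tendsto (fun z => z) (𝓝ˢ (A i) ⊓ 𝓟 Kᶜ) (𝓝ˢ (A' i)) := fun i => by
    have h1 : Tendsto f (𝓝ˢ (A i) ⊓ 𝓟 Kᶜ) (𝓝ˢ (B i) ⊓ 𝓟 (img K f)ᶜ) := by
      refine tendsto_inf.2 ⟨ht i, tendsto_principal.2 ?_⟩
      filter_upwards [mem_inf_of_right (mem_principal_self Kᶜ)] with z hz
      rw [compl_img]
      exact mem_image_of_mem f hz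
    refine ((ht' i).comp h1).congr' ?_
    filter_upwards [mem_inf_of_right (mem_principal_self Kᶜ)] with z hz
    exact hgf z hz
  have := hP.eq_of_tendsto (f := fun z => z) hP hA' (fun i => tendsto_id'.2 inf_le_left) hev
  rwa [this]

lemma Sig.eqOn_id_of_discs_or_points (hf : Sig K f) (hP : Pieces K A) (hc : IsPreconnected Kᶜ)
    (hB : Pieces (img K f) B) (ht : ∀ i, Tendsto f (𝓝ˢ (A i) ⊓ 𝓟 Kᶜ) (𝓝ˢ (B i)))
    (hA : ∀ i, ∃ c r, A i = closedBall c r) (hBd : ∀ i, ∃ c r, B i = closedBall c r) :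
    EqOn f (fun z => z) Kᶜ := by
  classical
  obtain ⟨hP', hc'⟩ := hP.nontrivialPieces hc
  have hop := hP.isCompact.isClosed.isOpen_compl
  choose b hb using fun i => (hB.conn i).nonempty
  set K' := ⋃ j : {i // (A i).Nontrivial}, A j with hK'
  have hsub : K' ⊆ K := iUnion_subset fun j => hP.subset j
  have hiff := hf.nontrivial_iff_of_pieces hP hB ht hc
  obtain ⟨F, hF1, hF2⟩ : ∃ F : ℂ → ℂ, (∀ z ∈ Kᶜ, F z = f z) ∧ ∀ i, ∀ z ∈ A i, F z = b i := by
    refine ⟨fun z => if h : ∃ i, z ∈ A i then b h.choose else f z, fun z hz => ?_,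
      fun i z hz => ?_⟩
    · exact dif_neg fun ⟨i, hi⟩ => hz (hP.subset i hi)
    · have h : ∃ i, z ∈ A i := ⟨i, hz⟩
      simp only [h, dif_pos]
      rw [hP.eq_of_mem h.choose_spec hz]
  have hpt : ∀ z ∈ K'ᶜ, z ∈ K → ∃ i, A i = {z} ∧ B i = {b i} := fun z hz hzK => by
    obtain ⟨i, hi⟩ := hP.mem hzK
    have hi1 : ¬ (A i).Nontrivial := fun h => hz (mem_iUnion.2 ⟨⟨i, h⟩, hi⟩)
    exact ⟨i, (not_nontrivial_iff.1 hi1).eq_singleton_of_mem hi,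
      (not_nontrivial_iff.1 fun h => hi1 ((hiff i).2 h)).eq_singleton_of_mem (hb i)⟩
  have hne : ∀ z ∈ Kᶜ, ∀ i, f z ≠ b i := fun z hz i h =>
    hB.subset i (hb i) (h ▸ mem_image_of_mem f hz)
  have hsig : Sig K' F := by
    refine ⟨fun z hz => DifferentiableAt.differentiableWithinAt ?_, fun z hz w hw hzw => ?_, ?_⟩
    · by_cases hzK : z ∈ K
      · obtain ⟨i, hi, hBi⟩ := hpt z hz hzK
        have hN : A i ∪ Kᶜ ∈ 𝓝 z := by
          have := hP.mem_nhdsSet_union i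
          rw [hi, nhdsSet_singleton] at this
          rwa [hi]
        have hsd : ∀ w ∈ (A i ∪ Kᶜ) \ {z}, w ∈ Kᶜ := fun w hw =>
          hw.1.resolve_left fun h => hw.2 (by rwa [hi] at h)
        refine ((Complex.differentiableOn_compl_singleton_and_continuousAt_iff hN).1
          ⟨?_, ?_⟩).differentiableAt hN
        · exact (hf.diff.mono hsd).congr fun w hw => hF1 w (hsd w hw)
        · rw [continuousAt_iff_punctured_nhds, hF2 i z (by simp [hi])]
          have h1 := ht i
          rw [hi, hBi, nhdsSet_singleton, nhdsSet_singleton] at h1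
          have hle : 𝓝[≠] z ≤ 𝓟 Kᶜ := by
            rw [le_principal_iff, mem_nhdsWithin_iff_exists_mem_nhds_inter]
            exact ⟨_, hN, fun w hw => hsd w hw⟩
          refine (h1.mono_left (le_inf nhdsWithin_le_nhds hle)).congr' ?_
          filter_upwards [le_principal_iff.1 hle] with w hw
          exact (hF1 w hw).symm
      · refine (hf.diff.differentiableAt (hop.mem_nhds hzK)).congr_of_eventuallyEq ?_
        filter_upwards [hop.mem_nhds hzK] with w hw
        exact hF1 w hw
    · by_cases hzK : z ∈ K <;> by_cases hwK : w ∈ K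
      · obtain ⟨i, hi, hBi⟩ := hpt z hz hzK
        obtain ⟨j, hj, hBj⟩ := hpt w hw hwK
        rw [hF2 i z (by simp [hi]), hF2 j w (by simp [hj])] at hzw
        obtain rfl := hB.eq_of_mem (hb i) (hzw ▸ hb j)
        exact singleton_injective (hi.symm.trans hj)
      · obtain ⟨i, hi, hBi⟩ := hpt z hz hzK
        rw [hF2 i z (by simp [hi]), hF1 w hwK] at hzw
        exact absurd hzw.symm (hne w hwK i)
      · obtain ⟨i, hi, hBi⟩ := hpt w hw hwK
        rw [hF2 i w (by simp [hi]), hF1 z hzK] at hzw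
        exact absurd hzw (hne z hzK i)
      · rw [hF1 z hzK, hF1 w hwK] at hzw
        exact hf.inj hzK hwK hzw
    · refine hf.inf.congr' ?_
      filter_upwards [hP.isCompact.compl_mem_cocompact] with z hz
      rw [hF1 z hz]
  have hdiff : ∀ j : {i // (A i).Nontrivial}, ∀ z ∈ K'ᶜ, F z ∉ B j := fun j z hz h => by
    by_cases hzK : z ∈ K
    · obtain ⟨i, hi, -⟩ := hpt z hz hzK
      rw [hF2 i z (by simp [hi])] at h
      have := hB.eq_of_mem (hb i) h
      exact not_nontrivial_singleton (hi ▸ this ▸ j.2)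
    · exact hB.subset _ h (hF1 z hzK ▸ mem_image_of_mem f hzK)
  have hB' : Pieces (img K' F) (fun j : {i // (A i).Nontrivial} => B j) := by
    refine ⟨fun j => hB.compact j, fun j => hB.conn j,
      fun i j hij => hB.disj _ _ fun h => hij (Subtype.ext h), ?_⟩
    refine Subset.antisymm (iUnion_subset fun j w hw => ?_) fun w hw => ?_
    · rintro ⟨z, hz, rfl⟩
      exact hdiff j z hz hw
    · have hw1 : w ∈ img K f := by
        rintro ⟨z, hz, rfl⟩
        exact hw ⟨z, compl_subset_compl.2 hsub hz, hF1 z hz⟩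
      obtain ⟨i, hi⟩ := hB.mem hw1
      by_cases h : (A i).Nontrivial
      · exact mem_iUnion.2 ⟨⟨i, h⟩, hi⟩
      · exfalso
        obtain ⟨a, ha⟩ := (hP.conn i).nonempty
        have ha' : a ∈ K'ᶜ := fun h' => by
          obtain ⟨j, hj⟩ := mem_iUnion.1 h'
          exact h (hP.eq_of_mem ha hj ▸ j.2)
        exact hw ⟨a, ha', (hF2 i a ha).trans
          ((not_nontrivial_iff.1 fun h' => h ((hiff i).2 h')) (hb i) hi)⟩
  have hpos : ∀ {S : Set ℂ}, S.Nontrivial → (∃ c r, S = closedBall c r) →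
      ∃ c r, 0 < r ∧ S = closedBall c r := by
    rintro S hS ⟨c, r, rfl⟩
    refine ⟨c, r, ?_, rfl⟩
    by_contra hr
    refine not_nontrivial_iff.2 ?_ hS
    exact (subsingleton_closedBall c (not_lt.1 hr))
  have := hsig.eqOn_id_of_discs hP' hc' hB' (fun j => ?_) (fun j => hpos j.2 (hA j))
    fun j => hpos ((hiff j).1 j.2) (hBd j)
  · intro z hz
    rw [← hF1 z hz]
    exact this (compl_subset_compl.2 hsub hz)
  · have hle : 𝓝ˢ (A j) ⊓ 𝓟 K'ᶜ ≤ 𝓝ˢ (A j) ⊓ 𝓟 Kᶜ := by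
      refine le_inf inf_le_left (le_principal_iff.2 ?_)
      filter_upwards [mem_inf_of_left (hP.mem_nhdsSet_union j),
        mem_inf_of_right (mem_principal_self K'ᶜ)] with z hz hz'
      exact hz.resolve_left fun h => hz' (mem_iUnion.2 ⟨j, h⟩)
    refine ((ht j).mono_left hle).congr' ?_
    filter_upwards [hle (mem_inf_of_right (mem_principal_self Kᶜ))] with z hz
    exact (hF1 z hz).symm

end PointPieces

section Sphere

variable {S D L : Set ℂ} {κ p q : ℂ}

lemma coe_mem_sph {z : ℂ} : (z : OnePoint ℂ) ∈ sph S ↔ z ∈ S :=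
  OnePoint.coe_injective.mem_set_image

lemma infty_notMem_sph : OnePoint.infty ∉ sph S := by
  rintro ⟨z, -, h⟩
  exact OnePoint.coe_ne_infty z h

lemma preimage_sph : (fun z : ℂ => (z : OnePoint ℂ)) ⁻¹' sph S = S :=
  ext fun _ => coe_mem_sph

lemma sph_injective : Function.Injective sph :=
  OnePoint.coe_injective.image_injective

lemma isOpen_sph (h : IsOpen S) : IsOpen (sph S) :=
  OnePoint.isOpenEmbedding_coe.isOpenMap _ h

lemma frontier_sph (h : IsCompact S) : frontier (sph S) = sph (frontier S) := by
  have h1 : IsClosed (sph S) := (h.image OnePoint.continuous_coe).isClosed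
  have h2 := OnePoint.isOpenEmbedding_coe.isOpenMap.preimage_frontier_eq_frontier_preimage
    (OnePoint.continuous_coe (X := ℂ)) (sph S)
  rw [preimage_sph] at h2
  rw [← h2]
  refine (image_preimage_eq_of_subset fun x hx => ?_).symm
  obtain ⟨z, -, rfl⟩ := h1.frontier_subset hx
  exact ⟨z, rfl⟩

lemma connectedComponentIn_sph {z : ℂ} (hz : z ∈ S) :
    connectedComponentIn (sph S) z = sph (connectedComponentIn S z) := by
  have he := (OnePoint.isOpenEmbedding_coe (X := ℂ)).isInducing
  refine Subset.antisymm ?_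
    (OnePoint.continuous_coe.continuousOn.image_connectedComponentIn_subset hz)
  have h0 := connectedComponentIn_subset (sph S) z
  have h1 : (fun z : ℂ => (z : OnePoint ℂ)) '' ((fun z : ℂ => (z : OnePoint ℂ)) ⁻¹'
      connectedComponentIn (sph S) z) = connectedComponentIn (sph S) z :=
    image_preimage_eq_of_subset (h0.trans (image_subset_range _ _))
  rw [← h1]
  refine image_mono (IsPreconnected.subset_connectedComponentIn ?_ ?_ fun w hw =>
    coe_mem_sph.1 (h0 hw))
  · refine he.isPreconnected_image.1 ?_
    rw [h1]
    exact isPreconnected_connectedComponentIn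
  · exact mem_connectedComponentIn (coe_mem_sph.2 hz)

/-- The Möbius transformation `v ↦ p + κ / (v - q)` of the Riemann sphere. -/
def mob (κ p q : ℂ) : OnePoint ℂ → OnePoint ℂ
  | OnePoint.infty => (p : OnePoint ℂ)
  | OnePoint.some v => if v = q then OnePoint.infty else ((p + κ * (v - q)⁻¹ : ℂ) : OnePoint ℂ)

lemma mob_infty : mob κ p q OnePoint.infty = p := rfl

lemma mob_pole : mob κ p q (q : OnePoint ℂ) = OnePoint.infty := if_pos rfl

lemma mob_coe {v : ℂ} (h : v ≠ q) :
    mob κ p q (v : OnePoint ℂ) = ((p + κ * (v - q)⁻¹ : ℂ) : OnePoint ℂ) := if_neg h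

lemma mob_mob (hκ : κ ≠ 0) (x : OnePoint ℂ) : mob κ q p (mob κ p q x) = x := by
  induction x using OnePoint.rec with
  | infty => rw [mob_infty, mob_pole]
  | coe v =>
    by_cases h : v = q
    · rw [h, mob_pole, mob_infty]
    · have h1 : v - q ≠ 0 := sub_ne_zero.2 h
      have h2 : p + κ * (v - q)⁻¹ ≠ p := by simp [hκ, h1]
      rw [mob_coe h, mob_coe h2]
      congr 1
      rw [add_sub_cancel_left, mul_inv, inv_inv, mul_inv_cancel_left₀ hκ, add_sub_cancel]

lemma continuous_mob (hκ : κ ≠ 0) : Continuous (mob κ p q) := by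
  have hco : coclosedCompact ℂ = cocompact ℂ := coclosedCompact_eq_cocompact
  have hcoe : Tendsto (fun z : ℂ => (z : OnePoint ℂ)) (cocompact ℂ) (𝓝 OnePoint.infty) :=
    hco ▸ OnePoint.tendsto_coe_infty
  rw [OnePoint.continuous_iff, hco]
  constructor
  · rw [mob_infty]
    have h1 : Tendsto (fun v : ℂ => p + κ * (v - q)⁻¹) (cocompact ℂ) (𝓝 (p + κ * 0)) := by
      refine tendsto_const_nhds.add (Tendsto.const_mul _ ?_)
      rw [← Metric.cobounded_eq_cocompact]
      exact tendsto_inv₀_cobounded.comp (tendsto_sub_const_cobounded q)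
    rw [mul_zero, add_zero] at h1
    refine (OnePoint.continuous_coe.continuousAt.tendsto.comp h1).congr' ?_
    filter_upwards [(isCompact_singleton (x := q)).compl_mem_cocompact] with v hv
    exact (mob_coe hv).symm
  · rw [continuous_iff_continuousAt]
    intro v
    by_cases h : v = q
    · rw [h, continuousAt_iff_punctured_nhds, mob_pole]
      have h1 : Tendsto (fun v : ℂ => p + κ * (v - q)⁻¹) (𝓝[≠] q) (cocompact ℂ) := by
        have ha : Tendsto (fun v : ℂ => v - q) (𝓝[≠] q) (𝓝[≠] 0) := by
          refine tendsto_nhdsWithin_iff.2 ⟨?_, ?_⟩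
          · have : Tendsto (fun v : ℂ => v - q) (𝓝 q) (𝓝 (q - q)) :=
              (continuous_id.sub continuous_const).tendsto q
            rw [sub_self] at this
            exact this.mono_left nhdsWithin_le_nhds
          · filter_upwards [self_mem_nhdsWithin] with v hv
            exact sub_ne_zero.2 hv
        have hb := (tendsto_inv₀_nhdsNE_zero (α := ℂ)).comp ha
        rw [← Metric.cobounded_eq_cocompact]
        exact tendsto_const_add_cobounded p |>.comp ((tendsto_mul_left_cobounded hκ).comp hb)
      refine (hcoe.comp h1).congr' ?_
      filter_upwards [self_mem_nhdsWithin] with v hv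
      exact (mob_coe hv).symm
    · have h1 : ContinuousAt (fun v : ℂ => p + κ * (v - q)⁻¹) v :=
        continuousAt_const.add (continuousAt_const.mul
          ((continuousAt_id.sub continuousAt_const).inv₀ (sub_ne_zero.2 h)))
      refine (OnePoint.continuous_coe.continuousAt.comp h1).congr ?_
      filter_upwards [isOpen_ne.mem_nhds h] with w hw
      exact (mob_coe hw).symm

/-- `mob` as a homeomorphism. -/
def mobHomeo (hκ : κ ≠ 0) (p q : ℂ) : OnePoint ℂ ≃ₜ OnePoint ℂ where
  toFun := mob κ p q
  invFun := mob κ q p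
  left_inv := mob_mob hκ
  right_inv := mob_mob hκ
  continuous_toFun := continuous_mob hκ
  continuous_invFun := continuous_mob hκ

lemma norm_sq_inv_identity {u a : ℂ} {r d : ℝ} (hd : d = ‖a‖ ^ 2 - r ^ 2) (hd0 : d ≠ 0)
    (hu : u ≠ 0) : ‖u⁻¹ - conj a / d‖ ^ 2 - (r / |d|) ^ 2 = (‖u - a‖ ^ 2 - r ^ 2) / (d * ‖u‖ ^ 2) := by
  have hn : u.re ^ 2 + u.im ^ 2 ≠ 0 := by
    have := (normSq_pos.2 hu).ne'
    rwa [normSq_apply, ← sq, ← sq] at this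
  rw [div_pow, sq_abs]
  simp only [← normSq_eq_norm_sq, normSq_apply, ← sq] at hd ⊢
  simp only [sub_re, sub_im, inv_re, inv_im, normSq_apply, div_ofReal_re, div_ofReal_im, conj_re,
    conj_im, ← sq]
  field_simp
  subst hd
  ring

lemma image_mob_sphere (hκ : κ ≠ 0) {c : ℂ} {r : ℝ} (hr : 0 < r) (hq : q ∉ sphere c r) :
    ∃ c' r', 0 < r' ∧ mob κ p q '' sph (sphere c r) = sph (sphere c' r') := by
  set a : ℂ := c - q with ha
  obtain ⟨d, hd⟩ : ∃ d : ℝ, d = ‖a‖ ^ 2 - r ^ 2 := ⟨_, rfl⟩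
  have har : ‖a‖ ≠ r := fun h => hq (by rw [mem_sphere, dist_comm, dist_eq_norm]; exact h)
  have hd0 : d ≠ 0 := by
    intro h
    exact har ((pow_left_inj₀ (norm_nonneg a) hr.le two_ne_zero).1 (by linarith))
  have hr' : 0 < r / |d| := by positivity
  have key : ∀ v : ℂ, v ≠ q → (v ∈ sphere c r ↔
      p + κ * (v - q)⁻¹ ∈ sphere (p + κ * (conj a / d)) (‖κ‖ * (r / |d|))) := fun v hv => by
    have hu : v - q ≠ 0 := sub_ne_zero.2 hv
    have h1 := norm_sq_inv_identity hd hd0 hu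
    rw [mem_sphere, mem_sphere, dist_eq_norm, dist_eq_norm, add_sub_add_left_eq_sub, ← mul_sub,
      norm_mul, mul_right_inj' (norm_ne_zero_iff.2 hκ),
      ← pow_left_inj₀ (norm_nonneg (v - c)) hr.le two_ne_zero,
      ← pow_left_inj₀ (norm_nonneg _) hr'.le two_ne_zero, ← sub_eq_zero,
      ← sub_eq_zero (a := ‖(v - q)⁻¹ - conj a / d‖ ^ 2), h1, ha,
      sub_sub_sub_cancel_right, _root_.div_eq_zero_iff, or_iff_left]
    exact mul_ne_zero hd0 (by positivity)
  refine ⟨p + κ * (conj a / d), ‖κ‖ * (r / |d|), by positivity, Subset.antisymm ?_ ?_⟩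
  · rintro _ ⟨_, ⟨v, hv, rfl⟩, rfl⟩
    have hvq : v ≠ q := fun h => hq (h ▸ hv)
    rw [mob_coe hvq]
    exact coe_mem_sph.2 ((key v hvq).1 hv)
  · rintro _ ⟨w, hw, rfl⟩
    have hwp : w ≠ p := by
      rintro rfl
      rw [mem_sphere, dist_eq_norm, sub_add_cancel_left, norm_neg, norm_mul,
        mul_right_inj' (norm_ne_zero_iff.2 hκ), norm_div, Complex.norm_conj, norm_real,
        Real.norm_eq_abs, div_left_inj' (abs_ne_zero.2 hd0)] at hw
      exact har hw
    refine ⟨((q + κ * (w - p)⁻¹ : ℂ) : OnePoint ℂ), coe_mem_sph.2 ?_, ?_⟩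
    · have h1 : w - p ≠ 0 := sub_ne_zero.2 hwp
      have h2 : q + κ * (w - p)⁻¹ ≠ q := by simp [hκ, h1]
      rw [key _ h2, add_sub_cancel_left, mul_inv, inv_inv, mul_inv_cancel_left₀ hκ, add_sub_cancel]
      exact hw
    · rw [← mob_coe hwp, mob_mob hκ]

end Sphere

section Frontiers

variable {ι : Type*} [Finite ι] {K L D S : Set ℂ} {A B : ι → Set ℂ} {κ p q : ℂ}

lemma isConnected_frontier {A : Set ℂ} (hA : IsCompact A) (hc : IsConnected A)
    (hc' : IsPreconnected Aᶜ) : IsConnected (frontier A) := by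
  obtain ⟨u, hu, hu0, hut⟩ := exists_seq_strictAnti_tendsto (0 : ℝ)
  have hne : ∀ n, (thickening (u n) A ∩ Aᶜ).Nonempty := fun n =>
    not_subset_of_isOpen_of_isCompact hA isOpen_thickening hc.nonempty
      (self_subset_thickening (hu0 n) A)
  have h1 : ∀ n, IsConnected (thickening (u n) A ∩ Aᶜ) := fun n =>
    ⟨hne n, isPreconnected_inter_of_union_eq_univ isOpen_thickening hA.isClosed.isOpen_compl
      (isConnected_thickening hc (hu0 n)).isPreconnected hc' (eq_univ_of_forall fun z =>
        (em (z ∈ A)).imp (fun h => self_subset_thickening (hu0 n) A h) id)⟩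
  have h2 := isPreconnected_iInter_closure h1
    (fun m n hmn => inter_subset_inter_left _ (thickening_mono (hu.antitone hmn) A))
    (hA.isBounded.thickening.subset inter_subset_left)
  convert h2 using 1
  refine Subset.antisymm (subset_iInter fun n x hx => ?_) fun x hx => ?_
  · rw [frontier_eq_closure_inter_closure] at hx
    exact isOpen_thickening.inter_closure
      ⟨self_subset_thickening (hu0 n) A (hA.isClosed.closure_eq ▸ hx.1), hx.2⟩
  · rw [mem_iInter] at hx
    rw [frontier_eq_closure_inter_closure]
    refine ⟨?_, closure_mono inter_subset_right (hx 0)⟩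
    rw [mem_closure_iff_infEDist_zero]
    refine le_antisymm (ENNReal.le_of_forall_pos_le_add fun ε hε _ => ?_) bot_le
    obtain ⟨n, hn⟩ := (hut.eventually_lt_const (show (0 : ℝ) < ε from hε)).exists
    have h3 : infEDist x A ≤ ENNReal.ofReal (u n) :=
      closure_thickening_subset_cthickening _ _ (closure_mono inter_subset_left (hx n))
    rw [zero_add]
    exact h3.trans (ENNReal.ofReal_le_of_le_toReal hn.le)

lemma eq_closedBall_of_frontier {A : Set ℂ} (hA : IsCompact A) (hc : IsPreconnected Aᶜ)
    {c : ℂ} {r : ℝ} (hr : 0 ≤ r) (hf : frontier A = sphere c r) : A = closedBall c r := by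
  have hsA : sphere c r ⊆ A := hf ▸ hA.isClosed.frontier_subset
  have hout : A ⊆ closedBall c r := by
    intro x hx
    by_contra hxc
    have hpre : IsPreconnected (closedBall c r)ᶜ := by
      have h0 := (isConnected_norm_gt r).isPreconnected.image (fun z => c + z)
        (continuous_const.add continuous_id).continuousOn
      convert h0 using 1
      ext z
      simp only [mem_compl_iff, mem_closedBall, not_le, mem_image, dist_eq_norm]
      exact ⟨fun h => ⟨z - c, h, by ring⟩, by rintro ⟨w, hw, rfl⟩; simpa using hw⟩
    have hbd : ((closedBall c r)ᶜ ∩ Aᶜ).Nonempty := by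
      rw [← compl_union, nonempty_compl]
      exact fun h => noncompact_univ ℂ (h ▸ (isCompact_closedBall c r).union hA)
    obtain ⟨z, hz, hzf⟩ := nonempty_inter_frontier hpre ⟨x, hxc, hx⟩ hbd
    exact hz (sphere_subset_closedBall (hf ▸ hzf))
  refine Subset.antisymm hout fun x hx => ?_
  by_contra hxA
  have hxb : x ∈ ball c r := by
    rw [← ball_union_sphere] at hx
    exact hx.resolve_right fun h => hxA (hsA h)
  have hr0 : r ≠ 0 := (dist_nonneg.trans_lt hxb).ne'
  obtain ⟨y, hy⟩ : (closedBall c r)ᶜ.Nonempty :=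
    nonempty_compl.2 fun h => noncompact_univ ℂ (h ▸ isCompact_closedBall c r)
  obtain ⟨z, hz, hzf⟩ := nonempty_inter_frontier hc ⟨x, hxA, hxb⟩
    ⟨y, fun h => hy (hout h), fun h => hy (ball_subset_closedBall h)⟩
  exact hz (hsA (frontier_ball c hr0 ▸ hzf))

lemma frontier_closedBall_of_nonneg (c : ℂ) {r : ℝ} (hr : 0 ≤ r) :
    frontier (closedBall c r) = sphere c r := by
  rcases hr.eq_or_lt with rfl | hr
  · rw [closedBall_zero, sphere_zero, frontier, interior_singleton, closure_singleton, sdiff_empty]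
  · exact frontier_closedBall c hr.ne'

lemma Pieces.connectedComponentIn_frontier (hP : Pieces K A) (hc : IsPreconnected Kᶜ) {i : ι}
    {z : ℂ} (hz : z ∈ frontier K) (hzi : z ∈ A i) :
    connectedComponentIn (frontier K) z = frontier (A i) := by
  have hKc := hP.isCompact.isClosed
  have h1 : frontier K ∩ A i ⊆ frontier (A i) := fun x hx =>
    ⟨subset_closure hx.2, fun h => hx.1.2 (interior_mono (hP.subset i) h)⟩
  have h2 : frontier (A i) ⊆ frontier K := fun x hx => by
    rw [frontier_eq_closure_inter_closure]
    exact ⟨subset_closure (hP.subset i ((hP.compact i).isClosed.frontier_subset hx)),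
      hP.frontier_subset_closure i hx⟩
  refine Subset.antisymm (fun x hx => h1 ⟨connectedComponentIn_subset _ _ hx, ?_⟩) ?_
  · exact hP.subset_of_isPreconnected isPreconnected_connectedComponentIn
      ((connectedComponentIn_subset _ _).trans hKc.frontier_subset)
      (mem_connectedComponentIn hz) hzi hx
  · exact (isConnected_frontier (hP.compact i) (hP.conn i)
      (hP.isPreconnected_compl hc i)).isPreconnected.subset_connectedComponentIn
      (h1 ⟨hz, hzi⟩) h2

/-- The compact planar set `L` is the image under `mob κ p q` of the spherical complement of
`D`. -/
def IsMobCompl (κ p q : ℂ) (D L : Set ℂ) : Prop :=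
  ∀ x, mob κ p q x ∈ sph L ↔ x ∉ sph D

lemma IsMobCompl.mem_iff (h : IsMobCompl κ p q D L) {v : ℂ} (hv : v ≠ q) :
    p + κ * (v - q)⁻¹ ∈ L ↔ v ∉ D := by
  have := h v
  rwa [mob_coe hv, coe_mem_sph, coe_mem_sph] at this

lemma isMobCompl_of_forall (hq : q ∈ D) (hp : p ∈ L)
    (h : ∀ v, v ≠ q → (p + κ * (v - q)⁻¹ ∈ L ↔ v ∉ D)) : IsMobCompl κ p q D L := by
  intro x
  induction x using OnePoint.rec with
  | infty => simp [mob_infty, coe_mem_sph, hp, infty_notMem_sph]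
  | coe v =>
    by_cases hv : v = q
    · simp [hv, mob_pole, coe_mem_sph, hq, infty_notMem_sph]
    · rw [mob_coe hv, coe_mem_sph, coe_mem_sph]
      exact h v hv

lemma IsMobCompl.image_compl (hκ : κ ≠ 0) (h : IsMobCompl κ p q D L) :
    mobHomeo hκ p q '' (sph D)ᶜ = sph L := by
  ext y
  constructor
  · rintro ⟨x, hx, rfl⟩
    exact (h x).2 hx
  · intro hy
    refine ⟨mob κ q p y, (h _).1 ?_, mob_mob hκ y⟩
    rwa [mob_mob hκ]

lemma IsMobCompl.isCompact (hκ : κ ≠ 0) (h : IsMobCompl κ p q D L) (hD : IsOpen D) :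
    IsCompact L := by
  rw [(OnePoint.isOpenEmbedding_coe (X := ℂ)).isInducing.isCompact_iff]
  have := h.image_compl hκ
  rw [show OnePoint.some '' L = sph L from rfl, ← this]
  exact (isOpen_sph hD).isClosed_compl.isCompact.image (mobHomeo hκ p q).continuous

lemma IsMobCompl.connectedComponentIn_frontier (hκ : κ ≠ 0) (h : IsMobCompl κ p q D L)
    (hP : Pieces L B) (hc : IsPreconnected Lᶜ) {i : ι} {z : ℂ} (hz : z ∈ frontier L)
    (hzi : z ∈ B i) :
    mob κ q p z ∈ frontier (sph D) ∧
    mob κ p q '' connectedComponentIn (frontier (sph D)) (mob κ q p z) = sph (frontier (B i)) := by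
  have h1 : mobHomeo hκ p q '' frontier (sph D) = sph (frontier L) := by
    rw [← frontier_compl, Homeomorph.image_frontier, h.image_compl hκ, frontier_sph hP.isCompact]
  have h2 : mob κ q p z ∈ frontier (sph D) := by
    obtain ⟨x, hx, hxz⟩ : (z : OnePoint ℂ) ∈ mobHomeo hκ p q '' frontier (sph D) :=
      h1 ▸ coe_mem_sph.2 hz
    rw [← hxz]
    exact (mob_mob hκ x).symm ▸ hx
  refine ⟨h2, ?_⟩
  have h3 := (mobHomeo hκ p q).image_connectedComponentIn h2
  rw [h1, show mobHomeo hκ p q (mob κ q p z) = z from mob_mob hκ _, connectedComponentIn_sph hz,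
    hP.connectedComponentIn_frontier hc hz hzi] at h3
  exact h3

lemma IsNormalizedCircleDomain.pieces_eq_closedBall (hD : IsNormalizedCircleDomain D) (hκ : κ ≠ 0)
    (h : IsMobCompl κ p q D L) (hP : Pieces L B) (hc : IsPreconnected Lᶜ) (i : ι) :
    ∃ c r, B i = closedBall c r := by
  have hci := hP.isPreconnected_compl hc i
  obtain ⟨z, hzi⟩ := (isConnected_frontier (hP.compact i) (hP.conn i) hci).nonempty
  have hzB := (hP.compact i).isClosed.frontier_subset hzi
  have hz : z ∈ frontier L := by
    rw [frontier_eq_closure_inter_closure]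
    exact ⟨subset_closure (hP.subset i hzB), hP.frontier_subset_closure i hzi⟩
  obtain ⟨hx, h1⟩ := h.connectedComponentIn_frontier hκ hP hc hz hzB
  have hB := fun c r => eq_closedBall_of_frontier (hP.compact i) hci (c := c) (r := r)
  rcases hD.2.2 _ hx with h2 | ⟨c, r, hr, h2⟩
  · rw [h2, image_singleton, mob_mob hκ, show {(z : OnePoint ℂ)} = sph {z} from
      image_singleton.symm] at h1
    exact ⟨z, 0, hB z 0 le_rfl (by rw [sphere_zero, sph_injective h1])⟩
  · rw [h2] at h1
    have hq : q ∉ sphere c r := fun hq => infty_notMem_sph (S := frontier (B i))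
      (h1 ▸ ⟨q, coe_mem_sph.2 hq, mob_pole⟩)
    obtain ⟨c', r', hr', h3⟩ := image_mob_sphere (p := p) hκ hr hq
    exact ⟨c', r', hB c' r' hr'.le (sph_injective (h1.symm.trans h3))⟩

lemma IsMobCompl.isNormalizedCircleDomain (hDo : IsOpen D) (hDc : IsConnected D) (hκ : κ ≠ 0)
    (h : IsMobCompl κ p q D L) (hP : Pieces L B) (hc : IsPreconnected Lᶜ)
    (hB : ∀ i, ∃ c r, 0 ≤ r ∧ B i = closedBall c r ∧ (0 < r → p ∉ sphere c r)) :
    IsNormalizedCircleDomain D := by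
  refine ⟨hDo, hDc, fun x hx => ?_⟩
  have h1 : mobHomeo hκ p q '' frontier (sph D) = sph (frontier L) := by
    rw [← frontier_compl, Homeomorph.image_frontier, h.image_compl hκ, frontier_sph hP.isCompact]
  obtain ⟨z, hz, hzx⟩ : mobHomeo hκ p q x ∈ sph (frontier L) := h1 ▸ mem_image_of_mem _ hx
  have hxz : x = mob κ q p z := by
    rw [show (z : OnePoint ℂ) = mob κ p q x from hzx, mob_mob hκ]
  obtain ⟨i, hi⟩ := hP.mem (hP.isCompact.isClosed.frontier_subset hz)
  obtain ⟨-, h2⟩ := h.connectedComponentIn_frontier hκ hP hc hz hi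
  rw [← hxz] at h2
  obtain ⟨c, r, hr, hBi, hp⟩ := hB i
  rw [hBi, frontier_closedBall_of_nonneg c hr] at h2
  have h3 := congrArg (fun T => mob κ q p '' T) h2
  simp only [image_image, mob_mob hκ, image_id'] at h3
  rcases hr.eq_or_lt with rfl | hr
  · left
    have hxc : x ∈ mob κ q p '' sph (sphere c 0) := h3 ▸ mem_connectedComponentIn hx
    rw [sphere_zero, show sph {c} = {(c : OnePoint ℂ)} from image_singleton,
      image_singleton] at h3 hxc
    rw [h3, mem_singleton_iff.1 hxc]
  · right
    obtain ⟨c', r', hr', h4⟩ := image_mob_sphere (p := q) hκ hr (hp hr)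
    exact ⟨c', r', hr', h3.trans h4⟩

end Frontiers

section Main

variable {Ω K D : Set ℂ} {κ p q z₀ : ℂ}

lemma exists_isMobCompl (hκ : κ ≠ 0) (p : ℂ) (hq : q ∈ D) : ∃ L, IsMobCompl κ p q D L := by
  refine ⟨{w | mob κ q p w ∉ sph D}, fun x => ⟨?_, fun hx => ?_⟩⟩
  · rintro ⟨w, hw, hwx⟩
    have hw' : (w : OnePoint ℂ) = mob κ p q x := hwx
    have h1 : mob κ q p w ∉ sph D := hw
    rwa [hw', mob_mob hκ] at h1
  · cases hm : mob κ p q x using OnePoint.rec with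
    | infty =>
      have h1 := mob_mob hκ (p := p) (q := q) x
      rw [hm, mob_infty] at h1
      exact absurd (h1 ▸ coe_mem_sph.2 hq) hx
    | coe w =>
      refine coe_mem_sph.2 ?_
      show mob κ q p w ∉ sph D
      rwa [← hm, mob_mob hκ]

lemma IsMobCompl.isPreconnected_compl (hκ : κ ≠ 0) (h : IsMobCompl κ p q D K) (hD : IsOpen D)
    (hDc : IsPreconnected D) : IsPreconnected Kᶜ := by
  have h1 : IsPreconnected (D ∩ {q}ᶜ) :=
    isPreconnected_inter_of_union_eq_univ hD isOpen_compl_singleton hDc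
      (isConnected_compl_singleton_of_one_lt_rank (by simp) q).isPreconnected
      (eq_univ_of_forall fun z => by
        by_cases hz : z = q
        · by_cases hq : q ∈ D
          · exact Or.inl (hz ▸ hq)
          · exfalso
            have h2 := (h q).2 fun h' => hq (coe_mem_sph.1 h')
            exact infty_notMem_sph (mob_pole (κ := κ) (p := p) ▸ h2)
        · exact Or.inr hz)
  have h2 := h1.image (fun v => p + κ * (v - q)⁻¹) (continuousOn_const.add
    (continuousOn_const.mul ((continuousOn_id.sub continuousOn_const).inv₀
      fun v hv => sub_ne_zero.2 hv.2)))
  convert h2 using 1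
  refine Subset.antisymm (fun w hw => ?_) ?_
  · have hwp : w - p ≠ 0 := by
      refine sub_ne_zero.2 fun hwp => hw (hwp ▸ coe_mem_sph.1 ((h OnePoint.infty).2 ?_))
      exact infty_notMem_sph
    have hv : q + κ * (w - p)⁻¹ ≠ q := by simp [hκ, hwp]
    have he : p + κ * (q + κ * (w - p)⁻¹ - q)⁻¹ = w := by
      rw [add_sub_cancel_left, mul_inv, inv_inv, mul_inv_cancel_left₀ hκ, add_sub_cancel]
    refine ⟨q + κ * (w - p)⁻¹, ⟨?_, hv⟩, he⟩
    by_contra hvD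
    exact hw (he ▸ (h.mem_iff hv).2 hvD)
  · rintro _ ⟨v, hv, rfl⟩ hvK
    exact (h.mem_iff hv.2).1 hvK hv.1

lemma IsMobCompl.exists_pieces (hκ : κ ≠ 0) (h : IsMobCompl κ p q Ω K) (hΩ : IsOpen Ω)
    (hfin : {C : Set (OnePoint ℂ) |
      ∃ x ∈ (sph Ω)ᶜ, C = connectedComponentIn (sph Ω)ᶜ x}.Finite) :
    ∃ ι : Type, Finite ι ∧ ∃ A : ι → Set ℂ, Pieces K A := by
  have hK := h.isCompact hκ hΩ
  set T : Set (Set ℂ) := {C | ∃ w ∈ K, C = connectedComponentIn K w} with hT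
  have hTf : T.Finite := by
    refine (hfin.image fun C => (fun z : ℂ => (z : OnePoint ℂ)) ⁻¹' (mob κ p q '' C)).subset ?_
    rintro _ ⟨w, hw, rfl⟩
    have h1 : mob κ q p w ∈ (sph Ω)ᶜ := (h _).1 (by rw [mob_mob hκ]; exact coe_mem_sph.2 hw)
    refine ⟨_, ⟨_, h1, rfl⟩, ?_⟩
    have h2 := (mobHomeo hκ p q).image_connectedComponentIn h1
    rw [h.image_compl hκ, show mobHomeo hκ p q (mob κ q p w) = w from mob_mob hκ _,
      connectedComponentIn_sph hw] at h2
    have h3 := preimage_sph (S := connectedComponentIn K w)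
    rw [← h2] at h3
    exact h3
  refine ⟨T, hTf, fun C => C.1, ?_, ?_, ?_, ?_⟩
  · rintro ⟨_, w, hw, rfl⟩
    refine hK.of_isClosed_subset (isClosed_of_closure_subset ?_) (connectedComponentIn_subset K w)
    exact isPreconnected_connectedComponentIn.closure.subset_connectedComponentIn
      (subset_closure (mem_connectedComponentIn hw))
      (closure_minimal (connectedComponentIn_subset K w) hK.isClosed)
  · rintro ⟨_, w, hw, rfl⟩
    exact isConnected_connectedComponentIn_iff.2 hw
  · rintro ⟨_, w, hw, rfl⟩ ⟨_, w', hw', rfl⟩ hne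
    refine disjoint_left.2 fun z hz hz' => hne (Subtype.ext ?_)
    exact (connectedComponentIn_eq hz).trans (connectedComponentIn_eq hz').symm
  · refine Subset.antisymm (iUnion_subset ?_) fun w hw => ?_
    · rintro ⟨_, w, hw, rfl⟩
      exact connectedComponentIn_subset K w
    · exact mem_iUnion.2 ⟨⟨_, w, hw, rfl⟩, mem_connectedComponentIn hw⟩

lemma IsMobCompl.zero_mem (h : IsMobCompl 1 0 z₀ Ω K) : (0 : ℂ) ∈ K :=
  coe_mem_sph.1 ((h OnePoint.infty).2 infty_notMem_sph)

lemma IsMobCompl.inv_sub_mem (h : IsMobCompl 1 0 z₀ Ω K) {z : ℂ} (hz : z ∈ Ω) (hz₀ : z ≠ z₀) :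
    (z - z₀)⁻¹ ∈ Kᶜ := fun hK => by
  have := h.mem_iff hz₀
  rw [zero_add, one_mul] at this
  exact this.1 hK hz

lemma IsMobCompl.add_inv_mem (h : IsMobCompl 1 0 z₀ Ω K) {w : ℂ} (hw : w ∈ Kᶜ) :
    z₀ + w⁻¹ ∈ Ω ∧ z₀ + w⁻¹ ≠ z₀ := by
  have hw0 : w ≠ 0 := fun h0 => hw (h0 ▸ h.zero_mem)
  have hne : z₀ + w⁻¹ ≠ z₀ := by simp [hw0]
  refine ⟨?_, hne⟩
  by_contra hΩ
  have := (h.mem_iff hne).2 hΩ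
  rw [add_sub_cancel_left, inv_inv, zero_add, one_mul] at this
  exact hw this

lemma exists_sig_of_injOn {f : ℂ → ℂ} (hΩ : IsOpen Ω) (h : IsMobCompl 1 0 z₀ Ω K) (hz₀ : z₀ ∈ Ω)
    (hd : DifferentiableOn ℂ f Ω) (hi : InjOn f Ω) :
    ∃ κ c F, κ ≠ 0 ∧ Sig K F ∧ IsMobCompl κ c (f z₀) (f '' Ω) (img K F) ∧
      ∀ z ∈ Ω, z ≠ z₀ → F (z - z₀)⁻¹ = c + κ * (f z - f z₀)⁻¹ := by
  have hK := h.isCompact one_ne_zero hΩ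
  have hne : ∀ w ∈ Kᶜ, f (z₀ + w⁻¹) - f z₀ ≠ 0 := fun w hw =>
    sub_ne_zero.2 fun he => (h.add_inv_mem hw).2 (hi (h.add_inv_mem hw).1 hz₀ he)
  have hw0 : ∀ w ∈ Kᶜ, w ≠ 0 := fun w hw h0 => hw (h0 ▸ h.zero_mem)
  have hinv0 : Tendsto (fun w : ℂ => w⁻¹) (cocompact ℂ) (𝓝 0) := by
    rw [← Metric.cobounded_eq_cocompact]; exact tendsto_inv₀_cobounded
  obtain ⟨κ, c, hκ, -, hF⟩ := exists_normalize (F := fun w => (f (z₀ + w⁻¹) - f z₀)⁻¹) hK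
    (fun w hw => by
      have h1 : DifferentiableAt ℂ f (z₀ + w⁻¹) :=
        hd.differentiableAt (hΩ.mem_nhds (h.add_inv_mem hw).1)
      have h2 : DifferentiableAt ℂ (fun w : ℂ => z₀ + w⁻¹) w :=
        (differentiableAt_const _).add (differentiableAt_inv (hw0 w hw))
      exact (((DifferentiableAt.comp (g := f) w h1 h2).sub_const _).inv
        (hne w hw)).differentiableWithinAt)
    (fun w hw w' hw' he => by
      have h1 := hi (h.add_inv_mem hw).1 (h.add_inv_mem hw').1 (sub_left_inj.1 (inv_injective he))
      exact inv_injective (add_left_cancel h1))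
    (by
      have h1 : Tendsto (fun w : ℂ => f (z₀ + w⁻¹) - f z₀) (cocompact ℂ) (𝓝[≠] 0) := by
        refine tendsto_nhdsWithin_iff.2 ⟨?_, ?_⟩
        · have h2 : Tendsto (fun w : ℂ => z₀ + w⁻¹) (cocompact ℂ) (𝓝 (z₀ + 0)) :=
            tendsto_const_nhds.add hinv0
          rw [add_zero] at h2
          have h3 := (((hd.differentiableAt (hΩ.mem_nhds hz₀)).continuousAt.tendsto.comp h2).sub_const
            (f z₀))
          rwa [sub_self] at h3
        · filter_upwards [hK.compl_mem_cocompact] with w hw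
          exact hne w hw
      have h2 := (tendsto_inv₀_nhdsNE_zero (α := ℂ)).comp h1
      rwa [Metric.cobounded_eq_cocompact] at h2)
  have key : ∀ z ∈ Ω, z ≠ z₀ → κ * (f (z₀ + ((z - z₀)⁻¹)⁻¹) - f z₀)⁻¹ + c =
      c + κ * (f z - f z₀)⁻¹ := fun z hz hz' => by
    rw [inv_inv, add_sub_cancel, add_comm]
  refine ⟨κ, c, _, hκ, hF, isMobCompl_of_forall (mem_image_of_mem f hz₀) ?_ fun v hv => ?_, key⟩
  · rintro ⟨w, hw, he⟩
    have h1 : κ * (f (z₀ + w⁻¹) - f z₀)⁻¹ = 0 := by simpa using he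
    exact mul_ne_zero hκ (inv_ne_zero (hne w hw)) h1
  · rw [← not_iff_not, not_not]
    refine not_not.trans ⟨?_, ?_⟩
    · rintro ⟨w, hw, he⟩
      have he' : κ * (f (z₀ + w⁻¹) - f z₀)⁻¹ + c = c + κ * (v - f z₀)⁻¹ := he
      rw [add_comm c, _root_.add_left_inj, mul_right_inj' hκ, inv_inj, sub_left_inj] at he'
      exact ⟨_, (h.add_inv_mem hw).1, he'⟩
    · rintro ⟨z, hz, rfl⟩
      have hz' : z ≠ z₀ := fun h' => hv (h' ▸ rfl)
      exact ⟨_, h.inv_sub_mem hz hz', key z hz hz'⟩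

lemma exists_conformalMapOnto {ι : Type*} [Finite ι] {A : ι → Set ℂ} (hΩ : IsOpen Ω)
    (hc : IsConnected Ω) (hz₀ : z₀ ∈ Ω) (h : IsMobCompl 1 0 z₀ Ω K) (hP : Pieces K A) :
    ∃ (f : ℂ → ℂ) (D : Set ℂ), IsNormalizedCircleDomain D ∧ ConformalMapOnto f Ω D := by
  classical
  have hKc := h.isPreconnected_compl one_ne_zero hΩ hc.isPreconnected
  obtain ⟨G, B, hG, hB, hBd⟩ := exists_sig_discs_or_points hP hKc
  choose c r hr hBd using hBd
  obtain ⟨i₀, -⟩ := hP.mem h.zero_mem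
  have hp : c i₀ ∈ B i₀ := hBd i₀ ▸ mem_closedBall_self (hr i₀)
  have hpG : ∀ w ∈ Kᶜ, G w - c i₀ ≠ 0 := fun w hw =>
    sub_ne_zero.2 fun he => hB.subset i₀ hp (he ▸ mem_image_of_mem G hw)
  have hop := hP.isCompact.isClosed.isOpen_compl
  obtain ⟨f, hf0, hf⟩ : ∃ f : ℂ → ℂ, f z₀ = 0 ∧
      ∀ z, z ≠ z₀ → f z = (G (z - z₀)⁻¹ - c i₀)⁻¹ :=
    ⟨fun z => if z = z₀ then 0 else (G (z - z₀)⁻¹ - c i₀)⁻¹, if_pos rfl, fun z hz => if_neg hz⟩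
  have hfne : ∀ z ∈ Ω, z ≠ z₀ → f z ≠ 0 := fun z hz hz' => by
    rw [hf z hz']
    exact inv_ne_zero (hpG _ (h.inv_sub_mem hz hz'))
  have hd : DifferentiableOn ℂ f Ω := by
    refine (Complex.differentiableOn_compl_singleton_and_continuousAt_iff (hΩ.mem_nhds hz₀)).1
      ⟨?_, ?_⟩
    · refine DifferentiableOn.congr (f := fun z => (G (z - z₀)⁻¹ - c i₀)⁻¹) (fun z hz => ?_)
        fun z hz => hf z hz.2
      have hw := h.inv_sub_mem hz.1 hz.2
      have h1 : DifferentiableAt ℂ G (z - z₀)⁻¹ := hG.diff.differentiableAt (hop.mem_nhds hw)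
      have h2 : DifferentiableAt ℂ (fun z : ℂ => (z - z₀)⁻¹) z :=
        (differentiableAt_id.sub_const z₀).inv (sub_ne_zero.2 hz.2)
      exact (((DifferentiableAt.comp (g := G) z h1 h2).sub_const _).inv
        (hpG _ hw)).differentiableWithinAt
    · rw [continuousAt_iff_punctured_nhds, hf0]
      have ha : Tendsto (fun z : ℂ => z - z₀) (𝓝[≠] z₀) (𝓝[≠] 0) := by
        refine tendsto_nhdsWithin_iff.2 ⟨?_, ?_⟩
        · have : Tendsto (fun z : ℂ => z - z₀) (𝓝 z₀) (𝓝 (z₀ - z₀)) :=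
            (continuous_id.sub continuous_const).tendsto z₀
          rw [sub_self] at this
          exact this.mono_left nhdsWithin_le_nhds
        · filter_upwards [self_mem_nhdsWithin] with v hv
          exact sub_ne_zero.2 hv
      have h1 := (tendsto_inv₀_nhdsNE_zero (α := ℂ)).comp ha
      rw [Metric.cobounded_eq_cocompact] at h1
      have h2 := (tendsto_cocompact_of_sub hG.inf).comp h1
      rw [← Metric.cobounded_eq_cocompact] at h2
      refine (tendsto_inv₀_cobounded.comp ((tendsto_sub_const_cobounded (c i₀)).comp h2)).congr' ?_
      filter_upwards [self_mem_nhdsWithin] with z hz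
      exact (hf z hz).symm
  have hi : InjOn f Ω := by
    intro z hz w hw hzw
    by_cases hz' : z = z₀ <;> by_cases hw' : w = z₀
    · rw [hz', hw']
    · rw [hz', hf0] at hzw
      exact absurd hzw.symm (hfne w hw hw')
    · rw [hw', hf0] at hzw
      exact absurd hzw (hfne z hz hz')
    · rw [hf z hz', hf w hw', inv_inj, sub_left_inj] at hzw
      have := hG.inj (h.inv_sub_mem hz hz') (h.inv_sub_mem hw hw') hzw
      exact sub_left_inj.1 (inv_injective this)
  have hmob : IsMobCompl 1 (c i₀) 0 (f '' Ω) (img K G) := by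
    refine isMobCompl_of_forall ⟨z₀, hz₀, hf0⟩ (hB.subset i₀ hp) fun v hv => ?_
    rw [sub_zero, one_mul, ← not_iff_not, not_not]
    refine not_not.trans ⟨?_, ?_⟩
    · rintro ⟨w, hw, he⟩
      obtain ⟨h1, h2⟩ := h.add_inv_mem hw
      refine ⟨_, h1, ?_⟩
      rw [hf _ h2, add_sub_cancel_left, inv_inv, he, add_sub_cancel_left, inv_inv]
    · rintro ⟨z, hz, rfl⟩
      have hz' : z ≠ z₀ := fun h' => hv (h' ▸ hf0)
      refine ⟨_, h.inv_sub_mem hz hz', ?_⟩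
      rw [hf z hz', inv_inv, add_sub_cancel]
  refine ⟨f, f '' Ω, ?_, hd, hi, rfl⟩
  refine hmob.isNormalizedCircleDomain (isOpen_image_of_injOn hΩ hd hi)
    (hc.image f hd.continuousOn) one_ne_zero hB (hG.isPreconnected_compl_img hKc) fun i =>
    ⟨c i, r i, hr i, hBd i, fun hri hpi => ?_⟩
  obtain rfl := hB.eq_of_mem hp (hBd i ▸ sphere_subset_closedBall hpi)
  rw [mem_sphere, dist_self] at hpi
  exact hri.ne hpi

lemma isMobiusOn_of_isNormalizedCircleDomain {ι : Type*} [Finite ι] {A : ι → Set ℂ}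
    {f g : ℂ → ℂ} {Df Dg : Set ℂ} (hΩ : IsOpen Ω) (hc : IsConnected Ω) (hz₀ : z₀ ∈ Ω)
    (h : IsMobCompl 1 0 z₀ Ω K) (hP : Pieces K A) (hDf : IsNormalizedCircleDomain Df)
    (hDg : IsNormalizedCircleDomain Dg) (hf : ConformalMapOnto f Ω Df)
    (hg : ConformalMapOnto g Ω Dg) : IsMobiusOn (fun w => f (Function.invFunOn g Ω w)) Dg := by
  have hKc := h.isPreconnected_compl one_ne_zero hΩ hc.isPreconnected
  obtain ⟨hfd, hfi, rfl⟩ := hf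
  obtain ⟨hgd, hgi, rfl⟩ := hg
  obtain ⟨κ, c, F, hκ, hF, hFm, hFf⟩ := exists_sig_of_injOn hΩ h hz₀ hfd hfi
  obtain ⟨κ', c', G, hκ', hG, hGm, hGg⟩ := exists_sig_of_injOn hΩ h hz₀ hgd hgi
  have heq : ∀ w ∈ Kᶜ, F w = G w := by
    obtain ⟨B, hB, -⟩ := hG.exists_pieces hP hKc
    have hBc := hG.isPreconnected_compl_img hKc
    obtain ⟨g', hg', hg'K, hg'G, -⟩ := hG.exists_inv hP.isCompact
    obtain ⟨hT, hTi⟩ := hg'.comp (hG.isCompact_img hP.isCompact) (hg'K.symm ▸ hF)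
    rw [hg'K] at hTi
    obtain ⟨C, hC, hCt⟩ := hT.exists_pieces hB hBc
    have hCd := hDf.pieces_eq_closedBall hκ hFm (hTi ▸ hC) (hF.isPreconnected_compl_img hKc)
    have hBd := hDg.pieces_eq_closedBall hκ' hGm hB hBc
    have hid := hT.eqOn_id_of_discs_or_points hB hBc hC hCt hBd hCd
    intro w hw
    have := hid (show G w ∈ (img K G)ᶜ from compl_img K G ▸ mem_image_of_mem G hw)
    simpa [hg'G w hw] using this
  refine ⟨f z₀ * (c' - c) + κ, f z₀ * (κ' - (c' - c) * g z₀) - κ * g z₀, c' - c,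
    κ' - (c' - c) * g z₀, ?_, ?_⟩
  · rw [show (f z₀ * (c' - c) + κ) * (κ' - (c' - c) * g z₀) -
      (f z₀ * (κ' - (c' - c) * g z₀) - κ * g z₀) * (c' - c) = κ * κ' by ring]
    exact mul_ne_zero hκ hκ'
  · rintro _ ⟨z, hz, rfl⟩
    have hinv : Function.invFunOn g Ω (g z) = z := hgi.leftInvOn_invFunOn hz
    simp only [hinv]
    rw [show (c' - c) * g z + (κ' - (c' - c) * g z₀) = (c' - c) * (g z - g z₀) + κ' by ring]
    by_cases hz' : z = z₀
    · subst hz'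
      rw [sub_self, mul_zero, zero_add]
      refine ⟨hκ', ?_⟩
      field_simp
      ring
    · have h1 : f z - f z₀ ≠ 0 := sub_ne_zero.2 fun he => hz' (hfi hz hz₀ he)
      have h2 : g z - g z₀ ≠ 0 := sub_ne_zero.2 fun he => hz' (hgi hz hz₀ he)
      have h3 := heq _ (h.inv_sub_mem hz hz')
      rw [hFf z hz hz', hGg z hz hz'] at h3
      have h4 : (f z - f z₀) * ((c' - c) * (g z - g z₀) + κ') = κ * (g z - g z₀) := by
        field_simp at h3
        linear_combination -h3
      have h5 : (c' - c) * (g z - g z₀) + κ' ≠ 0 := fun h0 => by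
        rw [h0, mul_zero] at h4
        exact mul_ne_zero hκ h2 h4.symm
      refine ⟨h5, ?_⟩
      rw [eq_div_iff h5]
      linear_combination h4

end Main

/-- **Koebe's uniformization theorem for finitely connected domains.** Every domain `Ω ⊆ ℂ`
whose spherical complement has finitely many connected components admits a conformal map onto a
normalized circle domain, and any two such maps differ by a Möbius transformation. -/
theorem koebe_uniformization_finitely_connected (Ω : Set ℂ) (hopen : IsOpen Ω)
    (hconn : IsConnected Ω)
    (hfin : {C : Set (OnePoint ℂ) |
      ∃ x ∈ (sph Ω)ᶜ, C = connectedComponentIn (sph Ω)ᶜ x}.Finite) :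
    (∃ (f : ℂ → ℂ) (D : Set ℂ), IsNormalizedCircleDomain D ∧ ConformalMapOnto f Ω D) ∧
    ∀ (f g : ℂ → ℂ) (Df Dg : Set ℂ), IsNormalizedCircleDomain Df →
      IsNormalizedCircleDomain Dg → ConformalMapOnto f Ω Df → ConformalMapOnto g Ω Dg →
      IsMobiusOn (fun w => f (Function.invFunOn g Ω w)) Dg := by
  obtain ⟨z₀, hz₀⟩ := hconn.nonempty
  obtain ⟨K, hK⟩ := exists_isMobCompl one_ne_zero 0 hz₀
  obtain ⟨ι, hι, A, hA⟩ := hK.exists_pieces one_ne_zero hopen hfin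
  exact ⟨exists_conformalMapOnto hopen hconn hz₀ hK hA, fun f g Df Dg hDf hDg hf hg =>
    isMobiusOn_of_isNormalizedCircleDomain hopen hconn hz₀ hK hA hDf hDg hf hg⟩
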